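/- Let Q_M be a quasianalytic Denjoy–Carleman class, U ⊆ ℝ^n an open set, p,q ≥ 1, and Φ_1,…,Φ_q : U → ℝ^p maps all of whose components belong to Q_M(U). Let f : U → ℝ^p be C^∞. Then there exist g_1,…,g_q ∈ C^∞(U) with f = Σ_{j=1}^q g_j·Φ_j on U if and only if for every a ∈ U there exist formal power series G_{1,a},…,G_{q,a} ∈ ℝ[[x_1,…,x_n]] such that T_a f = Σ_{j=1}^q G_{j,a}·T_a Φ_j (the scalar series G_{j,a} multiplying each component of T_a Φ_j). -/

import Mathlib

namespace QDC

/-- `M` is a sequence defining a quasianalytic Denjoy–Carleman class: positive,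
logarithmically convex, with `sup_k (M_{k+1}/M_k)^{1/k} < ∞` and
`Σ_k M_k/((k+1) M_{k+1}) = ∞`. -/
def IsDCSeq (M : ℕ → ℝ) : Prop :=
  (∀ k, 0 < M k) ∧
  (∀ k, M (k + 1) / M k ≤ M (k + 2) / M (k + 1)) ∧
  (∃ C : ℝ, ∀ k : ℕ, 1 ≤ k → (M (k + 1) / M k) ^ ((1 : ℝ) / k) ≤ C) ∧
  ¬ Summable (fun k => M k / ((k + 1) * M (k + 1)))

variable {σ : Type*} [Fintype σ] [DecidableEq σ]

/-- First-order partial derivative in the `i`-th coordinate direction. -/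
noncomputable def pd (i : σ) (f : (σ → ℝ) → ℝ) : (σ → ℝ) → ℝ :=
  fun x => fderiv ℝ f x (Pi.single i 1)

/-- Iterated partial derivative `∂^{|α|} f / ∂x^α` for a multi-index `α`. -/
noncomputable def mpd (α : σ → ℕ) (f : (σ → ℝ) → ℝ) : (σ → ℝ) → ℝ :=
  (Finset.univ : Finset σ).toList.foldr (fun i g => (pd i)^[α i] g) f

/-- `α! = α_1! ⋯ α_n!`. -/
def mfact (α : σ → ℕ) : ℕ := ∏ i, (α i).factorial

/-- `|α| = α_1 + ⋯ + α_n`. -/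
def mdeg (α : σ → ℕ) : ℕ := ∑ i, α i

/-- `f` belongs to the Denjoy–Carleman class `Q_M(V)`. -/
def MemDC (M : ℕ → ℝ) (V : Set (σ → ℝ)) (f : (σ → ℝ) → ℝ) : Prop :=
  ContDiffOn ℝ (⊤ : ℕ∞) f V ∧
  ∀ K ⊆ V, IsCompact K → ∃ A B : ℝ, 0 < A ∧ 0 < B ∧
    ∀ x ∈ K, ∀ α : σ → ℕ,
      |mpd α f x| ≤ A * B ^ mdeg α * (mfact α : ℝ) * M (mdeg α)

/-- `X` is a closed `Q_M`-subset of the open set `U`: it is closed in `U` and locally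
the common zero set of finitely many functions of class `Q_M`. -/
def IsQMClosed (M : ℕ → ℝ) {n : ℕ} (U X : Set (Fin n → ℝ)) : Prop :=
  X ⊆ U ∧ closure X ∩ U ⊆ X ∧
  ∀ b ∈ X, ∃ V : Set (Fin n → ℝ), IsOpen V ∧ b ∈ V ∧ V ⊆ U ∧
    ∃ (k : ℕ) (g : Fin k → ((Fin n → ℝ) → ℝ)),
      (∀ i, MemDC M V (g i)) ∧ X ∩ V = {x ∈ V | ∀ i, g i x = 0}

/-- `f : X∖Z → ℝ` belongs to `Q_M(X,Z)`: it is a quotient `g/h` of restrictions to `X` of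
functions of class `Q_M` on a neighbourhood of `X`, where `h` vanishes nowhere on `X∖Z`. -/
def MemQXZ (M : ℕ → ℝ) {n : ℕ} (X Z : Set (Fin n → ℝ)) (f : (Fin n → ℝ) → ℝ) : Prop :=
  ∃ (V : Set (Fin n → ℝ)) (g h : (Fin n → ℝ) → ℝ), IsOpen V ∧ X ⊆ V ∧
    MemDC M V g ∧ MemDC M V h ∧ (∀ x ∈ X \ Z, h x ≠ 0) ∧
    ∀ x ∈ X \ Z, f x = g x / h x

/-- `b` is a `Q_M`-smooth point of `X ⊆ ℝ^n`: near `b`, `X` is the graph of a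
`Q_M`-map over some subset `I` of the coordinates. -/
def QMSmoothPt (M : ℕ → ℝ) {n : ℕ} (X : Set (Fin n → ℝ)) (b : Fin n → ℝ) : Prop :=
  ∃ W : Set (Fin n → ℝ), IsOpen W ∧ b ∈ W ∧
    ∃ (I : Finset (Fin n)) (Ω : Set ({ i : Fin n // i ∈ I } → ℝ))
      (ψ : ({ i : Fin n // i ∈ I } → ℝ) → ({ i : Fin n // i ∉ I } → ℝ)),
      IsOpen Ω ∧ (∀ j : { i : Fin n // i ∉ I }, MemDC M Ω (fun u => ψ u j)) ∧
      X ∩ W = {y ∈ W | (fun i : { i : Fin n // i ∈ I } => y i) ∈ Ω ∧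
        ∀ j : { i : Fin n // i ∉ I }, y j = ψ (fun i : { i : Fin n // i ∈ I } => y i) j}

/-- The formal Taylor expansion `T_a f` of `f` at `a`, as a multivariate formal
power series. -/
noncomputable def taylorAt {n : ℕ} (f : (Fin n → ℝ) → ℝ) (a : Fin n → ℝ) :
    MvPowerSeries (Fin n) ℝ :=
  fun α : Fin n →₀ ℕ => mpd (fun i => α i) f a / (mfact fun i => α i : ℕ)

/-- `f` is flat at `x`: all iterated partial derivatives (including order `0`) vanish. -/
def FlatAt {n : ℕ} (f : (Fin n → ℝ) → ℝ) (x : Fin n → ℝ) : Prop :=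
  ∀ α : Fin n → ℕ, mpd α f x = 0

end QDC

section
open Set Filter Topology
open scoped ContDiff Nat

set_option linter.unusedSectionVars false
set_option linter.style.longLine false
namespace QDC

/-- Normalized quasianalytic weight sequence. -/
class NSeq (M : ℕ → ℝ) : Prop where
  zero : M 0 = 1
  one : M 1 = 1
  pos : ∀ k, 0 < M k
  lc : ∀ k, M (k + 1) / M k ≤ M (k + 2) / M (k + 1)
  growth : ∃ C : ℝ, 1 ≤ C ∧ ∀ k, M (k + 1) ≤ C ^ (k + 1) * M k
  qa : ¬ Summable (fun k => M k / ((k + 1) * M (k + 1)))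

namespace NSeq
variable {M : ℕ → ℝ} [hM : NSeq M]

theorem ratio_mono {i j : ℕ} (h : i ≤ j) : M (i + 1) / M i ≤ M (j + 1) / M j :=
  monotone_nat_of_le_succ (f := fun k => M (k + 1) / M k) hM.lc h

theorem one_le_ratio (k : ℕ) : 1 ≤ M (k + 1) / M k := by
  have := ratio_mono (M := M) (Nat.zero_le k)
  rwa [hM.zero, zero_add, hM.one, div_one] at this

theorem mono : Monotone M := by
  refine monotone_nat_of_le_succ fun k => ?_
  have := one_le_ratio (M := M) k
  rwa [le_div_iff₀ (hM.pos k), one_mul] at this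

theorem one_le (k : ℕ) : 1 ≤ M k := by
  have := mono (M := M) (Nat.zero_le k); rwa [hM.zero] at this

/-- `M_{a+1} M_{b+1} ≤ M_{a+b+1}`. -/
theorem mul_le_succ (a b : ℕ) : M (a + 1) * M (b + 1) ≤ M (a + b + 1) := by
  induction b with
  | zero => simp [hM.one]
  | succ b ih =>
    have h1 : M (b + 1 + 1) / M (b + 1) ≤ M (a + b + 1 + 1) / M (a + b + 1) :=
      ratio_mono (by omega)
    rw [div_le_div_iff₀ (hM.pos _) (hM.pos _)] at h1
    have p1 := hM.pos (b + 1); have p2 := hM.pos (a + b + 1); have p3 := hM.pos (a + 1)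
    have p4 := hM.pos (a + b + 1 + 1); have p5 := hM.pos (b + 1 + 1)
    have e : a + (b + 1) + 1 = a + b + 1 + 1 := by ring
    rw [e]
    have : M (a + 1) * M (b + 1 + 1) * M (a + b + 1) ≤ M (a + b + 1 + 1) * M (a + b + 1) := by
      calc M (a + 1) * M (b + 1 + 1) * M (a + b + 1)
          = M (a + 1) * (M (b + 1 + 1) * M (a + b + 1)) := by ring
        _ ≤ M (a + 1) * (M (a + b + 1 + 1) * M (b + 1)) := by gcongr
        _ = M (a + b + 1 + 1) * (M (a + 1) * M (b + 1)) := by ring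
        _ ≤ M (a + b + 1 + 1) * M (a + b + 1) := by gcongr
    exact le_of_mul_le_mul_right this p2

theorem mul_le_add (a b : ℕ) : M a * M b ≤ M (a + b) := by
  rcases a with _ | a
  · simp [hM.zero]
  rcases b with _ | b
  · simp [hM.zero]
  · exact (mul_le_succ a b).trans (mono (by omega))

theorem mul_prod_le {l : ℕ} (s : Fin l → ℕ) (hs : ∀ i, 0 < s i) :
    M l * ∏ i, M (s i) ≤ M (∑ i, s i) := by
  induction l with
  | zero => simp [hM.zero]
  | succ l ih =>
    rw [Fin.prod_univ_succ, Fin.sum_univ_succ]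
    have h := ih (fun i => s i.succ) (fun i => hs _)
    have hnn : 0 ≤ ∏ i : Fin l, M (s i.succ) := Finset.prod_nonneg fun i _ => (hM.pos _).le
    obtain ⟨t, ht⟩ : ∃ t, s 0 = t + 1 := ⟨s 0 - 1, by have := hs 0; omega⟩
    rcases Nat.eq_zero_or_pos l with rfl | hl
    · simp [hM.one]
    · obtain ⟨k, rfl⟩ : ∃ k, l = k + 1 := ⟨l - 1, by omega⟩
      have hsum : k + 1 ≤ ∑ i : Fin (k + 1), s i.succ := by
        calc k + 1 = ∑ i : Fin (k + 1), 1 := by simp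
          _ ≤ _ := Finset.sum_le_sum fun i _ => hs _
      obtain ⟨S, hS⟩ : ∃ S, ∑ i : Fin (k + 1), s i.succ = S + 1 :=
        ⟨∑ i : Fin (k + 1), s i.succ - 1, by omega⟩
      rw [hS] at h ⊢
      rw [ht]
      -- ratio: M (k+2)/M(k+1) * M (t+1) ≤ ...; use ratio monotonicity
      have hr : ∀ t S, k ≤ S → M (k + 1 + 1) / M (k + 1) * M (t + 1) * M (S + 1)
          ≤ M (t + 1 + (S + 1)) := by
        intro t S hkS
        have h1 : M (k + 1 + 1) / M (k + 1) ≤ M (t + S + 1 + 1) / M (t + S + 1) :=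
          ratio_mono (by omega)
        calc M (k + 1 + 1) / M (k + 1) * M (t + 1) * M (S + 1)
            = M (k + 1 + 1) / M (k + 1) * (M (t + 1) * M (S + 1)) := by ring
          _ ≤ M (t + S + 1 + 1) / M (t + S + 1) * M (t + S + 1) := by
              apply mul_le_mul h1 (mul_le_succ t S)
              · exact mul_nonneg (hM.pos _).le (hM.pos _).le
              · exact div_nonneg (hM.pos _).le (hM.pos _).le
          _ = M (t + 1 + (S + 1)) := by
              rw [div_mul_cancel₀ _ (hM.pos _).ne']; congr 1; ring
      calc M (k + 1 + 1) * (M (t + 1) * ∏ i : Fin (k + 1), M (s i.succ))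
          = M (k + 1 + 1) / M (k + 1) * M (t + 1) *
            (M (k + 1) * ∏ i : Fin (k + 1), M (s i.succ)) := by
            field_simp [(hM.pos (k + 1)).ne']
        _ ≤ M (k + 1 + 1) / M (k + 1) * M (t + 1) * M (S + 1) := by
            have : 0 ≤ M (k + 1 + 1) / M (k + 1) * M (t + 1) :=
              mul_nonneg (div_nonneg (hM.pos _).le (hM.pos _).le) (hM.pos _).le
            gcongr
        _ ≤ _ := hr t S (by omega)

end NSeq

section ofp
open OrderedFinpartition

theorem ofp_sum_partSize {n : ℕ} (c : OrderedFinpartition n) : ∑ i, c.partSize i = n := by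
  have := c.sum_sigma_eq_sum (fun _ : Fin n => 1)
  simpa using this

/-- The combinatorial weight. -/
theorem ofp_weight_le (b : ℝ) (hb : 0 ≤ b) (n : ℕ) :
    ∑ c : OrderedFinpartition n, (c.length ! : ℝ) * b ^ c.length * ∏ i, ((c.partSize i)! : ℝ)
      ≤ n ! * (b + 2) ^ n := by
  induction n with
  | zero =>
    have : (Finset.univ : Finset (OrderedFinpartition 0)) = {default} := by
      ext c; simp [Subsingleton.elim c default]
    rw [this]; simp
    
  | succ n ih =>
    rw [← (extendEquiv n).sum_comp, Fintype.sum_sigma]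
    have key : ∀ c : OrderedFinpartition n, ∑ o : Option (Fin c.length),
        (((extendEquiv n ⟨c, o⟩).length ! : ℝ) * b ^ (extendEquiv n ⟨c, o⟩).length *
          ∏ i, (((extendEquiv n ⟨c, o⟩).partSize i)! : ℝ)) ≤
        ((n + 1) * (b + 2)) *
        ((c.length ! : ℝ) * b ^ c.length * ∏ i, ((c.partSize i)! : ℝ)) := by
      intro c
      rw [Fintype.sum_option]
      have e1 : ((extendEquiv n ⟨c, none⟩).length ! : ℝ) * b ^ (extendEquiv n ⟨c, none⟩).length *
          ∏ i, (((extendEquiv n ⟨c, none⟩).partSize i)! : ℝ) = ((c.length + 1) * b) *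
          ((c.length ! : ℝ) * b ^ c.length * ∏ i, ((c.partSize i)! : ℝ)) := by
        change ((c.length + 1)! : ℝ) * b ^ (c.length + 1) *
          ∏ i : Fin (c.length + 1), (((Fin.cons 1 c.partSize : Fin (c.length + 1) → ℕ) i)! : ℝ) = _
        rw [Fin.prod_univ_succ, Nat.factorial_succ]
        simp; ring
      have e2 : ∀ k : Fin c.length, ((extendEquiv n ⟨c, some k⟩).length ! : ℝ) *
          b ^ (extendEquiv n ⟨c, some k⟩).length *
          ∏ i, (((extendEquiv n ⟨c, some k⟩).partSize i)! : ℝ) = (c.partSize k + 1) *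
          ((c.length ! : ℝ) * b ^ c.length * ∏ i, ((c.partSize i)! : ℝ)) := by
        intro k
        change (c.length ! : ℝ) * b ^ (c.length) *
          ∏ i : Fin c.length, (((Function.update c.partSize k (c.partSize k + 1)) i)! : ℝ) = _
        rw [← Finset.mul_prod_erase _ _ (Finset.mem_univ k),
          ← Finset.mul_prod_erase _ (fun i => ((c.partSize i)! : ℝ)) (Finset.mem_univ k)]
        have : ∏ i ∈ Finset.univ.erase k,
            (((Function.update c.partSize k (c.partSize k + 1)) i)! : ℝ) =
            ∏ i ∈ Finset.univ.erase k, ((c.partSize i)! : ℝ) := by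
          refine Finset.prod_congr rfl fun i hi => ?_
          rw [Function.update_of_ne (Finset.ne_of_mem_erase hi)]
        rw [this, Function.update_self, Nat.factorial_succ]
        push_cast; ring
      rw [e1, Finset.sum_congr rfl fun k _ => e2 k, ← Finset.sum_mul, ← add_mul]
      have hnn : 0 ≤ (c.length ! : ℝ) * b ^ c.length * ∏ i, ((c.partSize i)! : ℝ) := by
        positivity
      refine mul_le_mul_of_nonneg_right ?_ hnn
      rw [Finset.sum_add_distrib]
      have h1 : ∑ i : Fin c.length, (c.partSize i : ℝ) = n := by
        exact_mod_cast ofp_sum_partSize c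
      have h2 : (c.length : ℝ) ≤ n := by exact_mod_cast c.length_le
      rw [h1]; simp only [Finset.sum_const, Finset.card_univ, Fintype.card_fin, nsmul_eq_mul]
      nlinarith
    refine (Finset.sum_le_sum fun c _ => key c).trans ?_
    rw [← Finset.mul_sum, Nat.factorial_succ, pow_succ]
    push_cast
    have : ((n : ℝ) + 1) * (b + 2) * (n ! * (b + 2) ^ n) =
      (n + 1) * n ! * ((b + 2) ^ n * (b + 2)) := by ring
    rw [← this]
    gcongr

end ofp

section DC
variable {E F G : Type*} [NormedAddCommGroup E] [NormedSpace ℝ E]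
  [NormedAddCommGroup F] [NormedSpace ℝ F] [NormedAddCommGroup G] [NormedSpace ℝ G]

/-- `f` is of Denjoy–Carleman class near `x`. -/
def DCAt (M : ℕ → ℝ) (f : E → F) (x : E) : Prop :=
  ∃ A B : ℝ, 1 ≤ A ∧ 1 ≤ B ∧ ∀ᶠ y in 𝓝 x, ContDiffAt ℝ ∞ f y ∧
    ∀ k, ‖iteratedFDeriv ℝ k f y‖ ≤ A * B ^ k * k ! * M k

variable {M : ℕ → ℝ} [hM : NSeq M] {f : E → F} {g : F → G} {x : E}

theorem dcAt_of_bound {A B : ℝ} (hA : 0 ≤ A) (hB : 0 ≤ B)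
    (h : ∀ᶠ y in 𝓝 x, ContDiffAt ℝ ∞ f y ∧
    ∀ k, ‖iteratedFDeriv ℝ k f y‖ ≤ A * B ^ k * k ! * M k) : DCAt M f x := by
  refine ⟨A + 1, B + 1, by linarith, by linarith, ?_⟩
  filter_upwards [h] with y hy
  refine ⟨hy.1, fun k => (hy.2 k).trans ?_⟩
  have : 0 < M k := hM.pos k
  gcongr <;> linarith

theorem DCAt.congr {f₁ : E → F} (h : DCAt M f x) (he : f₁ =ᶠ[𝓝 x] f) : DCAt M f₁ x := by
  obtain ⟨A, B, hA, hB, h⟩ := h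
  refine ⟨A, B, hA, hB, ?_⟩
  filter_upwards [h, he.eventually_nhds] with y hy hey
  refine ⟨hy.1.congr_of_eventuallyEq hey, fun k => ?_⟩
  rw [(Filter.EventuallyEq.iteratedFDeriv ℝ hey k).eq_of_nhds]
  exact hy.2 k

theorem DCAt.eventually (h : DCAt M f x) : ∀ᶠ y in 𝓝 x, DCAt M f y := by
  obtain ⟨A, B, hA, hB, h⟩ := h
  filter_upwards [h.eventually_nhds] with y hy
  exact ⟨A, B, hA, hB, hy⟩

theorem DCAt.contDiffAt (h : DCAt M f x) : ContDiffAt ℝ ∞ f x := by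
  obtain ⟨A, B, hA, hB, h⟩ := h
  exact h.self_of_nhds.1

theorem DCAt.continuousAt (h : DCAt M f x) : ContinuousAt f x := h.contDiffAt.continuousAt

theorem DCAt.add {f₁ : E → F} (h : DCAt M f x) (h1 : DCAt M f₁ x) :
    DCAt M (fun y => f y + f₁ y) x := by
  obtain ⟨A, B, hA, hB, h⟩ := h
  obtain ⟨A', B', hA', hB', h1⟩ := h1
  refine dcAt_of_bound (A := A + A') (B := max B B') (by linarith) (by positivity) ?_
  filter_upwards [h, h1] with y hy hy1
  refine ⟨hy.1.add hy1.1, fun k => ?_⟩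
  have e : iteratedFDeriv ℝ k (fun y => f y + f₁ y) y =
      iteratedFDeriv ℝ k f y + iteratedFDeriv ℝ k f₁ y :=
    iteratedFDeriv_add_apply (hy.1.of_le (by exact_mod_cast le_top)) (hy1.1.of_le (by exact_mod_cast le_top))
  rw [e]
  have : 0 < M k := hM.pos k
  calc _ ≤ A * B ^ k * k ! * M k + A' * B' ^ k * k ! * M k :=
        (norm_add_le _ _).trans (add_le_add (hy.2 k) (hy1.2 k))
    _ ≤ A * (max B B') ^ k * k ! * M k + A' * (max B B') ^ k * k ! * M k := by
        gcongr
        · exact le_max_left _ _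
        · exact le_max_right _ _
    _ = _ := by ring

theorem DCAt.clm_comp (L : F →L[ℝ] G) (h : DCAt M f x) : DCAt M (fun y => L (f y)) x := by
  obtain ⟨A, B, hA, hB, h⟩ := h
  refine dcAt_of_bound (A := ‖L‖ * A) (B := B) (by positivity) (by positivity) ?_
  filter_upwards [h] with y hy
  refine ⟨L.contDiff.contDiffAt.comp y hy.1, fun k => ?_⟩
  have := L.norm_iteratedFDeriv_comp_left (f := f) (x := y) (N := ∞) hy.1 (n := k) (by exact_mod_cast le_top)
  calc _ ≤ ‖L‖ * ‖iteratedFDeriv ℝ k f y‖ := this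
    _ ≤ ‖L‖ * (A * B ^ k * k ! * M k) := by gcongr; exact hy.2 k
    _ = _ := by ring

theorem dcAt_const (c : F) : DCAt M (fun _ : E => c) x := by
  refine dcAt_of_bound (A := ‖c‖) (B := 1) (norm_nonneg _) zero_le_one (.of_forall fun y => ⟨contDiffAt_const, fun k => ?_⟩)
  have h1 := NSeq.one_le (M := M) k
  rcases Nat.eq_zero_or_pos k with rfl | hk
  · simp [hM.zero]
  · rw [iteratedFDeriv_const_of_ne hk.ne']; simp only [Pi.zero_apply, norm_zero]; positivity

theorem DCAt.neg (h : DCAt M f x) : DCAt M (fun y => - f y) x :=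
  h.clm_comp (-(ContinuousLinearMap.id ℝ F))

theorem DCAt.sub {f₁ : E → F} (h : DCAt M f x) (h1 : DCAt M f₁ x) :
    DCAt M (fun y => f y - f₁ y) x := by
  simpa [sub_eq_add_neg] using h.add h1.neg

theorem dcAt_sum {ι : Type*} (s : Finset ι) {f : ι → E → F} (h : ∀ i ∈ s, DCAt M (f i) x) :
    DCAt M (fun y => ∑ i ∈ s, f i y) x := by
  classical
  induction s using Finset.induction_on with
  | empty => simpa using dcAt_const 0
  | insert i s hi ih =>
    simp only [Finset.sum_insert hi]
    exact (h i (by simp)).add (ih fun j hj => h j (by simp [hj]))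

theorem DCAt.clm (L : E →L[ℝ] F) : DCAt M (fun y => L y) x := by
  refine dcAt_of_bound (A := ‖L‖ * (‖x‖ + 1) + ‖L‖) (B := 1) (by positivity) (by positivity) ?_
  filter_upwards [Metric.ball_mem_nhds x one_pos] with y hy
  refine ⟨L.contDiff.contDiffAt, fun k => ?_⟩
  have hM1 := NSeq.one_le (M := M) k
  have hnn : 0 ≤ ‖L‖ * (‖x‖ + 1) := by positivity
  rcases k with _ | k
  · simp only [norm_iteratedFDeriv_zero, pow_zero, Nat.factorial_zero, Nat.cast_one, mul_one, hM.zero]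
    have : ‖y‖ ≤ ‖x‖ + 1 := by
      have := norm_le_norm_add_norm_sub' y x
      rw [mem_ball_iff_norm] at hy; linarith
    have := L.le_opNorm_of_le this
    linarith [norm_nonneg L]
  · rw [← norm_iteratedFDeriv_fderiv]
    have : fderiv ℝ (fun y => L y) = fun _ => L := by ext1 z; exact L.fderiv
    rw [this]
    rcases k with _ | k
    · simp [hM.one]; exact hnn
    · rw [iteratedFDeriv_const_of_ne (by simp)]; simp only [Pi.zero_apply, norm_zero]; positivity

theorem dcAt_id : DCAt M (fun y : E => y) x := DCAt.clm (ContinuousLinearMap.id ℝ E)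

theorem dcAt_pi {ι : Type*} [Fintype ι] {f : E → ι → ℝ} :
    DCAt M f x ↔ ∀ i, DCAt M (fun y => f y i) x := by
  classical
  constructor
  · intro h i
    exact h.clm_comp (ContinuousLinearMap.proj i : (ι → ℝ) →L[ℝ] ℝ)
  · intro h
    have := dcAt_sum (M := M) (x := x) Finset.univ (f := fun i y => (ContinuousLinearMap.single ℝ (fun _ : ι => ℝ) i) (f y i))
      (fun i _ => (h i).clm_comp _)
    refine this.congr (.of_forall fun y => ?_)
    ext j
    simp [Finset.sum_apply, Pi.single_apply]

theorem DCAt.prodMk {f₁ : E → G} (h : DCAt M f x) (h1 : DCAt M f₁ x) :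
    DCAt M (fun y => (f y, f₁ y)) x := by
  have := (h.clm_comp (ContinuousLinearMap.inl ℝ F G)).add (h1.clm_comp (ContinuousLinearMap.inr ℝ F G))
  simpa using this

theorem DCAt.smul' {f : E → ℝ} {f₁ : E → F} (h : DCAt M f x) (h1 : DCAt M f₁ x) :
    DCAt M (fun y => f y • f₁ y) x := by
  obtain ⟨A, B, hA, hB, h⟩ := h
  obtain ⟨A', B', hA', hB', h1⟩ := h1
  refine dcAt_of_bound (A := A * A') (B := B + B') (by positivity) (by positivity) ?_
  filter_upwards [h, h1, (h.and h1).eventually_nhds] with y hy hy1 hyn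
  refine ⟨hy.1.smul hy1.1, fun k => ?_⟩
  have hMk : 0 < M k := hM.pos k
  obtain ⟨s, hs, hso, hys⟩ := eventually_nhds_iff.1 hyn
  have := (ContinuousLinearMap.lsmul ℝ ℝ : ℝ →L[ℝ] F →L[ℝ] F).norm_iteratedFDerivWithin_le_of_bilinear_of_le_one
    (s := s) (N := ∞) (n := k) (x := y) (f := f) (g := f₁) (fun z hz => (hs z hz).1.1.contDiffWithinAt)
    (fun z hz => (hs z hz).2.1.contDiffWithinAt) hso.uniqueDiffOn hys (by exact_mod_cast le_top)
    ContinuousLinearMap.opNorm_lsmul_le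
  simp only [iteratedFDerivWithin_of_isOpen _ hso hys] at this
  refine this.trans ?_
  calc ∑ i ∈ Finset.range (k + 1), (k.choose i : ℝ) * ‖iteratedFDeriv ℝ i f y‖ * ‖iteratedFDeriv ℝ (k - i) f₁ y‖
      ≤ ∑ i ∈ Finset.range (k + 1), (A * A' * k ! * M k) * (B ^ i * B' ^ (k - i) * (k.choose i : ℝ)) := by
        refine Finset.sum_le_sum fun i hi => ?_
        have hik : i ≤ k := by simp at hi; omega
        have h1 : M i * M (k - i) ≤ M k := by
          have := NSeq.mul_le_add (M := M) i (k - i); rwa [Nat.add_sub_cancel' hik] at this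
        have h2 : ((k.choose i : ℝ)) * i ! * (k - i)! = k ! := by exact_mod_cast Nat.choose_mul_factorial_mul_factorial hik
        have h3 : (1 : ℝ) ≤ k.choose i := by exact_mod_cast Nat.choose_pos hik
        have p1 := hM.pos i
        have p2 := hM.pos (k - i)
        calc (k.choose i : ℝ) * ‖iteratedFDeriv ℝ i f y‖ * ‖iteratedFDeriv ℝ (k - i) f₁ y‖
            ≤ (k.choose i : ℝ) * (A * B ^ i * i ! * M i) * (A' * B' ^ (k - i) * (k - i)! * M (k - i)) := by
              gcongr
              · exact hy.2 i
              · exact hy1.2 (k - i)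
          _ = (A * A' * (B ^ i * B' ^ (k - i))) * ((k.choose i : ℝ) * i ! * (k - i)!) * (M i * M (k - i)) := by ring
          _ ≤ (A * A' * (B ^ i * B' ^ (k - i))) * k ! * M k := by rw [h2]; gcongr
          _ = (A * A' * k ! * M k) * (B ^ i * B' ^ (k - i) * 1) := by ring
          _ ≤ _ := by gcongr
    _ = _ := by rw [← Finset.mul_sum, ← add_pow]; ring

theorem DCAt.mul {f f₁ : E → ℝ} (h : DCAt M f x) (h1 : DCAt M f₁ x) :
    DCAt M (fun y => f y * f₁ y) x := h.smul' h1

theorem DCAt.pow {f : E → ℝ} (h : DCAt M f x) (k : ℕ) : DCAt M (fun y => f y ^ k) x := by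
  induction k with
  | zero => simpa using dcAt_const 1
  | succ k ih => simpa [pow_succ] using ih.mul h

theorem dcAt_prod {ι : Type*} (s : Finset ι) {f : ι → E → ℝ} (h : ∀ i ∈ s, DCAt M (f i) x) :
    DCAt M (fun y => ∏ i ∈ s, f i y) x := by
  classical
  induction s using Finset.induction_on with
  | empty => simpa using dcAt_const 1
  | insert i s hi ih =>
    simp only [Finset.prod_insert hi]
    exact (h i (by simp)).mul (ih fun j hj => h j (by simp [hj]))

theorem DCAt.fderiv (h : DCAt M f x) : DCAt M (fderiv ℝ f) x := by
  obtain ⟨A, B, hA, hB, h⟩ := h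
  obtain ⟨C, hC1, hC⟩ := hM.growth
  refine dcAt_of_bound (A := A * B * C) (B := 2 * B * C) (by positivity) (by positivity) ?_
  filter_upwards [h] with y hy
  refine ⟨hy.1.fderiv_right (m := ∞) le_rfl, fun k => ?_⟩
  rw [norm_iteratedFDeriv_fderiv]
  refine (hy.2 (k + 1)).trans ?_
  have h2 : ((k + 1)! : ℝ) ≤ 2 ^ k * k ! := by
    rw [Nat.factorial_succ]; push_cast
    have : (k + 1 : ℝ) ≤ 2 ^ k := by exact_mod_cast Nat.lt_two_pow_self
    gcongr
  have hMk := hM.pos k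
  have hMk1 := hM.pos (k + 1)
  calc A * B ^ (k + 1) * (k + 1)! * M (k + 1) ≤ A * B ^ (k + 1) * (2 ^ k * k !) * (C ^ (k + 1) * M k) := by
        gcongr; exact hC k
    _ = _ := by ring

theorem norm_taylorComp_le {n : ℕ} (p : FormalMultilinearSeries ℝ F G) (q : FormalMultilinearSeries ℝ E F)
    (P Q : ℕ → ℝ) (hp : ∀ k ≤ n, ‖p k‖ ≤ P k) (hq : ∀ k ≤ n, 0 < k → ‖q k‖ ≤ Q k) :
    ‖p.taylorComp q n‖ ≤ ∑ c : OrderedFinpartition n, P c.length * ∏ i, Q (c.partSize i) := by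
  refine (norm_sum_le _ _).trans (Finset.sum_le_sum fun c _ => ?_)
  refine (c.norm_compAlongOrderedFinpartition_le _ _).trans ?_
  have h1 := hp _ c.length_le
  refine mul_le_mul h1 (Finset.prod_le_prod (fun _ _ => norm_nonneg _) fun i _ => hq _ (c.partSize_le i) (c.partSize_pos i))
    (Finset.prod_nonneg fun _ _ => norm_nonneg _) ((norm_nonneg _).trans h1)

theorem DCAt.comp (hg : DCAt M g (f x)) (hf : DCAt M f x) : DCAt M (fun y => g (f y)) x := by
  obtain ⟨A, B, hA, hB, h⟩ := hg
  obtain ⟨A', B', hA', hB', h1⟩ := id hf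
  refine dcAt_of_bound (A := A) (B := (B * A' + 2) * B') (by positivity) (by positivity) ?_
  filter_upwards [h1, hf.continuousAt.eventually h] with y hy hgy
  refine ⟨hgy.1.comp y hy.1, fun k => ?_⟩
  have e := iteratedFDeriv_comp (n := ∞) hgy.1 hy.1 (i := k) (by exact_mod_cast le_top)
  change ‖iteratedFDeriv ℝ k (g ∘ f) y‖ ≤ _
  rw [e]
  refine (norm_taylorComp_le _ _ _ _ (fun k _ => hgy.2 k) (fun k _ _ => hy.2 k)).trans ?_
  have hMk := hM.pos k
  calc ∑ c : OrderedFinpartition k, A * B ^ c.length * c.length ! * M c.length *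
        ∏ i, (A' * B' ^ (c.partSize i) * (c.partSize i)! * M (c.partSize i))
      ≤ ∑ c : OrderedFinpartition k, (A * B' ^ k * M k) * ((c.length ! : ℝ) * (B * A') ^ c.length * ∏ i, ((c.partSize i)! : ℝ)) := by
        refine Finset.sum_le_sum fun c _ => ?_
        simp only [Finset.prod_mul_distrib, Finset.prod_const, Finset.prod_pow_eq_pow_sum, ofp_sum_partSize,
          Finset.card_univ, Fintype.card_fin]
        have h3 := NSeq.mul_prod_le (M := M) c.partSize c.partSize_pos
        rw [ofp_sum_partSize] at h3
        calc _ = (A * B' ^ k) * ((c.length ! : ℝ) * (B * A') ^ c.length * ∏ i, ((c.partSize i)! : ℝ)) *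
              (M c.length * ∏ i, M (c.partSize i)) := by rw [mul_pow]; ring
          _ ≤ (A * B' ^ k) * ((c.length ! : ℝ) * (B * A') ^ c.length * ∏ i, ((c.partSize i)! : ℝ)) * M k := by
              gcongr
          _ = _ := by ring
    _ ≤ (A * B' ^ k * M k) * (k ! * (B * A' + 2) ^ k) := by
        rw [← Finset.mul_sum]
        gcongr
        exact ofp_weight_le (B * A') (by positivity) k
    _ = _ := by rw [mul_pow]; ring

theorem dcAt_inv {t : ℝ} (ht : t ≠ 0) : DCAt M (fun s : ℝ => s⁻¹) t := by
  refine dcAt_of_bound (A := 2 / |t|) (B := 2 / |t|) (by positivity) (by positivity) ?_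
  have h1 : ∀ᶠ s in 𝓝 t, |t| / 2 < |s| :=
    (continuous_abs.tendsto t).eventually (lt_mem_nhds (by have := abs_pos.2 ht; linarith))
  filter_upwards [h1] with s hs
  have ht' := abs_pos.2 ht
  have hs0 : s ≠ 0 := by rintro rfl; simp at hs; linarith
  refine ⟨contDiffAt_inv ℝ hs0, fun k => ?_⟩
  rw [norm_iteratedFDeriv_eq_norm_iteratedDeriv, iteratedDeriv_eq_iterate, iter_deriv_inv']
  have hM1 := NSeq.one_le (M := M) k
  have e : (-1 - (k : ℤ)) = -((k + 1 : ℕ) : ℤ) := by push_cast; ring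
  have : ‖(-1 : ℝ) ^ k * k ! * s ^ (-1 - (k : ℤ))‖ = k ! * (|s|⁻¹) ^ (k + 1) := by
    rw [e, zpow_neg, zpow_natCast]; simp
  rw [this]
  have h2 : |s|⁻¹ ≤ 2 / |t| := by
    rw [inv_le_comm₀ (by positivity) (by positivity), inv_div]; exact hs.le
  calc k ! * (|s|⁻¹) ^ (k + 1) ≤ k ! * (2 / |t|) ^ (k + 1) := by gcongr
    _ = 2 / |t| * (2 / |t|) ^ k * k ! * 1 := by ring
    _ ≤ _ := by gcongr

theorem DCAt.inv {f : E → ℝ} (h : DCAt M f x) (h0 : f x ≠ 0) : DCAt M (fun y => (f y)⁻¹) x :=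
  DCAt.comp (g := fun s : ℝ => s⁻¹) (dcAt_inv h0) h

end DC
end QDC
end


section
open Set Filter Topology
open scoped ContDiff Nat
set_option linter.unusedSectionVars false
namespace QDC

/-- Majorant for the autonomous ODE. -/
theorem exists_majorant (A B : ℝ) (hA : 1 ≤ A) (hB : 1 ≤ B) :
    ∃ y : ℕ → ℝ, (∀ k, y (k + 1) = ∑ c : OrderedFinpartition k,
      (A * B ^ c.length * c.length !) * ∏ i, y (c.partSize i)) ∧
      ∃ A' B' : ℝ, 0 ≤ A' ∧ 0 ≤ B' ∧ ∀ k, y k ≤ A' * B' ^ k * k ! := by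
  set Y : ℝ → ℝ := fun t => (1 - √(1 - 2 * A * B * t)) / B with hY
  have hB0 : B ≠ 0 := by positivity
  have hpos : ∀ᶠ t in 𝓝 (0 : ℝ), 0 < 1 - 2 * A * B * t := by
    have : ContinuousAt (fun t : ℝ => 1 - 2 * A * B * t) 0 := by fun_prop
    exact this.eventually (lt_mem_nhds (by simp))
  have hYs : ContDiffAt ℝ ω Y 0 := by
    have h1 : ContDiffAt ℝ ω (fun t : ℝ => 1 - 2 * A * B * t) 0 := by fun_prop
    have h2 : ContDiffAt ℝ ω (fun t : ℝ => √(1 - 2 * A * B * t)) 0 :=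
      h1.sqrt (by simp)
    exact (contDiffAt_const.sub h2).div_const B
  have hY0 : Y 0 = 0 := by simp [hY]
  set Q : ℝ → ℝ := fun s => A * ((-B) * s + 1)⁻¹ with hQ
  have hYd : deriv Y =ᶠ[𝓝 0] Q ∘ Y := by
    filter_upwards [hpos] with t ht
    have h1 : HasDerivAt (fun t : ℝ => 1 - 2 * A * B * t) (-(2 * A * B)) t := by
      simpa using ((hasDerivAt_id t).const_mul (2 * A * B)).const_sub 1
    have h2 := ((h1.sqrt ht.ne').const_sub 1).div_const B
    have hs : √(1 - 2 * A * B * t) ≠ 0 := (Real.sqrt_pos.2 ht).ne'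
    rw [h2.deriv]
    simp only [hQ, hY, Function.comp]
    have e : -B * ((1 - √(1 - 2 * A * B * t)) / B) + 1 = √(1 - 2 * A * B * t) := by
      field_simp; ring
    rw [e]
    field_simp
  have hQk : ∀ k, iteratedDeriv k Q 0 = A * B ^ k * k ! := by
    intro k
    have : Q = fun s => A * (fun s => ((-B) * s + 1)⁻¹) s := rfl
    rw [this, iteratedDeriv_const_mul_field, iteratedDeriv_eq_iterate, iter_deriv_inv_linear]
    simp only [mul_zero, zero_add, one_zpow]
    have : (-1 : ℝ) ^ k * (-B) ^ k = B ^ k := by rw [← mul_pow]; simp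
    linear_combination (A * k !) * this
  have hQs : ContDiffAt ℝ ω Q 0 := by
    refine contDiffAt_const.mul (ContDiffAt.inv (by fun_prop) (by simp))
  refine ⟨fun k => iteratedDeriv k Y 0, fun k => ?_, ?_⟩
  · simp only []
    rw [iteratedDeriv_succ', (hYd.iteratedDeriv_eq k)]
    have := iteratedDeriv_comp_eq_sum_orderedFinpartition (n := ω) (g := Q) (f := Y) (x := 0) (by rw [hY0]; exact hQs) hYs (i := k) le_top
    rw [this]
    refine Finset.sum_congr rfl fun c _ => ?_
    rw [hY0, hQk]
  · have han : AnalyticAt ℝ Y 0 := hYs.analyticAt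
    obtain ⟨p, r, hp⟩ := han
    obtain ⟨r', hr'0, hr'⟩ := ENNReal.lt_iff_exists_nnreal_btwn.1 (hp.r_pos.trans_le hp.r_le)
    obtain ⟨C, hC, hpC⟩ := p.norm_le_div_pow_of_pos_of_lt_radius (by simpa using hr'0) hr'
    refine ⟨C, (r' : ℝ)⁻¹, hC.le, by positivity, fun k => ?_⟩
    have h1 := hp.factorial_smul (1 : ℝ) k
    simp only []
    rw [iteratedDeriv_eq_iteratedFDeriv, ← h1, nsmul_eq_mul, mul_comm]
    gcongr
    calc (p k fun _ => 1) ≤ ‖p k fun _ => 1‖ := le_abs_self _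
      _ ≤ ‖p k‖ * ∏ i : Fin k, ‖(1 : ℝ)‖ := (p k).le_opNorm _
      _ ≤ _ := by simpa [div_eq_mul_inv] using hpC k

section
variable {E F : Type*} [NormedAddCommGroup E] [NormedSpace ℝ E]
  [NormedAddCommGroup F] [NormedSpace ℝ F]
variable {M : ℕ → ℝ} [hM : NSeq M]

theorem dcAt_of_ode {g : E → F} {Ψ : F → (E →L[ℝ] F)} {z : E} (hΨ : DCAt M Ψ (g z))
    (hg : ∀ᶠ w in 𝓝 z, ContDiffAt ℝ ∞ g w) (h : ∀ᶠ w in 𝓝 z, fderiv ℝ g w = Ψ (g w)) :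
    DCAt M g z := by
  obtain ⟨A, B, hA, hB, hAB⟩ := hΨ
  obtain ⟨y, hy, A', B', hA', hB', hyb⟩ := exists_majorant A B hA hB
  have hcont : ContinuousAt g z := hg.self_of_nhds.continuousAt
  refine dcAt_of_bound (A := A' + ‖g z‖ + 1) (B := B') (by positivity) hB' ?_
  have hnb : ∀ᶠ w in 𝓝 z, ‖g w‖ < ‖g z‖ + 1 :=
    hcont.norm.eventually (gt_mem_nhds (by linarith))
  filter_upwards [hg, h.eventually_nhds, hcont.eventually hAB, hnb] with w hgw hw hΨw hn
  refine ⟨hgw, ?_⟩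
  have key : ∀ k, 0 < k → ‖iteratedFDeriv ℝ k g w‖ ≤ y k * M k := by
    intro k
    induction k using Nat.strong_induction_on with
    | _ k ih =>
      intro hk
      obtain ⟨k, rfl⟩ : ∃ j, k = j + 1 := ⟨k - 1, by omega⟩
      rw [← norm_iteratedFDeriv_fderiv]
      have e1 : fderiv ℝ g =ᶠ[𝓝 w] Ψ ∘ g := hw
      rw [(e1.iteratedFDeriv ℝ k).eq_of_nhds,
        iteratedFDeriv_comp (n := ∞) hΨw.1 hgw (i := k) (by exact_mod_cast le_top)]
      refine (norm_taylorComp_le _ _ _ _ (fun k _ => hΨw.2 k)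
        (fun j hj hj0 => ih j (by omega) hj0)).trans ?_
      rw [hy k, Finset.sum_mul]
      refine Finset.sum_le_sum fun c _ => ?_
      have hpn : 0 ≤ ∏ i, y (c.partSize i) := by
        refine Finset.prod_nonneg fun i _ => ?_
        have := ih (c.partSize i) (by have := c.partSize_le i; omega) (c.partSize_pos i)
        exact nonneg_of_mul_nonneg_left ((norm_nonneg _).trans this) (hM.pos _)
      have h3 := NSeq.mul_prod_le (M := M) c.partSize c.partSize_pos
      rw [ofp_sum_partSize] at h3
      rw [Finset.prod_mul_distrib]
      calc _ = (A * B ^ c.length * c.length ! * ∏ i, y (c.partSize i)) *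
            (M c.length * ∏ i, M (c.partSize i)) := by ring
        _ ≤ (A * B ^ c.length * c.length ! * ∏ i, y (c.partSize i)) * M (k + 1) := by
            gcongr
            exact h3.trans (NSeq.mono (by omega))
  intro k
  have hMk := hM.pos k
  rcases Nat.eq_zero_or_pos k with rfl | hk
  · simp [hM.zero]; linarith
  · refine (key k hk).trans ?_
    gcongr
    refine (hyb k).trans ?_
    gcongr
    have := norm_nonneg (g z)
    linarith

variable {σ : Type*} [Fintype σ] [DecidableEq σ]

theorem dcAt_det {x : E} {D : E → Matrix σ σ ℝ} (h : ∀ i j, DCAt M (fun y => D y i j) x) :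
    DCAt M (fun y => (D y).det) x := by
  simp only [Matrix.det_apply']
  exact dcAt_sum _ fun s _ => (dcAt_const _).mul (dcAt_prod _ fun i _ => h _ _)

theorem dcAt_adjugate {x : E} {D : E → Matrix σ σ ℝ} (h : ∀ i j, DCAt M (fun y => D y i j) x)
    (i j : σ) : DCAt M (fun y => (D y).adjugate i j) x := by
  simp only [Matrix.adjugate_apply]
  refine dcAt_det fun a b => ?_
  by_cases ha : a = j
  · subst ha; simpa using dcAt_const _
  · simpa [Matrix.updateRow_ne ha] using h a b

/-- The Jacobian matrix. -/
noncomputable def jac (f : (σ → ℝ) → (σ → ℝ)) (x : σ → ℝ) : Matrix σ σ ℝ :=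
  LinearMap.toMatrix' (fderiv ℝ f x : (σ → ℝ) →ₗ[ℝ] (σ → ℝ))

theorem jac_apply (f : (σ → ℝ) → (σ → ℝ)) (x : σ → ℝ) (i j : σ) :
    jac f x i j = fderiv ℝ f x (Pi.single j 1) i := by
  simp [jac, LinearMap.toMatrix'_apply, Pi.single_apply]

/-- Right inverses of class-`M` maps are of class `M`. -/
theorem dcAt_of_right_inverse {f g : (σ → ℝ) → (σ → ℝ)} {z : σ → ℝ} (hf : DCAt M f (g z))
    (hg : ∀ᶠ w in 𝓝 z, ContDiffAt ℝ ∞ g w) (h : ∀ᶠ w in 𝓝 z, f (g w) = w) : DCAt M g z := by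
  have hcont : ContinuousAt g z := hg.self_of_nhds.continuousAt
  have hfe : ∀ᶠ w in 𝓝 z, ContDiffAt ℝ ∞ f (g w) :=
    hcont.eventually (hf.eventually.mono fun y hy => hy.contDiffAt)
  have hjac : ∀ᶠ w in 𝓝 z, jac f (g w) * jac g w = 1 := by
    filter_upwards [hg, hfe, h.eventually_nhds] with w hgw hfw hw
    have e : fderiv ℝ (f ∘ g) w = ContinuousLinearMap.id ℝ _ := by
      have : f ∘ g =ᶠ[𝓝 w] id := hw
      rw [this.fderiv_eq, fderiv_id]
    rw [fderiv_comp w (hfw.differentiableAt (by simp)) (hgw.differentiableAt (by simp))] at e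
    rw [jac, jac, ← LinearMap.toMatrix'_comp]
    have e' : ((fderiv ℝ f (g w) : (σ → ℝ) →ₗ[ℝ] (σ → ℝ)).comp (fderiv ℝ g w : (σ → ℝ) →ₗ[ℝ] (σ → ℝ)))
      = LinearMap.id := by
      have := congrArg (fun L : (σ → ℝ) →L[ℝ] (σ → ℝ) => (L : (σ → ℝ) →ₗ[ℝ] (σ → ℝ))) e
      simpa using this
    rw [e', LinearMap.toMatrix'_id]
  have hdet : (jac f (g z)).det ≠ 0 := by
    have := congrArg Matrix.det hjac.self_of_nhds
    rw [Matrix.det_mul, Matrix.det_one] at this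
    exact left_ne_zero_of_mul_eq_one this
  have hJ : ∀ i j, DCAt M (fun y => jac f y i j) (g z) := by
    intro i j
    simp only [jac_apply]
    exact hf.fderiv.clm_comp ((ContinuousLinearMap.proj i : (σ → ℝ) →L[ℝ] ℝ).comp
      (ContinuousLinearMap.apply ℝ (σ → ℝ) (Pi.single j 1)))
  set Ψ : (σ → ℝ) → ((σ → ℝ) →L[ℝ] (σ → ℝ)) := fun y => ∑ i, ∑ j,
    ((jac f y).det⁻¹ * (jac f y).adjugate i j) •
      ((ContinuousLinearMap.single ℝ (fun _ : σ => ℝ) i).comp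
        (ContinuousLinearMap.proj j : (σ → ℝ) →L[ℝ] ℝ)) with hΨ
  refine dcAt_of_ode (Ψ := Ψ) ?_ hg ?_
  · exact dcAt_sum _ fun i _ => dcAt_sum _ fun j _ =>
      (((dcAt_det hJ).inv hdet).mul (dcAt_adjugate hJ i j)).smul' (dcAt_const _)
  · filter_upwards [hjac] with w hw
    have h1 : jac g w = (jac f (g w))⁻¹ := (Matrix.inv_eq_right_inv hw).symm
    have h2 : (fderiv ℝ g w : (σ → ℝ) →ₗ[ℝ] (σ → ℝ)) = Matrix.toLin' (jac g w) := by
      simp [jac]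
    have h3 : ∀ v, fderiv ℝ g w v = (jac g w).mulVec v := by
      intro v
      have := LinearMap.congr_fun h2 v
      simpa using this
    ext v i
    rw [h3, h1, Matrix.inv_def, Ring.inverse_eq_inv']
    simp [hΨ, ContinuousLinearMap.sum_apply, Finset.sum_apply, Pi.single_apply, Matrix.mulVec, dotProduct]

/-- Local inverse theorem in the class. -/
theorem dcAt_inverse {f : (σ → ℝ) → (σ → ℝ)} {x : σ → ℝ} (hf : DCAt M f x)
    (hdet : (jac f x).det ≠ 0) : ∃ e : OpenPartialHomeomorph (σ → ℝ) (σ → ℝ),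
      x ∈ e.source ∧ (∀ y ∈ e.source, e y = f y) ∧ (∀ y ∈ e.source, DCAt M f y) ∧
      ∀ z ∈ e.target, DCAt M e.symm z := by
  have hd : (fderiv ℝ f x).det ≠ 0 := by
    rw [jac, LinearMap.det_toMatrix'] at hdet; exact hdet
  have hd1 : HasFDerivAt f (((fderiv ℝ f x).toContinuousLinearEquivOfDetNeZero hd :
      (σ → ℝ) ≃L[ℝ] (σ → ℝ)) : (σ → ℝ) →L[ℝ] (σ → ℝ)) x := by
    rw [ContinuousLinearMap.coe_toContinuousLinearEquivOfDetNeZero]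
    exact (hf.contDiffAt.differentiableAt (by simp)).hasFDerivAt
  set e := hf.contDiffAt.toOpenPartialHomeomorph f hd1 (by simp) with he
  have hJc : ContinuousAt (fun y => (jac f y).det) x := by
    refine (dcAt_det (M := M) fun i j => ?_).continuousAt
    simp only [jac_apply]
    exact hf.fderiv.clm_comp ((ContinuousLinearMap.proj i : (σ → ℝ) →L[ℝ] ℝ).comp
      (ContinuousLinearMap.apply ℝ (σ → ℝ) (Pi.single j 1)))
  have hev : ∀ᶠ y in 𝓝 x, DCAt M f y ∧ (jac f y).det ≠ 0 :=
    hf.eventually.and (hJc.eventually_ne hdet)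
  obtain ⟨s, hs, hso, hxs⟩ := eventually_nhds_iff.1 hev
  have hcoe : ∀ y, (e.restrOpen s hso) y = f y := fun y => rfl
  refine ⟨e.restrOpen s hso, ⟨hf.contDiffAt.mem_toOpenPartialHomeomorph_source hd1 _, hxs⟩, fun y _ => rfl,
    fun y hy => (hs y hy.2).1, fun z hz => ?_⟩
  have hmem : ∀ z ∈ (e.restrOpen s hso).target, (e.restrOpen s hso).symm z ∈ s := fun z hz =>
    ((e.restrOpen s hso).map_target hz).2
  have hri : ∀ z ∈ (e.restrOpen s hso).target, f ((e.restrOpen s hso).symm z) = z := fun z hz =>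
    (e.restrOpen s hso).right_inv hz
  have hsm : ∀ z ∈ (e.restrOpen s hso).target, ContDiffAt ℝ ∞ (e.restrOpen s hso).symm z := by
    intro z hz
    have h1 := hs _ (hmem z hz)
    have hd' : (fderiv ℝ f ((e.restrOpen s hso).symm z)).det ≠ 0 := by
      have := h1.2
      rw [jac, LinearMap.det_toMatrix'] at this; exact this
    refine (e.restrOpen s hso).contDiffAt_symm (f₀' := (fderiv ℝ f _).toContinuousLinearEquivOfDetNeZero hd') hz ?_ h1.1.contDiffAt
    rw [ContinuousLinearMap.coe_toContinuousLinearEquivOfDetNeZero]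
    exact (h1.1.contDiffAt.differentiableAt (by simp)).hasFDerivAt
  have hnh := (e.restrOpen s hso).open_target.mem_nhds hz
  exact dcAt_of_right_inverse (hs _ (hmem z hz)).1 (by filter_upwards [hnh] with w hw using hsm w hw)
    (by filter_upwards [hnh] with w hw using hri w hw)
end
end QDC
end


section
open Set Filter Topology
open scoped ContDiff Nat
set_option linter.unusedSectionVars false
namespace QDC

section pint
variable {E : Type} [NormedAddCommGroup E] [NormedSpace ℝ E] [FiniteDimensional ℝ E]
  {S : Set ℝ} {O : Set E}

theorem pint_hasFDerivAt {G : Type} [NormedAddCommGroup G] [NormedSpace ℝ G] [CompleteSpace G]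
    (hS : IsOpen S) (hO : IsOpen O) (hIS : Icc (0 : ℝ) 1 ⊆ S) {P : ℝ × E → G}
    (hP : ContDiffOn ℝ ∞ P (S ×ˢ O)) {x : E} (hx : x ∈ O) :
    HasFDerivAt (fun x => ∫ t in (0 : ℝ)..1, P (t, x))
      (∫ t in (0 : ℝ)..1, (fderiv ℝ P (t, x)).comp (ContinuousLinearMap.inr ℝ ℝ E)) x := by
  have : ProperSpace E := FiniteDimensional.proper ℝ E
  have hSO : IsOpen (S ×ˢ O) := hS.prod hO
  obtain ⟨ε, hε, hball⟩ := Metric.nhds_basis_closedBall.mem_iff.1 (hO.mem_nhds hx)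
  have hP' : ContDiffOn ℝ ∞ (fun q => (fderiv ℝ P q).comp (ContinuousLinearMap.inr ℝ ℝ E)) (S ×ˢ O) := by
    have := hP.fderiv_of_isOpen (m := ∞) hSO (by simp)
    exact this.clm_comp contDiffOn_const
  have hcpt : IsCompact (Icc (0 : ℝ) 1 ×ˢ Metric.closedBall x ε) :=
    isCompact_Icc.prod (isCompact_closedBall x ε)
  have hsub : Icc (0 : ℝ) 1 ×ˢ Metric.closedBall x ε ⊆ S ×ˢ O := prod_mono hIS hball
  obtain ⟨C, hC⟩ := hcpt.exists_bound_of_continuousOn (hP'.continuousOn.mono hsub)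
  have hIoc : Set.uIoc (0 : ℝ) 1 ⊆ Icc 0 1 := by
    rw [uIoc_of_le zero_le_one]; exact Ioc_subset_Icc_self
  have hcurve : ∀ y ∈ O, MapsTo (fun t : ℝ => (t, y)) (Icc 0 1) (S ×ˢ O) := fun y hy t ht => ⟨hIS ht, hy⟩
  have hcont : ∀ y ∈ O, ContinuousOn (fun t : ℝ => P (t, y)) (Icc 0 1) := fun y hy =>
    hP.continuousOn.comp (by fun_prop) (hcurve y hy)
  have hcont' : ∀ y ∈ O, ContinuousOn (fun t : ℝ => (fderiv ℝ P (t, y)).comp (ContinuousLinearMap.inr ℝ ℝ E)) (Icc 0 1) := fun y hy =>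
    hP'.continuousOn.comp (f := fun t : ℝ => (t, y)) (by fun_prop) (hcurve y hy)
  refine intervalIntegral.hasFDerivAt_integral_of_dominated_of_fderiv_le (𝕜 := ℝ) (F := fun x t => P (t, x))
    (F' := fun x t => (fderiv ℝ P (t, x)).comp (ContinuousLinearMap.inr ℝ ℝ E))
    (s := Metric.ball x ε) (bound := fun _ => C)
    (Metric.ball_mem_nhds x hε) ?_ ?_ ?_ ?_ ?_ ?_
  · filter_upwards [hO.mem_nhds hx] with y hy
    rw [uIoc_of_le zero_le_one]
    exact ((hcont y hy).mono Ioc_subset_Icc_self).aestronglyMeasurable measurableSet_Ioc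
  · exact ContinuousOn.intervalIntegrable (by rw [uIcc_of_le zero_le_one]; exact hcont x hx)
  · rw [uIoc_of_le zero_le_one]
    exact ((hcont' x hx).mono Ioc_subset_Icc_self).aestronglyMeasurable measurableSet_Ioc
  · refine .of_forall fun t ht y hy => hC (t, y) ⟨hIoc ht, Metric.ball_subset_closedBall hy⟩
  · exact intervalIntegrable_const
  · refine .of_forall fun t ht y hy => ?_
    have hmem : (t, y) ∈ S ×ˢ O := hsub ⟨hIoc ht, Metric.ball_subset_closedBall hy⟩
    have h1 : HasFDerivAt P (fderiv ℝ P (t, y)) (t, y) :=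
      ((hP.contDiffAt (hSO.mem_nhds hmem)).differentiableAt (by simp)).hasFDerivAt
    exact h1.comp y (hasFDerivAt_prodMk_right t y)

theorem pint_bound (hS : IsOpen S) (hO : IsOpen O) (hIS : Icc (0 : ℝ) 1 ⊆ S) (k : ℕ) :
    ∀ {G : Type} [NormedAddCommGroup G] [NormedSpace ℝ G] [CompleteSpace G]
    {P : ℝ × E → G} (_ : ContDiffOn ℝ ∞ P (S ×ˢ O)),
    ContDiffOn ℝ k (fun x => ∫ t in (0 : ℝ)..1, P (t, x)) O ∧
    ∀ x ∈ O, ∀ C, (∀ t ∈ Icc (0 : ℝ) 1, ‖iteratedFDeriv ℝ k (fun y => P (t, y)) x‖ ≤ C) →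
      ‖iteratedFDeriv ℝ k (fun x => ∫ t in (0 : ℝ)..1, P (t, x)) x‖ ≤ C := by
  have hSO : IsOpen (S ×ˢ O) := hS.prod hO
  induction k with
  | zero =>
    intro G _ _ _ P hP
    refine ⟨contDiffOn_zero.2 fun x hx => (pint_hasFDerivAt hS hO hIS hP hx).continuousAt.continuousWithinAt, ?_⟩
    intro x hx C hC
    simp only [norm_iteratedFDeriv_zero] at hC ⊢
    have := intervalIntegral.norm_integral_le_of_norm_le_const (a := (0 : ℝ)) (b := 1) (f := fun t => P (t, x)) (C := C) ?_
    · simpa using this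
    · intro t ht
      rw [uIoc_of_le zero_le_one] at ht
      exact hC t (Ioc_subset_Icc_self ht)
  | succ k ih =>
    intro G _ _ _ P hP
    have hP' : ContDiffOn ℝ ∞ (fun q => (fderiv ℝ P q).comp (ContinuousLinearMap.inr ℝ ℝ E)) (S ×ˢ O) := by
      have := hP.fderiv_of_isOpen (m := ∞) hSO (by simp)
      exact this.clm_comp contDiffOn_const
    obtain ⟨i1, i2⟩ := ih hP'
    have hfd : ∀ x ∈ O, fderiv ℝ (fun x => ∫ t in (0 : ℝ)..1, P (t, x)) x =
        ∫ t in (0 : ℝ)..1, (fderiv ℝ P (t, x)).comp (ContinuousLinearMap.inr ℝ ℝ E) := fun x hx =>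
      (pint_hasFDerivAt hS hO hIS hP hx).fderiv
    constructor
    · push_cast
      rw [contDiffOn_succ_iff_fderiv_of_isOpen hO]
      refine ⟨fun x hx => (pint_hasFDerivAt hS hO hIS hP hx).differentiableAt.differentiableWithinAt, by simp, ?_⟩
      exact i1.congr hfd
    · intro x hx C hC
      rw [← norm_iteratedFDeriv_fderiv]
      have e : fderiv ℝ (fun x => ∫ t in (0 : ℝ)..1, P (t, x)) =ᶠ[𝓝 x] fun x =>
          ∫ t in (0 : ℝ)..1, (fderiv ℝ P (t, x)).comp (ContinuousLinearMap.inr ℝ ℝ E) := by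
        filter_upwards [hO.mem_nhds hx] with y hy using hfd y hy
      rw [(e.iteratedFDeriv ℝ k).eq_of_nhds]
      refine i2 x hx C fun t ht => ?_
      refine le_trans (le_of_eq ?_) (hC t ht)
      rw [← norm_iteratedFDeriv_fderiv]
      have e2 : (fun y => (fderiv ℝ P (t, y)).comp (ContinuousLinearMap.inr ℝ ℝ E)) =ᶠ[𝓝 x]
          fderiv ℝ (fun y => P (t, y)) := by
        filter_upwards [hO.mem_nhds hx] with y hy
        have h1 : HasFDerivAt P (fderiv ℝ P (t, y)) (t, y) :=
          ((hP.contDiffAt (hSO.mem_nhds ⟨hIS ht, hy⟩)).differentiableAt (by simp)).hasFDerivAt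
        exact (h1.comp y (hasFDerivAt_prodMk_right t y)).fderiv.symm
      rw [(e2.iteratedFDeriv ℝ k).eq_of_nhds]

end pint

variable {M : ℕ → ℝ} [hM : NSeq M] {σ : Type} [Fintype σ] [DecidableEq σ]

/-- the partial scaling map -/
noncomputable def scal (j : σ) (t : ℝ) : (σ → ℝ) →L[ℝ] (σ → ℝ) :=
  ContinuousLinearMap.pi fun i => (if i = j then t else 1) • (ContinuousLinearMap.proj i : (σ → ℝ) →L[ℝ] ℝ)

theorem scal_apply (j : σ) (t : ℝ) (x : σ → ℝ) : scal j t x = fun i => (if i = j then t else 1) * x i := by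
  ext i; by_cases h : i = j <;> simp [scal, h]

theorem scal_eq_update (j : σ) (t : ℝ) (x : σ → ℝ) : scal j t x = Function.update x j (t * x j) := by
  ext i; rw [scal_apply]; by_cases h : i = j
  · subst h; simp
  · simp [h]

theorem norm_scal_le (j : σ) (t : ℝ) (ht : |t| ≤ 1) : ‖scal j t‖ ≤ 1 := by
  refine ContinuousLinearMap.opNorm_le_bound _ zero_le_one fun x => ?_
  rw [one_mul, scal_apply]
  refine (pi_norm_le_iff_of_nonneg (norm_nonneg _)).2 fun i => ?_
  rw [norm_mul]
  have h1 : ‖(if i = j then t else 1)‖ ≤ 1 := by split_ifs <;> simp [ht]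
  calc _ ≤ 1 * ‖x‖ := mul_le_mul h1 (norm_le_pi_norm x i) (norm_nonneg _) zero_le_one
    _ = _ := one_mul _

theorem pd_dcAt {f : (σ → ℝ) → ℝ} {a : σ → ℝ} (hf : DCAt M f a) (j : σ) : DCAt M (pd j f) a :=
  hf.fderiv.clm_comp (ContinuousLinearMap.apply ℝ ℝ (Pi.single j (1 : ℝ)))

/-- Division by a coordinate. -/
theorem dcAt_div_coord {f : (σ → ℝ) → ℝ} {a : σ → ℝ} (hf : DCAt M f a) (j : σ) (ha : a j = 0) :
    ∃ u : (σ → ℝ) → ℝ, DCAt M u a ∧ ∀ᶠ x in 𝓝 a, f x = f (Function.update x j 0) + x j * u x := by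
  obtain ⟨A, B, hA, hB, hAB⟩ := pd_dcAt hf j
  obtain ⟨r, hr, hball⟩ := Metric.eventually_nhds_iff_ball.1 (hAB.and hf.eventually)
  have hsc : ∀ t : ℝ, |t| < 2 → ∀ x ∈ Metric.ball a (r / 2), scal j t x ∈ Metric.ball a r := by
    intro t ht x hx
    rw [Metric.mem_ball] at hx ⊢
    rw [dist_pi_lt_iff hr]
    rw [dist_pi_lt_iff (by linarith)] at hx
    intro i
    rw [scal_apply]
    by_cases h : i = j
    · subst h
      have := hx i
      simp only [ha, dist_zero_right, Real.norm_eq_abs] at this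
      simp only [if_true, ha, dist_zero_right, norm_mul, Real.norm_eq_abs]
      nlinarith [abs_nonneg t, abs_nonneg (x i)]
    · have := hx i
      simp only [h, if_false, one_mul]; linarith
  set P : ℝ × (σ → ℝ) → ℝ := fun q => pd j f (scal j q.1 q.2) with hP
  set S : Set ℝ := Ioo (-2) 2
  set O := Metric.ball a (r / 2)
  have hIS : Icc (0 : ℝ) 1 ⊆ S := fun t ht => ⟨by linarith [ht.1], by linarith [ht.2]⟩
  have hLs : ContDiff ℝ ∞ (fun q : ℝ × (σ → ℝ) => scal j q.1 q.2) := by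
    simp only [scal_apply]
    refine contDiff_pi.2 fun i => ?_
    by_cases h : i = j
    · simp only [h, if_true]; fun_prop
    · simp only [h, if_false]; fun_prop
  have hPs : ContDiffOn ℝ ∞ P (S ×ˢ O) := by
    rintro ⟨t, x⟩ ⟨ht, hx⟩
    have := (hball _ (hsc t (abs_lt.2 ht) x hx)).1.1
    exact (this.comp (t, x) hLs.contDiffAt).contDiffWithinAt
  have hmain := fun k => pint_bound isOpen_Ioo Metric.isOpen_ball hIS k hPs
  refine ⟨fun x => ∫ t in (0 : ℝ)..1, P (t, x), ?_, ?_⟩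
  · refine dcAt_of_bound (A := A) (B := B) (by linarith) (by linarith) ?_
    filter_upwards [Metric.ball_mem_nhds a (half_pos hr)] with x hx
    refine ⟨?_, fun k => ?_⟩
    · rw [contDiffAt_infty]
      exact fun k => (hmain k).1.contDiffAt (Metric.isOpen_ball.mem_nhds hx)
    · refine (hmain k).2 x hx _ fun t ht => ?_
      have hmem := hsc t (abs_lt.2 (hIS ht)) x hx
      have hpre : IsOpen ((scal j t) ⁻¹' (Metric.ball a r)) := Metric.isOpen_ball.preimage (scal j t).continuous
      have h1 := (scal j t).iteratedFDerivWithin_comp_right (n := ∞) (f := pd j f) (s := Metric.ball a r)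
        (fun z hz => ((hball z hz).1.1).contDiffWithinAt) Metric.isOpen_ball.uniqueDiffOn
        hpre.uniqueDiffOn (x := x) hmem (i := k) (by exact_mod_cast le_top)
      rw [iteratedFDerivWithin_of_isOpen k hpre hmem, iteratedFDerivWithin_of_isOpen k Metric.isOpen_ball hmem] at h1
      change ‖iteratedFDeriv ℝ k (pd j f ∘ scal j t) x‖ ≤ _
      rw [h1]
      refine (ContinuousMultilinearMap.norm_compContinuousLinearMap_le _ _).trans ?_
      have h2 : ∏ i : Fin k, ‖scal j t‖ ≤ 1 := by
        simp only [Finset.prod_const]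
        exact pow_le_one₀ (norm_nonneg _) (norm_scal_le j t (abs_le.2 ⟨by linarith [ht.1], ht.2⟩))
      calc _ ≤ ‖iteratedFDeriv ℝ k (pd j f) (scal j t x)‖ * 1 := by gcongr
        _ ≤ _ := by rw [mul_one]; exact (hball _ hmem).1.2 k
  · filter_upwards [Metric.ball_mem_nhds a (half_pos hr)] with x hx
    have hd : ∀ t ∈ uIcc (0 : ℝ) 1, HasDerivAt (fun t => f (scal j t x)) (x j * P (t, x)) t := by
      intro t ht
      rw [uIcc_of_le zero_le_one] at ht
      have hmem := hsc t (abs_lt.2 (hIS ht)) x hx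
      have h1 := ((hball _ hmem).2.contDiffAt.differentiableAt (by simp)).hasFDerivAt
      have h2 : HasDerivAt (fun t => scal j t x) (x j • Pi.single j (1 : ℝ)) t := by
        rw [hasDerivAt_pi]
        intro i
        simp only [scal_apply]
        by_cases h : i = j
        · subst h; simpa using (hasDerivAt_id t).mul_const (x i)
        · simpa [h] using hasDerivAt_const t (x i)
      have h3 := h1.comp_hasDerivAt t h2
      refine HasDerivAt.congr_deriv (f := fun t => f (scal j t x)) h3 ?_
      simp only [hP, pd, map_smul, smul_eq_mul]
    have hcont : ContinuousOn (fun t => P (t, x)) (Icc 0 1) :=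
      hPs.continuousOn.comp (f := fun t : ℝ => (t, x)) (by fun_prop) (fun t ht => ⟨hIS ht, hx⟩)
    have hi : IntervalIntegrable (fun t => x j * P (t, x)) MeasureTheory.volume 0 1 :=
      ContinuousOn.intervalIntegrable (by rw [uIcc_of_le zero_le_one]; exact continuousOn_const.mul hcont)
    have := intervalIntegral.integral_eq_sub_of_hasDerivAt hd hi
    rw [intervalIntegral.integral_const_mul] at this
    rw [this, scal_eq_update, scal_eq_update]
    simp

end QDC
end


section
open Set Filter Topology
open scoped ContDiff Nat
set_option linter.unusedSectionVars false
namespace QDC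

theorem bang_step {N : ℕ → ℝ} (hN : ∀ n, 0 < N n) (hmono : Monotone fun n => N (n + 1) / N n)
    {f : ℕ → ℝ → ℝ} {L : ℝ} (hf : ∀ j, ∀ t ∈ Icc 0 L, HasDerivAt (f j) (f (j + 1) t) t)
    (hb : ∀ j, ∀ t ∈ Icc 0 L, |f j t| ≤ N j) (n : ℕ) {t h : ℝ} (ht : 0 ≤ t) (hh : 0 ≤ h) (hth : t + h ≤ L)
    (hh' : h ≤ N n / (Real.exp 1 * N (n + 1)))
    (hP : ∀ j, |f j t| ≤ Real.exp (-(n + 1 : ℝ)) * Real.exp j * N j) :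
    ∀ j, |f j (t + h)| ≤ Real.exp (-(n : ℝ)) * Real.exp j * N j := by
  have key : ∀ d ≤ n + 1, ∀ s ∈ Icc t (t + h), |f (n + 1 - d) s| ≤
      Real.exp (-(n + 1 : ℝ)) * Real.exp ((n + 1 - d : ℕ) : ℝ) * N (n + 1 - d) *
        Real.exp (Real.exp 1 * (N (n + 1) / N n) * (s - t)) := by
    intro d
    induction d with
    | zero =>
      intro _ s hs
      have h1 := hb (n + 1) s ⟨ht.trans hs.1, hs.2.trans hth⟩
      have h2 : Real.exp (-(n + 1 : ℝ)) * Real.exp ((n + 1 : ℕ) : ℝ) = 1 := by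
        rw [← Real.exp_add]; simp
      simp only [Nat.sub_zero, h2, one_mul]
      refine h1.trans (le_mul_of_one_le_right (hN _).le (Real.one_le_exp ?_))
      have := hN (n + 1); have := hN n; have := hs.1
      have : 0 ≤ s - t := by linarith
      positivity
    | succ d ih =>
      intro hd s hs
      have ih := ih (by omega)
      set j := n + 1 - (d + 1) with hj
      have hj1 : n + 1 - d = j + 1 := by omega
      rw [hj1] at ih
      set ρ := N (n + 1) / N n
      have hB : ∀ x, HasDerivAt (fun x => Real.exp (-(n + 1 : ℝ)) * Real.exp (j : ℝ) * N j *
        Real.exp (Real.exp 1 * ρ * (x - t))) (Real.exp (-(n + 1 : ℝ)) * Real.exp (j : ℝ) * N j *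
          (Real.exp (Real.exp 1 * ρ * (x - t)) * (Real.exp 1 * ρ))) x := by
        intro x
        have := ((((hasDerivAt_id x).sub_const t).const_mul (Real.exp 1 * ρ)).exp).const_mul
          (Real.exp (-(n + 1 : ℝ)) * Real.exp (j : ℝ) * N j)
        simpa using this
      have hmem : ∀ x ∈ Icc t (t + h), x ∈ Icc 0 L := fun x hx => ⟨ht.trans hx.1, hx.2.trans hth⟩
      refine image_norm_le_of_norm_deriv_right_le_deriv_boundary (f := f j) (f' := f (j + 1)) (a := t) (b := t + h)
        (fun x hx => (hf j x (hmem x hx)).continuousAt.continuousWithinAt)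
        (fun x hx => (hf j x (hmem x (Ico_subset_Icc_self hx))).hasDerivWithinAt) ?_ hB ?_ hs
      · simpa using hP j
      · intro x hx
        refine (ih x (Ico_subset_Icc_self hx)).trans ?_
        have h1 : N (j + 1) ≤ N j * ρ := by
          have := hmono (show j ≤ n by omega)
          simp only at this
          rw [div_le_iff₀ (hN j)] at this
          linarith
        have h2 : Real.exp ((j + 1 : ℕ) : ℝ) = Real.exp j * Real.exp 1 := by
          rw [← Real.exp_add]; push_cast; rfl
        rw [h2]
        calc _ = (Real.exp (-(n + 1 : ℝ)) * Real.exp j * Real.exp 1 * Real.exp (Real.exp 1 * ρ * (x - t))) * N (j + 1) := by ring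
          _ ≤ (Real.exp (-(n + 1 : ℝ)) * Real.exp j * Real.exp 1 * Real.exp (Real.exp 1 * ρ * (x - t))) * (N j * ρ) := by
              gcongr
          _ = _ := by ring
  intro j
  by_cases hj : j ≤ n + 1
  · have h1 := key (n + 1 - j) (by omega) (t + h) ⟨by linarith, le_rfl⟩
    have e : n + 1 - (n + 1 - j) = j := by omega
    rw [e] at h1
    refine h1.trans ?_
    have h3 : Real.exp 1 * (N (n + 1) / N n) * h ≤ 1 := by
      have := hN n; have := hN (n + 1)
      rw [le_div_iff₀ (by positivity)] at hh'
      rw [mul_div_assoc', div_mul_eq_mul_div, div_le_one (hN n)]; linarith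
    have h2 : Real.exp (Real.exp 1 * (N (n + 1) / N n) * (t + h - t)) ≤ Real.exp 1 := by
      rw [add_sub_cancel_left]; exact Real.exp_le_exp.2 h3
    have h4 : Real.exp (-(n : ℝ)) = Real.exp (-(n + 1 : ℝ)) * Real.exp 1 := by
      rw [← Real.exp_add]; congr 1; ring
    rw [h4]
    have := hN j
    calc _ ≤ Real.exp (-(n + 1 : ℝ)) * Real.exp j * N j * Real.exp 1 := by gcongr
      _ = _ := by ring
  · refine (hb j _ ⟨by linarith, hth⟩).trans ?_
    rw [← Real.exp_add]
    refine le_mul_of_one_le_left (hN _).le (Real.one_le_exp ?_)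
    have : (n : ℝ) ≤ j := by exact_mod_cast (by omega : n ≤ j)
    linarith

theorem bang {N : ℕ → ℝ} (hN : ∀ n, 0 < N n) (hmono : Monotone fun n => N (n + 1) / N n)
    (hdiv : ¬ Summable fun n => N n / N (n + 1))
    {f : ℕ → ℝ → ℝ} {L : ℝ} (hf : ∀ j, ∀ t ∈ Icc 0 L, HasDerivAt (f j) (f (j + 1) t) t)
    (hb : ∀ j, ∀ t ∈ Icc 0 L, |f j t| ≤ N j) (h0 : ∀ j, f j 0 = 0) :
    ∀ j, ∀ t ∈ Icc 0 L, f j t = 0 := by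
  have key : ∀ k d : ℕ, ∀ t ∈ Icc 0 L, t ≤ ∑ i ∈ Finset.range d, N (k + i) / (Real.exp 1 * N (k + i + 1)) →
      ∀ j, |f j t| ≤ Real.exp (-(k : ℝ)) * Real.exp j * N j := by
    intro k d
    induction d generalizing k with
    | zero =>
      intro t ht h1 j
      simp only [Finset.range_zero, Finset.sum_empty] at h1
      have : t = 0 := le_antisymm h1 ht.1
      rw [this, h0 j, abs_zero]
      have := hN j; positivity
    | succ d ih =>
      intro t ht h1
      have ih := ih (k + 1)
      rw [Finset.sum_range_succ'] at h1
      set s := ∑ i ∈ Finset.range d, N (k + (i + 1)) / (Real.exp 1 * N (k + (i + 1) + 1)) with hs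
      have hs' : ∑ i ∈ Finset.range d, N (k + 1 + i) / (Real.exp 1 * N (k + 1 + i + 1)) = s := by
        refine Finset.sum_congr rfl fun i _ => ?_
        rw [show k + 1 + i = k + (i + 1) by ring]
      rw [hs'] at ih
      have hs0 : 0 ≤ s := Finset.sum_nonneg fun i _ => by
        have := hN (k + (i + 1)); have := hN (k + (i + 1) + 1); positivity
      push_cast at ih
      by_cases hts : t ≤ s
      · intro j
        refine (ih t ht hts j).trans ?_
        have := hN j
        gcongr
        linarith
      · push Not at hts
        have := bang_step hN hmono hf hb k (t := s) (h := t - s) hs0 (by linarith) (by linarith [ht.2])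
          (by simp only [add_zero] at h1; linarith)
          (ih s ⟨hs0, hts.le.trans ht.2⟩ le_rfl)
        simpa using this
  intro j t ht
  have h1 : ∀ k : ℕ, |f j t| ≤ Real.exp (-(k : ℝ)) * (Real.exp j * N j) := by
    intro k
    have hd : ¬ Summable fun i => N (k + i) / (Real.exp 1 * N (k + i + 1)) := by
      intro hsum
      apply hdiv
      rw [← summable_nat_add_iff k]
      refine (hsum.mul_left (Real.exp 1)).congr fun i => ?_
      rw [show k + i = i + k by ring]
      have := (hN (i + k + 1)).ne'
      field_simp
    have hpos : ∀ i, 0 ≤ N (k + i) / (Real.exp 1 * N (k + i + 1)) := fun i => by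
      have := hN (k + i); have := hN (k + i + 1); positivity
    have := (not_summable_iff_tendsto_nat_atTop_of_nonneg hpos).1 hd
    obtain ⟨d, hd⟩ := (this.eventually_ge_atTop t).exists
    rw [← mul_assoc]
    exact key k d t ht hd j
  have h2 : Tendsto (fun k : ℕ => Real.exp (-(k : ℝ)) * (Real.exp j * N j)) atTop (𝓝 (0 * (Real.exp j * N j))) := by
    refine Tendsto.mul_const _ ?_
    exact Real.tendsto_exp_neg_atTop_nhds_zero.comp tendsto_natCast_atTop_atTop
  rw [zero_mul] at h2
  have := ge_of_tendsto' h2 h1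
  simpa using this

variable {M : ℕ → ℝ} [hM : NSeq M] {E : Type*} [NormedAddCommGroup E] [NormedSpace ℝ E]

theorem dcAt_uniform {F : Type*} [NormedAddCommGroup F] [NormedSpace ℝ F] {f : E → F} {K : Set E} (hK : IsCompact K) (hf : ∀ x ∈ K, DCAt M f x) :
    ∃ A B : ℝ, 1 ≤ A ∧ 1 ≤ B ∧ ∀ x ∈ K, ∀ k, ‖iteratedFDeriv ℝ k f x‖ ≤ A * B ^ k * k ! * M k := by
  refine hK.induction_on (p := fun K => ∃ A B : ℝ, 1 ≤ A ∧ 1 ≤ B ∧ ∀ x ∈ K, ∀ k, ‖iteratedFDeriv ℝ k f x‖ ≤ A * B ^ k * k ! * M k)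
    ⟨1, 1, le_rfl, le_rfl, by simp⟩ ?_ ?_ ?_
  · rintro s t hst ⟨A, B, hA, hB, h⟩
    exact ⟨A, B, hA, hB, fun x hx => h x (hst hx)⟩
  · rintro s t ⟨A, B, hA, hB, h⟩ ⟨A', B', hA', hB', h'⟩
    refine ⟨max A A', max B B', le_max_of_le_left hA, le_max_of_le_left hB, ?_⟩
    have hpos := fun k => (NSeq.pos (M := M) k).le
    rintro x (hx | hx) k
    · refine (h x hx k).trans ?_
      have := hpos k
      gcongr <;> exact le_max_left _ _
    · refine (h' x hx k).trans ?_
      have := hpos k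
      gcongr <;> exact le_max_right _ _
  · intro x hx
    obtain ⟨A, B, hA, hB, h⟩ := hf x hx
    exact ⟨_, mem_nhdsWithin_of_mem_nhds h, A, B, hA, hB, fun y hy => hy.2⟩

/-- one-dimensional quasianalyticity along a segment -/
theorem quasi_segment {f : E → ℝ} {a v : E} (h : ∀ t ∈ Icc (0 : ℝ) 1, DCAt M f (a + t • v))
    (h0 : ∀ k, iteratedFDeriv ℝ k f a (fun _ => v) = 0) : ∀ t ∈ Icc (0 : ℝ) 1, f (a + t • v) = 0 := by
  have hK : IsCompact ((fun t : ℝ => a + t • v) '' Icc 0 1) := isCompact_Icc.image (by fun_prop)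
  obtain ⟨A, B, hA, hB, hAB⟩ := dcAt_uniform hK (f := f) (by rintro _ ⟨t, ht, rfl⟩; exact h t ht)
  set D := B * (1 + ‖v‖) with hD
  have hDpos : 0 < D := by positivity
  have hpos := fun k => (NSeq.pos (M := M) k)
  have hq : ∀ n, A * D ^ n * n ! * M n / (A * D ^ (n + 1) * (n + 1)! * M (n + 1)) = D⁻¹ * (M n / ((n + 1) * M (n + 1))) := by
    intro n
    have h1 := (hpos n).ne'; have h2 := (hpos (n+1)).ne'; have h3 : ((n ! : ℕ) : ℝ) ≠ 0 := by positivity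
    have h4 : A ≠ 0 := by positivity
    have h5 : ((n : ℝ) + 1) ≠ 0 := by positivity
    rw [Nat.factorial_succ, pow_succ]; push_cast; field_simp
  have hq' : ∀ n, (A * D ^ (n + 1) * (n + 1)! * M (n + 1)) / (A * D ^ n * n ! * M n) = D * ((n + 1) * (M (n + 1) / M n)) := by
    intro n
    rw [← inv_div, hq]
    have h1 := (hpos n).ne'; have h2 := (hpos (n+1)).ne'
    have h5 : ((n : ℝ) + 1) ≠ 0 := by positivity
    field_simp
  have := bang (N := fun n => A * D ^ n * n ! * M n) (f := fun k t => iteratedFDeriv ℝ k f (a + t • v) (fun _ => v)) (L := 1)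
    (fun n => by have := hpos n; positivity) ?_ ?_ ?_ ?_ (by simpa using h0) 0
  · simpa using this
  · refine monotone_nat_of_le_succ fun n => ?_
    simp only [hq']
    have h1 : (M (n + 1) / M n) ≤ (M (n + 1 + 1) / M (n + 1)) := NSeq.lc n
    have h2 := hpos n; have := hpos (n + 1)
    gcongr
    linarith
  · intro hs
    simp only [hq] at hs
    refine NSeq.qa (M := M) ((hs.mul_left D).congr fun n => ?_)
    field_simp
  · intro j t ht
    have h1 := ((h t ht).contDiffAt.differentiableAt_iteratedFDeriv (m := j) (by exact_mod_cast WithTop.coe_lt_top _)).hasFDerivAt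
    have h2 : HasDerivAt (fun t : ℝ => a + t • v) v t := by
      simpa using ((hasDerivAt_id t).smul_const v).const_add a
    have h3 := h1.comp_hasDerivAt t h2
    have h4 := (ContinuousMultilinearMap.apply ℝ (fun _ : Fin j => E) ℝ (fun _ => v)).hasFDerivAt.comp_hasDerivAt t h3
    exact h4
  · intro j t ht
    have h1 := (iteratedFDeriv ℝ j f (a + t • v)).le_opNorm (fun _ => v)
    rw [Real.norm_eq_abs] at h1
    refine h1.trans ?_
    have h2 := hAB _ ⟨t, ht, rfl⟩ j
    simp only [Finset.prod_const, Finset.card_univ, Fintype.card_fin]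
    have := hpos j
    calc _ ≤ (A * B ^ j * j ! * M j) * (1 + ‖v‖) ^ j := by gcongr; linarith
      _ = _ := by rw [hD, mul_pow]; ring

theorem quasi_convex {f : E → ℝ} {S : Set E} (hS : Convex ℝ S) (hf : ∀ x ∈ S, DCAt M f x) {a : E} (ha : a ∈ S)
    (h0 : ∀ k v, iteratedFDeriv ℝ k f a (fun _ => v) = 0) : ∀ x ∈ S, f x = 0 := by
  intro x hx
  have := quasi_segment (M := M) (f := f) (a := a) (v := x - a) (fun t ht => hf _ (hS.add_smul_sub_mem ha hx ht))
    (fun k => h0 k _) 1 (by simp)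
  simpa using this

theorem quasi_convex' {f : E → ℝ} {S : Set E} (hS : Convex ℝ S) (hf : ∀ x ∈ S, DCAt M f x) {a : E} (ha : a ∈ S)
    (h0 : ∀ᶠ y in 𝓝 a, f y = 0) : ∀ x ∈ S, f x = 0 := by
  refine quasi_convex hS hf ha fun k v => ?_
  have h : f =ᶠ[𝓝 a] fun _ => 0 := h0
  rw [(h.iteratedFDeriv ℝ k).eq_of_nhds]
  simp

theorem exists_direction {f : E → ℝ} {a : E} (hf : DCAt M f a) (h : ¬ ∀ᶠ y in 𝓝 a, f y = 0) :
    ∃ k v, iteratedFDeriv ℝ k f a (fun _ => v) ≠ 0 := by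
  by_contra! hc
  obtain ⟨r, hr, hb⟩ := Metric.eventually_nhds_iff_ball.1 hf.eventually
  refine h (Metric.eventually_nhds_iff_ball.2 ⟨r, hr, ?_⟩)
  exact quasi_convex (convex_ball a r) hb (Metric.mem_ball_self hr) hc

theorem germ_mul_ne {f g : E → ℝ} {a : E} (hf : DCAt M f a) (hg : DCAt M g a)
    (h : ∀ᶠ y in 𝓝 a, f y * g y = 0) : (∀ᶠ y in 𝓝 a, f y = 0) ∨ ∀ᶠ y in 𝓝 a, g y = 0 := by
  by_cases hg0 : ∀ᶠ y in 𝓝 a, g y = 0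
  · exact .inr hg0
  left
  obtain ⟨r, hr, hb⟩ := Metric.eventually_nhds_iff_ball.1 (h.and (hf.eventually.and hg.eventually))
  have : ∃ y ∈ Metric.ball a r, g y ≠ 0 := by
    by_contra! hc
    exact hg0 (Metric.eventually_nhds_iff_ball.2 ⟨r, hr, hc⟩)
  obtain ⟨y, hy, hgy⟩ := this
  have h1 : ∀ᶠ z in 𝓝 y, f z = 0 := by
    filter_upwards [(hb y hy).2.2.continuousAt.eventually_ne hgy, Metric.isOpen_ball.mem_nhds hy] with z hz hz'
    exact (mul_eq_zero.1 (hb z hz').1).resolve_right hz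
  exact Metric.eventually_nhds_iff_ball.2 ⟨r, hr, quasi_convex' (convex_ball a r) (fun x hx => (hb x hx).2.1) hy h1⟩

end QDC
end


section
open Set Filter Topology
open scoped ContDiff Nat
set_option linter.unusedSectionVars false
namespace QDC

section pdw
variable {σ : Type} [Fintype σ] [DecidableEq σ] {O : Set (σ → ℝ)} {f g : (σ → ℝ) → ℝ}

theorem pd_smoothOn (hO : IsOpen O) (hf : ContDiffOn ℝ ∞ f O) (i : σ) : ContDiffOn ℝ ∞ (pd i f) O :=
  (hf.fderiv_of_isOpen (m := ∞) hO (by simp)).clm_apply contDiffOn_const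

theorem pd_congr_at {x : σ → ℝ} (h : f =ᶠ[𝓝 x] g) (i : σ) : pd i f =ᶠ[𝓝 x] pd i g := by
  filter_upwards [h.fderiv (𝕜 := ℝ)] with y hy
  simp only [pd, hy]

theorem pd_congr_on (hO : IsOpen O) (h : EqOn f g O) (i : σ) : EqOn (pd i f) (pd i g) O := fun _ hx =>
  (pd_congr_at (h.eventuallyEq_of_mem (hO.mem_nhds hx)) i).eq_of_nhds

theorem pd_comm (hO : IsOpen O) (hf : ContDiffOn ℝ ∞ f O) (i j : σ) : EqOn (pd i (pd j f)) (pd j (pd i f)) O := by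
  intro x hx
  have h1 := hf.contDiffAt (hO.mem_nhds hx)
  have hd : DifferentiableAt ℝ (fderiv ℝ f) x := (h1.fderiv_right (m := ∞) (by simp)).differentiableAt (by simp)
  have h2 : ∀ v w : σ → ℝ, fderiv ℝ (fun y => fderiv ℝ f y v) x w = fderiv ℝ (fderiv ℝ f) x w v := by
    intro v w
    rw [fderiv_clm_apply hd (by fun_prop)]; simp
  unfold pd
  rw [h2, h2]
  exact (h1.isSymmSndFDerivAt (by simp only [minSmoothness_of_isRCLikeNormedField]; exact WithTop.coe_le_coe.2 le_top)).eq _ _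

/-- iterated partial derivatives along words -/
noncomputable def pdw (l : List σ) (f : (σ → ℝ) → ℝ) : (σ → ℝ) → ℝ := l.foldr pd f

@[simp] theorem pdw_nil : pdw [] f = f := rfl
@[simp] theorem pdw_cons (i : σ) (l : List σ) : pdw (i :: l) f = pd i (pdw l f) := rfl
theorem pdw_append (l l' : List σ) : pdw (l ++ l') f = pdw l (pdw l' f) := by simp [pdw]

theorem pdw_smoothOn (hO : IsOpen O) (hf : ContDiffOn ℝ ∞ f O) (l : List σ) : ContDiffOn ℝ ∞ (pdw l f) O := by
  induction l with
  | nil => exact hf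
  | cons i l ih => exact pd_smoothOn hO ih i

theorem pdw_congr_at {x : σ → ℝ} (h : f =ᶠ[𝓝 x] g) (l : List σ) : pdw l f =ᶠ[𝓝 x] pdw l g := by
  induction l with
  | nil => exact h
  | cons i l ih => exact pd_congr_at ih i

theorem pdw_perm (hO : IsOpen O) (hf : ContDiffOn ℝ ∞ f O) {l l' : List σ} (h : l.Perm l') :
    EqOn (pdw l f) (pdw l' f) O := by
  induction h with
  | nil => exact fun _ _ => rfl
  | cons i _ ih => exact pd_congr_on hO ih i
  | swap i j l => exact pd_comm hO (pdw_smoothOn hO hf l) _ _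
  | trans _ _ h1 h2 => exact h1.trans h2

/-- the standard word of a multi-index -/
noncomputable def stdWord (α : σ → ℕ) : List σ :=
  (Finset.univ : Finset σ).toList.flatMap fun i => List.replicate (α i) i

theorem pd_iterate (i : σ) (k : ℕ) : (pd i)^[k] f = pdw (List.replicate k i) f := by
  induction k with
  | zero => rfl
  | succ k ih => rw [Function.iterate_succ_apply', ih, List.replicate_succ, pdw_cons]

theorem mpd_eq_pdw (α : σ → ℕ) : mpd α f = pdw (stdWord α) f := by
  unfold mpd stdWord
  induction (Finset.univ : Finset σ).toList with
  | nil => rfl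
  | cons i l ih => rw [List.foldr_cons, ih, List.flatMap_cons, pdw_append, pd_iterate]

theorem count_stdWord (α : σ → ℕ) (i : σ) : (stdWord α).count i = α i := by
  unfold stdWord
  rw [List.count_flatMap]
  have : ((Finset.univ : Finset σ).toList.map (List.count i ∘ fun j => List.replicate (α j) j)).sum =
      ∑ j : σ, if j = i then α j else 0 := by
    rw [← Finset.sum_map_toList]
    congr 1
    refine List.map_congr_left fun j _ => ?_
    simp [List.count_replicate]
  rw [this]; simp

theorem length_stdWord (α : σ → ℕ) : (stdWord α).length = mdeg α := by
  unfold stdWord mdeg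
  rw [List.length_flatMap, ← Finset.sum_map_toList]
  simp

theorem perm_stdWord (l : List σ) : l.Perm (stdWord fun i => l.count i) := by
  rw [List.perm_iff_count]; intro i; rw [count_stdWord]

theorem pdw_eq_mpd (hO : IsOpen O) (hf : ContDiffOn ℝ ∞ f O) (l : List σ) :
    EqOn (pdw l f) (mpd (fun i => l.count i) f) O := by
  rw [mpd_eq_pdw]; exact pdw_perm hO hf (perm_stdWord l)

theorem iteratedFDeriv_eq_pdw (hO : IsOpen O) (hf : ContDiffOn ℝ ∞ f O) (k : ℕ) (w : Fin k → σ) :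
    ∀ x ∈ O, iteratedFDeriv ℝ k f x (fun j => Pi.single (w j) 1) = pdw (List.ofFn w) f x := by
  induction k with
  | zero => intro x hx; simp
  | succ k ih =>
    intro x hx
    rw [iteratedFDeriv_succ_apply_left, List.ofFn_succ, pdw_cons, pd]
    have h1 : pdw (List.ofFn fun i => w i.succ) f =ᶠ[𝓝 x] fun y => iteratedFDeriv ℝ k f y (fun j => Pi.single (w j.succ) 1) := by
      filter_upwards [hO.mem_nhds hx] with y hy
      exact (ih _ y hy).symm
    rw [h1.fderiv_eq]
    have h2 := ((hf.contDiffAt (hO.mem_nhds hx)).differentiableAt_iteratedFDeriv (m := k) (by exact_mod_cast WithTop.coe_lt_top _)).hasFDerivAt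
    have h4 := (ContinuousMultilinearMap.apply ℝ (fun _ : Fin k => (σ → ℝ)) ℝ (fun j => Pi.single (w j.succ) 1)).hasFDerivAt.comp x h2
    have h5 := h4.fderiv
    change fderiv ℝ (fun y => iteratedFDeriv ℝ k f y (fun j => Pi.single (w j.succ) 1)) x = _ at h5
    rw [h5]; rfl

theorem norm_multilinear_le (k : ℕ) (T : ContinuousMultilinearMap ℝ (fun _ : Fin k => (σ → ℝ)) ℝ) {C : ℝ}
    (hC : ∀ w : Fin k → σ, |T (fun j => Pi.single (w j) 1)| ≤ C) : ‖T‖ ≤ (Fintype.card σ : ℝ) ^ k * C := by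
  by_cases hne : Nonempty (Fin k → σ)
  swap
  · have : k ≠ 0 ∧ IsEmpty σ := by
      constructor
      · rintro rfl; exact hne ⟨Fin.elim0⟩
      · by_contra h; rw [not_isEmpty_iff] at h; exact hne ⟨fun _ => h.some⟩
    obtain ⟨hk, _⟩ := this
    have h0 : T = 0 := by
      ext m
      exact T.map_coord_zero ⟨0, Nat.pos_of_ne_zero hk⟩ (Subsingleton.elim _ _)
    simp [h0, hk]
  have hC0 : 0 ≤ C := (abs_nonneg _).trans (hC hne.some)
  refine T.opNorm_le_bound (by positivity) fun m => ?_
  have h1 : T m = ∑ w : Fin k → σ, (∏ j, m j (w j)) * T (fun j => Pi.single (w j) 1) := by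
    conv_lhs => rw [show m = fun j => ∑ i, (m j i) • (Pi.single i (1 : ℝ) : σ → ℝ) from by
      ext j l; simp [Finset.sum_apply, Pi.single_apply]]
    have := T.toMultilinearMap.map_sum (fun (j : Fin k) (i : σ) => (m j i) • (Pi.single i (1 : ℝ) : σ → ℝ))
    refine this.trans (Finset.sum_congr rfl fun w _ => ?_)
    have := T.toMultilinearMap.map_smul_univ (fun j => m j (w j)) (fun j => (Pi.single (w j) (1 : ℝ) : σ → ℝ))
    simpa using this
  rw [h1]
  refine (norm_sum_le _ _).trans ?_
  have h2 : ∀ w ∈ (Finset.univ : Finset (Fin k → σ)), ‖(∏ j, m j (w j)) * T (fun j => Pi.single (w j) 1)‖ ≤ (∏ j, ‖m j‖) * C := by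
    intro w _
    rw [norm_mul, norm_prod]
    refine mul_le_mul ?_ (hC w) (norm_nonneg _) (by positivity)
    exact Finset.prod_le_prod (fun _ _ => norm_nonneg _) fun j _ => norm_le_pi_norm _ _
  refine (Finset.sum_le_sum h2).trans ?_
  simp only [Finset.sum_const, Finset.card_univ, Fintype.card_fun, Fintype.card_fin, nsmul_eq_mul]
  push_cast
  exact le_of_eq (by ring)

theorem norm_iteratedFDeriv_le_pdw (hO : IsOpen O) (hf : ContDiffOn ℝ ∞ f O) {x : σ → ℝ} (hx : x ∈ O) (k : ℕ) {C : ℝ}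
    (hC : ∀ l : List σ, l.length = k → |pdw l f x| ≤ C) : ‖iteratedFDeriv ℝ k f x‖ ≤ (Fintype.card σ : ℝ) ^ k * C := by
  refine norm_multilinear_le k _ fun w => ?_
  rw [iteratedFDeriv_eq_pdw hO hf k w x hx]
  exact hC _ (by simp)

theorem abs_pdw_le (hO : IsOpen O) (hf : ContDiffOn ℝ ∞ f O) {x : σ → ℝ} (hx : x ∈ O) (l : List σ) :
    |pdw l f x| ≤ ‖iteratedFDeriv ℝ l.length f x‖ := by
  have h1 := iteratedFDeriv_eq_pdw hO hf l.length (fun j => l.get j) x hx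
  rw [List.ofFn_get] at h1
  rw [← h1]
  refine ((iteratedFDeriv ℝ l.length f x).le_opNorm _).trans ?_
  refine mul_le_of_le_one_right (norm_nonneg _) ?_
  refine Finset.prod_le_one (fun _ _ => norm_nonneg _) fun j _ => ?_
  rw [Pi.norm_single]; simp

end pdw

/-- normalised sequence -/
noncomputable def nrm (M : ℕ → ℝ) (k : ℕ) : ℝ := M k / (M 0 * (M 1 / M 0) ^ k)

theorem nrm_nseq {M : ℕ → ℝ} (hM : IsDCSeq M) : NSeq (nrm M) := by
  obtain ⟨hpos, hlc, ⟨C, hC⟩, hqa⟩ := hM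
  have h0 := hpos 0
  have h1 := hpos 1
  have hr : ∀ k, nrm M (k + 1) / nrm M k = (M (k + 1) / M k) / (M 1 / M 0) := by
    intro k
    have := (hpos k).ne'; have := (hpos (k+1)).ne'
    unfold nrm; rw [pow_succ]; field_simp
  have hp : ∀ k, 0 < nrm M k := fun k => by have := hpos k; unfold nrm; positivity
  constructor
  · unfold nrm; field_simp
  · unfold nrm; field_simp
  · exact hp
  · intro k
    rw [hr, hr]
    have := hlc k
    gcongr
  · refine ⟨max 1 (C * max 1 (M 0 / M 1)), le_max_left _ _, fun k => ?_⟩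
    rw [← div_le_iff₀ (hp k), hr]
    rcases Nat.eq_zero_or_pos k with rfl | hk
    · simp only [zero_add, pow_one]
      rw [div_self (by positivity)]; exact le_max_left _ _
    · set q := M (k + 1) / M k
      have hq : 0 < q := div_pos (hpos _) (hpos _)
      have h2 := hC k hk
      have hC0 : 0 ≤ C := (Real.rpow_nonneg hq.le _).trans h2
      have h3 : q ≤ C ^ k := by
        have := Real.rpow_le_rpow (Real.rpow_nonneg hq.le _) h2 (show (0 : ℝ) ≤ k by positivity)
        rwa [← Real.rpow_mul hq.le, one_div_mul_cancel (by positivity), Real.rpow_one, Real.rpow_natCast] at this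
      set m := max 1 (M 0 / M 1)
      have hm : 1 ≤ m := le_max_left _ _
      have hm' : M 0 / M 1 ≤ m := le_max_right _ _
      calc q / (M 1 / M 0) = q * (M 0 / M 1) := by field_simp
        _ ≤ C ^ k * m := by gcongr
        _ ≤ C ^ k * m ^ k := by gcongr; exact le_self_pow₀ hm (by omega)
        _ = (C * m) ^ k := (mul_pow _ _ _).symm
        _ ≤ (max 1 (C * m)) ^ k := by gcongr; exact le_max_right _ _
        _ ≤ (max 1 (C * m)) ^ (k + 1) := pow_le_pow_right₀ (le_max_left _ _) (by omega)
  · intro hs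
    apply hqa
    refine (hs.mul_left (M 0 / M 1)).congr fun k => ?_
    have := (hpos k).ne'; have := (hpos (k+1)).ne'
    unfold nrm; rw [pow_succ]; field_simp

theorem mfact_le {σ : Type} [Fintype σ] (α : σ → ℕ) : mfact α ≤ (mdeg α)! :=
  Nat.le_of_dvd (Nat.factorial_pos _) (Nat.prod_factorial_dvd_factorial_sum _ _)

theorem dcAt_of_memDC {σ : Type} [Fintype σ] [DecidableEq σ] {M : ℕ → ℝ} (hM : IsDCSeq M) {U : Set (σ → ℝ)} (hU : IsOpen U)
    {f : (σ → ℝ) → ℝ} (hf : MemDC M U f) {x : σ → ℝ} (hx : x ∈ U) : DCAt (nrm M) f x := by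
  have := nrm_nseq hM
  obtain ⟨r, hr, hb⟩ := Metric.nhds_basis_closedBall.mem_iff.1 (hU.mem_nhds hx)
  obtain ⟨A, B, hA, hB, hAB⟩ := hf.2 _ hb (isCompact_closedBall x r)
  have h0 := hM.1 0
  have h1 := hM.1 1
  refine dcAt_of_bound (A := A * M 0) (B := Fintype.card σ * (B * (M 1 / M 0))) (by positivity) (by positivity) ?_
  filter_upwards [Metric.closedBall_mem_nhds x hr] with y hy
  refine ⟨hf.1.contDiffAt (hU.mem_nhds (hb hy)), fun k => ?_⟩
  refine (norm_iteratedFDeriv_le_pdw hU hf.1 (hb hy) k (C := A * B ^ k * k ! * M k) ?_).trans ?_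
  · intro l hl
    rw [pdw_eq_mpd hU hf.1 l (hb hy)]
    refine (hAB y hy _).trans ?_
    have hk : mdeg (fun i => l.count i) = k := by
      rw [← length_stdWord, ← (perm_stdWord l).length_eq, hl]
    have h2 := mfact_le (fun i => l.count i)
    rw [hk] at h2 ⊢
    have := hM.1 k
    gcongr
  · refine le_of_eq ?_
    have h2 := (hM.1 0).ne'; have := (hM.1 1).ne'
    unfold nrm
    rw [mul_pow, mul_pow]
    field_simp
end QDC
end


section
open Set Filter Topology
open scoped ContDiff Nat
set_option linter.unusedSectionVars false
namespace QDC

section nc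
variable {M : ℕ → ℝ} [hM : NSeq M] {σ : Type} [Fintype σ] [DecidableEq σ]

theorem dcAt_coord (j : σ) (a : σ → ℝ) : DCAt M (fun x : σ → ℝ => x j) a :=
  DCAt.clm (ContinuousLinearMap.proj j : (σ → ℝ) →L[ℝ] ℝ)

theorem dcAt_sub_coord (j : σ) (c : ℝ) (a : σ → ℝ) : DCAt M (fun x : σ → ℝ => x j - c) a :=
  (dcAt_coord j a).sub (dcAt_const c)

/-- monomial times unit -/
def NCAt (M : ℕ → ℝ) (f : (σ → ℝ) → ℝ) (a : σ → ℝ) : Prop :=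
  ∃ (α : σ → ℕ) (u : (σ → ℝ) → ℝ), DCAt M u a ∧ u a ≠ 0 ∧ ∀ᶠ x in 𝓝 a, f x = (∏ j, (x j - a j) ^ α j) * u x

variable {f g : (σ → ℝ) → ℝ} {a : σ → ℝ}

theorem NCAt.congr (h : NCAt M f a) (he : g =ᶠ[𝓝 a] f) : NCAt M g a := by
  obtain ⟨α, u, h1, h2, h3⟩ := h
  refine ⟨α, u, h1, h2, ?_⟩
  filter_upwards [h3, he] with x hx hx'
  rw [hx', hx]

theorem ncAt_unit (h : DCAt M f a) (h0 : f a ≠ 0) : NCAt M f a :=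
  ⟨0, f, h, h0, by simp⟩

theorem NCAt.mul (hf : NCAt M f a) (hg : NCAt M g a) : NCAt M (fun x => f x * g x) a := by
  obtain ⟨α, u, h1, h2, h3⟩ := hf
  obtain ⟨β, v, h1', h2', h3'⟩ := hg
  refine ⟨α + β, fun x => u x * v x, h1.mul h1', mul_ne_zero h2 h2', ?_⟩
  filter_upwards [h3, h3'] with x hx hx'
  rw [hx, hx']
  simp only [Pi.add_apply, pow_add, Finset.prod_mul_distrib]; ring

theorem ncAt_prod {ι : Type*} (s : Finset ι) {f : ι → (σ → ℝ) → ℝ} (h : ∀ i ∈ s, NCAt M (f i) a) :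
    NCAt M (fun x => ∏ i ∈ s, f i x) a := by
  classical
  induction s using Finset.induction_on with
  | empty => simpa using ncAt_unit (dcAt_const (1 : ℝ)) one_ne_zero
  | insert i s hi ih =>
    simp only [Finset.prod_insert hi]
    exact (h i (by simp)).mul (ih fun j hj => h j (by simp [hj]))

theorem NCAt.pow (hf : NCAt M f a) (k : ℕ) : NCAt M (fun x => f x ^ k) a := by
  simpa using ncAt_prod (Finset.range k) (f := fun _ => f) (fun _ _ => hf)

theorem ncAt_sub_coord (j : σ) (c : ℝ) (a : σ → ℝ) : NCAt M (fun x : σ → ℝ => x j - c) a := by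
  by_cases h : a j = c
  · refine ⟨Pi.single j 1, fun _ => 1, dcAt_const 1, one_ne_zero, .of_forall fun x => ?_⟩
    rw [mul_one, Finset.prod_eq_single j]
    · simp [h]
    · intro b _ hb; simp [hb]
    · simp
  · exact ncAt_unit (dcAt_sub_coord j c a) (sub_ne_zero.2 h)

theorem ncAt_coord (j : σ) (a : σ → ℝ) : NCAt M (fun x : σ → ℝ => x j) a := by
  simpa using ncAt_sub_coord (M := M) j 0 a

theorem NCAt.dcAt (h : NCAt M f a) : DCAt M f a := by
  obtain ⟨α, u, h1, _, h3⟩ := h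
  exact ((dcAt_prod _ fun j _ => (dcAt_sub_coord j (a j) a).pow (α j)).mul h1).congr h3

theorem NCAt.eventually (h : NCAt M f a) : ∀ᶠ y in 𝓝 a, NCAt M f y := by
  obtain ⟨α, u, h1, h2, h3⟩ := h
  filter_upwards [h1.eventually, h1.continuousAt.eventually_ne h2, h3.eventually_nhds] with y hy1 hy2 hy3
  refine NCAt.congr (f := fun x => (∏ j, (x j - a j) ^ α j) * u x) ?_ hy3
  exact (ncAt_prod _ fun j _ => (ncAt_sub_coord j (a j) y).pow (α j)).mul (ncAt_unit hy1 hy2)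

theorem sub_coord_not_ev (j : σ) (a : σ → ℝ) : ¬ ∀ᶠ x in 𝓝 a, x j - a j = 0 := by
  intro h
  have hc : Tendsto (fun t : ℝ => a + t • (Pi.single j 1 : σ → ℝ)) (𝓝[≠] 0) (𝓝 a) := by
    have : Continuous (fun t : ℝ => a + t • (Pi.single j 1 : σ → ℝ)) := by fun_prop
    have := this.tendsto 0
    simp only [zero_smul, add_zero] at this
    exact this.mono_left nhdsWithin_le_nhds
  obtain ⟨t, ht, ht0⟩ := ((hc.eventually h).and self_mem_nhdsWithin).exists
  simp at ht; exact ht0 ht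

theorem germ_prod_ne {ι : Type*} (s : Finset ι) {f : ι → (σ → ℝ) → ℝ} (hd : ∀ i ∈ s, DCAt M (f i) a)
    (h : ∀ i ∈ s, ¬ ∀ᶠ x in 𝓝 a, f i x = 0) : ¬ ∀ᶠ x in 𝓝 a, ∏ i ∈ s, f i x = 0 := by
  classical
  induction s using Finset.induction_on with
  | empty =>
    intro h; obtain ⟨x, hx⟩ := h.exists; simp at hx
  | insert i s hi ih =>
    intro h'
    simp only [Finset.prod_insert hi] at h'
    rcases germ_mul_ne (hd i (by simp)) (dcAt_prod s fun j hj => hd j (by simp [hj])) h' with h1 | h1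
    · exact h i (by simp) h1
    · exact ih (fun j hj => hd j (by simp [hj])) (fun j hj => h j (by simp [hj])) h1

theorem NCAt.not_ev (h : NCAt M f a) : ¬ ∀ᶠ x in 𝓝 a, f x = 0 := by
  obtain ⟨α, u, h1, h2, h3⟩ := h
  intro h0
  have h4 : ∀ᶠ x in 𝓝 a, (∏ j, (x j - a j) ^ α j) = 0 := by
    filter_upwards [h3, h0, h1.continuousAt.eventually_ne h2] with x h5 h6 h7
    rw [h6] at h5
    exact (mul_eq_zero.1 h5.symm).resolve_right h7
  refine germ_prod_ne (M := M) Finset.univ (f := fun j x => (x j - a j) ^ α j) (fun j _ => (dcAt_sub_coord j _ _).pow _) ?_ h4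
  intro j _ hj
  refine sub_coord_not_ev j a ?_
  filter_upwards [hj] with x hx
  exact (pow_eq_zero_iff (n := α j + 1) (by omega)).1 (by rw [pow_succ, hx, zero_mul])

theorem dcAt_update (j : σ) (c : ℝ) (a : σ → ℝ) : DCAt M (fun x : σ → ℝ => Function.update x j c) a := by
  rw [dcAt_pi]
  intro i
  by_cases h : i = j
  · subst h; simpa using dcAt_const (M := M) (x := a) c
  · simpa [h] using dcAt_coord (M := M) i a

/-- division by a shifted coordinate -/
theorem dcAt_div_coord' (hf : DCAt M f a) (j : σ) :
    ∃ u : (σ → ℝ) → ℝ, DCAt M u a ∧ ∀ᶠ x in 𝓝 a, f x = f (Function.update x j (a j)) + (x j - a j) * u x := by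
  set s : (σ → ℝ) := Pi.single j (a j) with hs
  have h0 : DCAt M (fun x => f (x + s)) (a - s) := by
    refine DCAt.comp (g := f) (f := fun x => x + s) (by simpa using hf) (dcAt_id.add (dcAt_const s))
  obtain ⟨u, hu, h⟩ := dcAt_div_coord h0 j (by simp [hs])
  refine ⟨fun x => u (x - s), DCAt.comp (g := u) (f := fun x => x - s) hu (dcAt_id.sub (dcAt_const s)), ?_⟩
  have ht : Tendsto (fun x : σ → ℝ => x - s) (𝓝 a) (𝓝 (a - s)) := (continuous_id.sub continuous_const).tendsto a
  filter_upwards [ht.eventually h] with x hx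
  simp only [sub_add_cancel] at hx
  rw [hx]
  congr 2
  · ext i
    by_cases hi : i = j
    · subst hi; simp [hs]
    · simp [hi, hs]
  · simp [hs]

theorem germ_cancel (hf : DCAt M f a) (hg : DCAt M g a) (j : σ)
    (h : ∀ᶠ x in 𝓝 a, (x j - a j) * f x = (x j - a j) * g x) : f =ᶠ[𝓝 a] g := by
  have h1 : ∀ᶠ x in 𝓝 a, (x j - a j) * (f x - g x) = 0 := by
    filter_upwards [h] with x hx; rw [mul_sub, hx, sub_self]
  rcases germ_mul_ne (dcAt_sub_coord j (a j) a) (hf.sub hg) h1 with h2 | h2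
  · exact absurd h2 (sub_coord_not_ev j a)
  · filter_upwards [h2] with x hx; linarith

theorem ncAt_factor_aux (N : ℕ) : ∀ (α : σ → ℕ), ∑ j, α j = N → ∀ (f g w : (σ → ℝ) → ℝ), DCAt M f a → DCAt M g a →
    DCAt M w a → w a ≠ 0 → (∀ᶠ x in 𝓝 a, f x * g x = (∏ j, (x j - a j) ^ α j) * w x) → NCAt M f a := by
  induction N with
  | zero =>
    intro α hα f g w hf hg hw hw0 h
    have h0 : ∀ j, α j = 0 := fun j => by
      have := Finset.sum_eq_zero_iff.1 hα j (Finset.mem_univ j); exact this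
    simp only [h0, pow_zero, Finset.prod_const_one, one_mul] at h
    refine ncAt_unit hf fun hfa => hw0 ?_
    rw [← h.self_of_nhds, hfa, zero_mul]
  | succ N ih =>
    intro α hα f g w hf hg hw hw0 h
    obtain ⟨j, hj⟩ : ∃ j, 0 < α j := by
      by_contra! hc
      have : ∑ j, α j = 0 := Finset.sum_eq_zero fun j _ => by have := hc j; omega
      omega
    set β : σ → ℕ := Function.update α j (α j - 1) with hβ
    have hβs : ∑ i, β i = N := by
      rw [← Finset.add_sum_erase _ _ (Finset.mem_univ j)] at hα ⊢
      have : ∑ i ∈ Finset.univ.erase j, β i = ∑ i ∈ Finset.univ.erase j, α i :=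
        Finset.sum_congr rfl fun i hi => by simp [hβ, Finset.ne_of_mem_erase hi]
      rw [this]; simp only [hβ, Function.update_self]; omega
    have hprod : ∀ x : σ → ℝ, ∏ i, (x i - a i) ^ α i = (x j - a j) * ∏ i, (x i - a i) ^ β i := by
      intro x
      rw [← Finset.mul_prod_erase _ _ (Finset.mem_univ j), ← Finset.mul_prod_erase _ (fun i => (x i - a i) ^ β i) (Finset.mem_univ j)]
      have : ∏ i ∈ Finset.univ.erase j, (x i - a i) ^ β i = ∏ i ∈ Finset.univ.erase j, (x i - a i) ^ α i :=
        Finset.prod_congr rfl fun i hi => by simp [hβ, Finset.ne_of_mem_erase hi]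
      rw [this, ← mul_assoc, ← pow_succ']
      simp only [hβ, Function.update_self]
      rw [Nat.sub_add_cancel hj]
    simp only [hprod] at h
    have hup : Tendsto (fun x : σ → ℝ => Function.update x j (a j)) (𝓝 a) (𝓝 a) := by
      have := (dcAt_update (M := M) j (a j) a).continuousAt.tendsto
      simpa using this
    have hz : ∀ᶠ x in 𝓝 a, f (Function.update x j (a j)) * g (Function.update x j (a j)) = 0 := by
      filter_upwards [hup.eventually h] with x hx
      rw [hx]; simp
    have hfu : DCAt M (fun x => f (Function.update x j (a j))) a :=
      DCAt.comp (g := f) (by simpa using hf) (dcAt_update j (a j) a)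
    have hgu : DCAt M (fun x => g (Function.update x j (a j))) a :=
      DCAt.comp (g := g) (by simpa using hg) (dcAt_update j (a j) a)
    have hdc : DCAt M (fun x => (∏ i, (x i - a i) ^ β i) * w x) a :=
      (dcAt_prod _ fun j _ => (dcAt_sub_coord j (a j) a).pow (β j)).mul hw
    rcases germ_mul_ne hfu hgu hz with h1 | h1
    · obtain ⟨f1, hf1, h2⟩ := dcAt_div_coord' hf j
      have h3 : f =ᶠ[𝓝 a] fun x => (x j - a j) * f1 x := by
        filter_upwards [h1, h2] with x hx hx'; rw [hx', hx, zero_add]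
      have h4 := germ_cancel (hf1.mul hg) hdc j (by
        filter_upwards [h, h3] with x hx hx'
        rw [← mul_assoc, ← hx', hx, mul_assoc])
      have := ih β hβs f1 g w hf1 hg hw hw0 h4
      exact ((ncAt_sub_coord j (a j) a).mul this).congr h3
    · obtain ⟨g1, hg1, h2⟩ := dcAt_div_coord' hg j
      have h3 : g =ᶠ[𝓝 a] fun x => (x j - a j) * g1 x := by
        filter_upwards [h1, h2] with x hx hx'; rw [hx', hx, zero_add]
      have h4 := germ_cancel (hf.mul hg1) hdc j (by
        filter_upwards [h, h3] with x hx hx'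
        rw [hx'] at hx
        rw [← mul_assoc (x j - a j) (∏ i, (x i - a i) ^ β i), ← hx]; ring)
      exact ih β hβs f g1 w hf hg1 hw hw0 h4

theorem NCAt.of_mul_left (hf : DCAt M f a) (hg : DCAt M g a) (h : NCAt M (fun x => f x * g x) a) : NCAt M f a := by
  obtain ⟨α, w, h1, h2, h3⟩ := h
  exact ncAt_factor_aux _ α rfl f g w hf hg h1 h2 h3

theorem NCAt.of_mul_right (hf : DCAt M f a) (hg : DCAt M g a) (h : NCAt M (fun x => f x * g x) a) : NCAt M g a :=
  NCAt.of_mul_left hg hf (h.congr (.of_forall fun _ => mul_comm _ _))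

theorem NCAt.of_prod {ι : Type*} (s : Finset ι) {f : ι → (σ → ℝ) → ℝ} (hd : ∀ i ∈ s, DCAt M (f i) a)
    (h : NCAt M (fun x => ∏ i ∈ s, f i x) a) : ∀ i ∈ s, NCAt M (f i) a := by
  classical
  intro i hi
  have h2 : NCAt M (fun x => f i x * ∏ k ∈ s.erase i, f k x) a := h.congr (.of_forall fun x => Finset.mul_prod_erase s (fun k => f k x) hi)
  exact NCAt.of_mul_left (hd i hi) (dcAt_prod _ fun k hk => hd k (Finset.mem_of_mem_erase hk)) h2

/-- comparability of exponents -/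
theorem exponents_comparable {α β : σ → ℕ} {u v : (σ → ℝ) → ℝ} (hu : DCAt M u a) (hv : DCAt M v a)
    (hu0 : u a ≠ 0) (hv0 : v a ≠ 0)
    (hd : (∀ᶠ x in 𝓝 a, (∏ j, (x j - a j) ^ α j) * u x - (∏ j, (x j - a j) ^ β j) * v x = 0) ∨
      NCAt M (fun x => (∏ j, (x j - a j) ^ α j) * u x - (∏ j, (x j - a j) ^ β j) * v x) a) :
    α ≤ β ∨ β ≤ α := by
  by_contra! hc
  obtain ⟨hc1, hc2⟩ := hc
  rw [Pi.le_def] at hc1 hc2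
  push Not at hc1 hc2
  obtain ⟨i, hi⟩ := hc1
  obtain ⟨j, hj⟩ := hc2
  set μ := α ⊓ β with hμ
  set α' : σ → ℕ := fun k => α k - μ k with hα'
  set β' : σ → ℕ := fun k => β k - μ k with hβ'
  have hdisj : ∀ k, α' k = 0 ∨ β' k = 0 := fun k => by
    simp only [hα', hβ', hμ, Pi.inf_apply]; omega
  have hi' : 0 < α' i := by simp only [hα', hμ, Pi.inf_apply]; omega
  have hj' : 0 < β' j := by simp only [hβ', hμ, Pi.inf_apply]; omega
  have hsplit : ∀ x : σ → ℝ, ((∏ j, (x j - a j) ^ α j) * u x - (∏ j, (x j - a j) ^ β j) * v x) =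
      (∏ j, (x j - a j) ^ μ j) * ((∏ j, (x j - a j) ^ α' j) * u x - (∏ j, (x j - a j) ^ β' j) * v x) := by
    intro x
    rw [mul_sub, ← mul_assoc, ← mul_assoc, ← Finset.prod_mul_distrib, ← Finset.prod_mul_distrib]
    have e1 : ∀ k, μ k + α' k = α k := fun k => by simp only [hα', hμ, Pi.inf_apply]; omega
    have e2 : ∀ k, μ k + β' k = β k := fun k => by simp only [hβ', hμ, Pi.inf_apply]; omega
    simp only [← pow_add, e1, e2]
  simp only [hsplit] at hd
  set h : (σ → ℝ) → ℝ := fun x => (∏ j, (x j - a j) ^ α' j) * u x - (∏ j, (x j - a j) ^ β' j) * v x with hh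
  have hmon : ∀ γ : σ → ℕ, NCAt M (fun x => ∏ j, (x j - a j) ^ γ j) a := fun γ =>
    ncAt_prod _ fun j _ => (ncAt_sub_coord j (a j) a).pow _
  have hhd : DCAt M h a := ((hmon α').dcAt.mul hu).sub ((hmon β').dcAt.mul hv)
  have hzero : ∀ γ : σ → ℕ, ∀ k, 0 < γ k → ∀ x : σ → ℝ, x k = a k → ∏ j, (x j - a j) ^ γ j = 0 := by
    intro γ k hk x hx
    exact Finset.prod_eq_zero (Finset.mem_univ k) (by rw [hx, sub_self, zero_pow hk.ne'])
  -- test points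
  have test : ∀ S : Set σ, ∀ p : (σ → ℝ) → Prop, (∀ᶠ x in 𝓝 a, p x) →
      ∃ x, p x ∧ (∀ k ∈ S, x k = a k) ∧ ∀ k ∉ S, x k ≠ a k := by
    classical
    intro S p hp
    have hcn : Continuous (fun t : ℝ => (fun k => if k ∈ S then a k else a k + t : σ → ℝ)) := by
      refine continuous_pi fun k => ?_
      by_cases hk : k ∈ S <;> simp only [hk, if_true, if_false] <;> fun_prop
    have ht : Tendsto (fun t : ℝ => (fun k => if k ∈ S then a k else a k + t : σ → ℝ)) (𝓝[≠] 0) (𝓝 a) := by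
      have := hcn.tendsto 0
      simp only [add_zero, ite_self] at this
      exact this.mono_left nhdsWithin_le_nhds
    obtain ⟨t, ht1, ht2⟩ := ((ht.eventually hp).and self_mem_nhdsWithin).exists
    refine ⟨_, ht1, fun k hk => by simp [hk], fun k hk => ?_⟩
    simp only [hk, if_false]
    intro h'; exact ht2 (by simpa using h')
  have hnz : ∀ γ : σ → ℕ, ∀ x : σ → ℝ, (∀ k, x k = a k → γ k = 0) → ∏ j, (x j - a j) ^ γ j ≠ 0 := by
    intro γ x hx
    refine Finset.prod_ne_zero_iff.2 fun k _ => ?_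
    by_cases hk : x k = a k
    · rw [hx k hk, pow_zero]; exact one_ne_zero
    · exact pow_ne_zero _ (sub_ne_zero.2 hk)
  have contra : ∀ k, (∀ᶠ x in 𝓝 a, x k = a k → h x = 0) → False := by
    intro k hk
    rcases hdisj k with h1 | h1
    · obtain ⟨x, ⟨hx1, hx2⟩, hx3, hx4⟩ := test {k, j} _ (hk.and (hu.continuousAt.eventually_ne hu0))
      have h2 := hx1 (hx3 k (by simp))
      simp only [hh, hzero β' j hj' x (hx3 j (by simp)), zero_mul, sub_zero] at h2
      refine mul_ne_zero (hnz α' x fun l hl => ?_) hx2 h2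
      have : l ∈ ({k, j} : Set σ) := by by_contra hl'; exact hx4 l hl' hl
      rcases this with rfl | rfl
      · exact h1
      · exact (hdisj l).resolve_right hj'.ne'
    · obtain ⟨x, ⟨hx1, hx2⟩, hx3, hx4⟩ := test {k, i} _ (hk.and (hv.continuousAt.eventually_ne hv0))
      have h2 := hx1 (hx3 k (by simp))
      simp only [hh, hzero α' i hi' x (hx3 i (by simp)), zero_mul, zero_sub, neg_eq_zero] at h2
      refine mul_ne_zero (hnz β' x fun l hl => ?_) hx2 h2
      have : l ∈ ({k, i} : Set σ) := by by_contra hl'; exact hx4 l hl' hl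
      rcases this with rfl | rfl
      · exact h1
      · exact (hdisj l).resolve_left hi'.ne'
  rcases hd with hd | hd
  · rcases germ_mul_ne (hmon μ).dcAt hhd hd with h1 | h1
    · exact (hmon μ).not_ev h1
    · exact contra i (h1.mono fun x hx _ => hx)
  · obtain ⟨δ, w, hw1, hw2, hw3⟩ := NCAt.of_mul_right (hmon μ).dcAt hhd hd
    by_cases hδ : ∃ k, 0 < δ k
    · obtain ⟨k, hk⟩ := hδ
      exact contra k (hw3.mono fun x hx hxk => by rw [hx, hzero δ k hk x hxk, zero_mul])
    · push Not at hδ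
      have h0 : ∀ k, δ k = 0 := fun k => by have := hδ k; omega
      have h1 := hw3.self_of_nhds
      simp only [h0, pow_zero, Finset.prod_const_one, one_mul] at h1
      apply hw2
      rw [← h1]
      simp only [hh, hzero α' i hi' a rfl, hzero β' j hj' a rfl, zero_mul, sub_zero]
end nc
end QDC
end


section
open Set Filter Topology
open scoped ContDiff Nat
set_option linter.unusedSectionVars false
namespace QDC

section cov
variable {M : ℕ → ℝ} [hM : NSeq M] {σ : Type} [Fintype σ] [DecidableEq σ]

/-- sets covered by finitely many uniformizing charts with values in `G` -/
inductive Cov (M : ℕ → ℝ) (f : (σ → ℝ) → ℝ) (G : Set (σ → ℝ)) : Set (σ → ℝ) → Prop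
  | empty : Cov M f G ∅
  | union {S T : Set (σ → ℝ)} : Cov M f G S → Cov M f G T → Cov M f G (S ∪ T)
  | mono {S T : Set (σ → ℝ)} : S ⊆ T → Cov M f G T → Cov M f G S
  | chart (s : (σ → ℝ) → (σ → ℝ)) (K : Set (σ → ℝ)) : IsCompact K →
      (∀ y ∈ K, DCAt M s y ∧ s y ∈ G ∧ NCAt M (fun x => f (s x)) y) → Cov M f G (s '' K)

def Unif (M : ℕ → ℝ) (f : (σ → ℝ) → ℝ) (a : σ → ℝ) : Prop :=
  ∀ G ∈ 𝓝 a, ∃ S ∈ 𝓝 a, Cov M f G S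

variable {f g : (σ → ℝ) → ℝ} {a : σ → ℝ}

theorem Cov.comp {p : (σ → ℝ) → (σ → ℝ)} {G G' S : Set (σ → ℝ)} (hp : ∀ z ∈ G', DCAt M p z ∧ p z ∈ G)
    (h : Cov M (fun x => f (p x)) G' S) : Cov M f G (p '' S) := by
  induction h with
  | empty => simpa using Cov.empty
  | union _ _ h1 h2 => rw [image_union]; exact h1.union h2
  | mono hST _ ih => exact Cov.mono (image_mono hST) ih
  | chart s K hK h =>
    rw [← image_comp]
    refine Cov.chart (p ∘ s) K hK fun y hy => ?_
    obtain ⟨h1, h2, h3⟩ := h y hy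
    exact ⟨DCAt.comp (g := p) (hp _ h2).1 h1, (hp _ h2).2, h3⟩

theorem Cov.congr {G S : Set (σ → ℝ)} (hG : ∀ x ∈ G, g =ᶠ[𝓝 x] f) (h : Cov M f G S) : Cov M g G S := by
  induction h with
  | empty => exact Cov.empty
  | union _ _ h1 h2 => exact h1.union h2
  | mono hST _ ih => exact Cov.mono hST ih
  | chart s K hK h =>
    refine Cov.chart s K hK fun y hy => ?_
    obtain ⟨h1, h2, h3⟩ := h y hy
    exact ⟨h1, h2, h3.congr (h1.continuousAt.eventually (hG _ h2))⟩

theorem Cov.weaken {G G' S : Set (σ → ℝ)} (hG : G ⊆ G') (h : Cov M f G S) : Cov M f G' S := by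
  induction h with
  | empty => exact Cov.empty
  | union _ _ h1 h2 => exact h1.union h2
  | mono hST _ ih => exact Cov.mono hST ih
  | chart s K hK h => exact Cov.chart s K hK fun y hy => ⟨(h y hy).1, hG (h y hy).2.1, (h y hy).2.2⟩

theorem Unif.congr (h : Unif M f a) (he : g =ᶠ[𝓝 a] f) : Unif M g a := by
  intro G hG
  obtain ⟨S, hS, hc⟩ := h (G ∩ {x | g =ᶠ[𝓝 x] f}) (inter_mem hG (eventually_eventually_nhds.2 he))
  exact ⟨S, hS, (hc.congr fun x hx => hx.2).weaken inter_subset_left⟩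

theorem NCAt.unif (h : NCAt M f a) : Unif M f a := by
  intro G hG
  obtain ⟨r, hr, hb⟩ := Metric.nhds_basis_closedBall.mem_iff.1 (inter_mem hG h.eventually)
  refine ⟨Metric.closedBall a r, Metric.closedBall_mem_nhds a hr, ?_⟩
  have := Cov.chart (M := M) (f := f) (G := G) (fun x => x) (Metric.closedBall a r) (isCompact_closedBall a r)
    (fun y hy => ⟨dcAt_id, (hb hy).1, (hb hy).2⟩)
  simpa using this

theorem cov_compact {p : (σ → ℝ) → (σ → ℝ)} {K G : Set (σ → ℝ)} (hK : IsCompact K)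
    (h : ∀ y ∈ K, DCAt M p y ∧ G ∈ 𝓝 (p y) ∧ Unif M (fun x => f (p x)) y) :
    ∃ O ∈ 𝓝ˢ K, Cov M f G (p '' O) := by
  refine hK.induction_on (p := fun K => ∃ O ∈ 𝓝ˢ K, Cov M f G (p '' O)) ?_ ?_ ?_ ?_
  · exact ⟨∅, by simp, by simpa using Cov.empty⟩
  · rintro s t hst ⟨O, hO, hc⟩
    exact ⟨O, nhdsSet_mono hst hO, hc⟩
  · rintro s t ⟨O, hO, hc⟩ ⟨O', hO', hc'⟩
    refine ⟨O ∪ O', ?_, by rw [image_union]; exact hc.union hc'⟩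
    rw [nhdsSet_union]
    exact union_mem_sup hO hO'
  · intro y hy
    obtain ⟨h1, h2, h3⟩ := h y hy
    obtain ⟨S, hS, hc⟩ := h3 {z | DCAt M p z ∧ p z ∈ G} (h1.eventually.and (h1.continuousAt.eventually h2))
    refine ⟨interior S, mem_nhdsWithin_of_mem_nhds (interior_mem_nhds.2 hS), S, ?_, hc.comp fun z hz => hz⟩
    exact mem_of_superset (isOpen_interior.mem_nhdsSet.2 subset_rfl) interior_subset

theorem unif_comp {ι : Type*} [Fintype ι] (p : ι → (σ → ℝ) → (σ → ℝ)) (K : ι → Set (σ → ℝ)) (hK : ∀ i, IsCompact (K i))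
    (h : ∀ i, ∀ y ∈ K i, p i y = a ∧ DCAt M (p i) y ∧ Unif M (fun x => f (p i x)) y)
    (hcov : ∀ O : ι → Set (σ → ℝ), (∀ i, O i ∈ 𝓝ˢ (K i)) → (⋃ i, p i '' O i) ∈ 𝓝 a) : Unif M f a := by
  classical
  intro G hG
  have h1 : ∀ i, ∃ O ∈ 𝓝ˢ (K i), Cov M f G (p i '' O) := fun i =>
    cov_compact (hK i) fun y hy => ⟨(h i y hy).2.1, by rw [(h i y hy).1]; exact hG, (h i y hy).2.2⟩
  choose O hO hc using h1
  refine ⟨_, hcov O hO, ?_⟩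
  have h2 : ∀ s : Finset ι, Cov M f G (⋃ i ∈ s, p i '' O i) := by
    intro s
    induction s using Finset.induction_on with
    | empty => simpa using Cov.empty
    | insert i s _ ih => rw [Finset.set_biUnion_insert]; exact (hc i).union ih
  simpa using h2 Finset.univ

/-- single chart, one-point fibre -/
theorem unif_comp_one {p : (σ → ℝ) → (σ → ℝ)} {b : σ → ℝ} (hb : p b = a) (hp : DCAt M p b)
    (h : Unif M (fun x => f (p x)) b) (hopen : ∀ O ∈ 𝓝 b, p '' O ∈ 𝓝 a) : Unif M f a := by
  refine unif_comp (ι := Unit) (fun _ => p) (fun _ => {b}) (fun _ => isCompact_singleton)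
    (by rintro _ y rfl; exact ⟨hb, hp, h⟩) fun O hO => ?_
  have := hopen (O ()) (by simpa using hO ())
  refine mem_of_superset this (subset_iUnion (fun i => p '' O i) ())

theorem unif_translate (h : Unif M (fun x => f (x + a)) 0) : Unif M f a := by
  refine unif_comp_one (p := fun x => x + a) (b := 0) (by simp) (dcAt_id.add (dcAt_const a)) h fun O hO => ?_
  have := (Homeomorph.addRight a).isOpenMap.image_mem_nhds hO
  simpa using this

end cov

section cons
variable {M : ℕ → ℝ} [hM : NSeq M] {n : ℕ}

theorem dcAt_tail (a : Fin (n + 1) → ℝ) : DCAt M (fun x : Fin (n + 1) → ℝ => Fin.tail x) a := by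
  rw [dcAt_pi]; intro i; exact dcAt_coord _ _

theorem tendsto_tail (a : Fin (n + 1) → ℝ) : Tendsto (fun x : Fin (n + 1) → ℝ => Fin.tail x) (𝓝 a) (𝓝 (Fin.tail a)) :=
  (continuous_pi fun i => continuous_apply _ : Continuous fun x : Fin (n + 1) → ℝ => Fin.tail x).tendsto a

theorem DCAt.comp_tail {g : (Fin n → ℝ) → ℝ} {a : Fin (n + 1) → ℝ} (hg : DCAt M g (Fin.tail a)) :
    DCAt M (fun x => g (Fin.tail x)) a := DCAt.comp (g := g) hg (dcAt_tail a)

theorem DCAt.comp_tail' {E : Type*} [NormedAddCommGroup E] [NormedSpace ℝ E] {g : (Fin n → ℝ) → E} {a : Fin (n + 1) → ℝ} (hg : DCAt M g (Fin.tail a)) :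
    DCAt M (fun x => g (Fin.tail x)) a := DCAt.comp (g := g) hg (dcAt_tail a)

theorem NCAt.comp_tail {g : (Fin n → ℝ) → ℝ} {a : Fin (n + 1) → ℝ} (hg : NCAt M g (Fin.tail a)) :
    NCAt M (fun x => g (Fin.tail x)) a := by
  obtain ⟨α, u, h1, h2, h3⟩ := hg
  refine NCAt.congr (f := fun x => (∏ j, (x j.succ - a j.succ) ^ α j) * u (Fin.tail x)) ?_ ((tendsto_tail a).eventually h3)
  exact (ncAt_prod _ fun j _ => (ncAt_sub_coord j.succ _ a).pow _).mul (ncAt_unit h1.comp_tail h2)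

theorem dcAt_cons {E : Type*} [NormedAddCommGroup E] [NormedSpace ℝ E] {t : E → ℝ} {z : E → Fin n → ℝ} {a : E} (ht : DCAt M t a) (hz : DCAt M z a) :
    DCAt M (fun x => (Fin.cons (t x) (z x) : Fin (n + 1) → ℝ)) a := by
  rw [dcAt_pi] at hz ⊢
  intro i
  refine Fin.cases ?_ (fun j => ?_) i
  · simpa using ht
  · simpa using hz j

/-- product lemma -/
theorem Cov.prod_unif {E0 : (Fin n → ℝ) → ℝ} {G' S' : Set (Fin n → ℝ)} {I : Set ℝ} {f : (Fin (n + 1) → ℝ) → ℝ} {G : Set (Fin (n + 1) → ℝ)}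
    (hI : IsCompact I) (hG : ∀ t ∈ I, ∀ z ∈ G', G ∈ 𝓝 (Fin.cons t z : Fin (n + 1) → ℝ))
    (H : ∀ (s : (Fin n → ℝ) → (Fin n → ℝ)) (b : Fin n → ℝ), DCAt M s b → s b ∈ G' → NCAt M (fun z => E0 (s z)) b →
      ∀ t ∈ I, Unif M (fun x => f (Fin.cons (x 0) (s (Fin.tail x)))) (Fin.cons t b))
    (h : Cov M E0 G' S') : Cov M f G {x | x 0 ∈ I ∧ Fin.tail x ∈ S'} := by
  induction h with
  | empty => simpa using Cov.empty
  | union _ _ h1 h2 =>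
    refine Cov.mono ?_ (h1.union h2)
    rintro x ⟨hx1, hx2 | hx2⟩
    · exact .inl ⟨hx1, hx2⟩
    · exact .inr ⟨hx1, hx2⟩
  | mono hST _ ih =>
    refine Cov.mono ?_ ih
    rintro x ⟨h1, h2⟩
    exact ⟨h1, hST h2⟩
  | chart s K hK hs =>
    have hKc : IsCompact ((fun q : ℝ × (Fin n → ℝ) => (Fin.cons q.1 q.2 : Fin (n + 1) → ℝ)) '' (I ×ˢ K)) := by
      refine (hI.prod hK).image ?_
      refine continuous_pi fun i => Fin.cases ?_ (fun j => ?_) i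
      · simpa using continuous_fst
      · simp only [Fin.cons_succ]; exact (continuous_apply j).comp continuous_snd
    obtain ⟨O, hO, hc⟩ := cov_compact (M := M) (f := f) (p := fun x => Fin.cons (x 0) (s (Fin.tail x))) (G := G) hKc (by
      rintro _ ⟨⟨t, b⟩, ⟨ht, hb⟩, rfl⟩
      obtain ⟨h1, h2, h3⟩ := hs b hb
      refine ⟨dcAt_cons (dcAt_coord 0 _) (DCAt.comp (g := s) (by simpa using h1) (dcAt_tail _)), ?_, H s b h1 h2 h3 t ht⟩
      simpa using hG t ht _ h2)
    refine Cov.mono ?_ hc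
    rintro x ⟨hx, y, hy, hxy⟩
    refine ⟨Fin.cons (x 0) y, subset_of_mem_nhdsSet hO ⟨(x 0, y), ⟨hx, hy⟩, rfl⟩, ?_⟩
    simp only [Fin.cons_zero, Fin.tail_cons, hxy]
    exact Fin.cons_self_tail x

/-- product lemma, germ version -/
theorem unif_prod {E0 : (Fin n → ℝ) → ℝ} {a : Fin (n + 1) → ℝ} {f : (Fin (n + 1) → ℝ) → ℝ} {W : Set (Fin n → ℝ)} {I : Set ℝ}
    (hE : Unif M E0 (Fin.tail a)) (hW : W ∈ 𝓝 (Fin.tail a)) (hI : I ∈ 𝓝 (a 0))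
    (H : ∀ (s : (Fin n → ℝ) → (Fin n → ℝ)) (b : Fin n → ℝ), DCAt M s b → s b ∈ W → NCAt M (fun z => E0 (s z)) b →
      ∀ t ∈ I, Unif M (fun x => f (Fin.cons (x 0) (s (Fin.tail x)))) (Fin.cons t b)) : Unif M f a := by
  intro G hG
  obtain ⟨r, hr, hb⟩ := Metric.nhds_basis_ball.mem_iff.1 hG
  obtain ⟨S', hS', hc⟩ := hE (Metric.ball (Fin.tail a) r ∩ W) (inter_mem (Metric.ball_mem_nhds _ hr) hW)
  obtain ⟨r', hr', hb'⟩ := Metric.nhds_basis_closedBall.mem_iff.1 (inter_mem (Metric.ball_mem_nhds (a 0) hr) hI)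
  have hprod : ∀ (t : ℝ) (z : Fin n → ℝ), dist t (a 0) < r → dist z (Fin.tail a) < r → dist (Fin.cons t z : Fin (n + 1) → ℝ) a < r := by
    intro t z h1 h2
    rw [dist_pi_lt_iff hr] at h2 ⊢
    intro i
    refine Fin.cases ?_ (fun j => ?_) i
    · simpa using h1
    · simp only [Fin.cons_succ]; exact h2 j
  refine ⟨_, ?_, Cov.prod_unif (I := Metric.closedBall (a 0) r') (isCompact_closedBall _ _) ?_ ?_ hc⟩
  · filter_upwards [(continuous_apply (0 : Fin (n + 1))).continuousAt.preimage_mem_nhds (x := a) (Metric.closedBall_mem_nhds _ hr'),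
      (tendsto_tail a).eventually hS'] with x h1 h2
    exact ⟨h1, h2⟩
  · intro t ht z hz
    refine mem_of_superset (Metric.isOpen_ball.mem_nhds ?_) hb
    exact hprod t z (hb' ht).1 hz.1
  · intro s b h1 h2 h3 t ht
    exact H s b h1 h2.2 h3 t (hb' ht).2

theorem pd_iter_smooth {f : (Fin (n + 1) → ℝ) → ℝ} {a : Fin (n + 1) → ℝ} (hf : DCAt M f a) (k : ℕ) : DCAt M ((pd 0)^[k] f) a := by
  induction k with
  | zero => exact hf
  | succ k ih => rw [Function.iterate_succ_apply']; exact pd_dcAt ih 0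

/-- (L0) iterated partial derivatives and one variable derivatives -/
theorem pd_iter_eq {f : (Fin (n + 1) → ℝ) → ℝ} {z : Fin n → ℝ} (k : ℕ) : ∀ {t : ℝ}, DCAt M f (Fin.cons t z) →
    (pd 0)^[k] f (Fin.cons t z) = iteratedDeriv k (fun s => f (Fin.cons s z)) t := by
  induction k with
  | zero => intro t _; simp
  | succ k ih =>
    intro t hf
    rw [iteratedDeriv_succ, Function.iterate_succ_apply']
    have hc : HasDerivAt (fun s : ℝ => (Fin.cons s z : Fin (n + 1) → ℝ)) (Pi.single 0 1) t := by
      rw [hasDerivAt_pi]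
      intro i
      refine Fin.cases ?_ (fun j => ?_) i
      · simp only [Fin.cons_zero, Pi.single_eq_same]; exact hasDerivAt_id' t
      · simpa using hasDerivAt_const t (z j)
    have hev : ∀ᶠ s in 𝓝 t, (pd 0)^[k] f (Fin.cons s z) = iteratedDeriv k (fun s => f (Fin.cons s z)) s := by
      filter_upwards [hc.continuousAt.eventually hf.eventually] with s hs
      exact ih hs
    have h1 : HasDerivAt (fun s => (pd 0)^[k] f (Fin.cons s z)) (pd 0 ((pd 0)^[k] f) (Fin.cons t z)) t :=
      ((pd_iter_smooth hf k).contDiffAt.differentiableAt (by simp)).hasFDerivAt.comp_hasDerivAt t hc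
    rw [← h1.deriv]
    exact Filter.EventuallyEq.deriv_eq hev

/-- division expansion -/
theorem exists_expansion {f : (Fin (n + 1) → ℝ) → ℝ} {a : Fin (n + 1) → ℝ} (hf : DCAt M f a) (k : ℕ) :
    ∃ (c : ℕ → (Fin n → ℝ) → ℝ) (u : (Fin (n + 1) → ℝ) → ℝ), (∀ i < k, DCAt M (c i) (Fin.tail a)) ∧ DCAt M u a ∧
      ∀ᶠ x in 𝓝 a, f x = ∑ i ∈ Finset.range k, c i (Fin.tail x) * (x 0 - a 0) ^ i + (x 0 - a 0) ^ k * u x := by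
  induction k with
  | zero => exact ⟨fun _ _ => 0, f, by simp, hf, by simp⟩
  | succ k ih =>
    obtain ⟨c, u, hc, hu, h⟩ := ih
    obtain ⟨v, hv, h'⟩ := dcAt_div_coord' hu 0
    refine ⟨fun i => if i = k then fun z => u (Fin.cons (a 0) z) else c i, v, ?_, hv, ?_⟩
    · intro i hi
      by_cases hik : i = k
      · simp only [hik, if_true]
        refine DCAt.comp (g := u) ?_ (dcAt_cons (dcAt_const _) dcAt_id)
        rw [Fin.cons_self_tail]; exact hu
      · simp only [hik, if_false]; exact hc i (by omega)
    · filter_upwards [h, h'] with x hx hx'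
      rw [hx, hx', Finset.sum_range_succ]
      have h1 : Function.update x 0 (a 0) = Fin.cons (a 0) (Fin.tail x) := by
        conv_lhs => rw [← Fin.cons_self_tail x]
        exact Fin.update_cons_zero _ _ _
      have h2 : ∑ i ∈ Finset.range k, (if i = k then fun z => u (Fin.cons (a 0) z) else c i) (Fin.tail x) * (x 0 - a 0) ^ i
          = ∑ i ∈ Finset.range k, c i (Fin.tail x) * (x 0 - a 0) ^ i := by
        refine Finset.sum_congr rfl fun i hi => ?_
        rw [if_neg (by simp at hi; omega)]
      rw [h1, h2]
      simp only [if_true]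
      ring

theorem iteratedDeriv_shift {g : ℝ → ℝ} (c : ℝ) (k : ℕ) (t : ℝ) :
    iteratedDeriv k (fun s => g (s + c)) t = iteratedDeriv k g (t + c) := by
  rw [iteratedDeriv_comp_add_const]

theorem iteratedDeriv_shift_pow (l i : ℕ) (t0 : ℝ) :
    iteratedDeriv l (fun s : ℝ => (s - t0) ^ i) t0 = if l = i then (i ! : ℝ) else 0 := by
  have := iteratedDeriv_shift (g := fun s => s ^ i) (-t0) l t0
  simp only [← sub_eq_add_neg] at this
  rw [this, sub_self, iteratedDeriv_fun_pow_zero]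
  push_cast; rfl

theorem iteratedDeriv_shift_mul {u : ℝ → ℝ} {t0 : ℝ} (hu : ContDiffAt ℝ ∞ u t0) (j k : ℕ) (hjk : j ≤ k) :
    iteratedDeriv j (fun s : ℝ => (s - t0) ^ k * u s) t0 = if j = k then (k ! : ℝ) * u t0 else 0 := by
  have hs : ContDiffAt ℝ j (fun s : ℝ => (s - t0) ^ k) t0 := by fun_prop
  rw [iteratedDeriv_fun_mul hs (hu.of_le (by exact_mod_cast le_top))]
  simp only [iteratedDeriv_shift_pow]
  rcases hjk.lt_or_eq with h | h
  · rw [if_neg h.ne]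
    refine Finset.sum_eq_zero fun i hi => ?_
    simp only [Finset.mem_range] at hi
    rw [if_neg (by omega)]; simp
  · subst h
    rw [if_pos rfl, Finset.sum_eq_single j]
    · simp
    · intro i _ hi; rw [if_neg hi]; simp
    · simp

theorem expansion_deriv {g u : ℝ → ℝ} {c : ℕ → ℝ} {t0 : ℝ} {k : ℕ} (hu : ContDiffAt ℝ ∞ u t0)
    (h : ∀ᶠ t in 𝓝 t0, g t = ∑ i ∈ Finset.range k, c i * (t - t0) ^ i + (t - t0) ^ k * u t) (j : ℕ) (hj : j ≤ k) :
    iteratedDeriv j g t0 = if j = k then (k ! : ℝ) * u t0 else (j ! : ℝ) * c j := by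
  rw [Filter.EventuallyEq.iteratedDeriv_eq j h]
  have hu' : ContDiffAt ℝ j u t0 := hu.of_le (by exact_mod_cast le_top)
  rw [iteratedDeriv_fun_add (ContDiffAt.sum fun i _ => by fun_prop) (by fun_prop), iteratedDeriv_shift_mul hu j k hj,
    iteratedDeriv_fun_sum (fun i _ => by fun_prop)]
  simp only [iteratedDeriv_const_mul_field, iteratedDeriv_shift_pow]
  split_ifs with hjk
  · rw [Finset.sum_eq_zero, zero_add]
    intro i hi
    simp only [Finset.mem_range] at hi
    rw [if_neg (by omega)]; simp
  · rw [Finset.sum_eq_single j]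
    · simp [mul_comm]
    · intro i _ hi; rw [if_neg (Ne.symm hi)]; simp
    · intro h; simp only [Finset.mem_range] at h; omega

end cons
end QDC
end


section
open Set Filter Topology
open scoped ContDiff Nat
set_option linter.unusedSectionVars false
namespace QDC

section TT
variable {M : ℕ → ℝ} [hM : NSeq M] {n : ℕ}

/-- functions regular of order `m` in the first variable can be uniformized -/
def SS (M : ℕ → ℝ) (n m : ℕ) : Prop := ∀ (f : (Fin (n + 1) → ℝ) → ℝ) (E : (Fin n → ℝ) → ℝ) (a : Fin (n + 1) → ℝ),
  DCAt M f a → DCAt M E (Fin.tail a) → (¬ ∀ᶠ z in 𝓝 (Fin.tail a), E z = 0) → (pd 0)^[m] f a ≠ 0 →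
  Unif M (fun x => E (Fin.tail x) * f x) a

/-- the polynomial-like function of the `T` step -/
noncomputable def tf (m : ℕ) (γ : Fin n → ℕ) (c : ℕ → (Fin n → ℝ) → ℝ) (u : (Fin (n + 1) → ℝ) → ℝ) (x : Fin (n + 1) → ℝ) : ℝ :=
  ∑ i ∈ Finset.range (m - 1), c i (Fin.tail x) * (∏ j, (x (Fin.succ j)) ^ ((m - i) * γ j)) * x 0 ^ i + x 0 ^ m * u x

theorem tf_dcAt {m : ℕ} {γ : Fin n → ℕ} {c : ℕ → (Fin n → ℝ) → ℝ} {u : (Fin (n + 1) → ℝ) → ℝ} {a : Fin (n + 1) → ℝ}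
    (hc : ∀ i < m - 1, DCAt M (c i) (Fin.tail a)) (hu : DCAt M u a) : DCAt M (tf m γ c u) a := by
  refine (dcAt_sum _ fun i hi => ?_).add (((dcAt_coord 0 a).pow m).mul hu)
  exact ((hc i (Finset.mem_range.1 hi)).comp_tail.mul (dcAt_prod _ fun j _ => (dcAt_coord _ a).pow _)).mul ((dcAt_coord 0 a).pow i)

theorem contDiffAt_cons {u : (Fin (n + 1) → ℝ) → ℝ} {t : ℝ} {z : Fin n → ℝ} (hu : DCAt M u (Fin.cons t z)) :
    ContDiffAt ℝ ∞ (fun s : ℝ => u (Fin.cons s z)) t := by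
  refine ContDiffAt.comp (g := u) t hu.contDiffAt ?_
  rw [contDiffAt_pi]
  intro i
  refine Fin.cases ?_ (fun j => ?_) i
  · simp only [Fin.cons_zero]; exact contDiffAt_id
  · simp only [Fin.cons_succ]; exact contDiffAt_const

/-- blow-up charts cover -/
theorem blowup_cover (k : Fin n) {C : ℝ} (hC : 0 < C) {OA OB : Set (Fin (n + 1) → ℝ)}
    (hA : OA ∈ 𝓝ˢ {y : Fin (n + 1) → ℝ | Fin.tail y = 0 ∧ |y 0| ≤ C})
    (hB : OB ∈ 𝓝ˢ {y : Fin (n + 1) → ℝ | (∀ j, j ≠ k.succ → y j = 0) ∧ |y k.succ| ≤ 1 / C})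
    (hcA : IsCompact {y : Fin (n + 1) → ℝ | Fin.tail y = 0 ∧ |y 0| ≤ C})
    (hcB : IsCompact {y : Fin (n + 1) → ℝ | (∀ j, j ≠ k.succ → y j = 0) ∧ |y k.succ| ≤ 1 / C}) :
    ((fun x : Fin (n + 1) → ℝ => Function.update x 0 (x k.succ * x 0)) '' OA ∪
      (fun x : Fin (n + 1) → ℝ => Function.update x k.succ (x 0 * x k.succ)) '' OB) ∈ 𝓝 0 := by
  rw [mem_nhdsSet_iff_exists] at hA hB
  obtain ⟨UA, hUA, hKA, hUA'⟩ := hA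
  obtain ⟨UB, hUB, hKB, hUB'⟩ := hB
  obtain ⟨δA, hδA, hA2⟩ := hcA.exists_thickening_subset_open hUA hKA
  obtain ⟨δB, hδB, hB2⟩ := hcB.exists_thickening_subset_open hUB hKB
  have hδ : 0 < min δA δB := lt_min hδA hδB
  refine mem_of_superset (Metric.ball_mem_nhds 0 hδ) fun x hx => ?_
  rw [Metric.mem_ball, dist_pi_lt_iff hδ] at hx
  simp only [Pi.zero_apply, dist_zero_right, Real.norm_eq_abs] at hx
  have h0k : (0 : Fin (n + 1)) ≠ k.succ := (Fin.succ_ne_zero k).symm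
  by_cases hxk : |x 0| ≤ C * |x k.succ|
  · left
    refine ⟨Function.update x 0 (x 0 / x k.succ), hUA' (hA2 ?_), ?_⟩
    · rw [Metric.mem_thickening_iff]
      refine ⟨Pi.single 0 (x 0 / x k.succ), ⟨?_, ?_⟩, ?_⟩
      · ext j; simp [Fin.tail]
      · simp only [Pi.single_eq_same, abs_div]
        exact div_le_of_le_mul₀ (abs_nonneg _) hC.le hxk
      · rw [dist_pi_lt_iff hδA]
        intro j
        by_cases hj : j = 0
        · subst hj; simpa using hδA
        · simp only [Function.update_of_ne hj, Pi.single_eq_of_ne hj, dist_zero_right, Real.norm_eq_abs]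
          exact (hx j).trans_le (min_le_left _ _)
    · simp only [Function.update_of_ne h0k.symm, Function.update_self, Function.update_idem]
      by_cases hk : x k.succ = 0
      · have : x 0 = 0 := by rw [hk] at hxk; simpa using hxk
        rw [hk]; simp only [zero_mul]; rw [← this, Function.update_eq_self]
      · rw [mul_div_cancel₀ _ hk, Function.update_eq_self]
  · right
    push Not at hxk
    have hx0 : x 0 ≠ 0 := by
      intro h; rw [h] at hxk; simp at hxk
      nlinarith [abs_nonneg (x k.succ), mul_nonneg hC.le (abs_nonneg (x k.succ))]
    refine ⟨Function.update x k.succ (x k.succ / x 0), hUB' (hB2 ?_), ?_⟩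
    · rw [Metric.mem_thickening_iff]
      refine ⟨Pi.single k.succ (x k.succ / x 0), ⟨?_, ?_⟩, ?_⟩
      · intro j hj; simp [hj]
      · simp only [Pi.single_eq_same, abs_div]
        rw [div_le_div_iff₀ (abs_pos.2 hx0) hC]; linarith
      · rw [dist_pi_lt_iff hδB]
        intro j
        by_cases hj : j = k.succ
        · subst hj; simpa using hδB
        · simp only [Function.update_of_ne hj, Pi.single_eq_of_ne hj, dist_zero_right, Real.norm_eq_abs]
          exact (hx j).trans_le (min_le_right _ _)
    · simp only [Function.update_of_ne h0k, Function.update_self, Function.update_idem]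
      rw [mul_div_cancel₀ _ hx0, Function.update_eq_self]

theorem compactA (C : ℝ) : IsCompact {y : Fin (n + 1) → ℝ | Fin.tail y = 0 ∧ |y 0| ≤ C} := by
  refine Metric.isCompact_of_isClosed_isBounded ?_ ?_
  · refine IsClosed.inter ?_ ?_
    · exact isClosed_eq (continuous_pi fun i => continuous_apply _) continuous_const
    · exact isClosed_le (continuous_apply 0).abs continuous_const
  · refine (Metric.isBounded_closedBall (x := 0) (r := |C|)).subset fun y hy => ?_
    rw [Metric.mem_closedBall, dist_pi_le_iff (abs_nonneg _)]
    intro j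
    refine Fin.cases ?_ (fun j => ?_) j
    · simpa using hy.2.trans (le_abs_self _)
    · have : y j.succ = 0 := congrFun hy.1 j
      simp [this]

theorem compactB (C : ℝ) (k : Fin n) : IsCompact {y : Fin (n + 1) → ℝ | (∀ j, j ≠ k.succ → y j = 0) ∧ |y k.succ| ≤ C} := by
  refine Metric.isCompact_of_isClosed_isBounded ?_ ?_
  · have : {y : Fin (n + 1) → ℝ | (∀ j, j ≠ k.succ → y j = 0) ∧ |y k.succ| ≤ C} =
        (⋂ j, ⋂ (_ : j ≠ k.succ), {y : Fin (n + 1) → ℝ | y j = 0}) ∩ {y | |y k.succ| ≤ C} := by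
      ext y; simp
    rw [this]
    refine IsClosed.inter ?_ ?_
    · exact isClosed_iInter fun j => isClosed_iInter fun _ => isClosed_eq (continuous_apply _) continuous_const
    · exact isClosed_le (continuous_apply _).abs continuous_const
  · refine (Metric.isBounded_closedBall (x := 0) (r := |C|)).subset fun y hy => ?_
    rw [Metric.mem_closedBall, dist_pi_le_iff (abs_nonneg _)]
    intro j
    by_cases hj : j = k.succ
    · subst hj; simpa using hy.2.trans (le_abs_self _)
    · simp [hy.1 j hj]

theorem tf_chartA (m : ℕ) (γ : Fin n → ℕ) (k : Fin n) (hk : 1 ≤ γ k) (c : ℕ → (Fin n → ℝ) → ℝ) (u : (Fin (n + 1) → ℝ) → ℝ)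
    (x : Fin (n + 1) → ℝ) :
    tf m γ c u (Function.update x 0 (x k.succ * x 0)) = x k.succ ^ m *
      tf m (fun j => γ j - if j = k then 1 else 0) c (fun x => u (Function.update x 0 (x k.succ * x 0))) x := by
  have ht : Fin.tail (Function.update x 0 (x k.succ * x 0)) = Fin.tail x := by
    ext j; simp [Fin.tail]
  unfold tf
  simp only [ht, Function.update_self, mul_add, Finset.mul_sum, Function.update_of_ne (Fin.succ_ne_zero _)]
  congr 1
  · refine Finset.sum_congr rfl fun i hi => ?_
    have hi' : i < m - 1 := Finset.mem_range.1 hi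
    have h1 : ∏ j, x (Fin.succ j) ^ ((m - i) * γ j) =
        (∏ j, x (Fin.succ j) ^ ((m - i) * (γ j - if j = k then 1 else 0))) * x k.succ ^ (m - i) := by
      have h2 : x k.succ ^ (m - i) = ∏ j, x (Fin.succ j) ^ ((m - i) * if j = k then 1 else 0) := by
        rw [Finset.prod_eq_single k] <;> simp +contextual
      rw [h2, ← Finset.prod_mul_distrib]
      refine Finset.prod_congr rfl fun j _ => ?_
      rw [← pow_add, ← mul_add]
      congr 2
      split_ifs with h
      · subst h; omega
      · omega
    have h3 : x k.succ ^ m = x k.succ ^ (m - i) * x k.succ ^ i := by rw [← pow_add]; congr 1; omega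
    rw [h1, h3, mul_pow]; ring
  · ring

theorem tf_chartB (m : ℕ) (γ : Fin n → ℕ) (k : Fin n) (hk : 1 ≤ γ k) (c : ℕ → (Fin n → ℝ) → ℝ) (u : (Fin (n + 1) → ℝ) → ℝ)
    (x : Fin (n + 1) → ℝ) :
    tf m γ c u (Function.update x k.succ (x 0 * x k.succ)) = x 0 ^ m *
      (∑ i ∈ Finset.range (m - 1), c i (Fin.tail (Function.update x k.succ (x 0 * x k.succ))) *
        ((∏ j, (x (Fin.succ j)) ^ ((m - i) * γ j)) * x 0 ^ ((m - i) * (γ k - 1)))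
        + u (Function.update x k.succ (x 0 * x k.succ))) := by
  have h0k : (0 : Fin (n + 1)) ≠ k.succ := (Fin.succ_ne_zero k).symm
  unfold tf
  simp only [Function.update_of_ne h0k, mul_add, Finset.mul_sum]
  congr 1
  refine Finset.sum_congr rfl fun i hi => ?_
  have hi' : i < m - 1 := Finset.mem_range.1 hi
  have h1 : ∏ j, Function.update x k.succ (x 0 * x k.succ) (Fin.succ j) ^ ((m - i) * γ j) =
      (∏ j, x (Fin.succ j) ^ ((m - i) * γ j)) * x 0 ^ ((m - i) * γ k) := by
    have h2 : x 0 ^ ((m - i) * γ k) = ∏ j : Fin n, if j = k then x 0 ^ ((m - i) * γ k) else 1 := by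
      simp
    rw [h2, ← Finset.prod_mul_distrib]
    refine Finset.prod_congr rfl fun j _ => ?_
    by_cases h : j = k
    · subst h; simp [mul_pow]; ring
    · have : j.succ ≠ k.succ := fun h' => h (Fin.succ_injective _ h')
      rw [Function.update_of_ne this, if_neg h, mul_one]
  have h3 : x 0 ^ ((m - i) * γ k) * x 0 ^ i = x 0 ^ m * x 0 ^ ((m - i) * (γ k - 1)) := by
    rw [← pow_add, ← pow_add]; congr 1
    obtain ⟨g, hg⟩ := Nat.exists_eq_add_of_le' hk
    rw [hg, Nat.add_sub_cancel, Nat.mul_add]; omega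
  rw [h1]
  linear_combination (c i (Fin.tail (Function.update x k.succ (x 0 * x k.succ))) * (∏ j, x (Fin.succ j) ^ ((m - i) * γ j))) * h3

end TT
end QDC
end


section
open Set Filter Topology
open scoped ContDiff Nat
set_option linter.unusedSectionVars false
namespace QDC

section TT
variable {M : ℕ → ℝ} [hM : NSeq M] {n : ℕ}

theorem tail_zero' : Fin.tail (0 : Fin (n + 1) → ℝ) = 0 := rfl

theorem cons_zero_zero : (Fin.cons 0 0 : Fin (n + 1) → ℝ) = 0 := by
  ext i; refine Fin.cases ?_ (fun j => ?_) i <;> simp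

theorem tf_cons (m : ℕ) (γ : Fin n → ℕ) (c : ℕ → (Fin n → ℝ) → ℝ) (u : (Fin (n + 1) → ℝ) → ℝ) (t : ℝ) (z : Fin n → ℝ) :
    tf m γ c u (Fin.cons t z) = ∑ i ∈ Finset.range (m - 1), (c i z * ∏ j, z j ^ ((m - i) * γ j)) * t ^ i + t ^ m * u (Fin.cons t z) := by
  simp [tf]

theorem tf_deriv_zero {m : ℕ} (hm : 1 ≤ m) {γ : Fin n → ℕ} {c : ℕ → (Fin n → ℝ) → ℝ} {u : (Fin (n + 1) → ℝ) → ℝ}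
    (hc : ∀ i < m - 1, DCAt M (c i) 0) (hu : DCAt M u 0) (i : ℕ) (hi : i < m - 1) :
    (pd 0)^[i] (tf m γ c u) 0 = (i ! : ℝ) * (c i 0 * ∏ j, (0 : ℝ) ^ ((m - i) * γ j)) := by
  have h0 : DCAt M (tf m γ c u) (Fin.cons 0 0 : Fin (n + 1) → ℝ) := by
    rw [cons_zero_zero]; exact tf_dcAt hc hu
  have h1 := pd_iter_eq i h0
  rw [cons_zero_zero] at h1
  rw [h1]
  have hu' : ContDiffAt ℝ ∞ (fun s : ℝ => u (Fin.cons s 0)) 0 := contDiffAt_cons (by rw [cons_zero_zero]; exact hu)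
  rw [expansion_deriv (k := m - 1) (c := fun i => c i 0 * ∏ j, (0 : Fin n → ℝ) j ^ ((m - i) * γ j))
    (u := fun t => t * u (Fin.cons t 0)) (contDiffAt_id.mul hu') (.of_forall fun t => ?_) i hi.le, if_neg hi.ne]
  · simp
  · rw [tf_cons]
    simp only [sub_zero]
    have : t ^ m = t ^ (m - 1) * t := by rw [← pow_succ]; congr 1; omega
    rw [this]; ring

theorem tf_deriv_axis {m : ℕ} (hm : 1 ≤ m) {γ : Fin n → ℕ} {c : ℕ → (Fin n → ℝ) → ℝ} {u : (Fin (n + 1) → ℝ) → ℝ} {w : ℝ}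
    (hc : ∀ i < m - 1, DCAt M (c i) 0) (hu : DCAt M u (Fin.cons w 0)) (u0 : ℝ) (hu0 : ∀ t, u (Fin.cons t 0) = u0) :
    (pd 0)^[m - 1] (tf m γ c u) (Fin.cons w 0) = (m ! : ℝ) * w * u0 := by
  have h0 : DCAt M (tf m γ c u) (Fin.cons w 0 : Fin (n + 1) → ℝ) := tf_dcAt hc hu
  rw [pd_iter_eq (m - 1) h0]
  simp only [tf_cons, hu0]
  rw [iteratedDeriv_fun_add (ContDiffAt.sum fun i _ => by fun_prop) (by fun_prop), iteratedDeriv_fun_sum (fun i _ => by fun_prop)]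
  rw [Finset.sum_eq_zero, iteratedDeriv_mul_const_field]
  · rw [iteratedDeriv_pow]
    have h1 : m - (m - 1) = 1 := by omega
    have h2 : m.descFactorial (m - 1) = m ! := by
      obtain ⟨k, rfl⟩ := Nat.exists_eq_add_of_le' hm
      rw [Nat.add_sub_cancel, Nat.descFactorial_eq_factorial_mul_choose, Nat.choose_succ_self_right, Nat.factorial_succ]; ring
    rw [h1, h2]; simp
  · intro i hi
    simp only [Finset.mem_range] at hi
    rw [iteratedDeriv_const_mul_field, iteratedDeriv_pow, Nat.descFactorial_of_lt hi]; simp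

theorem unifT {m : ℕ} (hm : 1 ≤ m) (hS : ∀ m' < m, SS M n m') (N : ℕ) : ∀ (γ : Fin n → ℕ), ∑ j, γ j = N →
    ∀ (E : (Fin n → ℝ) → ℝ) (c : ℕ → (Fin n → ℝ) → ℝ) (u : (Fin (n + 1) → ℝ) → ℝ) (i0 : ℕ),
    NCAt M E 0 → (∀ i < m - 1, DCAt M (c i) 0) → DCAt M u 0 → u 0 ≠ 0 → i0 < m - 1 → c i0 0 ≠ 0 →
    Unif M (fun x => E (Fin.tail x) * tf m γ c u x) 0 := by
  induction N with
  | zero =>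
    intro γ hγ E c u i0 hE hc hu hu0 hi0 hci
    have hγ0 : ∀ j, γ j = 0 := by simpa using hγ
    refine hS i0 (by omega) _ E 0 (tf_dcAt hc hu) hE.dcAt hE.not_ev ?_
    rw [tf_deriv_zero hm hc hu i0 hi0]
    simp only [hγ0, mul_zero, pow_zero, Finset.prod_const_one, mul_one]
    exact mul_ne_zero (by positivity) hci
  | succ N ih =>
    intro γ hγ E c u i0 hE hc hu hu0 hi0 hci
    obtain ⟨k, hk⟩ : ∃ k, 1 ≤ γ k := by
      by_contra! h
      have : ∑ j, γ j = 0 := Finset.sum_eq_zero fun j _ => by have := h j; omega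
      omega
    have h0k : (0 : Fin (n + 1)) ≠ k.succ := (Fin.succ_ne_zero k).symm
    set C : ℝ := 1 + (∑ i ∈ Finset.range (m - 1), |c i 0|) / |u 0| with hCdef
    have hup : 0 < |u 0| := abs_pos.2 hu0
    have hC1 : 1 ≤ C := by rw [hCdef]; have : 0 ≤ (∑ i ∈ Finset.range (m - 1), |c i 0|) / |u 0| := by positivity
                           linarith
    have hC : 0 < C := by linarith
    let pA : (Fin (n + 1) → ℝ) → (Fin (n + 1) → ℝ) := fun x => Function.update x 0 (x k.succ * x 0)
    let pB : (Fin (n + 1) → ℝ) → (Fin (n + 1) → ℝ) := fun x => Function.update x k.succ (x 0 * x k.succ)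
    have hpA : ∀ y, DCAt M pA y := fun y => by
      rw [dcAt_pi]; intro j
      by_cases hj : j = 0
      · subst hj; simp only [pA, Function.update_self]; exact (dcAt_coord _ y).mul (dcAt_coord _ y)
      · simp only [pA, Function.update_of_ne hj]; exact dcAt_coord _ y
    have hpB : ∀ y, DCAt M pB y := fun y => by
      rw [dcAt_pi]; intro j
      by_cases hj : j = k.succ
      · subst hj; simp only [pB, Function.update_self]; exact (dcAt_coord _ y).mul (dcAt_coord _ y)
      · simp only [pB, Function.update_of_ne hj]; exact dcAt_coord _ y
    let KA : Set (Fin (n + 1) → ℝ) := {y | Fin.tail y = 0 ∧ |y 0| ≤ C}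
    let KB : Set (Fin (n + 1) → ℝ) := {y | (∀ j, j ≠ k.succ → y j = 0) ∧ |y k.succ| ≤ 1 / C}
    have hA0 : ∀ y ∈ KA, pA y = 0 := by
      rintro y ⟨hy, -⟩
      have hy' : ∀ j : Fin n, y j.succ = 0 := fun j => congrFun hy j
      ext j
      refine Fin.cases ?_ (fun j => ?_) j
      · simp [pA, hy']
      · simp [pA, hy']
    have hB0 : ∀ y ∈ KB, pB y = 0 := by
      rintro y ⟨hy, -⟩
      ext j
      by_cases hj : j = k.succ
      · subst hj; simp [pB, hy 0 h0k]
      · simp [pB, Function.update_of_ne hj, hy j hj]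
    have htA : ∀ x, Fin.tail (pA x) = Fin.tail x := fun x => by
      ext j; simp [Fin.tail, pA]
    refine unif_comp (ι := Bool) (fun b => if b then pA else pB) (fun b => if b then KA else KB) ?_ ?_ ?_
    · intro b; cases b
      · exact compactB _ k
      · exact compactA _
    · intro b; cases b
      · -- chart B
        intro y hy
        replace hy : y ∈ KB := hy
        refine ⟨hB0 y hy, hpB y, NCAt.unif ?_⟩
        obtain ⟨α, e, he, he0, hE2⟩ := hE
        have hcomp : ∀ {g : (Fin (n + 1) → ℝ) → ℝ}, DCAt M g 0 → DCAt M (fun x => g (pB x)) y := fun {g} hg =>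
          DCAt.comp (g := g) (by rw [hB0 y hy]; exact hg) (hpB y)
        have hcomp' : ∀ {g : (Fin n → ℝ) → ℝ}, DCAt M g 0 → DCAt M (fun x => g (Fin.tail (pB x))) y := fun {g} hg =>
          hcomp (DCAt.comp_tail (a := (0 : Fin (n + 1) → ℝ)) hg)
        have hNE : NCAt M (fun x => E (Fin.tail (pB x))) y := by
          refine NCAt.congr (f := fun x => (∏ j, (pB x (Fin.succ j)) ^ α j) * e (Fin.tail (pB x))) ?_ ?_
          · refine (ncAt_prod _ fun j _ => NCAt.pow ?_ _).mul (ncAt_unit (hcomp' he) (by rw [hB0 y hy]; exact he0))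
            by_cases hj : j = k
            · subst hj; simp only [pB, Function.update_self]; exact (ncAt_coord _ y).mul (ncAt_coord _ y)
            · have : j.succ ≠ k.succ := fun h => hj (Fin.succ_injective _ h)
              simp only [pB, Function.update_of_ne this]; exact ncAt_coord _ y
          · have ht : Tendsto (fun x => Fin.tail (pB x)) (𝓝 y) (𝓝 0) := by
              have h1 : Tendsto pB (𝓝 y) (𝓝 0) := by have := (hpB y).continuousAt.tendsto; rwa [hB0 y hy] at this
              exact (tendsto_tail 0).comp h1
            filter_upwards [ht.eventually hE2] with x hx
            rw [hx]; simp [Fin.tail]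
        refine hNE.mul ?_
        refine NCAt.congr (f := fun x => x 0 ^ m * (∑ i ∈ Finset.range (m - 1), c i (Fin.tail (pB x)) *
          ((∏ j, (x (Fin.succ j)) ^ ((m - i) * γ j)) * x 0 ^ ((m - i) * (γ k - 1))) + u (pB x))) ?_
          (.of_forall fun x => tf_chartB m γ k hk c u x)
        refine ((ncAt_coord 0 y).pow m).mul (ncAt_unit ?_ ?_)
        · refine (dcAt_sum _ fun i hi => (hcomp' (hc i (Finset.mem_range.1 hi))).mul ?_).add (hcomp hu)
          exact (dcAt_prod _ fun j _ => (dcAt_coord _ y).pow _).mul ((dcAt_coord _ y).pow _)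
        · rw [hB0 y hy, tail_zero']
          intro hzero
          have h1 : |u 0| ≤ ∑ i ∈ Finset.range (m - 1), |c i 0| * (1 / C) := by
            have h2 : u 0 = - ∑ i ∈ Finset.range (m - 1), c i 0 *
              ((∏ j, (y (Fin.succ j)) ^ ((m - i) * γ j)) * y 0 ^ ((m - i) * (γ k - 1))) := by linarith
            rw [h2, abs_neg]
            refine (Finset.abs_sum_le_sum_abs _ _).trans (Finset.sum_le_sum fun i hi => ?_)
            rw [abs_mul]
            refine mul_le_mul_of_nonneg_left ?_ (abs_nonneg _)
            have hi' : i < m - 1 := Finset.mem_range.1 hi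
            have hyl : ∀ j, |y j| ≤ 1 := fun j => by
              by_cases hj : j = k.succ
              · subst hj; exact hy.2.trans (by rw [div_le_one hC]; exact hC1)
              · rw [hy.1 j hj]; simp
            have h3 : |∏ j : Fin n, y (Fin.succ j) ^ ((m - i) * γ j)| ≤ 1 / C := by
              rw [← Finset.mul_prod_erase _ _ (Finset.mem_univ k), abs_mul, Finset.abs_prod]
              have h4 : ∏ j ∈ Finset.univ.erase k, |y (Fin.succ j) ^ ((m - i) * γ j)| ≤ 1 := by
                refine Finset.prod_le_one (fun j _ => abs_nonneg _) fun j _ => ?_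
                rw [abs_pow]; exact pow_le_one₀ (abs_nonneg _) (hyl _)
              have h5 : |y k.succ ^ ((m - i) * γ k)| ≤ 1 / C := by
                rw [abs_pow]
                refine (pow_le_of_le_one (abs_nonneg _) (hyl _) ?_).trans hy.2
                exact Nat.mul_ne_zero (by omega) (by omega)
              calc _ ≤ |y k.succ ^ ((m - i) * γ k)| * 1 := mul_le_mul_of_nonneg_left h4 (abs_nonneg _)
                _ ≤ _ := by rw [mul_one]; exact h5
            have h6 : |y 0 ^ ((m - i) * (γ k - 1))| ≤ 1 := by
              rw [abs_pow]; exact pow_le_one₀ (abs_nonneg _) (hyl _)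
            rw [abs_mul]
            calc _ ≤ |∏ j : Fin n, y (Fin.succ j) ^ ((m - i) * γ j)| * 1 := mul_le_mul_of_nonneg_left h6 (abs_nonneg _)
              _ ≤ _ := by rw [mul_one]; exact h3
          rw [← Finset.sum_mul, mul_one_div, le_div_iff₀ hC, hCdef, mul_add, mul_div_cancel₀ _ hup.ne'] at h1
          linarith
      · -- chart A
        intro y hy
        replace hy : y ∈ KA := hy
        refine ⟨hA0 y hy, hpA y, ?_⟩
        have hcomp : ∀ {g : (Fin (n + 1) → ℝ) → ℝ}, DCAt M g 0 → DCAt M (fun x => g (pA x)) y := fun {g} hg =>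
          DCAt.comp (g := g) (by rw [hA0 y hy]; exact hg) (hpA y)
        set γ' : Fin n → ℕ := fun j => γ j - if j = k then 1 else 0 with hγ'
        set E' : (Fin n → ℝ) → ℝ := fun z => E z * z k ^ m with hE'
        set u' : (Fin (n + 1) → ℝ) → ℝ := fun x => u (pA x) with hu'
        have hNE' : NCAt M E' 0 := hE.mul ((ncAt_coord k 0).pow m)
        have heq : (fun x => E (Fin.tail (pA x)) * tf m γ c u (pA x)) = fun x => E' (Fin.tail x) * tf m γ' c u' x := by
          funext x
          rw [htA, show tf m γ c u (pA x) = _ from tf_chartA m γ k hk c u x]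
          simp only [E', Fin.tail]; ring
        show Unif M (fun x => E (Fin.tail (pA x)) * tf m γ c u (pA x)) y
        rw [heq]
        by_cases hy0 : y 0 = 0
        · have hyz : y = 0 := by rw [← Fin.cons_self_tail y, hy0, hy.1, cons_zero_zero]
          have hA00 : pA 0 = 0 := by rw [← hyz]; rw [hA0 y hy, hyz]
          rw [hyz] at hcomp ⊢
          refine ih γ' ?_ E' c u' i0 hNE' hc (hcomp hu) (by simp only [u', hA00]; exact hu0) hi0 hci
          have : ∑ j, γ j = ∑ j, γ' j + 1 := by
            have h1 : ∑ j : Fin n, (if j = k then 1 else 0) = 1 := by simp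
            rw [← h1, ← Finset.sum_add_distrib]
            refine Finset.sum_congr rfl fun j _ => ?_
            simp only [hγ']
            split_ifs with h
            · subst h; omega
            · omega
          omega
        · have hyc : y = Fin.cons (y 0) 0 := by conv_lhs => rw [← Fin.cons_self_tail y, hy.1]
          have huy : DCAt M u' (Fin.cons (y 0) 0) := by rw [← hyc]; exact hcomp hu
          refine hS (m - 1) (by omega) _ E' y (tf_dcAt (by rw [hy.1]; exact hc) (hcomp hu)) (by rw [hy.1]; exact hNE'.dcAt)
            (by rw [hy.1]; exact hNE'.not_ev) ?_
          rw [hyc, tf_deriv_axis hm hc huy (u 0)]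
          · exact mul_ne_zero (mul_ne_zero (by positivity) (by simpa using hy0)) hu0
          · intro t
            simp only [u']
            congr 1
            ext j
            refine Fin.cases ?_ (fun j => ?_) j
            · simp [pA]
            · simp [pA]
    · intro O hO
      have := blowup_cover k hC (OA := O true) (OB := O false) (hO true) (hO false) (compactA _) (compactB _ k)
      refine mem_of_superset this (union_subset ?_ ?_)
      · exact subset_iUnion (fun b => (if b then pA else pB) '' O b) true
      · exact subset_iUnion (fun b => (if b then pA else pB) '' O b) false

end TT
end QDC
end


section
open Set Filter Topology
open scoped ContDiff Nat
set_option linter.unusedSectionVars false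
namespace QDC

section TT
variable {M : ℕ → ℝ} [hM : NSeq M] {n : ℕ}

/-- power substitution -/
noncomputable def psub (N : ℕ) (b : Fin n → ℝ) (ε : Fin n → Bool) (x : Fin (n + 1) → ℝ) : Fin (n + 1) → ℝ :=
  Fin.cons (x 0) fun j => b j + (if ε j then 1 else -1) * x j.succ ^ N

theorem psub_cover {N : ℕ} (hN : 0 < N) (b : Fin n → ℝ) (O : (Fin n → Bool) → Set (Fin (n + 1) → ℝ)) (hO : ∀ ε, O ε ∈ 𝓝 0) :
    (⋃ ε, psub N b ε '' O ε) ∈ 𝓝 (Fin.cons 0 b : Fin (n + 1) → ℝ) := by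
  have hN' : (0 : ℝ) < (N : ℝ)⁻¹ := by positivity
  let q : (Fin (n + 1) → ℝ) → (Fin (n + 1) → ℝ) := fun x => Fin.cons (x 0) fun j => |x j.succ - b j| ^ ((N : ℝ)⁻¹)
  have hq : Continuous q := by
    refine continuous_pi fun i => Fin.cases ?_ (fun j => ?_) i
    · simp only [q, Fin.cons_zero]; exact continuous_apply 0
    · simp only [q, Fin.cons_succ]
      exact ((continuous_apply j.succ).sub continuous_const).abs.rpow_const fun _ => .inr hN'.le
  have hq0 : q (Fin.cons 0 b) = 0 := by
    ext i; refine Fin.cases ?_ (fun j => ?_) i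
    · simp [q]
    · simp [q, Real.zero_rpow hN'.ne']
  have h1 : (⋂ ε, O ε) ∈ 𝓝 (q (Fin.cons 0 b)) := by
    rw [hq0]; exact (Filter.iInter_mem).2 hO
  refine mem_of_superset (hq.continuousAt.preimage_mem_nhds h1) fun x hx => ?_
  refine mem_iUnion.2 ⟨fun j => decide (b j ≤ x j.succ), q x, (mem_iInter.1 hx) _, ?_⟩
  ext i; refine Fin.cases ?_ (fun j => ?_) i
  · simp [psub, q]
  · simp only [psub, q, Fin.cons_succ, decide_eq_true_eq]
    rw [← Real.rpow_natCast, ← Real.rpow_mul (abs_nonneg _), inv_mul_cancel₀ (by positivity), Real.rpow_one]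
    split_ifs with h
    · rw [abs_of_nonneg (by linarith)]; ring
    · rw [abs_of_neg (by linarith)]; ring

theorem psub_dcAt (N : ℕ) (b : Fin n → ℝ) (ε : Fin n → Bool) (a : Fin (n + 1) → ℝ) : DCAt M (psub N b ε) a := by
  refine dcAt_cons (dcAt_coord _ _) ?_
  rw [dcAt_pi]; intro j
  exact (dcAt_const _).add ((dcAt_const _).mul ((dcAt_coord _ _).pow _))

/-- total preorder on finitely many exponents: a minimum exists -/
theorem exists_min_exp (Z : Finset ℕ) (hZ : Z.Nonempty) (β : ℕ → Fin n → ℕ) (h : ∀ i ∈ Z, ∀ j ∈ Z, β i ≤ β j ∨ β j ≤ β i) :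
    ∃ i ∈ Z, ∀ j ∈ Z, β i ≤ β j := by
  obtain ⟨i, hi, hmin⟩ := Z.exists_min_image (fun i => ∑ k, β i k) hZ
  refine ⟨i, hi, fun j hj => ?_⟩
  rcases h i hi j hj with h1 | h1
  · exact h1
  · have h2 := hmin j hj
    have h3 : ∀ k ∈ Finset.univ, β j k ≤ β i k := fun k _ => h1 k
    have h4 := (Finset.sum_eq_sum_iff_of_le h3).1 (le_antisymm (Finset.sum_le_sum h3) h2)
    intro k; exact (h4 k (Finset.mem_univ k)).ge

theorem mono_case {m : ℕ} (hm : 1 ≤ m) (hS : ∀ m' < m, SS M n m') {b : Fin n → ℝ} {E : (Fin n → ℝ) → ℝ} (hE : NCAt M E b)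
    {c : ℕ → (Fin n → ℝ) → ℝ} {u : (Fin (n + 1) → ℝ) → ℝ} (hu : DCAt M u (Fin.cons 0 b)) (hu0 : u (Fin.cons 0 b) ≠ 0)
    (hc : ∀ i < m - 1, (∀ᶠ z in 𝓝 b, c i z = 0) ∨ NCAt M (c i) b)
    (hd : ∀ i < m - 1, ∀ j < m - 1, (∀ᶠ z in 𝓝 b, c i z ^ (m ! / (m - i)) - c j z ^ (m ! / (m - j)) = 0) ∨
      NCAt M (fun z => c i z ^ (m ! / (m - i)) - c j z ^ (m ! / (m - j))) b) :
    Unif M (fun x => E (Fin.tail x) * (∑ i ∈ Finset.range (m - 1), c i (Fin.tail x) * x 0 ^ i + x 0 ^ m * u x)) (Fin.cons 0 b) := by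
  classical
  set Z := (Finset.range (m - 1)).filter (fun i => ¬ ∀ᶠ z in 𝓝 b, c i z = 0) with hZdef
  have hZm : ∀ i ∈ Z, i < m - 1 ∧ NCAt M (c i) b := by
    intro i hi
    simp only [hZdef, Finset.mem_filter, Finset.mem_range] at hi
    exact ⟨hi.1, (hc i hi.1).resolve_left hi.2⟩
  have hZn : ∀ i < m - 1, i ∉ Z → ∀ᶠ z in 𝓝 b, c i z = 0 := by
    intro i hi hiZ
    by_contra h
    exact hiZ (by simp only [hZdef, Finset.mem_filter, Finset.mem_range]; exact ⟨hi, h⟩)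
  have htb : Tendsto (fun x : Fin (n + 1) → ℝ => Fin.tail x) (𝓝 (Fin.cons 0 b)) (𝓝 b) := by
    have := tendsto_tail (Fin.cons 0 b : Fin (n + 1) → ℝ); rwa [Fin.tail_cons] at this
  by_cases hZe : Z.Nonempty
  swap
  · rw [Finset.not_nonempty_iff_eq_empty] at hZe
    refine NCAt.unif (NCAt.mul (NCAt.comp_tail (by rw [Fin.tail_cons]; exact hE)) ?_)
    refine NCAt.congr (((ncAt_coord 0 _).pow m).mul (ncAt_unit hu hu0)) ?_
    have h1 : ∀ᶠ z in 𝓝 b, ∀ i ∈ Finset.range (m - 1), c i z = 0 := by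
      rw [Filter.eventually_all_finset]
      intro i hi
      exact hZn i (Finset.mem_range.1 hi) (by rw [hZe]; simp)
    filter_upwards [htb.eventually h1] with x hx
    rw [Finset.sum_eq_zero, zero_add]
    intro i hi
    rw [hx i hi, zero_mul]
  -- exponents
  have hch : ∀ i, ∃ (α : Fin n → ℕ) (v : (Fin n → ℝ) → ℝ), i ∈ Z → DCAt M v b ∧ v b ≠ 0 ∧
      ∀ᶠ z in 𝓝 b, c i z = (∏ j, (z j - b j) ^ α j) * v z := by
    intro i
    by_cases hi : i ∈ Z
    · obtain ⟨α, v, h1, h2, h3⟩ := (hZm i hi).2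
      exact ⟨α, v, fun _ => ⟨h1, h2, h3⟩⟩
    · exact ⟨0, 0, fun h => absurd h hi⟩
  choose α v hv using hch
  have hpow : ∀ i ∈ Z, ∀ᶠ z in 𝓝 b, c i z ^ (m ! / (m - i)) = (∏ j, (z j - b j) ^ ((m ! / (m - i)) * α i j)) * v i z ^ (m ! / (m - i)) := by
    intro i hi
    filter_upwards [(hv i hi).2.2] with z hz
    rw [hz, mul_pow, ← Finset.prod_pow]
    congr 1
    exact Finset.prod_congr rfl fun j _ => by rw [← pow_mul, mul_comm]
  have hcomp : ∀ i ∈ Z, ∀ j ∈ Z, (fun k => (m ! / (m - i)) * α i k) ≤ (fun k => (m ! / (m - j)) * α j k) ∨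
      (fun k => (m ! / (m - j)) * α j k) ≤ (fun k => (m ! / (m - i)) * α i k) := by
    intro i hi j hj
    refine exponents_comparable (M := M) (a := b) (u := fun z => v i z ^ (m ! / (m - i))) (v := fun z => v j z ^ (m ! / (m - j)))
      ((hv i hi).1.pow _) ((hv j hj).1.pow _) (pow_ne_zero _ (hv i hi).2.1) (pow_ne_zero _ (hv j hj).2.1) ?_
    rcases hd i (hZm i hi).1 j (hZm j hj).1 with h | h
    · left
      filter_upwards [h, hpow i hi, hpow j hj] with z h1 h2 h3
      rw [← h2, ← h3]; exact h1
    · right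
      refine h.congr ?_
      filter_upwards [hpow i hi, hpow j hj] with z h2 h3
      rw [← h2, ← h3]
  obtain ⟨i0, hi0, hmin⟩ := exists_min_exp Z hZe (fun i k => (m ! / (m - i)) * α i k) hcomp
  set γ : Fin n → ℕ := fun k => (m ! / (m - i0)) * α i0 k with hγ
  have hdvd : ∀ i, i < m - 1 → (m - i) * (m ! / (m - i)) = m ! := fun i hi =>
    Nat.mul_div_cancel' (Nat.dvd_factorial (by omega) (by omega))
  have hle : ∀ i ∈ Z, ∀ k, (m - i) * γ k ≤ m ! * α i k := by
    intro i hi k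
    calc (m - i) * γ k ≤ (m - i) * ((m ! / (m - i)) * α i k) := Nat.mul_le_mul_left _ (hmin i hi k)
      _ = m ! * α i k := by rw [← mul_assoc, hdvd i (hZm i hi).1]
  have hmf : 0 < m ! := Nat.factorial_pos m
  obtain ⟨αE, e, he, he0, hEe⟩ := hE
  -- power substitution
  refine unif_comp (ι := Fin n → Bool) (fun ε => psub (m !) b ε) (fun _ => {0}) (fun _ => isCompact_singleton) ?_
    (fun O hO => psub_cover hmf b O fun ε => by simpa using hO ε)
  intro ε y hy
  rw [mem_singleton_iff] at hy
  subst hy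
  have hp0 : psub (m !) b ε 0 = Fin.cons 0 b := by
    ext i; refine Fin.cases ?_ (fun j => ?_) i
    · simp [psub]
    · simp [psub, hmf.ne']
  refine ⟨hp0, psub_dcAt _ _ _ _, ?_⟩
  let s : (Fin n → ℝ) → (Fin n → ℝ) := fun z j => b j + (if ε j then 1 else -1) * z j ^ (m !)
  have hs0 : s 0 = b := by funext j; simp [s, hmf.ne']
  have hsd : ∀ z, DCAt M s z := fun z => by
    rw [dcAt_pi]; intro j
    exact (dcAt_const _).add ((dcAt_const _).mul ((dcAt_coord _ _).pow _))
  have hst : Tendsto s (𝓝 0) (𝓝 b) := by have := (hsd 0).continuousAt.tendsto; rwa [hs0] at this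
  have hpt : ∀ x, Fin.tail (psub (m !) b ε x) = s (Fin.tail x) := fun x => by
    funext j; simp [psub, Fin.tail, s]
  have hsub : ∀ z j, s z j - b j = (if ε j then 1 else -1) * z j ^ (m !) := fun z j => by simp [s]
  have hε : ∀ j, (if ε j then (1 : ℝ) else -1) ≠ 0 := fun j => by split_ifs <;> norm_num
  let c' : ℕ → (Fin n → ℝ) → ℝ := fun i => if i ∈ Z then fun z =>
    (∏ j, (if ε j then (1 : ℝ) else -1) ^ α i j) * (∏ j, z j ^ (m ! * α i j - (m - i) * γ j)) * v i (s z) else fun _ => 0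
  have hc' : ∀ i < m - 1, DCAt M (c' i) 0 := by
    intro i hi
    by_cases hiZ : i ∈ Z
    · simp only [c', hiZ, if_true]
      refine ((dcAt_const _).mul (dcAt_prod _ fun j _ => (dcAt_coord _ _).pow _)).mul ?_
      exact DCAt.comp (g := v i) (by rw [hs0]; exact (hv i hiZ).1) (hsd 0)
    · simp only [c', hiZ, if_false]; exact dcAt_const _
  have hci0 : c' i0 0 ≠ 0 := by
    simp only [c', hi0, if_true]
    refine mul_ne_zero (mul_ne_zero (Finset.prod_ne_zero_iff.2 fun j _ => pow_ne_zero _ (hε j)) ?_) (by rw [hs0]; exact (hv i0 hi0).2.1)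
    refine Finset.prod_ne_zero_iff.2 fun j _ => ?_
    have : m ! * α i0 j - (m - i0) * γ j = 0 := by
      simp only [hγ]; rw [← mul_assoc, hdvd i0 (hZm i0 hi0).1, Nat.sub_self]
    rw [this, pow_zero]; exact one_ne_zero
  have hE' : NCAt M (fun z => E (s z)) 0 := by
    refine NCAt.congr (f := fun z => (∏ j, ((if ε j then 1 else -1) * z j ^ (m !)) ^ αE j) * e (s z)) ?_ ?_
    · refine (ncAt_prod _ fun j _ => NCAt.pow ((ncAt_unit (dcAt_const _) (hε j)).mul ((ncAt_coord j 0).pow _)) _).mul (ncAt_unit ?_ ?_)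
      · exact DCAt.comp (g := e) (by rw [hs0]; exact he) (hsd 0)
      · rw [hs0]; exact he0
    · filter_upwards [hst.eventually hEe] with z hz
      rw [hz]; simp only [hsub]
  have hu' : DCAt M (fun x => u (psub (m !) b ε x)) 0 := DCAt.comp (g := u) (by rw [hp0]; exact hu) (psub_dcAt _ _ _ _)
  refine Unif.congr (unifT hm hS _ γ rfl (fun z => E (s z)) c' (fun x => u (psub (m !) b ε x)) i0 hE' hc' hu'
    (by rw [hp0]; exact hu0) (hZm i0 hi0).1 hci0) ?_
  have h1 : ∀ᶠ z in 𝓝 (0 : Fin n → ℝ), ∀ i ∈ Finset.range (m - 1), c i (s z) = c' i z * ∏ j, z j ^ ((m - i) * γ j) := by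
    rw [Filter.eventually_all_finset]
    intro i hi
    by_cases hiZ : i ∈ Z
    · filter_upwards [hst.eventually (hv i hiZ).2.2] with z hz
      rw [hz]
      simp only [c', hiZ, if_true, hsub, mul_pow, Finset.prod_mul_distrib, ← pow_mul]
      have h2 : ∏ j, z j ^ (m ! * α i j) = (∏ j, z j ^ (m ! * α i j - (m - i) * γ j)) * ∏ j, z j ^ ((m - i) * γ j) := by
        rw [← Finset.prod_mul_distrib]
        refine Finset.prod_congr rfl fun j _ => ?_
        rw [← pow_add, Nat.sub_add_cancel (hle i hiZ j)]
      rw [h2]; ring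
    · filter_upwards [hst.eventually (hZn i (Finset.mem_range.1 hi) hiZ)] with z hz
      rw [hz]; simp [c', hiZ]
  filter_upwards [(tendsto_tail (0 : Fin (n + 1) → ℝ)).eventually h1] with x hx
  simp only [hpt, tf]
  congr 2
  refine Finset.sum_congr rfl fun i hi => ?_
  rw [hx i hi]; rfl

end TT
end QDC
end


section
open Set Filter Topology
open scoped ContDiff Nat
set_option linter.unusedSectionVars false
namespace QDC

section TT
variable {M : ℕ → ℝ} [hM : NSeq M] {n : ℕ}

theorem exists_tau {h : (Fin (n + 1) → ℝ) → ℝ} {a : Fin (n + 1) → ℝ} (hh : DCAt M h a) (h0 : h a = 0) (h1 : pd 0 h a ≠ 0) :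
    ∃ τ : (Fin n → ℝ) → ℝ, DCAt M τ (Fin.tail a) ∧ τ (Fin.tail a) = a 0 ∧ ∀ᶠ z in 𝓝 (Fin.tail a), h (Fin.cons (τ z) z) = 0 := by
  let F : (Fin (n + 1) → ℝ) → (Fin (n + 1) → ℝ) := fun x => Fin.cons (h x) (Fin.tail x)
  have hF : DCAt M F a := dcAt_cons hh (dcAt_tail a)
  have hdF : DifferentiableAt ℝ F a := hF.contDiffAt.differentiableAt (by simp)
  have hcomp : ∀ i v, fderiv ℝ F a v i = fderiv ℝ (fun x => F x i) a v := by
    intro i v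
    rw [(hasFDerivAt_pi'.1 hdF.hasFDerivAt i).fderiv]; rfl
  have hsucc : ∀ (i : Fin n) j, jac F a i.succ j = (Pi.single j 1 : Fin (n + 1) → ℝ) i.succ := by
    intro i j
    rw [jac_apply, hcomp]
    rw [show (fun x => F x i.succ) = fun x => x i.succ from rfl, (hasFDerivAt_apply (𝕜 := ℝ) i.succ a).fderiv]; rfl
  have hdet : (jac F a).det ≠ 0 := by
    rw [Matrix.det_of_upperTriangular]
    · rw [Fin.prod_univ_succ]
      refine mul_ne_zero ?_ (Finset.prod_ne_zero_iff.2 fun i _ => by rw [hsucc]; simp)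
      rw [jac_apply, hcomp]; exact h1
    · intro i j hij
      simp only [id] at hij
      obtain ⟨i', rfl⟩ := Fin.exists_succ_eq.2 (Fin.ne_zero_of_lt hij)
      rw [hsucc, Pi.single_eq_of_ne hij.ne']
  obtain ⟨e, hae, heq, -, hsymm⟩ := dcAt_inverse hF hdet
  have hFa : e a = Fin.cons 0 (Fin.tail a) := by rw [heq a hae]; simp only [F, h0]
  have hta : (Fin.cons 0 (Fin.tail a) : Fin (n + 1) → ℝ) ∈ e.target := by rw [← hFa]; exact e.map_source hae
  have hcd : DCAt M (fun z : Fin n → ℝ => (Fin.cons 0 z : Fin (n + 1) → ℝ)) (Fin.tail a) := dcAt_cons (dcAt_const _) dcAt_id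
  refine ⟨fun z => e.symm (Fin.cons 0 z) 0, ?_, ?_, ?_⟩
  · exact (dcAt_pi.1 (DCAt.comp (g := e.symm) (hsymm _ hta) hcd)) 0
  · simp only []; rw [← hFa, e.left_inv hae]
  · filter_upwards [hcd.continuousAt.eventually (e.open_target.mem_nhds hta)] with z hz
    have hs := e.map_target hz
    have h2 := e.right_inv hz
    rw [heq _ hs] at h2
    have h3 : h (e.symm (Fin.cons 0 z)) = 0 := by have := congrFun h2 0; simpa [F] using this
    have h4 : Fin.tail (e.symm (Fin.cons 0 z)) = z := by
      have := congrArg Fin.tail h2; simpa [F] using this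
    have h5 : (Fin.cons (e.symm (Fin.cons 0 z) 0) z : Fin (n + 1) → ℝ) = e.symm (Fin.cons 0 z) := by
      conv_lhs => rw [← h4]
      rw [h4]
      conv_rhs => rw [← Fin.cons_self_tail (e.symm (Fin.cons 0 z)), h4]
    rw [h5, h3]

def Uall (M : ℕ → ℝ) (n : ℕ) : Prop := ∀ (f : (Fin n → ℝ) → ℝ) (a : Fin n → ℝ), DCAt M f a → (¬ ∀ᶠ x in 𝓝 a, f x = 0) → Unif M f a

theorem not_ev_one {a : Fin n → ℝ} {f : (Fin n → ℝ) → ℝ} (hf : f a ≠ 0) : ¬ ∀ᶠ x in 𝓝 a, f x = 0 :=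
  fun h => hf h.self_of_nhds

/-- normalized case -/
theorem SS_norm (hU : Uall M n) {m : ℕ} (hm : 1 ≤ m) (hS : ∀ m' < m, SS M n m') (f : (Fin (n + 1) → ℝ) → ℝ) (E : (Fin n → ℝ) → ℝ)
    (z0 : Fin n → ℝ) (hf : DCAt M f (Fin.cons 0 z0)) (hE : DCAt M E z0) (hE0 : ¬ ∀ᶠ z in 𝓝 z0, E z = 0)
    (hfm : (pd 0)^[m] f (Fin.cons 0 z0) ≠ 0) (hf0 : ∀ᶠ z in 𝓝 z0, (pd 0)^[m - 1] f (Fin.cons 0 z) = 0) :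
    Unif M (fun x => E (Fin.tail x) * f x) (Fin.cons 0 z0) := by
  classical
  set a : Fin (n + 1) → ℝ := Fin.cons 0 z0 with ha
  have hta : Fin.tail a = z0 := Fin.tail_cons _ _
  have ha0 : a 0 = 0 := Fin.cons_zero _ _
  obtain ⟨c, u, hc, hu, hexp⟩ := exists_expansion hf m
  rw [hta] at hc
  simp only [ha0, sub_zero] at hexp
  -- behaviour along vertical lines
  have hcz : Tendsto (fun z : Fin n → ℝ => (Fin.cons 0 z : Fin (n + 1) → ℝ)) (𝓝 z0) (𝓝 a) :=
    (dcAt_cons (M := M) (dcAt_const (0 : ℝ)) (dcAt_id (x := z0))).continuousAt.tendsto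
  have hct : ∀ z : Fin n → ℝ, Tendsto (fun t : ℝ => (Fin.cons t z : Fin (n + 1) → ℝ)) (𝓝 0) (𝓝 (Fin.cons 0 z)) := fun z =>
    (dcAt_cons (M := M) (dcAt_id (x := (0 : ℝ))) (dcAt_const z)).continuousAt.tendsto
  have hline : ∀ᶠ z in 𝓝 z0, ∀ j ≤ m, (pd 0)^[j] f (Fin.cons 0 z) = if j = m then (m ! : ℝ) * u (Fin.cons 0 z) else (j ! : ℝ) * c j z := by
    filter_upwards [hcz.eventually (hf.eventually.and (hu.eventually.and (eventually_eventually_nhds.2 hexp)))] with z hz j hj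
    obtain ⟨hz1, hz2, hz3⟩ := hz
    rw [pd_iter_eq j hz1]
    refine expansion_deriv (u := fun t => u (Fin.cons t z)) (c := fun i => c i z) (contDiffAt_cons hz2) ?_ j hj
    filter_upwards [(hct z).eventually hz3] with t ht
    rw [ht]; simp
  have hu0 : u a ≠ 0 := by
    have := hline.self_of_nhds m le_rfl
    rw [if_pos rfl] at this
    intro h; rw [ha] at h; rw [h, mul_zero] at this; exact hfm this
  have hcm : ∀ᶠ z in 𝓝 z0, c (m - 1) z = 0 := by
    filter_upwards [hline, hf0] with z h1 h2
    have := h1 (m - 1) (by omega)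
    rw [h2, if_neg (by omega)] at this
    have hp : ((m - 1) ! : ℝ) ≠ 0 := by positivity
    exact (mul_eq_zero.1 this.symm).resolve_left hp
  have hexp2 : ∀ᶠ x in 𝓝 a, f x = ∑ i ∈ Finset.range (m - 1), c i (Fin.tail x) * x 0 ^ i + x 0 ^ m * u x := by
    have ht := tendsto_tail a
    rw [hta] at ht
    filter_upwards [hexp, ht.eventually hcm] with x h1 h2
    rw [h1]
    have : Finset.range m = Finset.range (m - 1 + 1) := by congr 1; omega
    rw [this, Finset.sum_range_succ, h2]; ring
  -- the function E0
  set Z := (Finset.range (m - 1)).filter (fun i => ¬ ∀ᶠ z in 𝓝 z0, c i z = 0) with hZdef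
  set qd : ℕ × ℕ → (Fin n → ℝ) → ℝ := fun ij z => c ij.1 z ^ (m ! / (m - ij.1)) - c ij.2 z ^ (m ! / (m - ij.2)) with hqd
  set Y := (Finset.range (m - 1) ×ˢ Finset.range (m - 1)).filter (fun ij => ¬ ∀ᶠ z in 𝓝 z0, qd ij z = 0) with hYdef
  have hqdd : ∀ ij ∈ Finset.range (m - 1) ×ˢ Finset.range (m - 1), DCAt M (qd ij) z0 := by
    intro ij hij
    rw [Finset.mem_product, Finset.mem_range, Finset.mem_range] at hij
    exact ((hc _ (by omega)).pow _).sub ((hc _ (by omega)).pow _)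
  set PZ : (Fin n → ℝ) → ℝ := fun z => ∏ i ∈ Z, c i z with hPZ
  set PY : (Fin n → ℝ) → ℝ := fun z => ∏ ij ∈ Y, qd ij z with hPY
  have hcZ : ∀ i ∈ Z, DCAt M (c i) z0 := fun i hi => by
    simp only [hZdef, Finset.mem_filter, Finset.mem_range] at hi; exact hc i (by omega)
  have hqY : ∀ ij ∈ Y, DCAt M (qd ij) z0 := fun ij hij => hqdd ij (Finset.mem_filter.1 hij).1
  have hPZd : DCAt M PZ z0 := dcAt_prod _ hcZ
  have hPYd : DCAt M PY z0 := dcAt_prod _ hqY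
  set E0 : (Fin n → ℝ) → ℝ := fun z => (E z * PZ z) * PY z with hE0def
  have hE0d : DCAt M E0 z0 := (hE.mul hPZd).mul hPYd
  have hE0n : ¬ ∀ᶠ z in 𝓝 z0, E0 z = 0 := by
    intro h
    rcases germ_mul_ne (hE.mul hPZd) hPYd h with h | h
    · rcases germ_mul_ne hE hPZd h with h | h
      · exact hE0 h
      · exact germ_prod_ne Z hcZ (fun i hi => (Finset.mem_filter.1 hi).2) h
    · exact germ_prod_ne Y hqY (fun i hi => (Finset.mem_filter.1 hi).2) h
  -- good neighbourhoods
  have hW1 : ∀ᶠ z in 𝓝 z0, DCAt M E z ∧ DCAt M PZ z ∧ DCAt M PY z ∧ (∀ i ∈ Finset.range (m - 1), DCAt M (c i) z) ∧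
      (∀ ij ∈ Y, DCAt M (qd ij) z) ∧ (∀ i ∈ Finset.range (m - 1), i ∉ Z → ∀ᶠ w in 𝓝 z, c i w = 0) ∧
      (∀ ij ∈ Finset.range (m - 1) ×ˢ Finset.range (m - 1), ij ∉ Y → ∀ᶠ w in 𝓝 z, qd ij w = 0) ∧
      (pd 0)^[m - 1] f (Fin.cons 0 z) = 0 := by
    refine hE.eventually.and (hPZd.eventually.and (hPYd.eventually.and (.and ?_ (.and ?_ (.and ?_ (.and ?_ hf0))))))
    · rw [Filter.eventually_all_finset]; intro i hi
      exact (hc i (by have := Finset.mem_range.1 hi; omega)).eventually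
    · rw [Filter.eventually_all_finset]; intro i hi
      exact (hqY i hi).eventually
    · rw [Filter.eventually_all_finset]; intro i hi
      by_cases hiZ : i ∈ Z
      · exact .of_forall fun _ h => absurd hiZ h
      · have : ∀ᶠ z in 𝓝 z0, c i z = 0 := by
          by_contra h; exact hiZ (Finset.mem_filter.2 ⟨hi, h⟩)
        filter_upwards [eventually_eventually_nhds.2 this] with z hz _ using hz
    · rw [Filter.eventually_all_finset]; intro i hi
      by_cases hiZ : i ∈ Y
      · exact .of_forall fun _ h => absurd hiZ h
      · have : ∀ᶠ z in 𝓝 z0, qd i z = 0 := by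
          by_contra h; exact hiZ (Finset.mem_filter.2 ⟨hi, h⟩)
        filter_upwards [eventually_eventually_nhds.2 this] with z hz _ using hz
  have hX1 : ∀ᶠ x in 𝓝 a, DCAt M f x ∧ DCAt M u x ∧ u x ≠ 0 ∧ (pd 0)^[m] f x ≠ 0 ∧
      ∀ᶠ y in 𝓝 x, f y = ∑ i ∈ Finset.range (m - 1), c i (Fin.tail y) * y 0 ^ i + y 0 ^ m * u y :=
    hf.eventually.and (hu.eventually.and ((hu.continuousAt.eventually_ne hu0).and
      (((pd_iter_smooth hf m).continuousAt.eventually_ne hfm).and (eventually_eventually_nhds.2 hexp2))))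
  obtain ⟨r, hr, hX⟩ := Metric.nhds_basis_ball.mem_iff.1 hX1
  have hprod : ∀ (t : ℝ) (z : Fin n → ℝ), |t| < r → dist z z0 < r → (Fin.cons t z : Fin (n + 1) → ℝ) ∈ Metric.ball a r := by
    intro t z h1 h2
    rw [Metric.mem_ball, dist_pi_lt_iff hr]
    rw [dist_pi_lt_iff hr] at h2
    intro i
    refine Fin.cases ?_ (fun j => ?_) i
    · simpa [ha] using h1
    · simpa [ha] using h2 j
  refine unif_prod (E0 := E0) (W := Metric.ball z0 r ∩ {z | DCAt M E z ∧ DCAt M PZ z ∧ DCAt M PY z ∧ (∀ i ∈ Finset.range (m - 1), DCAt M (c i) z) ∧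
      (∀ ij ∈ Y, DCAt M (qd ij) z) ∧ (∀ i ∈ Finset.range (m - 1), i ∉ Z → ∀ᶠ w in 𝓝 z, c i w = 0) ∧
      (∀ ij ∈ Finset.range (m - 1) ×ˢ Finset.range (m - 1), ij ∉ Y → ∀ᶠ w in 𝓝 z, qd ij w = 0) ∧
      (pd 0)^[m - 1] f (Fin.cons 0 z) = 0}) (I := Metric.ball 0 r)
    (by rw [hta]; exact hU E0 z0 hE0d hE0n) (by rw [hta]; exact inter_mem (Metric.ball_mem_nhds _ hr) hW1)
    (by rw [ha0]; exact Metric.ball_mem_nhds _ hr) ?_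
  rintro s b hs ⟨hsb, hEb, hPZb, hPYb, hcb, hqb, hcz0, hqz0, hfb⟩ hNC t ht
  have ht' : |t| < r := by simpa using ht
  have hsb' : dist (s b) z0 < r := hsb
  have hcompE : ∀ {g : (Fin n → ℝ) → ℝ}, DCAt M g (s b) → DCAt M (fun z => g (s z)) b := fun {g} hg => DCAt.comp (g := g) hg hs
  have hNCl : NCAt M (fun z => E (s z) * PZ (s z)) b := NCAt.of_mul_left ((hcompE hEb).mul (hcompE hPZb)) (hcompE hPYb) hNC
  have hNCE : NCAt M (fun z => E (s z)) b := NCAt.of_mul_left (hcompE hEb) (hcompE hPZb) hNCl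
  have hNCZ : NCAt M (fun z => PZ (s z)) b := NCAt.of_mul_right (hcompE hEb) (hcompE hPZb) hNCl
  have hNCY : NCAt M (fun z => PY (s z)) b := NCAt.of_mul_right ((hcompE hEb).mul (hcompE hPZb)) (hcompE hPYb) hNC
  have hsx : DCAt M (fun x : Fin (n + 1) → ℝ => (Fin.cons (x 0) (s (Fin.tail x)) : Fin (n + 1) → ℝ)) (Fin.cons t b) :=
    dcAt_cons (dcAt_coord _ _) (DCAt.comp_tail' (by rw [Fin.tail_cons]; exact hs))
  have hsx0 : (Fin.cons ((Fin.cons t b : Fin (n + 1) → ℝ) 0) (s (Fin.tail (Fin.cons t b : Fin (n + 1) → ℝ))) : Fin (n + 1) → ℝ) =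
    Fin.cons t (s b) := by simp
  obtain ⟨hx1, hx2, hx3, hx4, hx5⟩ := hX (hprod t (s b) ht' hsb')
  have hfd : DCAt M (fun x : Fin (n + 1) → ℝ => f (Fin.cons (x 0) (s (Fin.tail x)))) (Fin.cons t b) :=
    DCAt.comp (g := f) (by rw [hsx0]; exact hx1) hsx
  simp only [Fin.tail_cons]
  by_cases ht0 : t = 0
  · subst ht0
    have hud : DCAt M (fun x : Fin (n + 1) → ℝ => u (Fin.cons (x 0) (s (Fin.tail x)))) (Fin.cons 0 b) :=
      DCAt.comp (g := u) (by rw [hsx0]; exact hx2) hsx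
    refine Unif.congr (mono_case hm hS (b := b) (E := fun z => E (s z)) (c := fun i z => c i (s z)) hNCE hud
      (by rw [hsx0]; exact hx3) ?_ ?_) ?_
    · intro i hi
      by_cases hiZ : i ∈ Z
      · right
        refine NCAt.of_prod Z (f := fun i z => c i (s z)) (fun j hj => hcompE (hcb j (Finset.mem_filter.1 hj).1)) hNCZ i hiZ
      · left
        exact hs.continuousAt.eventually (hcz0 i (Finset.mem_range.2 hi) hiZ)
    · intro i hi j hj
      have hij : (i, j) ∈ Finset.range (m - 1) ×ˢ Finset.range (m - 1) :=
        Finset.mem_product.2 ⟨Finset.mem_range.2 hi, Finset.mem_range.2 hj⟩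
      by_cases hiZ : (i, j) ∈ Y
      · right
        exact NCAt.of_prod Y (f := fun ij z => qd ij (s z)) (fun j hj => hcompE (hqb j hj)) hNCY (i, j) hiZ
      · left
        exact hs.continuousAt.eventually (hqz0 (i, j) hij hiZ)
    · have h1 := hsx.continuousAt.tendsto
      rw [hsx0] at h1
      filter_upwards [h1.eventually hx5] with x hx
      rw [hx]; simp
  · refine hS (m - 1) (by omega) (fun x : Fin (n + 1) → ℝ => f (Fin.cons (x 0) (s (Fin.tail x)))) (fun z => E (s z)) (Fin.cons t b) hfd
      (by rw [Fin.tail_cons]; exact hNCE.dcAt) (by rw [Fin.tail_cons]; exact hNCE.not_ev) ?_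
    rw [pd_iter_eq (m - 1) hfd]
    simp only [Fin.cons_zero, Fin.tail_cons]
    rw [← pd_iter_eq (m - 1) hx1]
    intro hzero
    -- Rolle
    have hder : ∀ r' ∈ Metric.ball (0 : ℝ) r, HasDerivAt (fun t => (pd 0)^[m - 1] f (Fin.cons t (s b))) ((pd 0)^[m] f (Fin.cons r' (s b))) r' := by
      intro r' hr'
      have hfr : DCAt M f (Fin.cons r' (s b)) := (hX (hprod r' (s b) (by simpa using hr') hsb')).1
      have hc : HasDerivAt (fun t : ℝ => (Fin.cons t (s b) : Fin (n + 1) → ℝ)) (Pi.single 0 1) r' := by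
        rw [hasDerivAt_pi]
        intro i
        refine Fin.cases ?_ (fun j => ?_) i
        · simp only [Fin.cons_zero, Pi.single_eq_same]; exact hasDerivAt_id' r'
        · simpa using hasDerivAt_const r' (s b j)
      have h1 := ((pd_iter_smooth hfr (m - 1)).contDiffAt.differentiableAt (by simp)).hasFDerivAt.comp_hasDerivAt r' hc
      have h2 : (pd 0)^[m] f = pd 0 ((pd 0)^[m - 1] f) := by
        rw [← Function.iterate_succ_apply' (pd 0)]; congr 2; omega
      rw [h2]; exact h1
    have hrolle : ∃ r' ∈ Metric.ball (0 : ℝ) r, (pd 0)^[m] f (Fin.cons r' (s b)) = 0 := by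
      have hconv : ∀ p q, p ∈ Metric.ball (0 : ℝ) r → q ∈ Metric.ball (0 : ℝ) r → Icc p q ⊆ Metric.ball (0 : ℝ) r := fun p q hp hq => by
        rw [← Real.norm_eq_abs] at ht'
        exact (convex_ball (0 : ℝ) r).ordConnected.out hp hq
      have hz : (0 : ℝ) ∈ Metric.ball (0 : ℝ) r := Metric.mem_ball_self hr
      rcases lt_or_gt_of_ne ht0 with h | h
      · obtain ⟨r', hr', he⟩ := exists_hasDerivAt_eq_zero (f := fun t => (pd 0)^[m - 1] f (Fin.cons t (s b)))
          (f' := fun r' => (pd 0)^[m] f (Fin.cons r' (s b))) h (fun x hx => (hder x (hconv t 0 ht hz hx)).continuousAt.continuousWithinAt)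
          (by beta_reduce; rw [hzero, hfb]) (fun x hx => hder x (hconv t 0 ht hz (Ioo_subset_Icc_self hx)))
        exact ⟨r', hconv t 0 ht hz (Ioo_subset_Icc_self hr'), he⟩
      · obtain ⟨r', hr', he⟩ := exists_hasDerivAt_eq_zero (f := fun t => (pd 0)^[m - 1] f (Fin.cons t (s b)))
          (f' := fun r' => (pd 0)^[m] f (Fin.cons r' (s b))) h (fun x hx => (hder x (hconv 0 t hz ht hx)).continuousAt.continuousWithinAt)
          (by beta_reduce; rw [hzero, hfb]) (fun x hx => hder x (hconv 0 t hz ht (Ioo_subset_Icc_self hx)))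
        exact ⟨r', hconv 0 t hz ht (Ioo_subset_Icc_self hr'), he⟩
    obtain ⟨r', hr', he⟩ := hrolle
    exact (hX (hprod r' (s b) (by simpa using hr') hsb')).2.2.2.1 he

theorem SS_all (hU : Uall M n) (m : ℕ) : SS M n m := by
  induction m using Nat.strong_induction_on with
  | _ m hS =>
  intro f E a hf hE hE0 hfm
  rcases Nat.eq_zero_or_pos m with hm | hm
  · subst hm
    simp only [Function.iterate_zero, id] at hfm
    obtain ⟨r, hr, hX⟩ := Metric.nhds_basis_ball.mem_iff.1 (hf.eventually.and (hf.continuousAt.eventually_ne hfm))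
    refine unif_prod (E0 := E) (W := Metric.ball (Fin.tail a) r ∩ {z | DCAt M E z}) (I := Metric.ball (a 0) r) (hU E _ hE hE0)
      (inter_mem (Metric.ball_mem_nhds _ hr) hE.eventually) (Metric.ball_mem_nhds _ hr) ?_
    rintro s b hs ⟨hsb, hEb⟩ hNC t ht
    have hmem : (Fin.cons t (s b) : Fin (n + 1) → ℝ) ∈ Metric.ball a r := by
      rw [Metric.mem_ball, dist_pi_lt_iff hr] at hsb ⊢
      intro i
      refine Fin.cases ?_ (fun j => ?_) i
      · simpa using ht
      · simp only [Fin.cons_succ]; exact hsb j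
    obtain ⟨h1, h2⟩ := hX hmem
    simp only [Fin.tail_cons]
    refine NCAt.unif (NCAt.mul (NCAt.comp_tail (g := fun z => E (s z)) (by rw [Fin.tail_cons]; exact hNC)) (ncAt_unit ?_ ?_))
    · refine DCAt.comp (g := f) (by simpa using h1) (dcAt_cons (dcAt_coord _ _) (DCAt.comp_tail' (by rw [Fin.tail_cons]; exact hs)))
    · simpa using h2
  · by_cases hz : (pd 0)^[m - 1] f a = 0
    swap
    · exact hS (m - 1) (by omega) f E a hf hE hE0 hz
    have hsucc : (pd 0)^[m] f = pd 0 ((pd 0)^[m - 1] f) := by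
      rw [← Function.iterate_succ_apply' (pd 0)]; congr 2; omega
    obtain ⟨τ, hτ, hτa, hτz⟩ := exists_tau (pd_iter_smooth hf (m - 1)) hz (by rw [← hsucc]; exact hfm)
    let p : (Fin (n + 1) → ℝ) → (Fin (n + 1) → ℝ) := fun x => Fin.cons (x 0 + τ (Fin.tail x)) (Fin.tail x)
    let q : (Fin (n + 1) → ℝ) → (Fin (n + 1) → ℝ) := fun x => Fin.cons (x 0 - τ (Fin.tail x)) (Fin.tail x)
    have hp0 : p (Fin.cons 0 (Fin.tail a)) = a := by
      simp only [p, Fin.cons_zero, Fin.tail_cons, zero_add, hτa, Fin.cons_self_tail]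
    have hpd : DCAt M p (Fin.cons 0 (Fin.tail a)) :=
      dcAt_cons ((dcAt_coord _ _).add (DCAt.comp_tail (by rw [Fin.tail_cons]; exact hτ))) (dcAt_tail _)
    have hq0 : q a = Fin.cons 0 (Fin.tail a) := by simp only [q, hτa, sub_self]
    have hqd : DCAt M q a := dcAt_cons ((dcAt_coord _ _).sub hτ.comp_tail) (dcAt_tail _)
    have hpq : ∀ x, p (q x) = x := fun x => by simp [p, q]
    have htp : ∀ x, Fin.tail (p x) = Fin.tail x := fun x => by simp [p]
    have hfp : DCAt M (fun x => f (p x)) (Fin.cons 0 (Fin.tail a)) := DCAt.comp (g := f) (by rw [hp0]; exact hf) hpd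
    -- derivatives
    have hkey : ∀ᶠ z in 𝓝 (Fin.tail a), ∀ k : ℕ, (pd 0)^[k] (fun x => f (p x)) (Fin.cons 0 z) = (pd 0)^[k] f (Fin.cons (τ z) z) := by
      have hcz : Tendsto (fun z : Fin n → ℝ => (Fin.cons 0 z : Fin (n + 1) → ℝ)) (𝓝 (Fin.tail a)) (𝓝 (Fin.cons 0 (Fin.tail a))) :=
        (dcAt_cons (M := M) (dcAt_const (0 : ℝ)) (dcAt_id (x := Fin.tail a))).continuousAt.tendsto
      have hpc := hpd.continuousAt.tendsto
      rw [hp0] at hpc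
      filter_upwards [hcz.eventually (hfp.eventually.and (hpc.eventually hf.eventually))] with z hz k
      have hpz : p (Fin.cons 0 z) = Fin.cons (τ z) z := by simp [p]
      rw [hpz] at hz
      rw [pd_iter_eq k hz.1, pd_iter_eq k hz.2]
      have := iteratedDeriv_shift (g := fun s => f (Fin.cons s z)) (τ z) k 0
      rw [zero_add] at this
      rw [← this]
      simp [p]
    refine unif_comp_one (p := p) (b := Fin.cons 0 (Fin.tail a)) hp0 hpd ?_ ?_
    · simp only [htp]
      refine SS_norm hU hm hS (fun x => f (p x)) E (Fin.tail a) hfp hE hE0 ?_ ?_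
      · rw [hkey.self_of_nhds m, hτa, Fin.cons_self_tail]; exact hfm
      · filter_upwards [hkey, hτz] with z h1 h2
        rw [h1]; exact h2
    · intro O hO
      refine mem_of_superset (hqd.continuousAt.preimage_mem_nhds (by rw [hq0]; exact hO)) fun x hx => ⟨q x, hx, hpq x⟩


theorem Uall_zero : Uall M 0 := by
  intro f a hf h0
  refine NCAt.unif (ncAt_unit hf fun h => h0 (.of_forall fun x => ?_))
  rw [Subsingleton.elim x a, h]

theorem iteratedDeriv_line {f : (Fin (n + 1) → ℝ) → ℝ} {a v : Fin (n + 1) → ℝ} (hf : DCAt M f a) (k : ℕ) :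
    iteratedDeriv k (fun s : ℝ => f (a + s • v)) 0 = iteratedFDeriv ℝ k f a (fun _ => v) := by
  have key : ∀ k : ℕ, ∀ᶠ t in 𝓝 (0 : ℝ), iteratedDeriv k (fun s : ℝ => f (a + s • v)) t = iteratedFDeriv ℝ k f (a + t • v) (fun _ => v) := by
    have hev : ∀ᶠ t in 𝓝 (0 : ℝ), DCAt M f (a + t • v) := by
      have hc : Tendsto (fun t : ℝ => a + t • v) (𝓝 0) (𝓝 a) := by
        have : Continuous (fun t : ℝ => a + t • v) := by fun_prop
        simpa using this.tendsto 0
      exact hc.eventually hf.eventually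
    intro k
    induction k with
    | zero => simp
    | succ j ih =>
      filter_upwards [eventually_eventually_nhds.2 ih, hev] with t ht hd
      rw [iteratedDeriv_succ, Filter.EventuallyEq.deriv_eq ht]
      have h1 : DifferentiableAt ℝ (iteratedFDeriv ℝ j f) (a + t • v) :=
        hd.contDiffAt.differentiableAt_iteratedFDeriv (m := j) (by exact_mod_cast WithTop.coe_lt_top _)
      have h2 : HasDerivAt (fun t : ℝ => a + t • v) v t := by
        simpa using ((hasDerivAt_id t).smul_const v).const_add a
      have h3 := h1.hasFDerivAt.comp_hasDerivAt t h2
      have h4 := (ContinuousMultilinearMap.apply ℝ (fun _ : Fin j => (Fin (n + 1) → ℝ)) ℝ (fun _ => v)).hasFDerivAt.comp_hasDerivAt t h3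
      have h5 := h4.deriv
      rw [iteratedFDeriv_succ_apply_left]
      exact h5
  simpa using (key k).self_of_nhds

theorem Uall_succ (hU : Uall M n) : Uall M (n + 1) := by
  intro f a hf h0
  obtain ⟨k, v, hkv⟩ := exists_direction hf h0
  rcases Nat.eq_zero_or_pos k with hk | hk
  · subst hk
    exact NCAt.unif (ncAt_unit hf (by simpa using hkv))
  have hv : v ≠ 0 := by
    rintro rfl
    exact hkv ((iteratedFDeriv ℝ k f a).map_coord_zero ⟨0, hk⟩ rfl)
  obtain ⟨L, hL⟩ := SeparatingDual.exists_continuousLinearEquiv_apply_eq (R := ℝ) (x := (Pi.single 0 1 : Fin (n + 1) → ℝ)) (y := v)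
    (by intro h; have := congrFun h 0; simp at this) hv
  let p : (Fin (n + 1) → ℝ) → (Fin (n + 1) → ℝ) := fun x => a + L x
  have hp0 : p 0 = a := by simp [p]
  have hpd : ∀ x, DCAt M p x := fun x => (dcAt_const a).add (DCAt.clm (L : (Fin (n + 1) → ℝ) →L[ℝ] (Fin (n + 1) → ℝ)))
  have hfp : DCAt M (fun x => f (p x)) 0 := DCAt.comp (g := f) (by rw [hp0]; exact hf) (hpd 0)
  refine unif_comp_one (p := p) (b := 0) hp0 (hpd 0) ?_ ?_
  · have := SS_all hU k (fun x => f (p x)) (fun _ => 1) 0 hfp (dcAt_const _) (not_ev_one (by simp)) ?_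
    · simpa using this
    · have h1 : DCAt M (fun x => f (p x)) (Fin.cons 0 0 : Fin (n + 1) → ℝ) := by rw [cons_zero_zero]; exact hfp
      have h2 := pd_iter_eq k h1
      rw [cons_zero_zero] at h2
      rw [h2]
      have h3 : ∀ s : ℝ, p (Fin.cons s 0) = a + s • v := fun s => by
        have : (Fin.cons s 0 : Fin (n + 1) → ℝ) = s • (Pi.single 0 1 : Fin (n + 1) → ℝ) := by
          ext i; refine Fin.cases ?_ (fun j => ?_) i <;> simp
        simp only [p, this, map_smul, hL]
      simp only [h3]
      rw [iteratedDeriv_line hf]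
      exact hkv
  · intro O hO
    have := (L.toHomeomorph.trans (Homeomorph.addLeft a)).isOpenMap.image_mem_nhds hO
    have h2 : (L.toHomeomorph.trans (Homeomorph.addLeft a)) 0 = a := hp0
    rw [h2] at this; exact this

theorem uall (n : ℕ) : Uall M n := by
  induction n with
  | zero => exact Uall_zero
  | succ n ih => exact Uall_succ ih

end TT
end QDC
end


section
open Set Filter Topology
open scoped ContDiff Nat
set_option linter.unusedSectionVars false
namespace QDC

section Loj
variable {M : ℕ → ℝ} [hM : NSeq M] {n : ℕ}

/-- Łojasiewicz property of a set -/
def LP (F : (Fin n → ℝ) → ℝ) (S : Set (Fin n → ℝ)) : Prop :=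
  ∃ (N : ℕ) (C : ℝ), 1 ≤ N ∧ 0 < C ∧ ∀ x ∈ S, 1 ≤ C * |F x| ∨ ∃ z, F z = 0 ∧ dist x z ≤ 1 ∧ dist x z ^ N ≤ C * |F x|

theorem LP.mono {F : (Fin n → ℝ) → ℝ} {S T : Set (Fin n → ℝ)} (hST : S ⊆ T) (h : LP F T) : LP F S := by
  obtain ⟨N, C, h1, h2, h3⟩ := h
  exact ⟨N, C, h1, h2, fun x hx => h3 x (hST hx)⟩

theorem LP.union {F : (Fin n → ℝ) → ℝ} {S T : Set (Fin n → ℝ)} (hS : LP F S) (hT : LP F T) : LP F (S ∪ T) := by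
  have aux : ∀ {N N' : ℕ} {C C' : ℝ} {x : Fin n → ℝ}, N ≤ N' → C ≤ C' →
      (1 ≤ C * |F x| ∨ ∃ z, F z = 0 ∧ dist x z ≤ 1 ∧ dist x z ^ N ≤ C * |F x|) →
      (1 ≤ C' * |F x| ∨ ∃ z, F z = 0 ∧ dist x z ≤ 1 ∧ dist x z ^ N' ≤ C' * |F x|) := by
    intro N N' C C' x hN hC h
    have hCC : C * |F x| ≤ C' * |F x| := mul_le_mul_of_nonneg_right hC (abs_nonneg _)
    rcases h with h | ⟨z, h1, h2, h3⟩
    · exact .inl (h.trans hCC)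
    · exact .inr ⟨z, h1, h2, (pow_le_pow_of_le_one dist_nonneg h2 hN).trans (h3.trans hCC)⟩
  obtain ⟨N, C, h1, h2, h3⟩ := hS
  obtain ⟨N', C', h1', h2', h3'⟩ := hT
  refine ⟨max N N', max C C', h1.trans (le_max_left _ _), h2.trans_le (le_max_left _ _), ?_⟩
  rintro x (hx | hx)
  · exact aux (le_max_left _ _) (le_max_left _ _) (h3 x hx)
  · exact aux (le_max_right _ _) (le_max_right _ _) (h3' x hx)

theorem LP.empty {F : (Fin n → ℝ) → ℝ} : LP F ∅ := ⟨1, 1, le_rfl, one_pos, by simp⟩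

theorem LP.of_compact {F : (Fin n → ℝ) → ℝ} {K : Set (Fin n → ℝ)} (hK : IsCompact K) {s : (Fin n → ℝ) → (Fin n → ℝ)}
    (h : ∀ y ∈ K, ∃ t ∈ 𝓝 y, LP F (s '' t)) : LP F (s '' K) := by
  refine hK.induction_on (p := fun K => LP F (s '' K)) (by rw [image_empty]; exact LP.empty) ?_ ?_ ?_
  · intro A B hAB h; exact h.mono (image_mono hAB)
  · intro A B hA hB; rw [image_union]; exact hA.union hB
  · intro y hy
    obtain ⟨t, ht, hl⟩ := h y hy
    exact ⟨t, mem_nhdsWithin_of_mem_nhds ht, hl⟩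

theorem NCAt.lp {F : (Fin n → ℝ) → ℝ} {s : (Fin n → ℝ) → (Fin n → ℝ)} {y : Fin n → ℝ} (hs : DCAt M s y)
    (h : NCAt M (fun x => F (s x)) y) : ∃ t ∈ 𝓝 y, LP F (s '' t) := by
  obtain ⟨α, u, hu, hu0, hF⟩ := h
  obtain ⟨L, T, hT, hL⟩ := (hs.contDiffAt.of_le (by exact_mod_cast le_top : (1:WithTop ℕ∞) ≤ ∞)).exists_lipschitzOnWith
  have hη : 0 < |u y| / 2 := by have := abs_pos.2 hu0; positivity
  have hue : ∀ᶠ x in 𝓝 y, |u y| / 2 < |u x| :=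
    hu.continuousAt.abs.eventually (lt_mem_nhds (half_lt_self (abs_pos.2 hu0)))
  obtain ⟨r, hr, hb⟩ := Metric.nhds_basis_ball.mem_iff.1 (inter_mem hT (hF.and hue))
  refine ⟨Metric.ball y r, Metric.ball_mem_nhds y hr, ?_⟩
  set η := |u y| / 2 with hηdef
  set N := ∑ j, α j with hN
  have hL1 : (1 : ℝ) ≤ (L : ℝ) + 1 := by have := L.2; simp
  refine ⟨N + 1, ((L : ℝ) + 1) ^ N * η⁻¹, by omega, by positivity, ?_⟩
  rintro _ ⟨x, hx, rfl⟩
  obtain ⟨hxT, hFx, hux⟩ := hb hx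
  simp only at hFx hux
  have hFabs : |F (s x)| = (∏ j, |x j - y j| ^ α j) * |u x| := by
    rw [hFx, abs_mul, Finset.abs_prod]; simp only [abs_pow]
  by_cases hα : ∃ j, 0 < α j
  · obtain ⟨j0, hj0⟩ := hα
    obtain ⟨j, hj, hmin⟩ := (Finset.univ.filter fun j => 0 < α j).exists_min_image (fun j => |x j - y j|) ⟨j0, by simpa using hj0⟩
    have hjα : 0 < α j := by simpa using hj
    have hlow : |x j - y j| ^ N * η ≤ |F (s x)| := by
      rw [hFabs]
      refine mul_le_mul ?_ hux.le hη.le (Finset.prod_nonneg fun _ _ => by positivity)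
      rw [hN, ← Finset.prod_pow_eq_pow_sum]
      refine Finset.prod_le_prod (fun _ _ => by positivity) fun k _ => ?_
      rcases Nat.eq_zero_or_pos (α k) with hk | hk
      · rw [hk]; simp
      · exact pow_le_pow_left₀ (abs_nonneg _) (hmin k (by simpa using hk)) _
    set x' := Function.update x j (y j) with hx'
    have hx'b : x' ∈ Metric.ball y r := by
      rw [Metric.mem_ball, dist_pi_lt_iff hr] at hx ⊢
      intro k
      by_cases hk : k = j
      · subst hk; simpa [hx'] using hr
      · simpa [hx', hk] using hx k
    obtain ⟨hxT', hFx', -⟩ := hb hx'b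
    simp only at hFx'
    have hz : F (s x') = 0 := by
      rw [hFx', Finset.prod_eq_zero (Finset.mem_univ j), zero_mul]
      simp [hx', hjα.ne']
    have hxx : dist x x' ≤ |x j - y j| := by
      rw [dist_pi_le_iff (abs_nonneg _)]
      intro k
      by_cases hk : k = j
      · subst hk; simp [hx', Real.dist_eq]
      · simp [hx', hk]
    have hdist : dist (s x) (s x') ≤ ((L : ℝ) + 1) * |x j - y j| := by
      refine (hL.dist_le_mul x hxT x' hxT').trans ?_
      have := L.2
      have h2 : (L : ℝ) * dist x x' ≤ (L : ℝ) * |x j - y j| := mul_le_mul_of_nonneg_left hxx L.2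
      nlinarith [abs_nonneg (x j - y j)]
    have hpow : dist (s x) (s x') ^ N ≤ ((L : ℝ) + 1) ^ N * η⁻¹ * |F (s x)| := by
      calc dist (s x) (s x') ^ N ≤ (((L : ℝ) + 1) * |x j - y j|) ^ N := pow_le_pow_left₀ dist_nonneg hdist _
        _ = ((L : ℝ) + 1) ^ N * η⁻¹ * (|x j - y j| ^ N * η) := by rw [mul_pow]; field_simp
        _ ≤ _ := mul_le_mul_of_nonneg_left hlow (by positivity)
    by_cases hd1 : dist (s x) (s x') ≤ 1
    · right
      refine ⟨s x', hz, hd1, le_trans ?_ hpow⟩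
      exact pow_le_pow_of_le_one dist_nonneg hd1 (Nat.le_succ _)
    · left
      push Not at hd1
      exact (one_le_pow₀ hd1.le).trans hpow
  · left
    push Not at hα
    have hα0 : ∀ j, α j = 0 := fun j => by have := hα j; omega
    have h1 : |F (s x)| = |u x| := by rw [hFabs]; simp [hα0]
    have h2 : N = 0 := by simp [hN, hα0]
    rw [h1, h2, pow_zero, one_mul, ← div_eq_inv_mul, le_div_iff₀ hη]; linarith

theorem Cov.lp {F : (Fin n → ℝ) → ℝ} {G S : Set (Fin n → ℝ)} (h : Cov M F G S) : LP F S := by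
  induction h with
  | empty => exact LP.empty
  | union _ _ h1 h2 => exact h1.union h2
  | mono hST _ ih => exact ih.mono hST
  | chart s K hK h => exact LP.of_compact hK fun y hy => (h y hy).2.2.lp (h y hy).1

/-- Łojasiewicz inequality -/
theorem lojasiewicz {F : (Fin n → ℝ) → ℝ} {K : Set (Fin n → ℝ)} (hK : IsCompact K) (hF : ∀ x ∈ K, DCAt M F x) : LP F K := by
  have := LP.of_compact (F := F) hK (s := fun x => x) fun a ha => ?_
  · simpa using this
  · by_cases h0 : ∀ᶠ x in 𝓝 a, F x = 0
    · refine ⟨_, h0, 1, 1, le_rfl, one_pos, ?_⟩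
      rintro _ ⟨x, hx, rfl⟩
      exact .inr ⟨x, hx, by simp, by simp⟩
    · obtain ⟨S, hS, hc⟩ := uall n F a (hF a ha) h0 univ univ_mem
      exact ⟨S, hS, by simpa using hc.lp⟩

end Loj

section Noeth
variable {M : ℕ → ℝ} [hM : NSeq M]

/-- stabilization of zero sets on `S` -/
def Stab {X : Type*} (f : ℕ → X → ℝ) (S : Set X) : Prop := ∃ k0, ∀ x ∈ S, (∀ j ≤ k0, f j x = 0) → ∀ j, f j x = 0

theorem Stab.mono {X : Type*} {f : ℕ → X → ℝ} {S T : Set X} (hST : S ⊆ T) (h : Stab f T) : Stab f S := by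
  obtain ⟨k, hk⟩ := h; exact ⟨k, fun x hx => hk x (hST hx)⟩

theorem Stab.union {X : Type*} {f : ℕ → X → ℝ} {S T : Set X} (hS : Stab f S) (hT : Stab f T) : Stab f (S ∪ T) := by
  obtain ⟨k, hk⟩ := hS
  obtain ⟨l, hl⟩ := hT
  refine ⟨max k l, ?_⟩
  rintro x (hx | hx) h
  · exact hk x hx fun j hj => h j (hj.trans (le_max_left _ _))
  · exact hl x hx fun j hj => h j (hj.trans (le_max_right _ _))

theorem Stab.empty {X : Type*} {f : ℕ → X → ℝ} : Stab f ∅ := ⟨0, by simp⟩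

theorem Stab.biUnion {X ι : Type*} {f : ℕ → X → ℝ} (I : Finset ι) (S : ι → Set X) (h : ∀ i ∈ I, Stab f (S i)) : Stab f (⋃ i ∈ I, S i) := by
  classical
  induction I using Finset.induction_on with
  | empty => simpa using Stab.empty
  | insert i s _ ih =>
    rw [Finset.set_biUnion_insert]
    exact (h i (Finset.mem_insert_self _ _)).union (ih fun j hj => h j (Finset.mem_insert_of_mem hj))

theorem Stab.of_compact {X : Type*} [TopologicalSpace X] {f : ℕ → X → ℝ} {K : Set X} (hK : IsCompact K)
    (h : ∀ y ∈ K, ∃ t ∈ 𝓝 y, Stab f t) : Stab f K := by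
  refine hK.induction_on (p := fun K => Stab f K) Stab.empty ?_ ?_ ?_
  · intro A B hAB h; exact h.mono hAB
  · intro A B hA hB; exact hA.union hB
  · intro y hy
    obtain ⟨t, ht, hl⟩ := h y hy
    exact ⟨t, mem_nhdsWithin_of_mem_nhds ht, hl⟩

theorem Stab.image {X Y : Type*} {f : ℕ → Y → ℝ} {s : X → Y} {S : Set X} (h : Stab (fun j x => f j (s x)) S) : Stab f (s '' S) := by
  obtain ⟨k, hk⟩ := h
  refine ⟨k, ?_⟩
  rintro _ ⟨x, hx, rfl⟩ h
  exact hk x hx h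

theorem Stab.zero_union {X : Type*} {f : ℕ → X → ℝ} {S T : Set X} (j0 : ℕ) (hS : ∀ x ∈ S, f j0 x = 0 → x ∈ T) (h : Stab f T) : Stab f S := by
  obtain ⟨k, hk⟩ := h
  refine ⟨max k j0, fun x hx hz => hk x (hS x hx (hz j0 (le_max_right _ _))) fun j hj => hz j (hj.trans (le_max_left _ _))⟩

theorem noeth_dim (n : ℕ) : ∀ (W : Set (Fin n → ℝ)) (f : ℕ → (Fin n → ℝ) → ℝ), IsOpen W → (∀ j, ∀ x ∈ W, DCAt M (f j) x) →
    ∀ K ⊆ W, IsCompact K → Stab f K := by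
  induction n with
  | zero =>
    intro W f _ _ K _ _
    by_cases h : ∀ j, f j (fun i => i.elim0) = 0
    · exact ⟨0, fun x _ _ j => by rw [Subsingleton.elim x (fun i => i.elim0)]; exact h j⟩
    · push Not at h
      obtain ⟨j, hj⟩ := h
      refine ⟨j, fun x _ h => absurd (h j le_rfl) ?_⟩
      rw [Subsingleton.elim x (fun i => i.elim0)]; exact hj
  | succ n ih =>
    intro W f hW hf K hKW hK
    refine Stab.of_compact hK fun a ha => ?_
    obtain ⟨r, hr, hb⟩ := Metric.nhds_basis_ball.mem_iff.1 (hW.mem_nhds (hKW ha))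
    by_cases h0 : ∀ j, ∀ᶠ x in 𝓝 a, f j x = 0
    · refine ⟨_, Metric.ball_mem_nhds a hr, 0, fun x hx _ j => ?_⟩
      exact quasi_convex' (convex_ball a r) (fun x hx => hf j x (hb hx)) (Metric.mem_ball_self hr) (h0 j) x hx
    obtain ⟨j0, hj0⟩ := not_forall.1 h0
    obtain ⟨S, hS, hc⟩ := uall (n + 1) (f j0) a (hf j0 a (hKW ha)) hj0 W (hW.mem_nhds (hKW ha))
    refine ⟨S, hS, ?_⟩
    clear hj0 hS
    induction hc with
    | empty => exact Stab.empty
    | union _ _ h1 h2 => exact h1.union h2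
    | mono hST _ ih => exact ih.mono hST
    | chart s K hK h =>
      refine Stab.image (Stab.of_compact hK fun y hy => ?_)
      obtain ⟨h1, h2, α, u, hu, hu0, hFe⟩ := h y hy
      have hev : ∀ᶠ x in 𝓝 y, (DCAt M s x ∧ s x ∈ W) ∧ (f j0 (s x) = (∏ j, (x j - y j) ^ α j) * u x ∧ u x ≠ 0) :=
        (h1.eventually.and (h1.continuousAt.eventually (hW.mem_nhds h2))).and (hFe.and (hu.continuousAt.eventually_ne hu0))
      obtain ⟨ρ, hρ, hball⟩ := Metric.nhds_basis_ball.mem_iff.1 hev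
      refine ⟨Metric.closedBall y (ρ / 2), Metric.closedBall_mem_nhds y (by positivity), ?_⟩
      have hsub : Metric.closedBall y (ρ / 2) ⊆ Metric.ball y ρ := Metric.closedBall_subset_ball (by linarith)
      refine Stab.zero_union j0 (T := ⋃ j ∈ (Finset.univ : Finset (Fin (n + 1))),
        (fun w : Fin n → ℝ => (Fin.insertNth j (y j) w : Fin (n + 1) → ℝ)) '' Metric.closedBall (Fin.removeNth j y) (ρ / 2)) ?_ ?_
      · intro x hx hz
        obtain ⟨-, he, hux⟩ := hball (hsub hx)
        rw [he] at hz
        obtain ⟨j, -, hj⟩ := Finset.prod_eq_zero_iff.1 ((mul_eq_zero.1 hz).resolve_right hux)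
        have hj' : x j = y j := sub_eq_zero.1 (eq_zero_of_pow_eq_zero hj)
        simp only [Finset.mem_univ, iUnion_true, mem_iUnion]
        refine ⟨j, Fin.removeNth j x, ?_, ?_⟩
        · rw [Metric.mem_closedBall, dist_pi_le_iff (by positivity)] at hx ⊢
          exact fun i => hx _
        · rw [← hj']; exact Fin.insertNth_self_removeNth j x
      · refine Stab.biUnion _ _ fun j _ => Stab.image ?_
        have hins : ∀ w, DCAt M (fun w : Fin n → ℝ => (Fin.insertNth j (y j) w : Fin (n + 1) → ℝ)) w := by
          intro w
          rw [dcAt_pi]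
          intro i
          refine Fin.succAboveCases j ?_ (fun i => ?_) i
          · simp only [Fin.insertNth_apply_same]; exact dcAt_const _
          · simp only [Fin.insertNth_apply_succAbove]; exact dcAt_coord _ _
        have hmem : ∀ w ∈ Metric.ball (Fin.removeNth j y) ρ, (Fin.insertNth j (y j) w : Fin (n + 1) → ℝ) ∈ Metric.ball y ρ := by
          intro w hw
          rw [Metric.mem_ball, dist_pi_lt_iff hρ] at hw ⊢
          intro i
          refine Fin.succAboveCases j ?_ (fun i => ?_) i
          · simpa using hρ
          · simp only [Fin.insertNth_apply_succAbove]; exact hw i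
        refine ih (Metric.ball (Fin.removeNth j y) ρ) _ Metric.isOpen_ball ?_ _ (Metric.closedBall_subset_ball (by linarith)) (isCompact_closedBall _ _)
        intro k w hw
        obtain ⟨⟨hd, hsW⟩, -⟩ := hball (hmem w hw)
        exact DCAt.comp (g := f k) (hf k _ hsW) (DCAt.comp (g := s) hd (hins w))

end Noeth
end QDC
end


section
open Set Filter Topology
open scoped ContDiff Nat
set_option linter.unusedSectionVars false
set_option linter.unusedVariables false
namespace QDC

section Lv
variable {n : ℕ} {O : Set (Fin n → ℝ)} {F G : (Fin n → ℝ) → ℝ}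

theorem pd_add_on (hO : IsOpen O) (hF : ContDiffOn ℝ ∞ F O) (hG : ContDiffOn ℝ ∞ G O) (i : Fin n) :
    EqOn (pd i (fun x => F x + G x)) (fun x => pd i F x + pd i G x) O := by
  intro x hx
  have h1 := (hF.contDiffAt (hO.mem_nhds hx)).differentiableAt (by simp)
  have h2 := (hG.contDiffAt (hO.mem_nhds hx)).differentiableAt (by simp)
  simp only [pd]
  rw [fderiv_fun_add h1 h2]; rfl

theorem pd_mul_on (hO : IsOpen O) (hF : ContDiffOn ℝ ∞ F O) (hG : ContDiffOn ℝ ∞ G O) (i : Fin n) :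
    EqOn (pd i (fun x => F x * G x)) (fun x => pd i F x * G x + F x * pd i G x) O := by
  intro x hx
  have h1 := (hF.contDiffAt (hO.mem_nhds hx)).differentiableAt (by simp)
  have h2 := (hG.contDiffAt (hO.mem_nhds hx)).differentiableAt (by simp)
  simp only [pd]
  rw [fderiv_fun_mul h1 h2]; simp; ring

theorem pd_sum_on (hO : IsOpen O) {ι : Type*} (s : Finset ι) {F : ι → (Fin n → ℝ) → ℝ}
    (hF : ∀ j ∈ s, ContDiffOn ℝ ∞ (F j) O) (i : Fin n) :
    EqOn (pd i (fun x => ∑ j ∈ s, F j x)) (fun x => ∑ j ∈ s, pd i (F j) x) O := by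
  intro x hx
  simp only [pd]
  rw [fderiv_fun_sum fun j hj => ((hF j hj).contDiffAt (hO.mem_nhds hx)).differentiableAt (by simp)]
  simp

theorem pd_const (c : ℝ) (i : Fin n) : pd i (fun _ : Fin n → ℝ => c) = fun _ => 0 := by
  funext x; simp [pd]

theorem pd_coord (j i : Fin n) : pd i (fun x : Fin n → ℝ => x j) = fun _ => if j = i then 1 else 0 := by
  funext x
  have : (fun x : Fin n → ℝ => x j) = (ContinuousLinearMap.proj j : (Fin n → ℝ) →L[ℝ] ℝ) := rfl
  simp only [pd, this, ContinuousLinearMap.fderiv]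
  simp [Pi.single_apply]

theorem pd_smooth (hF : ContDiff ℝ ∞ F) (i : Fin n) : ContDiff ℝ ∞ (pd i F) :=
  contDiffOn_univ.1 (pd_smoothOn isOpen_univ (contDiffOn_univ.2 hF) i)

/-- levelwise predicates on derivatives -/
def Lv (B : ((Fin n → ℝ) → ℝ) → Prop) : ℕ → ((Fin n → ℝ) → ℝ) → Prop
  | 0, F => B F
  | L + 1, F => B F ∧ ∀ i, Lv B L (pd i F)

variable {B B₁ B₂ B₃ : ((Fin n → ℝ) → ℝ) → Prop}

theorem Lv.base {L : ℕ} (h : Lv B L F) : B F := by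
  cases L with
  | zero => exact h
  | succ L => exact h.1

theorem Lv.pred {L : ℕ} : ∀ {F}, Lv B (L + 1) F → Lv B L F := by
  induction L with
  | zero => intro F h; exact h.1
  | succ L ih => intro F h; exact ⟨h.1, fun i => ih (h.2 i)⟩

theorem Lv.le {L L' : ℕ} (hL : L' ≤ L) (h : Lv B L F) : Lv B L' F := by
  induction hL with
  | refl => exact h
  | step _ ih => exact ih h.pred

theorem Lv.imp {L : ℕ} (hB : ∀ F, B₁ F → B₂ F) : ∀ {F}, Lv B₁ L F → Lv B₂ L F := by
  induction L with
  | zero => intro F h; exact hB _ h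
  | succ L ih => intro F h; exact ⟨hB _ h.1, fun i => ih (h.2 i)⟩

theorem Lv.congr (hO : IsOpen O) (hB : ∀ F G, EqOn F G O → B F → B G) {L : ℕ} :
    ∀ {F G}, EqOn F G O → Lv B L F → Lv B L G := by
  induction L with
  | zero => intro F G h; exact hB _ _ h
  | succ L ih => intro F G h hF; exact ⟨hB _ _ h hF.1, fun i => ih (pd_congr_on hO h i) (hF.2 i)⟩

theorem Lv.add (hO : IsOpen O) (hB : ∀ F G, EqOn F G O → B F → B G)
    (hadd : ∀ F G, B F → B G → B (fun x => F x + G x)) {L : ℕ} : ∀ {F G}, ContDiffOn ℝ ∞ F O →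
    ContDiffOn ℝ ∞ G O → Lv B L F → Lv B L G → Lv B L (fun x => F x + G x) := by
  induction L with
  | zero => intro F G _ _; exact hadd _ _
  | succ L ih =>
    intro F G hF hG h1 h2
    refine ⟨hadd _ _ h1.1 h2.1, fun i => ?_⟩
    exact Lv.congr hO hB (pd_add_on hO hF hG i).symm
      (ih (pd_smoothOn hO hF i) (pd_smoothOn hO hG i) (h1.2 i) (h2.2 i))

theorem Lv.mul (hO : IsOpen O) (hB : ∀ F G, EqOn F G O → B₃ F → B₃ G)
    (hadd : ∀ F G, B₃ F → B₃ G → B₃ (fun x => F x + G x))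
    (hmul : ∀ F G, B₁ F → B₂ G → B₃ (fun x => F x * G x)) {L : ℕ} : ∀ {F G}, ContDiffOn ℝ ∞ F O →
    ContDiffOn ℝ ∞ G O → Lv B₁ L F → Lv B₂ L G → Lv B₃ L (fun x => F x * G x) := by
  induction L with
  | zero => intro F G _ _; exact hmul _ _
  | succ L ih =>
    intro F G hF hG h1 h2
    refine ⟨hmul _ _ h1.1 h2.1, fun i => ?_⟩
    refine Lv.congr hO hB (pd_mul_on hO hF hG i).symm (Lv.add hO hB hadd ?_ ?_ ?_ ?_)
    · exact (pd_smoothOn hO hF i).mul hG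
    · exact hF.mul (pd_smoothOn hO hG i)
    · exact ih (pd_smoothOn hO hF i) hG (h1.2 i) h2.pred
    · exact ih hF (pd_smoothOn hO hG i) h1.pred (h2.2 i)

theorem Lv.sum (hO : IsOpen O) (hB : ∀ F G, EqOn F G O → B F → B G)
    (hadd : ∀ F G, B F → B G → B (fun x => F x + G x)) (h0 : ∀ L, Lv B L (fun _ => 0)) {L : ℕ}
    {ι : Type*} (s : Finset ι) {F : ι → (Fin n → ℝ) → ℝ} (hF : ∀ j ∈ s, ContDiffOn ℝ ∞ (F j) O)
    (h : ∀ j ∈ s, Lv B L (F j)) : Lv B L (fun x => ∑ j ∈ s, F j x) := by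
  classical
  induction s using Finset.induction_on with
  | empty => simpa using h0 L
  | insert a s ha ih =>
    simp only [Finset.sum_insert ha]
    refine Lv.add hO hB hadd (hF a (by simp)) (ContDiffOn.sum fun j hj => hF j (by simp [hj])) (h a (by simp)) ?_
    exact ih (fun j hj => hF j (by simp [hj])) (fun j hj => h j (by simp [hj]))

theorem lv_true {L : ℕ} : ∀ {F : (Fin n → ℝ) → ℝ}, Lv (fun _ => True) L F := by
  induction L with
  | zero => intro F; trivial
  | succ L ih => intro F; exact ⟨trivial, fun i => ih⟩

theorem lv_zero (h : B (fun _ => 0)) (L : ℕ) : Lv B L (fun _ : Fin n → ℝ => 0) := by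
  induction L with
  | zero => exact h
  | succ L ih => exact ⟨h, fun i => by rw [pd_const]; exact ih⟩

theorem lv_iff_pdw {L : ℕ} : ∀ {F}, Lv B L F ↔ ∀ w : List (Fin n), w.length ≤ L → B (pdw w F) := by
  induction L with
  | zero =>
    intro F
    constructor
    · intro h w hw; rw [List.length_eq_zero_iff.1 (Nat.le_zero.1 hw)]; exact h
    · intro h; exact h [] (by simp)
  | succ L ih =>
    intro F
    constructor
    · intro h w hw
      rcases List.eq_nil_or_concat w with rfl | ⟨w', i, rfl⟩
      · exact h.1
      · rw [List.concat_eq_append, pdw_append]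
        exact ih.1 (h.2 i) w' (by simpa using hw)
    · intro h
      refine ⟨h [] (by simp), fun i => ih.2 fun w hw => ?_⟩
      have := h (w ++ [i]) (by simpa using hw)
      rwa [pdw_append] at this

/-- vanishing of all derivatives up to order `L` -/
def FlatTo (L : ℕ) (F : (Fin n → ℝ) → ℝ) (x : Fin n → ℝ) : Prop := Lv (fun F => F x = 0) L F

/-- flatness -/
def Flat (F : (Fin n → ℝ) → ℝ) (x : Fin n → ℝ) : Prop := ∀ L, FlatTo L F x

theorem Flat.eq_zero {x : Fin n → ℝ} (h : Flat F x) : F x = 0 := h 0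
theorem Flat.pd {x : Fin n → ℝ} (h : Flat F x) (i : Fin n) : Flat (pd i F) x := fun L => (h (L + 1)).2 i
theorem flat_of {x : Fin n → ℝ} (h0 : F x = 0) (h : ∀ i, Flat (QDC.pd i F) x) : Flat F x := fun L => by
  cases L with
  | zero => exact h0
  | succ L => exact ⟨h0, fun i => h i L⟩

theorem flat_iff_pdw {x : Fin n → ℝ} : Flat F x ↔ ∀ w, pdw w F x = 0 := by
  constructor
  · intro h w; exact lv_iff_pdw.1 (h w.length) w le_rfl
  · intro h L; exact lv_iff_pdw.2 fun w _ => h w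

theorem FlatTo.congr {x : Fin n → ℝ} {L : ℕ} (hO : IsOpen O) (hx : x ∈ O) (h : EqOn F G O) (hF : FlatTo L F x) : FlatTo L G x :=
  Lv.congr hO (fun F G h hF => by rw [← h hx]; exact hF) h hF

theorem FlatTo.congr_nhds {x : Fin n → ℝ} {L : ℕ} (h : F =ᶠ[𝓝 x] G) (hF : FlatTo L F x) : FlatTo L G x := by
  obtain ⟨O, hO, ho, hx⟩ := eventually_nhds_iff.1 h
  exact hF.congr ho hx (fun y hy => hO y hy)

theorem FlatTo.add {x : Fin n → ℝ} {L : ℕ} (hO : IsOpen O) (hx : x ∈ O) (hF : ContDiffOn ℝ ∞ F O) (hG : ContDiffOn ℝ ∞ G O)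
    (h1 : FlatTo L F x) (h2 : FlatTo L G x) : FlatTo L (fun x => F x + G x) x :=
  Lv.add hO (fun F G h hF => by rw [← h hx]; exact hF) (fun F G h1 h2 => by simp [h1, h2]) hF hG h1 h2

theorem FlatTo.mul {x : Fin n → ℝ} {L : ℕ} (hO : IsOpen O) (hx : x ∈ O) (hF : ContDiffOn ℝ ∞ F O) (hG : ContDiffOn ℝ ∞ G O)
    (h1 : FlatTo L F x) : FlatTo L (fun x => F x * G x) x :=
  Lv.mul (B₂ := fun _ => True) hO (fun F G h hF => by rw [← h hx]; exact hF) (fun F G h1 h2 => by simp [h1, h2])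
    (fun F G h _ => by simp [h]) hF hG h1 lv_true

theorem FlatTo.sum {x : Fin n → ℝ} {L : ℕ} (hO : IsOpen O) (hx : x ∈ O) {ι : Type*} (s : Finset ι) {F : ι → (Fin n → ℝ) → ℝ}
    (hF : ∀ j ∈ s, ContDiffOn ℝ ∞ (F j) O) (h : ∀ j ∈ s, FlatTo L (F j) x) : FlatTo L (fun x => ∑ j ∈ s, F j x) x :=
  Lv.sum hO (fun F G h hF => by rw [← h hx]; exact hF) (fun F G h1 h2 => by simp [h1, h2]) (lv_zero (B := fun F => F x = 0) rfl) s hF h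

theorem flatTo_zero {x : Fin n → ℝ} {L : ℕ} : FlatTo L (fun _ => 0) x := lv_zero (B := fun F => F x = 0) rfl L

theorem flat_of_eventually {x : Fin n → ℝ} (h : ∀ᶠ y in 𝓝 x, F y = 0) : Flat F x := fun L =>
  flatTo_zero.congr_nhds (F := fun _ => 0) (h.mono fun y hy => hy.symm)

theorem flatTo_of_iteratedFDeriv {x : Fin n → ℝ} {L : ℕ} (hF : ContDiff ℝ ∞ F) (h : ∀ k ≤ L, iteratedFDeriv ℝ k F x = 0) : FlatTo L F x := by
  refine lv_iff_pdw.2 fun w hw => ?_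
  have h1 := abs_pdw_le isOpen_univ (contDiffOn_univ.2 hF) (mem_univ x) w
  rw [h _ hw, norm_zero] at h1
  exact abs_nonpos_iff.1 h1

theorem FlatTo.iteratedFDeriv {x : Fin n → ℝ} {L : ℕ} (hF : ContDiff ℝ ∞ F) (h : FlatTo L F x) {k : ℕ} (hk : k ≤ L) :
    iteratedFDeriv ℝ k F x = 0 := by
  have := norm_iteratedFDeriv_le_pdw isOpen_univ (contDiffOn_univ.2 hF) (mem_univ x) k (C := 0)
    (fun l hl => by rw [lv_iff_pdw.1 h l (hl.trans_le hk)]; simp)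
  exact norm_le_zero_iff.1 (by simpa using this)

/-- product of functions: vanishing orders add up -/
theorem FlatTo.mul_vanish {x : Fin n → ℝ} (hO : IsOpen O) (hx : x ∈ O) : ∀ {L : ℕ} {F G : (Fin n → ℝ) → ℝ}, ContDiffOn ℝ ∞ F O → ContDiffOn ℝ ∞ G O →
    FlatTo L F x → G x = 0 → FlatTo (L + 1) (fun x => F x * G x) x := by
  intro L
  induction L with
  | zero =>
    intro F G hF hG h1 h2
    refine ⟨by simp [h2], fun i => ?_⟩
    change pd i (fun x => F x * G x) x = 0
    rw [pd_mul_on hO hF hG i hx]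
    have : F x = 0 := h1
    simp [h2, this]
  | succ L ih =>
    intro F G hF hG h1 h2
    refine ⟨by simp [h2], fun i => ?_⟩
    refine FlatTo.congr hO hx (pd_mul_on hO hF hG i).symm ?_
    refine FlatTo.add hO hx ((pd_smoothOn hO hF i).mul hG) (hF.mul (pd_smoothOn hO hG i)) ?_ ?_
    · exact ih (pd_smoothOn hO hF i) hG (h1.2 i) h2
    · exact FlatTo.mul hO hx hF (pd_smoothOn hO hG i) h1

/-- Extension by zero. -/
theorem ext_zero {b δ : (Fin n → ℝ) → ℝ} (hO : IsOpen O) (hb : ContDiffOn ℝ ∞ b O) (hb0 : ∀ x ∉ O, b x = 0)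
    (hδ : Differentiable ℝ δ) (hδ0 : ∀ x ∈ closure O, x ∉ O → δ x = 0)
    (hw : ∀ w : List (Fin n), ∃ C : ℝ, 0 ≤ C ∧ ∀ x ∈ O, |pdw w b x| ≤ C * δ x ^ 2) :
    ContDiff ℝ ∞ b ∧ ∀ x ∉ O, Flat b x := by
  classical
  set bw : List (Fin n) → (Fin n → ℝ) → ℝ := fun w => O.indicator (pdw w b) with hbw
  have hder : ∀ w x, HasFDerivAt (bw w) (∑ i, (bw (i :: w) x) • (ContinuousLinearMap.proj i : (Fin n → ℝ) →L[ℝ] ℝ)) x := by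
    intro w x
    by_cases hx : x ∈ O
    · have h1 : bw w =ᶠ[𝓝 x] pdw w b := by
        filter_upwards [hO.mem_nhds hx] with y hy
        simp [hbw, hy]
      have h2 := (((pdw_smoothOn hO hb w).contDiffAt (hO.mem_nhds hx)).differentiableAt (by simp)).hasFDerivAt
      refine (h2.congr_of_eventuallyEq h1).congr_fderiv ?_
      ext v
      have : v = ∑ i, v i • (Pi.single i (1 : ℝ) : Fin n → ℝ) := by
        funext j; simp [Finset.sum_apply, Pi.single_apply]
      conv_lhs => rw [this]
      rw [map_sum]
      simp [hbw, hx, pd, mul_comm]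
    · have hz : (∑ i, (bw (i :: w) x) • (ContinuousLinearMap.proj i : (Fin n → ℝ) →L[ℝ] ℝ)) = 0 := by
        simp [hbw, hx]
      rw [hz]
      have hx0 : bw w x = 0 := by simp [hbw, hx]
      by_cases hc : x ∈ closure O
      · obtain ⟨C, hC0, hC⟩ := hw w
        have hd := (hδ x).hasFDerivAt.isBigO_sub
        rw [hδ0 x hc hx] at hd
        rw [hasFDerivAt_iff_isLittleO]
        simp only [hx0, sub_zero, ContinuousLinearMap.zero_apply] at hd ⊢
        have h2 : bw w =O[𝓝 x] fun y => δ y ^ 2 := by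
          refine Asymptotics.IsBigO.of_bound C (Eventually.of_forall fun y => ?_)
          by_cases hy : y ∈ O
          · simpa [hbw, hy] using hC y hy
          · simp only [hbw, hy, not_false_eq_true, indicator_of_notMem, norm_zero]; positivity
        refine h2.trans_isLittleO ?_
        have h3 : (fun y => δ y ^ 2) =O[𝓝 x] fun y => ‖y - x‖ ^ 2 := (hd.norm_right.pow 2)
        refine h3.trans_isLittleO ?_
        have h4 : (fun y : Fin n → ℝ => ‖y - x‖ ^ 2) =o[𝓝 x] fun y => ‖y - x‖ ^ 1 := by
          have := (Asymptotics.isLittleO_pow_pow (𝕜 := ℝ) (m := 1) (n := 2) (by norm_num)).comp_tendsto (tendsto_norm_sub_self x)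
          exact this
        simpa using h4.norm_right
      · have h1 : bw w =ᶠ[𝓝 x] fun _ => 0 := by
          filter_upwards [isClosed_closure.isOpen_compl.mem_nhds hc] with y hy
          have : y ∉ O := fun h => hy (subset_closure h)
          simp [hbw, this]
        exact (hasFDerivAt_const (0 : ℝ) x).congr_of_eventuallyEq h1
  have hfd : ∀ w, fderiv ℝ (bw w) = fun x => ∑ i, (bw (i :: w) x) • (ContinuousLinearMap.proj i : (Fin n → ℝ) →L[ℝ] ℝ) :=
    fun w => funext fun x => (hder w x).fderiv
  have hsm : ∀ k : ℕ, ∀ w, ContDiff ℝ k (bw w) := by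
    intro k
    induction k with
    | zero =>
      intro w
      exact contDiff_zero.2 (continuous_iff_continuousAt.2 fun x => (hder w x).continuousAt)
    | succ k ih =>
      intro w
      have : ((k + 1 : ℕ) : WithTop ℕ∞) = (k : WithTop ℕ∞) + 1 := by push_cast; rfl
      rw [this, contDiff_succ_iff_fderiv]
      refine ⟨fun x => (hder w x).differentiableAt, by simp, ?_⟩
      rw [hfd]
      exact ContDiff.sum fun i _ => (ih _).smul contDiff_const
  have hbb : bw [] = b := by
    funext x
    by_cases hx : x ∈ O
    · simp [hbw, hx]
    · simp [hbw, hx, hb0]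
  have hpd : ∀ w i, pd i (bw w) = bw (i :: w) := by
    intro w i
    funext x
    rw [pd, hfd]
    simp [Pi.single_apply]
  have hpw : ∀ w, pdw w b = bw w := by
    intro w
    induction w with
    | nil => exact hbb.symm
    | cons i w ih => rw [pdw_cons, ih, hpd]
  refine ⟨contDiff_infty.2 fun k => hbb ▸ hsm k [], fun x hx => flat_iff_pdw.2 fun w => ?_⟩
  rw [hpw]; simp [hbw, hx]

end Lv
end QDC
end


section
open Set Filter Topology
open scoped ContDiff Nat
set_option linter.unusedSectionVars false
set_option linter.unusedVariables false
namespace QDC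

section tay
variable {n : ℕ} {F G : (Fin n → ℝ) → ℝ}

theorem norm_fderiv_le_pd (x : Fin n → ℝ) : ‖fderiv ℝ F x‖ ≤ ∑ i, |pd i F x| := by
  refine ContinuousLinearMap.opNorm_le_bound _ (Finset.sum_nonneg fun i _ => abs_nonneg _) fun v => ?_
  have : v = ∑ i, v i • (Pi.single i (1 : ℝ) : Fin n → ℝ) := by
    funext j; simp [Finset.sum_apply, Pi.single_apply]
  conv_lhs => rw [this]
  rw [map_sum, Finset.sum_mul]
  refine (norm_sum_le _ _).trans (Finset.sum_le_sum fun i _ => ?_)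
  rw [map_smul, norm_smul, mul_comm]
  exact mul_le_mul_of_nonneg_left (norm_le_pi_norm v i) (abs_nonneg _)

theorem pd_support {i : Fin n} (hF : HasCompactSupport F) : HasCompactSupport (pd i F) := by
  have := hF.fderiv (𝕜 := ℝ)
  exact this.comp_left (g := fun L : (Fin n → ℝ) →L[ℝ] ℝ => L (Pi.single i 1)) rfl

theorem taylor_est (m : ℕ) : ∀ {F : (Fin n → ℝ) → ℝ}, ContDiff ℝ ∞ F → HasCompactSupport F →
    ∃ C : ℝ, 0 ≤ C ∧ ∀ x z, Flat F z → |F x| ≤ C * dist x z ^ m := by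
  induction m with
  | zero =>
    intro F hF hc
    obtain ⟨C, hC⟩ := hc.exists_bound_of_continuous hF.continuous
    exact ⟨C, (norm_nonneg _).trans (hC 0), fun x z _ => by simpa using hC x⟩
  | succ m ih =>
    intro F hF hc
    choose C hC0 hC using fun i => ih (pd_smooth hF i) (pd_support hc)
    refine ⟨∑ i, C i, Finset.sum_nonneg fun i _ => hC0 i, fun x z hz => ?_⟩
    have h := (convex_closedBall z (dist x z)).norm_image_sub_le_of_norm_fderiv_le (𝕜 := ℝ) (f := F)
      (C := (∑ i, C i) * dist x z ^ m) (x := z) (y := x) (fun y _ => hF.differentiable (by simp) y) ?_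
      (by simp) (by simp)
    · rw [hz.eq_zero, sub_zero, Real.norm_eq_abs, ← dist_eq_norm] at h
      rw [pow_succ, ← mul_assoc]; exact h
    · intro y hy
      refine (norm_fderiv_le_pd y).trans ?_
      rw [Finset.sum_mul]
      refine Finset.sum_le_sum fun i _ => (hC i y z (hz.pd i)).trans ?_
      exact mul_le_mul_of_nonneg_left (pow_le_pow_left₀ dist_nonneg hy m) (hC0 i)

end tay

section coefMul

theorem antidiag_shift {σ : Type} [DecidableEq σ] (i : σ) (α : σ →₀ ℕ) (P Q : (σ →₀ ℕ) → ℝ) :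
    ∑ b ∈ Finset.HasAntidiagonal.antidiagonal (α + Finsupp.single i 1), ((b : (σ →₀ ℕ) × (σ →₀ ℕ)).1 i : ℝ) * P b.1 * Q b.2 =
    ∑ b ∈ Finset.HasAntidiagonal.antidiagonal α, ((b.1 i : ℝ) + 1) * P (b.1 + Finsupp.single i 1) * Q b.2 := by
  rw [← Finset.sum_filter_add_sum_filter_not _ (fun b => b.1 i ≠ 0)]
  refine (congrArg₂ (· + ·) rfl (Finset.sum_eq_zero ?_)).trans ((add_zero _).trans ?_)
  rotate_left
  · symm
    refine Finset.sum_bij' (fun b _ => (b.1 + Finsupp.single i 1, b.2)) (fun b _ => (b.1 - Finsupp.single i 1, b.2)) ?_ ?_ ?_ ?_ ?_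
    · intro b hb
      simp only [Finset.mem_filter, Finset.HasAntidiagonal.mem_antidiagonal] at hb ⊢
      exact ⟨by rw [← hb]; abel, by simp⟩
    · intro b hb
      simp only [Finset.mem_filter, Finset.HasAntidiagonal.mem_antidiagonal] at hb ⊢
      have hle : Finsupp.single i 1 ≤ b.1 := by
        rw [Finsupp.single_le_iff]; exact Nat.one_le_iff_ne_zero.2 hb.2
      have := tsub_add_cancel_of_le hle
      have h2 : b.1 - Finsupp.single i 1 + b.2 + Finsupp.single i 1 = α + Finsupp.single i 1 := by
        rw [add_right_comm, this]; exact hb.1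
      exact add_right_cancel h2
    · intro b hb; simp
    · intro b hb
      simp only [Finset.mem_filter, Finset.HasAntidiagonal.mem_antidiagonal] at hb
      have hle : Finsupp.single i 1 ≤ b.1 := by
        rw [Finsupp.single_le_iff]; exact Nat.one_le_iff_ne_zero.2 hb.2
      simp [tsub_add_cancel_of_le hle]
    · intro b hb; simp
  · intro b hb
    simp only [Finset.mem_filter, not_not] at hb
    simp [hb.2]

theorem antidiag_shift' {σ : Type} [DecidableEq σ] (i : σ) (α : σ →₀ ℕ) (P Q : (σ →₀ ℕ) → ℝ) :
    ((α i : ℝ) + 1) * ∑ b ∈ Finset.HasAntidiagonal.antidiagonal (α + Finsupp.single i 1), P b.1 * Q b.2 =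
    ∑ b ∈ Finset.HasAntidiagonal.antidiagonal α, ((b.1 i : ℝ) + 1) * P (b.1 + Finsupp.single i 1) * Q b.2 +
    ∑ b ∈ Finset.HasAntidiagonal.antidiagonal α, P b.1 * (((b.2 i : ℝ) + 1) * Q (b.2 + Finsupp.single i 1)) := by
  have h2 : ∑ b ∈ Finset.HasAntidiagonal.antidiagonal α, P b.1 * (((b.2 i : ℝ) + 1) * Q (b.2 + Finsupp.single i 1)) =
      ∑ b ∈ Finset.HasAntidiagonal.antidiagonal (α + Finsupp.single i 1), ((b : (σ →₀ ℕ) × (σ →₀ ℕ)).2 i : ℝ) * Q b.2 * P b.1 := by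
    have := antidiag_shift i α Q P
    rw [← Finset.HasAntidiagonal.map_swap_antidiagonal, ← Finset.HasAntidiagonal.map_swap_antidiagonal (n := α), Finset.sum_map, Finset.sum_map] at this
    simp only [Function.Embedding.coeFn_mk, Prod.fst_swap, Prod.snd_swap] at this
    rw [this]
    exact Finset.sum_congr rfl fun b _ => by ring
  rw [h2, ← antidiag_shift, ← Finset.sum_add_distrib, Finset.mul_sum]
  refine Finset.sum_congr rfl fun b hb => ?_
  have : (b.1 i : ℝ) + b.2 i = α i + 1 := by
    have := congrArg (fun f : σ →₀ ℕ => f i) (Finset.HasAntidiagonal.mem_antidiagonal.1 hb)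
    simp at this
    exact_mod_cast this
  rw [← this]; ring

/-- Multiplicativity of expansions along commuting derivations. -/
theorem coefMul {σ X : Type} [DecidableEq σ] [Finite σ] {O : Set X} {S : Set (X → ℝ)} {c : (σ →₀ ℕ) → (X → ℝ) → X → ℝ}
    {D : σ → (X → ℝ) → (X → ℝ)} (hD : ∀ i, ∀ F ∈ S, D i F ∈ S)
    (h0 : ∀ F ∈ S, ∀ x ∈ O, c 0 F x = F x) (hmul : ∀ F ∈ S, ∀ G ∈ S, (fun x => F x * G x) ∈ S)
    (hstep : ∀ i α, ∀ F ∈ S, ∀ x ∈ O, ((α i : ℝ) + 1) * c (α + Finsupp.single i 1) F x = c α (D i F) x)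
    (hleib : ∀ i α, ∀ F ∈ S, ∀ G ∈ S, ∀ x ∈ O, c α (D i (fun x => F x * G x)) x =
      c α (fun x => D i F x * G x) x + c α (fun x => F x * D i G x) x) :
    ∀ (d : ℕ) (α : σ →₀ ℕ), α.degree = d → ∀ F ∈ S, ∀ G ∈ S, ∀ x ∈ O, c α (fun x => F x * G x) x =
      ∑ b ∈ Finset.HasAntidiagonal.antidiagonal α, c b.1 F x * c b.2 G x := by
  intro d
  induction d with
  | zero =>
    intro α hα F hF G hG x hx
    have : α = 0 := (Finsupp.degree_eq_zero_iff α).1 hα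
    subst this
    simp [h0 F hF x hx, h0 G hG x hx, h0 _ (hmul F hF G hG) x hx]
  | succ d ih =>
    intro α hα F hF G hG x hx
    have hne : α ≠ 0 := by rintro rfl; simp at hα
    obtain ⟨i, hi⟩ := Finsupp.ne_iff.1 hne
    have hle : Finsupp.single i 1 ≤ α := by
      rw [Finsupp.single_le_iff]; exact Nat.one_le_iff_ne_zero.2 hi
    obtain ⟨α, rfl⟩ : ∃ α', α = α' + Finsupp.single i 1 := ⟨_, (tsub_add_cancel_of_le hle).symm⟩
    have hd : α.degree = d := by simpa [map_add] using hα
    have hpos : ((α i : ℝ) + 1) ≠ 0 := by positivity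
    apply mul_left_cancel₀ hpos
    rw [hstep i α _ (hmul F hF G hG) x hx, hleib i α F hF G hG x hx, antidiag_shift' i α (fun b => c b F x) (fun b => c b G x),
      ih α hd _ (hD i F hF) G hG x hx, ih α hd F hF _ (hD i G hG) x hx]
    congr 1
    · exact Finset.sum_congr rfl fun b _ => by rw [hstep i _ F hF x hx]
    · exact Finset.sum_congr rfl fun b _ => by rw [hstep i _ G hG x hx]

end coefMul
end QDC
end


section
open Set Filter Topology
open scoped ContDiff Nat
set_option linter.unusedSectionVars false
set_option linter.unusedVariables false
namespace QDC

section Borel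
variable {n : ℕ} {σ : Type} [Fintype σ] [DecidableEq σ]

/-- monomials in functions -/
noncomputable def hpow (h : σ → (Fin n → ℝ) → ℝ) (β : σ →₀ ℕ) : (Fin n → ℝ) → ℝ := fun x => ∏ i, h i x ^ β i

theorem hpow_smooth {h : σ → (Fin n → ℝ) → ℝ} (hh : ∀ i, ContDiff ℝ ∞ (h i)) (β : σ →₀ ℕ) : ContDiff ℝ ∞ (hpow h β) :=
  contDiff_prod fun i _ => (hh i).pow _

theorem hpow_add_single (h : σ → (Fin n → ℝ) → ℝ) (β : σ →₀ ℕ) (i : σ) :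
    hpow h (β + Finsupp.single i 1) = fun x => hpow h β x * h i x := by
  funext x
  simp only [hpow, Finsupp.add_apply, pow_add, Finset.prod_mul_distrib]
  congr 1
  rw [Finset.prod_eq_single i]
  · simp
  · intro j _ hj; simp [Finsupp.single_apply, Ne.symm hj]
  · simp

theorem exists_sub_single {β : σ →₀ ℕ} (h : β ≠ 0) : ∃ i β', β = β' + Finsupp.single i 1 := by
  obtain ⟨i, hi⟩ := Finsupp.ne_iff.1 h
  have hle : Finsupp.single i 1 ≤ β := by
    rw [Finsupp.single_le_iff]; exact Nat.one_le_iff_ne_zero.2 hi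
  exact ⟨i, _, (tsub_add_cancel_of_le hle).symm⟩

theorem hpow_flatTo {h : σ → (Fin n → ℝ) → ℝ} (hh : ∀ i, ContDiff ℝ ∞ (h i)) {x : Fin n → ℝ} (hx : ∀ i, h i x = 0) (d : ℕ) :
    ∀ β : σ →₀ ℕ, β.degree = d + 1 → FlatTo d (hpow h β) x := by
  induction d with
  | zero =>
    intro β hβ
    have hne : β ≠ 0 := by rintro rfl; simp at hβ
    obtain ⟨i, β, rfl⟩ := exists_sub_single hne
    rw [hpow_add_single]
    change _ * h i x = 0
    rw [hx]; simp
  | succ d ih =>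
    intro β hβ
    have hne : β ≠ 0 := by rintro rfl; simp at hβ
    obtain ⟨i, β, rfl⟩ := exists_sub_single hne
    rw [hpow_add_single]
    exact FlatTo.mul_vanish isOpen_univ (mem_univ x) (contDiffOn_univ.2 (hpow_smooth hh β)) (contDiffOn_univ.2 (hh i))
      (ih β (by simpa [map_add] using hβ)) (hx i)

theorem bound_iter {E : Type} [NormedAddCommGroup E] [NormedSpace ℝ E] {G : Type} [NormedAddCommGroup G] [NormedSpace ℝ G] {F : E → G}
    (hF : ContDiff ℝ ∞ F) {K : Set E} (hK : IsCompact K) (N : ℕ) : ∃ C : ℝ, 1 ≤ C ∧ ∀ k ≤ N, ∀ x ∈ K, ‖iteratedFDeriv ℝ k F x‖ ≤ C := by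
  have h1 : ∀ k : ℕ, ∃ C : ℝ, 0 ≤ C ∧ ∀ x ∈ K, ‖iteratedFDeriv ℝ k F x‖ ≤ C := by
    intro k
    obtain ⟨C, hC⟩ := hK.exists_bound_of_continuousOn (f := iteratedFDeriv ℝ k F) ((hF.continuous_iteratedFDeriv (m := k) (by exact_mod_cast le_top)).continuousOn)
    exact ⟨max C 0, le_max_right _ _, fun x hx => (hC x hx).trans (le_max_left _ _)⟩
  choose C hC0 hC using h1
  refine ⟨1 + ∑ k ∈ Finset.range (N + 1), C k, le_add_of_nonneg_right (Finset.sum_nonneg fun k _ => hC0 k), fun k hk x hx => ?_⟩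
  have := Finset.single_le_sum (f := C) (s := Finset.range (N + 1)) (fun k _ => hC0 k) (Finset.mem_range.2 (Nat.lt_succ_of_le hk))
  linarith [hC k x hx]

theorem borel_term {K : Set (Fin n → ℝ)} (hK : IsCompact K) {h : σ → (Fin n → ℝ) → ℝ} (hh : ∀ i, ContDiff ℝ ∞ (h i))
    {b : (Fin n → ℝ) → ℝ} (hb : ContDiff ℝ ∞ b) (hbK : ∀ x ∉ K, b x = 0) {θ : (σ → ℝ) → ℝ} (hθ : ContDiff ℝ ∞ θ)
    (hθc : HasCompactSupport θ) (β : σ →₀ ℕ) {ε : ℝ} (hε : 0 < ε) : ∃ t : ℝ, 1 ≤ t ∧ ∀ k < β.degree, ∀ x,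
      ‖iteratedFDeriv ℝ k (fun x => b x * hpow h β x * θ (fun i => t * h i x)) x‖ ≤ ε := by
  set N := β.degree with hN
  set Hh : (Fin n → ℝ) → (σ → ℝ) := fun x i => h i x with hHh
  have hHs : ContDiff ℝ ∞ Hh := contDiff_pi.2 hh
  set η : (σ → ℝ) → ℝ := fun y => (∏ i, y i ^ β i) * θ y with hη
  have hηs : ContDiff ℝ ∞ η := (contDiff_prod fun i _ => (contDiff_apply ℝ ℝ i).pow _).mul hθ
  have hηc : HasCompactSupport η := hθc.mul_left
  obtain ⟨A, hA1, hA⟩ := bound_iter hHs hK N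
  obtain ⟨Cb, hCb1, hCb⟩ := bound_iter hb hK N
  obtain ⟨Ce, hCe1, hCe'⟩ := bound_iter hηs hηc.isCompact N
  have hCe : ∀ k ≤ N, ∀ y, ‖iteratedFDeriv ℝ k η y‖ ≤ Ce := by
    intro k hk y
    by_cases hy : y ∈ tsupport η
    · exact hCe' k hk y hy
    · have : iteratedFDeriv ℝ k η y = 0 := by
        by_contra hc
        exact hy ((support_iteratedFDeriv_subset (𝕜 := ℝ) k) hc)
      rw [this, norm_zero]; linarith
  set C' := 2 ^ N * Cb * (N ! * Ce * A ^ N) with hC'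
  have hC'0 : 0 ≤ C' := by positivity
  refine ⟨max 1 (C' / ε), le_max_left _ _, fun k hk x => ?_⟩
  set t := max 1 (C' / ε) with ht
  have ht1 : 1 ≤ t := le_max_left _ _
  have ht0 : 0 < t := by linarith
  have hfun : (fun x => b x * hpow h β x * θ (fun i => t * h i x)) = fun x => (t ^ N)⁻¹ • (b x * η (t • Hh x)) := by
    funext x
    have : ∏ i, (t * h i x) ^ β i = t ^ N * hpow h β x := by
      simp only [mul_pow, Finset.prod_mul_distrib, Finset.prod_pow_eq_pow_sum, hpow, hN, Finsupp.degree_eq_sum]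
    simp only [hη, hHh, Pi.smul_apply, smul_eq_mul]
    rw [this]
    have h1 : (t • fun i => h i x) = fun i => t * h i x := rfl
    rw [h1]
    field_simp
  have hts : ContDiff ℝ ∞ (fun x => t • Hh x) := hHs.const_smul t
  have hws : ContDiff ℝ ∞ (fun x => η (t • Hh x)) := hηs.comp hts
  rw [hfun]
  by_cases hx : x ∈ K
  · rw [iteratedFDeriv_const_smul_apply' ((hb.mul hws).contDiffAt.of_le (by exact_mod_cast le_top)), norm_smul]
    have h1 : ∀ i ≤ k, ‖iteratedFDeriv ℝ i (fun x => η (t • Hh x)) x‖ ≤ N ! * Ce * (A ^ N * t ^ k) := by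
      intro i hi
      have h2 := norm_iteratedFDeriv_comp_le (𝕜 := ℝ) (g := η) (f := fun x => t • Hh x) (n := i) (N := ∞) hηs hts
        (by exact_mod_cast le_top) x (C := Ce) (D := t * A) (fun j hj => hCe j (by omega) _) ?_
      · refine h2.trans ?_
        have h3 : ((i ! : ℕ) : ℝ) ≤ N ! := by exact_mod_cast Nat.factorial_le (by omega)
        have h4 : (t * A) ^ i ≤ A ^ N * t ^ k := by
          rw [mul_pow, mul_comm]
          exact mul_le_mul (pow_le_pow_right₀ hA1 (by omega)) (pow_le_pow_right₀ ht1 hi) (by positivity) (by positivity)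
        gcongr
      · intro j hj1 hj
        rw [show (fun x => t • Hh x) = t • Hh from rfl, iteratedFDeriv_const_smul_apply (hHs.contDiffAt.of_le (by exact_mod_cast le_top)), norm_smul, Real.norm_of_nonneg ht0.le]
        have h5 : t * ‖iteratedFDeriv ℝ j Hh x‖ ≤ t * A := mul_le_mul_of_nonneg_left (hA j (by omega) x hx) ht0.le
        refine h5.trans (le_self_pow₀ ?_ (by omega))
        nlinarith
    have h6 : ‖iteratedFDeriv ℝ k (fun x => b x * η (t • Hh x)) x‖ ≤ C' * t ^ k := by
      refine (norm_iteratedFDeriv_mul_le (N := ∞) hb hws x (n := k) (by exact_mod_cast le_top)).trans ?_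
      calc _ ≤ ∑ i ∈ Finset.range (k + 1), (k.choose i : ℝ) * Cb * (N ! * Ce * (A ^ N * t ^ k)) := by
            refine Finset.sum_le_sum fun i hi => ?_
            have hi' : i ≤ k := Nat.lt_succ_iff.1 (Finset.mem_range.1 hi)
            have := hCb i (by omega) x hx
            have := h1 (k - i) (by omega)
            gcongr
        _ = 2 ^ k * Cb * (N ! * Ce * (A ^ N * t ^ k)) := by
            rw [← Finset.sum_mul, ← Finset.sum_mul]
            congr 2
            exact_mod_cast Nat.sum_range_choose k
        _ ≤ _ := by
            rw [hC']
            have : (2 : ℝ) ^ k ≤ 2 ^ N := pow_le_pow_right₀ (by norm_num) hk.le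
            calc _ = (2 : ℝ) ^ k * (Cb * (N ! * Ce * (A ^ N * t ^ k))) := by ring
              _ ≤ (2 : ℝ) ^ N * (Cb * (N ! * Ce * (A ^ N * t ^ k))) := by gcongr
              _ = _ := by ring
    rw [norm_inv, norm_pow, Real.norm_of_nonneg ht0.le]
    have h7 : t ^ k * t ≤ t ^ N := by rw [← pow_succ]; exact pow_le_pow_right₀ ht1 hk
    have h8 : C' ≤ ε * t := by
      have : C' / ε ≤ t := le_max_right _ _
      rw [div_le_iff₀ hε] at this; linarith
    rw [inv_mul_le_iff₀ (by positivity)]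
    calc _ ≤ C' * t ^ k := h6
      _ ≤ ε * t * t ^ k := by gcongr
      _ = ε * (t ^ k * t) := by ring
      _ ≤ ε * t ^ N := by gcongr
      _ = _ := by ring
  · have h1 : (fun x => (t ^ N)⁻¹ • (b x * η (t • Hh x))) =ᶠ[𝓝 x] fun _ => 0 := by
      filter_upwards [hK.isClosed.isOpen_compl.mem_nhds hx] with y hy
      simp [hbK y hy]
    have h2 := (h1.iteratedFDeriv ℝ k).eq_of_nhds
    rw [h2]
    have h3 : iteratedFDeriv ℝ k (fun _ : Fin n → ℝ => (0 : ℝ)) x = 0 := by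
      rcases k with _ | k
      · ext; simp
      · rw [iteratedFDeriv_const_of_ne (by omega)]; rfl
    rw [h3, norm_zero]; exact hε.le

theorem borel {K : Set (Fin n → ℝ)} (hK : IsCompact K) {h : σ → (Fin n → ℝ) → ℝ} (hh : ∀ i, ContDiff ℝ ∞ (h i))
    {b : (σ →₀ ℕ) → (Fin n → ℝ) → ℝ} (hb : ∀ β, ContDiff ℝ ∞ (b β)) (hbK : ∀ β, ∀ x ∉ K, b β x = 0) :
    ∃ g : (Fin n → ℝ) → ℝ, ContDiff ℝ ∞ g ∧ (∀ x, (∀ β, Flat (b β) x) → Flat g x) ∧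
      ∀ L : ℕ, ∃ B : Finset (σ →₀ ℕ), (∀ β, β.degree ≤ L → β ∈ B) ∧ ∀ x, (∀ i, h i x = 0) →
        FlatTo L (fun x => g x - ∑ β ∈ B, b β x * hpow h β x) x := by
  classical
  obtain ⟨θ⟩ : Nonempty (ContDiffBump (0 : σ → ℝ)) := ⟨⟨1, 2, by norm_num, by norm_num⟩⟩
  obtain ⟨ε, hε, c, hc, -⟩ := NNReal.exists_pos_sum_of_countable (ι := σ →₀ ℕ) (ε := 1) one_ne_zero
  have hsum : Summable (fun β => (ε β : ℝ)) := NNReal.summable_coe.2 hc.summable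
  choose t ht1 ht using fun β => borel_term hK hh (hb β) (hbK β) θ.contDiff θ.hasCompactSupport β (ε := ε β) (by exact_mod_cast hε β)
  set u : (σ →₀ ℕ) → (Fin n → ℝ) → ℝ := fun β x => b β x * hpow h β x * θ (fun i => t β * h i x) with hu
  have hθs : ∀ β, ContDiff ℝ ∞ (fun x => θ (fun i => t β * h i x)) := fun β =>
    θ.contDiff.comp (contDiff_pi.2 fun i => contDiff_const.mul (hh i))
  have hus : ∀ β, ContDiff ℝ ∞ (u β) := fun β => ((hb β).mul (hpow_smooth hh β)).mul (hθs β)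
  have hfin : ∀ L : ℕ, {β : σ →₀ ℕ | β.degree ≤ L}.Finite := fun L => Finsupp.finite_of_degree_le L
  have hgs : ContDiff ℝ ∞ (fun x => ∑' β, u β x) := by
    refine contDiff_tsum_of_eventually (v := fun _ β => (ε β : ℝ)) (N := ⊤) hus (fun _ _ => hsum) fun k _ => ?_
    have : ∀ᶠ β : σ →₀ ℕ in cofinite, ¬ β.degree ≤ k := (hfin k).eventually_cofinite_notMem
    filter_upwards [this] with β hβ x
    exact ht β k (not_le.1 hβ) x
  have hdec : ∀ L : ℕ, ∃ r : (Fin n → ℝ) → ℝ, ContDiff ℝ ∞ r ∧ (∀ x, ∑' β, u β x = ∑ β ∈ (hfin L).toFinset, u β x + r x) ∧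
      ∀ x, (∀ β : σ →₀ ℕ, L < β.degree → FlatTo L (u β) x) → FlatTo L r x := by
    intro L
    set B := (hfin L).toFinset with hB
    set u' : (σ →₀ ℕ) → (Fin n → ℝ) → ℝ := fun β => if β ∈ B then (fun _ => 0) else u β with hu'
    have hu's : ∀ β, ContDiff ℝ ∞ (u' β) := by
      intro β; by_cases hβ : β ∈ B
      · simp only [hu', hβ, if_true]; exact contDiff_const
      · simp only [hu', hβ, if_false]; exact hus β
    have hz : ∀ (k : ℕ) x, iteratedFDeriv ℝ k (fun _ : Fin n → ℝ => (0 : ℝ)) x = 0 := by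
      intro k x
      rcases k with _ | k
      · ext; simp
      · rw [iteratedFDeriv_const_of_ne (by omega)]; rfl
    have hbd : ∀ (k : ℕ) (β : σ →₀ ℕ) x, k ≤ L → ‖iteratedFDeriv ℝ k (u' β) x‖ ≤ ε β := by
      intro k β x hk
      by_cases hβ : β ∈ B
      · simp only [hu', hβ, if_true]; rw [hz, norm_zero]; exact (ε β).2
      · simp only [hu', hβ, if_false]
        have : ¬ β.degree ≤ L := by simpa [hB] using hβ
        exact ht β k (by omega) x
    have hs' : ∀ x, Summable (fun β => u' β x) := fun x =>
      Summable.of_norm_bounded hsum fun β => by simpa using hbd 0 β x (by omega)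
    have heq : ∀ x, ∑' β, u β x = ∑ β ∈ B, u β x + ∑' β, u' β x := by
      intro x
      have h1 : ∀ β, u β x = (if β ∈ B then u β x else 0) + u' β x := by
        intro β; by_cases hβ : β ∈ B <;> simp [hu', hβ]
      rw [tsum_congr h1, Summable.tsum_add (summable_of_ne_finset_zero (s := B) fun β hβ => by simp [hβ]) (hs' x),
        tsum_eq_sum (s := B) fun β hβ => by simp [hβ]]
      congr 1
      exact Finset.sum_congr rfl fun β hβ => by simp [hβ]
    refine ⟨fun x => ∑' β, u' β x, ?_, heq, fun x hx => ?_⟩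
    · have : (fun x => ∑' β, u' β x) = fun x => (∑' β, u β x) - ∑ β ∈ B, u β x := by
        funext x; rw [heq x]; ring
      rw [this]
      exact hgs.sub (ContDiff.sum fun β _ => hus β)
    · refine flatTo_of_iteratedFDeriv ?_ fun k hk => ?_
      · have : (fun x => ∑' β, u' β x) = fun x => (∑' β, u β x) - ∑ β ∈ B, u β x := by
          funext x; rw [heq x]; ring
        rw [this]
        exact hgs.sub (ContDiff.sum fun β _ => hus β)
      · have := iteratedFDeriv_tsum (𝕜 := ℝ) (f := u') (N := (L : ℕ∞)) (v := fun _ β => (ε β : ℝ)) (fun β => (hu's β).of_le (by exact_mod_cast le_top))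
          (fun _ _ => hsum) (fun k β x hk => hbd k β x (by exact_mod_cast hk)) (k := k) (by exact_mod_cast hk)
        rw [this]
        dsimp only
        rw [tsum_congr (g := fun _ => 0)]
        · simp
        · intro β
          by_cases hβ : β ∈ B
          · simp only [hu', hβ, if_true]; exact hz k x
          · simp only [hu', hβ, if_false]
            have : ¬ β.degree ≤ L := by simpa [hB] using hβ
            exact FlatTo.iteratedFDeriv (hus β) (hx β (by omega)) hk
  refine ⟨fun x => ∑' β, u β x, hgs, ?_, ?_⟩
  · intro x hx L
    obtain ⟨r, hr, hre, hrf⟩ := hdec L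
    have hfl : ∀ β, FlatTo L (u β) x := by
      intro β
      have := FlatTo.mul isOpen_univ (mem_univ x) (contDiffOn_univ.2 (hb β)) (contDiffOn_univ.2 ((hpow_smooth hh β).mul (hθs β))) (hx β L)
      have e : u β = fun x => b β x * (hpow h β x * θ (fun i => t β * h i x)) := by funext x; simp only [hu]; ring
      rw [e]; exact this
    have e : (fun x => ∑' β, u β x) = fun x => (∑ β ∈ (hfin L).toFinset, u β x) + r x := funext hre
    rw [e]
    refine FlatTo.add isOpen_univ (mem_univ x) (contDiffOn_univ.2 (ContDiff.sum fun β _ => hus β)) (contDiffOn_univ.2 hr) ?_ (hrf x fun β _ => hfl β)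
    exact FlatTo.sum isOpen_univ (mem_univ x) _ (fun β _ => contDiffOn_univ.2 (hus β)) fun β _ => hfl β
  · intro L
    obtain ⟨r, hr, hre, hrf⟩ := hdec L
    refine ⟨(hfin L).toFinset, fun β hβ => by simpa using hβ, fun x hx => ?_⟩
    have h1 : FlatTo L r x := by
      refine hrf x fun β hβ => ?_
      obtain ⟨d, hd⟩ : ∃ d, β.degree = d + 1 := ⟨β.degree - 1, by omega⟩
      have h2 := (hpow_flatTo hh hx d β hd).le (show L ≤ d by omega)
      have := FlatTo.mul isOpen_univ (mem_univ x) (contDiffOn_univ.2 (hpow_smooth hh β)) (contDiffOn_univ.2 ((hb β).mul (hθs β))) h2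
      have e : u β = fun x => hpow h β x * (b β x * θ (fun i => t β * h i x)) := by funext x; simp only [hu]; ring
      rw [e]; exact this
    refine FlatTo.congr_nhds ?_ h1
    have h2 : ∀ β, ∀ᶠ y in 𝓝 x, θ (fun i => t β * h i y) = 1 := by
      intro β
      have hc : ContinuousAt (fun y => (fun i => t β * h i y : σ → ℝ)) x :=
        (continuous_pi fun i => continuous_const.mul (hh i).continuous).continuousAt
      have h0 : (fun i => t β * h i x : σ → ℝ) = 0 := by funext i; simp [hx]
      have h3 : Tendsto (fun y => (fun i => t β * h i y : σ → ℝ)) (𝓝 x) (𝓝 0) := by rw [← h0]; exact hc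
      exact h3.eventually θ.eventuallyEq_one
    have h3 : ∀ᶠ y in 𝓝 x, ∀ β ∈ (hfin L).toFinset, θ (fun i => t β * h i y) = 1 :=
      (Filter.eventually_all_finset _).2 fun β _ => h2 β
    filter_upwards [h3] with y hy
    rw [hre y]
    have : ∑ β ∈ (hfin L).toFinset, u β y = ∑ β ∈ (hfin L).toFinset, b β y * hpow h β y :=
      Finset.sum_congr rfl fun β hβ => by simp only [hu]; rw [hy β hβ, mul_one]
    rw [this]; ring

end Borel
end QDC
end


section
open Set Filter Topology
open scoped ContDiff Nat
set_option linter.unusedSectionVars false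
set_option linter.unusedVariables false
namespace QDC

section VF
variable {n : ℕ} {σ : Type} [Fintype σ] [DecidableEq σ]

/-- smooth functions on `O` -/
def Sm (O : Set (Fin n → ℝ)) : Set ((Fin n → ℝ) → ℝ) := {F | ContDiffOn ℝ ∞ F O}

/-- the vector field with coefficients `c i` -/
noncomputable def Vop (c : σ → Fin n → (Fin n → ℝ) → ℝ) (i : σ) (F : (Fin n → ℝ) → ℝ) : (Fin n → ℝ) → ℝ :=
  fun x => ∑ k, c i k x * pd k F x

noncomputable def Vw (c : σ → Fin n → (Fin n → ℝ) → ℝ) (l : List σ) (F : (Fin n → ℝ) → ℝ) : (Fin n → ℝ) → ℝ :=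
  l.foldr (Vop c) F

/-- Taylor coefficients along commuting vector fields -/
noncomputable def ec (c : σ → Fin n → (Fin n → ℝ) → ℝ) (β : σ →₀ ℕ) (F : (Fin n → ℝ) → ℝ) : (Fin n → ℝ) → ℝ :=
  fun x => ((∏ i, (β i)! : ℕ) : ℝ)⁻¹ * Vw c (Finsupp.toMultiset β).toList F x

/-- commuting smooth vector fields on an open set -/
structure VF (c : σ → Fin n → (Fin n → ℝ) → ℝ) (O : Set (Fin n → ℝ)) : Prop where
  isOpen : IsOpen O
  smooth : ∀ i k, ContDiffOn ℝ ∞ (c i k) O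
  comm : ∀ i j F, ContDiffOn ℝ ∞ F O → EqOn (Vop c i (Vop c j F)) (Vop c j (Vop c i F)) O

variable {c : σ → Fin n → (Fin n → ℝ) → ℝ} {O : Set (Fin n → ℝ)} {F G : (Fin n → ℝ) → ℝ}

theorem Vop_smooth (hO : IsOpen O) (hc : ∀ i k, ContDiffOn ℝ ∞ (c i k) O) (hF : ContDiffOn ℝ ∞ F O) (i : σ) :
    ContDiffOn ℝ ∞ (Vop c i F) O :=
  ContDiffOn.sum fun k _ => (hc i k).mul (pd_smoothOn hO hF k)

theorem Vop_congr (hO : IsOpen O) (h : EqOn F G O) (i : σ) : EqOn (Vop c i F) (Vop c i G) O := by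
  intro x hx
  simp only [Vop]
  exact Finset.sum_congr rfl fun k _ => by rw [pd_congr_on hO h k hx]

theorem Vop_add (hO : IsOpen O) (hF : ContDiffOn ℝ ∞ F O) (hG : ContDiffOn ℝ ∞ G O) (i : σ) :
    EqOn (Vop c i (fun x => F x + G x)) (fun x => Vop c i F x + Vop c i G x) O := by
  intro x hx
  simp only [Vop, ← Finset.sum_add_distrib]
  exact Finset.sum_congr rfl fun k _ => by rw [pd_add_on hO hF hG k hx]; ring

theorem Vop_mul (hO : IsOpen O) (hF : ContDiffOn ℝ ∞ F O) (hG : ContDiffOn ℝ ∞ G O) (i : σ) :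
    EqOn (Vop c i (fun x => F x * G x)) (fun x => Vop c i F x * G x + F x * Vop c i G x) O := by
  intro x hx
  simp only [Vop, Finset.sum_mul, Finset.mul_sum, ← Finset.sum_add_distrib]
  exact Finset.sum_congr rfl fun k _ => by rw [pd_mul_on hO hF hG k hx]; ring

theorem Vop_const (r : ℝ) (i : σ) : Vop c i (fun _ => r) = fun _ => 0 := by
  funext x; simp [Vop, pd_const]

theorem Vop_sum (hO : IsOpen O) {ι : Type*} (s : Finset ι) {F : ι → (Fin n → ℝ) → ℝ}
    (hF : ∀ j ∈ s, ContDiffOn ℝ ∞ (F j) O) (i : σ) :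
    EqOn (Vop c i (fun x => ∑ j ∈ s, F j x)) (fun x => ∑ j ∈ s, Vop c i (F j) x) O := by
  intro x hx
  simp only [Vop]
  rw [Finset.sum_comm]
  exact Finset.sum_congr rfl fun k _ => by rw [pd_sum_on hO s hF k hx, Finset.mul_sum]

theorem Vw_smooth (h : VF c O) (hF : ContDiffOn ℝ ∞ F O) (l : List σ) : ContDiffOn ℝ ∞ (Vw c l F) O := by
  induction l with
  | nil => exact hF
  | cons i l ih => exact Vop_smooth h.isOpen h.smooth ih i

theorem Vw_congr (hO : IsOpen O) (h : EqOn F G O) (l : List σ) : EqOn (Vw c l F) (Vw c l G) O := by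
  induction l with
  | nil => exact h
  | cons i l ih => exact Vop_congr hO ih i

theorem Vw_perm (h : VF c O) (hF : ContDiffOn ℝ ∞ F O) {l l' : List σ} (hl : l.Perm l') : EqOn (Vw c l F) (Vw c l' F) O := by
  induction hl with
  | nil => exact fun _ _ => rfl
  | cons i _ ih => exact Vop_congr h.isOpen ih i
  | swap i j l => exact h.comm _ _ _ (Vw_smooth h hF l)
  | trans _ _ h1 h2 => exact h1.trans h2

theorem Vw_add (h : VF c O) (hF : ContDiffOn ℝ ∞ F O) (hG : ContDiffOn ℝ ∞ G O) (l : List σ) :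
    EqOn (Vw c l (fun x => F x + G x)) (fun x => Vw c l F x + Vw c l G x) O := by
  induction l with
  | nil => exact fun _ _ => rfl
  | cons i l ih => exact (Vop_congr h.isOpen ih i).trans (Vop_add h.isOpen (Vw_smooth h hF l) (Vw_smooth h hG l) i)

theorem Vw_append (l l' : List σ) : Vw c (l ++ l') F = Vw c l (Vw c l' F) := by simp [Vw]

theorem Vw_const_zero (l : List σ) : Vw c l (fun _ => 0) = fun _ => 0 := by
  induction l with
  | nil => rfl
  | cons i l ih =>
    change Vop c i (Vw c l _) = _
    rw [ih, Vop_const]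

theorem ec_smooth (h : VF c O) (hF : ContDiffOn ℝ ∞ F O) (β : σ →₀ ℕ) : ContDiffOn ℝ ∞ (ec c β F) O :=
  contDiffOn_const.mul (Vw_smooth h hF _)

theorem ec_congr (hO : IsOpen O) (h : EqOn F G O) (β : σ →₀ ℕ) : EqOn (ec c β F) (ec c β G) O := fun x hx => by
  simp only [ec]; rw [Vw_congr hO h _ hx]

theorem ec_zero (F : (Fin n → ℝ) → ℝ) : ec c 0 F = F := by
  funext x; simp [ec, Vw]

theorem ec_add (h : VF c O) (hF : ContDiffOn ℝ ∞ F O) (hG : ContDiffOn ℝ ∞ G O) (β : σ →₀ ℕ) {x : Fin n → ℝ} (hx : x ∈ O) :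
    ec c β (fun x => F x + G x) x = ec c β F x + ec c β G x := by
  simp only [ec]; rw [Vw_add h hF hG _ hx]; ring

theorem prod_fact_add_single (α : σ →₀ ℕ) (i : σ) :
    (∏ j, ((α + Finsupp.single i 1 : σ →₀ ℕ) j)!) = (α i + 1) * ∏ j, (α j)! := by
  rw [← Finset.mul_prod_erase Finset.univ _ (Finset.mem_univ i), ← Finset.mul_prod_erase Finset.univ (fun j => (α j)!) (Finset.mem_univ i)]
  have : ∏ j ∈ Finset.univ.erase i, ((α + Finsupp.single i 1 : σ →₀ ℕ) j)! = ∏ j ∈ Finset.univ.erase i, (α j)! :=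
    Finset.prod_congr rfl fun j hj => by
      have : j ≠ i := Finset.ne_of_mem_erase hj
      simp [Finsupp.single_apply, Ne.symm this]
  rw [this]
  simp [Nat.factorial_succ, mul_assoc]

theorem ec_step (h : VF c O) (hF : ContDiffOn ℝ ∞ F O) (i : σ) (α : σ →₀ ℕ) {x : Fin n → ℝ} (hx : x ∈ O) :
    ((α i : ℝ) + 1) * ec c (α + Finsupp.single i 1) F x = ec c α (Vop c i F) x := by
  simp only [ec]
  have h1 : (Finsupp.toMultiset (α + Finsupp.single i 1)).toList.Perm ((Finsupp.toMultiset α).toList ++ [i]) := by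
    rw [← Multiset.coe_eq_coe, ← Multiset.coe_add]
    simp [map_add]
  rw [Vw_perm h hF h1 hx, Vw_append, prod_fact_add_single]
  have h2 : ((∏ j, (α j)! : ℕ) : ℝ) ≠ 0 := by
    exact_mod_cast (Finset.prod_pos fun j _ => Nat.factorial_pos _).ne'
  have h3 : ((α i : ℝ) + 1) ≠ 0 := by positivity
  push_cast at h2 ⊢
  change _ = _ * Vw c _ (Vw c [i] F) x
  field_simp

theorem ec_mul (h : VF c O) (hF : ContDiffOn ℝ ∞ F O) (hG : ContDiffOn ℝ ∞ G O) (α : σ →₀ ℕ) {x : Fin n → ℝ} (hx : x ∈ O) :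
    ec c α (fun x => F x * G x) x = ∑ b ∈ Finset.HasAntidiagonal.antidiagonal α, ec c b.1 F x * ec c b.2 G x := by
  refine coefMul (S := Sm O) (O := O) (c := ec c) (D := Vop c) (fun i F hF => Vop_smooth h.isOpen h.smooth hF i) (fun F _ x _ => by rw [ec_zero])
    (fun F hF G hG => ContDiffOn.mul hF hG) (fun i α F hF x hx => ec_step h hF i α hx) ?_ _ α rfl F hF G hG x hx
  intro i α F hF G hG x hx
  rw [ec_congr h.isOpen (Vop_mul h.isOpen hF hG i) α hx]
  exact ec_add h ((Vop_smooth h.isOpen h.smooth hF i).mul hG) (ContDiffOn.mul hF (Vop_smooth h.isOpen h.smooth hG i)) α hx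

theorem ec_const_zero (α : σ →₀ ℕ) (x : Fin n → ℝ) : ec c α (fun _ => 0) x = 0 := by
  simp only [ec, Vw_const_zero, mul_zero]

theorem ec_const (h : VF c O) (r : ℝ) (α : σ →₀ ℕ) {x : Fin n → ℝ} (hx : x ∈ O) :
    ec c α (fun _ => r) x = if α = 0 then r else 0 := by
  split_ifs with h0
  · rw [h0, ec_zero]
  · obtain ⟨i, β, rfl⟩ := exists_sub_single h0
    have h1 := ec_step h (F := fun _ => r) contDiffOn_const i β hx
    rw [Vop_const, ec_const_zero] at h1
    rcases mul_eq_zero.1 h1 with h2 | h2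
    · exact absurd h2 (by positivity)
    · exact h2

/-- The Taylor series along vector fields. -/
noncomputable def EE (c : σ → Fin n → (Fin n → ℝ) → ℝ) (x : Fin n → ℝ) (F : (Fin n → ℝ) → ℝ) : MvPowerSeries σ ℝ := fun α => ec c α F x

theorem coeff_EE (α : σ →₀ ℕ) (x : Fin n → ℝ) (F : (Fin n → ℝ) → ℝ) : MvPowerSeries.coeff α (EE c x F) = ec c α F x := rfl

theorem EE_congr (hO : IsOpen O) (h : EqOn F G O) {x : Fin n → ℝ} (hx : x ∈ O) : EE c x F = EE c x G := by
  ext α; rw [coeff_EE, coeff_EE, ec_congr hO h α hx]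

theorem EE_add (h : VF c O) (hF : ContDiffOn ℝ ∞ F O) (hG : ContDiffOn ℝ ∞ G O) {x : Fin n → ℝ} (hx : x ∈ O) :
    EE c x (fun x => F x + G x) = EE c x F + EE c x G := by
  ext α; rw [map_add]; simp only [coeff_EE]; exact ec_add h hF hG α hx

theorem EE_mul (h : VF c O) (hF : ContDiffOn ℝ ∞ F O) (hG : ContDiffOn ℝ ∞ G O) {x : Fin n → ℝ} (hx : x ∈ O) :
    EE c x (fun x => F x * G x) = EE c x F * EE c x G := by
  ext α; rw [MvPowerSeries.coeff_mul]; simp only [coeff_EE]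
  exact ec_mul h hF hG α hx

theorem EE_const (h : VF c O) (r : ℝ) {x : Fin n → ℝ} (hx : x ∈ O) : EE c x (fun _ => r) = MvPowerSeries.C r := by
  ext α; rw [coeff_EE, ec_const h r α hx, MvPowerSeries.coeff_C]

theorem EE_sub (h : VF c O) (hF : ContDiffOn ℝ ∞ F O) (hG : ContDiffOn ℝ ∞ G O) {x : Fin n → ℝ} (hx : x ∈ O) :
    EE c x (fun x => F x - G x) = EE c x F - EE c x G := by
  have h1 := EE_add h (hF.sub hG) hG hx
  have h2 : (fun x => (F x - G x) + G x) = F := by funext x; ring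
  rw [h2] at h1
  rw [h1, add_sub_cancel_right]

theorem EE_zero (x : Fin n → ℝ) : EE c x (fun _ => 0) = 0 := by
  ext α; rw [coeff_EE, ec_const_zero]; rfl

theorem EE_sum (h : VF c O) {ι : Type*} (s : Finset ι) {F : ι → (Fin n → ℝ) → ℝ} (hF : ∀ j ∈ s, ContDiffOn ℝ ∞ (F j) O)
    {x : Fin n → ℝ} (hx : x ∈ O) : EE c x (fun x => ∑ j ∈ s, F j x) = ∑ j ∈ s, EE c x (F j) := by
  classical
  induction s using Finset.induction_on with
  | empty => simp [EE_zero]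
  | insert a s ha ih =>
    simp only [Finset.sum_insert ha]
    rw [EE_add h (hF a (by simp)) (ContDiffOn.sum fun j hj => hF j (by simp [hj])) hx, ih (fun j hj => hF j (by simp [hj]))]

theorem Vop_flatTo (h : VF c O) (hF : ContDiffOn ℝ ∞ F O) {L : ℕ} {x : Fin n → ℝ} (hx : x ∈ O) (hf : FlatTo (L + 1) F x) (i : σ) :
    FlatTo L (Vop c i F) x := by
  refine FlatTo.sum h.isOpen hx _ (fun k _ => (h.smooth i k).mul (pd_smoothOn h.isOpen hF k)) fun k _ => ?_
  have h1 := FlatTo.mul h.isOpen hx (pd_smoothOn h.isOpen hF k) (h.smooth i k) (hf.2 k)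
  have e : (fun x => c i k x * pd k F x) = fun x => pd k F x * c i k x := by funext x; ring
  rw [e]; exact h1

theorem Vw_flatTo (h : VF c O) (hF : ContDiffOn ℝ ∞ F O) {x : Fin n → ℝ} (hx : x ∈ O) (l : List σ) :
    ∀ {L : ℕ}, FlatTo (L + l.length) F x → FlatTo L (Vw c l F) x := by
  induction l with
  | nil => intro L h; exact h
  | cons i l ih =>
    intro L hf
    exact Vop_flatTo h (Vw_smooth h hF l) hx (ih (by rwa [List.length_cons, ← add_assoc, add_right_comm] at hf)) i

theorem ec_eq_zero (h : VF c O) (hF : ContDiffOn ℝ ∞ F O) {x : Fin n → ℝ} (hx : x ∈ O) {L : ℕ} (hf : FlatTo L F x)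
    {β : σ →₀ ℕ} (hβ : β.degree ≤ L) : ec c β F x = 0 := by
  have hl : (Finsupp.toMultiset β).toList.length = β.degree := by
    rw [Multiset.length_toList, Finsupp.card_toMultiset, Finsupp.degree_apply]; rfl
  have h1 : FlatTo 0 (Vw c (Finsupp.toMultiset β).toList F) x := Vw_flatTo h hF hx _ (hf.le (by omega))
  have h2 : Vw c (Finsupp.toMultiset β).toList F x = 0 := h1
  simp only [ec, h2, mul_zero]

theorem EE_flat (h : VF c O) (hF : ContDiffOn ℝ ∞ F O) {x : Fin n → ℝ} (hx : x ∈ O) (hf : Flat F x) : EE c x F = 0 := by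
  ext α; exact ec_eq_zero h hF hx (hf _) le_rfl

/-- coordinates -/
theorem EE_coord (h : VF c O) {H : σ → (Fin n → ℝ) → ℝ} (hH : ∀ i, ContDiffOn ℝ ∞ (H i) O)
    (hV : ∀ i j, ∀ x ∈ O, Vop c j (H i) x = if i = j then 1 else 0) {x : Fin n → ℝ} (hx : x ∈ O) (hx0 : ∀ i, H i x = 0) (i : σ) :
    EE c x (H i) = MvPowerSeries.X i := by
  ext α
  rw [coeff_EE, MvPowerSeries.coeff_X]
  by_cases h0 : α = 0
  · subst h0
    rw [ec_zero, hx0, if_neg]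
    intro h; have := congrArg (fun f : σ →₀ ℕ => f i) h; simp at this
  obtain ⟨j, β, rfl⟩ := exists_sub_single h0
  have h1 := ec_step h (hH i) j β hx
  rw [ec_congr h.isOpen (G := fun _ => if i = j then 1 else 0) (fun y hy => hV i j y hy) β hx, ec_const h _ _ hx] at h1
  by_cases hij : i = j
  · subst hij
    simp only [if_true] at h1
    by_cases hβ : β = 0
    · subst hβ; simpa using h1
    · rw [if_neg hβ] at h1
      rw [if_neg]
      · rcases mul_eq_zero.1 h1 with h2 | h2
        · exact absurd h2 (by positivity)
        · exact h2
      · intro h2; exact hβ (by simpa using h2)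
  · simp only [if_neg hij, ite_self] at h1
    rw [if_neg]
    · rcases mul_eq_zero.1 h1 with h2 | h2
      · exact absurd h2 (by positivity)
      · exact h2
    · intro h2
      have := congrArg (fun f : σ →₀ ℕ => f j) h2
      simp [Finsupp.single_apply, hij] at this

theorem EE_hpow (h : VF c O) {H : σ → (Fin n → ℝ) → ℝ} (hH : ∀ i, ContDiff ℝ ∞ (H i))
    (hV : ∀ i j, ∀ x ∈ O, Vop c j (H i) x = if i = j then 1 else 0) {x : Fin n → ℝ} (hx : x ∈ O) (hx0 : ∀ i, H i x = 0) (d : ℕ) :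
    ∀ β : σ →₀ ℕ, β.degree = d → EE c x (hpow H β) = MvPowerSeries.monomial β 1 := by
  induction d with
  | zero =>
    intro β hβ
    have : β = 0 := (Finsupp.degree_eq_zero_iff β).1 hβ
    subst this
    have : hpow H 0 = fun _ => 1 := by funext x; simp [hpow]
    rw [this, EE_const h _ hx]; rfl
  | succ d ih =>
    intro β hβ
    have hne : β ≠ 0 := by rintro rfl; simp at hβ
    obtain ⟨i, β, rfl⟩ := exists_sub_single hne
    rw [hpow_add_single, EE_mul h (hpow_smooth hH β).contDiffOn (hH i).contDiffOn hx, ih β (by simpa [map_add] using hβ),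
      EE_coord h (fun i => (hH i).contDiffOn) hV hx hx0, MvPowerSeries.X, MvPowerSeries.monomial_mul_monomial, one_mul]

/-- Expansion of a Borel sum. -/
theorem ec_borel (h : VF c O) {H : σ → (Fin n → ℝ) → ℝ} (hH : ∀ i, ContDiff ℝ ∞ (H i))
    (hV : ∀ i j, ∀ x ∈ O, Vop c j (H i) x = if i = j then 1 else 0) {x : Fin n → ℝ} (hx : x ∈ O) (hx0 : ∀ i, H i x = 0)
    {g : (Fin n → ℝ) → ℝ} (hg : ContDiff ℝ ∞ g) {b : (σ →₀ ℕ) → (Fin n → ℝ) → ℝ} (hb : ∀ β, ContDiff ℝ ∞ (b β)) (α : σ →₀ ℕ)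
    {B : Finset (σ →₀ ℕ)} (hB : ∀ β, β.degree ≤ α.degree → β ∈ B)
    (hgB : FlatTo α.degree (fun x => g x - ∑ β ∈ B, b β x * hpow H β x) x) :
    ec c α g x = ∑ e ∈ Finset.HasAntidiagonal.antidiagonal α, ec c e.1 (b e.2) x := by
  have hs1 : ∀ β, ContDiffOn ℝ ∞ (fun x => b β x * hpow H β x) O := fun β => ((hb β).mul (hpow_smooth hH β)).contDiffOn
  have hs2 : ContDiffOn ℝ ∞ (fun x => ∑ β ∈ B, b β x * hpow H β x) O := ContDiffOn.sum fun β _ => hs1 β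
  have h1 := ec_eq_zero h (hg.contDiffOn.sub hs2) hx hgB le_rfl
  have h2 := congrArg (MvPowerSeries.coeff α) (EE_sub h hg.contDiffOn hs2 hx)
  rw [map_sub, EE_sum h B (fun β _ => hs1 β) hx, map_sum] at h2
  have h1' : MvPowerSeries.coeff α (EE c x (fun x => g x - ∑ β ∈ B, b β x * hpow H β x)) = 0 := h1
  rw [h1'] at h2
  have h3 : ec c α g x = ∑ β ∈ B, MvPowerSeries.coeff α (EE c x (fun x => b β x * hpow H β x)) := by
    rw [← coeff_EE]; linarith
  rw [h3]
  have h4 : ∀ β, MvPowerSeries.coeff α (EE c x (fun x => b β x * hpow H β x)) =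
      ∑ e ∈ Finset.HasAntidiagonal.antidiagonal α, if e.2 = β then ec c e.1 (b e.2) x else 0 := by
    intro β
    rw [EE_mul h (hb β).contDiffOn (hpow_smooth hH β).contDiffOn hx, EE_hpow h hH hV hx hx0 _ β rfl, MvPowerSeries.coeff_mul]
    refine Finset.sum_congr rfl fun e _ => ?_
    rw [MvPowerSeries.coeff_monomial]
    split_ifs with h5
    · rw [← h5, mul_one]; rfl
    · simp
  simp only [h4]
  rw [Finset.sum_comm]
  refine Finset.sum_congr rfl fun e he => ?_
  rw [Finset.sum_ite_eq, if_pos]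
  apply hB
  have := congrArg Finsupp.degree (Finset.HasAntidiagonal.mem_antidiagonal.1 he)
  rw [map_add] at this
  omega

end VF

section taylor
variable {n : ℕ} {O : Set (Fin n → ℝ)} {F G : (Fin n → ℝ) → ℝ}

/-- the coordinate vector fields -/
noncomputable def idc : Fin n → Fin n → (Fin n → ℝ) → ℝ := fun i k _ => if i = k then 1 else 0

theorem Vop_idc (i : Fin n) (F : (Fin n → ℝ) → ℝ) : Vop idc i F = pd i F := by
  funext x; simp [Vop, idc]

theorem VF_idc (hO : IsOpen O) : VF (idc (n := n)) O where
  isOpen := hO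
  smooth i k := contDiffOn_const
  comm i j F hF := by simp only [Vop_idc]; exact pd_comm hO hF i j

theorem taylorAt_eq (hO : IsOpen O) (hF : ContDiffOn ℝ ∞ F O) {a : Fin n → ℝ} (ha : a ∈ O) : taylorAt F a = EE idc a F := by
  funext α
  have hv : ∀ l : List (Fin n), Vw idc l F = pdw l F := by
    intro l
    induction l with
    | nil => rfl
    | cons i l ih =>
      change Vop idc i (Vw idc l F) = pd i (pdw l F)
      rw [ih, Vop_idc]
  change mpd (fun i => α i) F a / _ = _ * Vw idc _ F a
  rw [hv, mpd_eq_pdw, div_eq_inv_mul]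
  congr 1
  refine pdw_perm hO hF ?_ ha
  rw [List.perm_iff_count]
  intro i
  rw [count_stdWord, ← Multiset.coe_count, Multiset.coe_toList, Finsupp.count_toMultiset]

theorem flat_of_EE (hO : IsOpen O) (hF : ContDiffOn ℝ ∞ F O) {a : Fin n → ℝ} (ha : a ∈ O) (h : EE idc a F = 0) : Flat F a := by
  rw [flat_iff_pdw]
  intro w
  rw [pdw_eq_mpd hO hF w ha]
  rw [← taylorAt_eq hO hF ha] at h
  have h1 := congrFun h (Finsupp.equivFunOnFinite.symm fun i => w.count i)
  have h2 : mpd (fun i => w.count i) F a / ((mfact fun i => w.count i : ℕ) : ℝ) = 0 := h1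
  have h3 : ((mfact fun i => w.count i : ℕ) : ℝ) ≠ 0 := by
    exact_mod_cast (Finset.prod_pos fun j _ => Nat.factorial_pos _).ne'
  exact (div_eq_zero_iff.1 h2).resolve_right h3

/-- Borel's theorem at a point -/
theorem borel_pt (a : Fin n → ℝ) (P : MvPowerSeries (Fin n) ℝ) : ∃ g : (Fin n → ℝ) → ℝ, ContDiff ℝ ∞ g ∧ EE idc a g = P := by
  obtain ⟨θ⟩ : Nonempty (ContDiffBump a) := ⟨⟨1, 2, by norm_num, by norm_num⟩⟩
  set H : Fin n → (Fin n → ℝ) → ℝ := fun i x => x i - a i with hH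
  have hHs : ∀ i, ContDiff ℝ ∞ (H i) := fun i => (contDiff_apply ℝ ℝ i).sub contDiff_const
  set b : (Fin n →₀ ℕ) → (Fin n → ℝ) → ℝ := fun β x => MvPowerSeries.coeff β P * θ x with hb
  have hbs : ∀ β, ContDiff ℝ ∞ (b β) := fun β => contDiff_const.mul θ.contDiff
  obtain ⟨g, hg, -, hB⟩ := borel (θ.hasCompactSupport.isCompact) hHs hbs fun β x hx => by
    simp only [hb]; rw [image_eq_zero_of_notMem_tsupport hx, mul_zero]
  refine ⟨g, hg, ?_⟩
  ext α
  obtain ⟨B, hB1, hB2⟩ := hB α.degree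
  have hx0 : ∀ i, H i a = 0 := fun i => by simp [hH]
  have hV : ∀ i j, ∀ x ∈ (univ : Set (Fin n → ℝ)), Vop idc j (H i) x = if i = j then 1 else 0 := by
    intro i j x _
    rw [Vop_idc]
    have h1 := pd_add_on (F := fun x : Fin n → ℝ => x i) (G := fun _ => - a i) isOpen_univ (contDiff_apply ℝ ℝ i).contDiffOn contDiffOn_const j (mem_univ x)
    simp only [pd_const, pd_coord, add_zero] at h1
    exact h1
  rw [coeff_EE, ec_borel (VF_idc isOpen_univ) hHs hV (mem_univ a) hx0 hg hbs α hB1 (hB2 a hx0)]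
  rw [Finset.sum_eq_single (0, α)]
  · simp only [ec_zero, hb]
    rw [θ.one_of_mem_closedBall (by simp [θ.rIn_pos.le]), mul_one]
  · intro e he hne
    have h0 : e.1 ≠ 0 := by
      intro h0
      have := Finset.HasAntidiagonal.mem_antidiagonal.1 he
      rw [h0, zero_add] at this
      exact hne (Prod.ext h0 this)
    have h1 : b e.2 =ᶠ[𝓝 a] fun _ => MvPowerSeries.coeff e.2 P := by
      filter_upwards [θ.eventuallyEq_one] with y hy
      simp only [hb]; rw [hy]; simp
    obtain ⟨W, hW1, hW2, hW3⟩ := mem_nhds_iff.1 h1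
    rw [ec_congr hW2 (fun y hy => hW1 hy) e.1 hW3, ec_const (VF_idc hW2) _ _ hW3, if_neg h0]
  · intro h; exact absurd (Finset.HasAntidiagonal.mem_antidiagonal.2 (by simp)) h

end taylor
end QDC
end


section
open Set Filter Topology
open scoped ContDiff Nat
set_option linter.unusedSectionVars false
set_option linter.unusedVariables false
namespace QDC

section Stp
variable {M : ℕ → ℝ} [NSeq M] {n : ℕ}

/-- local setup: an open set `V` inside a compact `K` inside `U0`, `V = {ψ > 0}`. -/
structure Stp (M : ℕ → ℝ) (n : ℕ) where
  U0 : Set (Fin n → ℝ)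
  K : Set (Fin n → ℝ)
  V : Set (Fin n → ℝ)
  ψ : (Fin n → ℝ) → ℝ
  hU0 : IsOpen U0
  hK : IsCompact K
  hKU : K ⊆ U0
  hVK : V ⊆ K
  hV : V = {x | 0 < ψ x}
  hψ : ContDiff ℝ ∞ ψ
  hψ' : ∀ x ∈ U0, DCAt M ψ x
  hoff : Vᶜ ⊆ closure (interior Vᶜ)

/-- the ring of global smooth functions quasianalytic on `U0` -/
def Stp.R (S : Stp M n) : Subring ((Fin n → ℝ) → ℝ) where
  carrier := {r | ContDiff ℝ ∞ r ∧ ∀ x ∈ S.U0, DCAt M r x}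
  mul_mem' := fun h1 h2 => ⟨h1.1.mul h2.1, fun x hx => (h1.2 x hx).mul (h2.2 x hx)⟩
  one_mem' := ⟨contDiff_const, fun x hx => dcAt_const 1⟩
  add_mem' := fun h1 h2 => ⟨h1.1.add h2.1, fun x hx => (h1.2 x hx).add (h2.2 x hx)⟩
  zero_mem' := ⟨contDiff_const, fun x hx => dcAt_const 0⟩
  neg_mem' := fun h1 => ⟨h1.1.neg, fun x hx => (h1.2 x hx).neg⟩

variable {S : Stp M n}

theorem Stp.isOpenV : IsOpen S.V := by
  rw [S.hV]; exact isOpen_lt continuous_const S.hψ.continuous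

theorem Stp.ψ_mem : S.ψ ∈ S.R := ⟨S.hψ, S.hψ'⟩

theorem R_const (r : ℝ) : (fun _ => r) ∈ S.R := ⟨contDiff_const, fun x _ => dcAt_const r⟩

theorem R_pd {r : (Fin n → ℝ) → ℝ} (hr : r ∈ S.R) (i : Fin n) : pd i r ∈ S.R :=
  ⟨pd_smooth hr.1 i, fun x hx => pd_dcAt (hr.2 x hx) i⟩

theorem R_coord (i : Fin n) : (fun x : Fin n → ℝ => x i) ∈ S.R :=
  ⟨contDiff_apply ℝ ℝ i, fun x _ => DCAt.clm (ContinuousLinearMap.proj i : (Fin n → ℝ) →L[ℝ] ℝ)⟩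

theorem R_det {A : Matrix (Fin n) (Fin n) ((Fin n → ℝ) → ℝ)} (hA : ∀ i j, A i j ∈ S.R) : A.det ∈ S.R := by
  rw [Matrix.det_apply]
  refine S.R.sum_mem fun s _ => ?_
  rw [Units.smul_def]
  exact S.R.zsmul_mem (S.R.prod_mem fun i _ => hA _ _) _

theorem R_adj {A : Matrix (Fin n) (Fin n) ((Fin n → ℝ) → ℝ)} (hA : ∀ i j, A i j ∈ S.R) (i j : Fin n) : A.adjugate i j ∈ S.R := by
  rw [Matrix.adjugate_apply]
  refine R_det fun k l => ?_
  rw [Matrix.updateRow_apply]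
  split_ifs
  · rw [Pi.single_apply]; split_ifs
    · exact S.R.one_mem
    · exact S.R.zero_mem
  · exact hA _ _

/-- the jacobian matrix as a matrix of functions -/
noncomputable def Jm (H : Fin n → (Fin n → ℝ) → ℝ) : Matrix (Fin n) (Fin n) ((Fin n → ℝ) → ℝ) := Matrix.of fun i k => pd k (H i)

noncomputable def DD (H : Fin n → (Fin n → ℝ) → ℝ) : (Fin n → ℝ) → ℝ := (Jm H).det

noncomputable def cc (H : Fin n → (Fin n → ℝ) → ℝ) : Fin n → Fin n → (Fin n → ℝ) → ℝ := fun i k x => (Jm H).adjugate k i x / DD H x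

theorem adj_right (H : Fin n → (Fin n → ℝ) → ℝ) (l i : Fin n) (x : Fin n → ℝ) :
    ∑ k, pd k (H l) x * (Jm H).adjugate k i x = if l = i then DD H x else 0 := by
  have h := congrFun (congrFun (congrFun (Matrix.mul_adjugate (Jm H)) l) i) x
  rw [Matrix.mul_apply, Matrix.smul_apply, Finset.sum_apply] at h
  simp only [Pi.mul_apply, smul_eq_mul, Matrix.one_apply] at h
  have h2 : ∀ k, Jm H l k x = pd k (H l) x := fun k => rfl
  simp only [h2] at h
  rw [h]
  split_ifs <;> simp [DD]

theorem adj_left (H : Fin n → (Fin n → ℝ) → ℝ) (k l : Fin n) (x : Fin n → ℝ) :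
    ∑ i, (Jm H).adjugate k i x * pd l (H i) x = if k = l then DD H x else 0 := by
  have h := congrFun (congrFun (congrFun (Matrix.adjugate_mul (Jm H)) k) l) x
  rw [Matrix.mul_apply, Matrix.smul_apply, Finset.sum_apply] at h
  simp only [Pi.mul_apply, smul_eq_mul, Matrix.one_apply] at h
  have h2 : ∀ i, Jm H i l x = pd l (H i) x := fun k => rfl
  simp only [h2] at h
  rw [h]
  split_ifs <;> simp [DD]

variable {H : Fin n → (Fin n → ℝ) → ℝ}

theorem cc_dual {x : Fin n → ℝ} (hx : DD H x ≠ 0) (i l : Fin n) : Vop (cc H) i (H l) x = if l = i then 1 else 0 := by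
  simp only [Vop, cc]
  have h := adj_right H l i x
  have : ∑ k, (Jm H).adjugate k i x / DD H x * pd k (H l) x = (∑ k, pd k (H l) x * (Jm H).adjugate k i x) / DD H x := by
    rw [Finset.sum_div]; exact Finset.sum_congr rfl fun k _ => by ring
  rw [this, h]
  split_ifs
  · exact div_self hx
  · simp

theorem pd_eq_V {x : Fin n → ℝ} (hx : DD H x ≠ 0) (F : (Fin n → ℝ) → ℝ) (l : Fin n) :
    pd l F x = ∑ i, pd l (H i) x * Vop (cc H) i F x := by
  simp only [Vop, cc, Finset.mul_sum]
  rw [Finset.sum_comm]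
  have : ∀ k, ∑ i, pd l (H i) x * ((Jm H).adjugate k i x / DD H x * pd k F x) = if k = l then pd k F x else 0 := by
    intro k
    have h := adj_left H k l x
    have : ∑ i, pd l (H i) x * ((Jm H).adjugate k i x / DD H x * pd k F x) =
        (∑ i, (Jm H).adjugate k i x * pd l (H i) x) * (pd k F x / DD H x) := by
      rw [Finset.sum_mul]; exact Finset.sum_congr rfl fun k _ => by ring
    rw [this, h]
    split_ifs
    · field_simp
    · simp
  simp [this]

/-- a covector killing all gradients of `H` vanishes -/
theorem vec_unique {x : Fin n → ℝ} (hx : DD H x ≠ 0) {v : Fin n → ℝ} {i : Fin n}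
    (hv : ∀ l, ∑ k, pd k (H l) x * v k = if l = i then 1 else 0) (k : Fin n) : v k = cc H i k x := by
  have h1 : ∑ l, (Jm H).adjugate k l x * (∑ m, pd m (H l) x * v m) = DD H x * v k := by
    simp only [Finset.mul_sum]
    rw [Finset.sum_comm]
    have : ∀ m, ∑ l, (Jm H).adjugate k l x * (pd m (H l) x * v m) = if k = m then DD H x * v m else 0 := by
      intro m
      have h := adj_left H k m x
      have : ∑ l, (Jm H).adjugate k l x * (pd m (H l) x * v m) = (∑ i, (Jm H).adjugate k i x * pd m (H i) x) * v m := by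
        rw [Finset.sum_mul]; exact Finset.sum_congr rfl fun k _ => by ring
      rw [this, h]; split_ifs <;> simp
    simp [this]
  simp only [hv, mul_ite, mul_one, mul_zero, Finset.sum_ite_eq', Finset.mem_univ, if_true] at h1
  rw [cc, h1]; field_simp

theorem DD_smooth (hH : ∀ i, ContDiff ℝ ∞ (H i)) : ContDiff ℝ ∞ (DD H) := by
  have : DD H = fun x => ∑ s : Equiv.Perm (Fin n), ((Equiv.Perm.sign s : ℤ) : ℝ) * ∏ i, pd i (H (s i)) x := by
    funext x
    rw [DD, Matrix.det_apply, Finset.sum_apply]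
    refine Finset.sum_congr rfl fun s _ => ?_
    rw [Units.smul_def, Pi.smul_apply, Finset.prod_apply, zsmul_eq_mul]; rfl
  rw [this]
  exact ContDiff.sum fun s _ => contDiff_const.mul (contDiff_prod fun i _ => pd_smooth (hH _) _)

theorem VF_cc {O : Set (Fin n → ℝ)} (hO : IsOpen O) (hHR : ∀ i, H i ∈ S.R) (hD : ∀ x ∈ O, DD H x ≠ 0) : VF (cc H) O := by
  have hH : ∀ i, ContDiffOn ℝ ∞ (H i) O := fun i => (hHR i).1.contDiffOn
  have hs : ∀ i k, ContDiffOn ℝ ∞ (cc H i k) O := fun i k =>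
    (R_adj (S := S) (A := Jm H) (fun i k => R_pd (hHR i) k) k i).1.contDiffOn.div (DD_smooth fun i => (hHR i).1).contDiffOn hD
  have hexp : ∀ i j F, ContDiffOn ℝ ∞ F O → ∀ x ∈ O, Vop (cc H) i (Vop (cc H) j F) x =
      (∑ k, Vop (cc H) i (cc H j k) x * pd k F x) + ∑ k, ∑ l, cc H j k x * cc H i l x * pd l (pd k F) x := by
    intro i j F hF x hx
    have h1 := Vop_sum (c := cc H) hO Finset.univ (F := fun k x => cc H j k x * pd k F x) (fun k _ => (hs j k).mul (pd_smoothOn hO hF k)) i hx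
    change Vop (cc H) i (fun x => ∑ k, cc H j k x * pd k F x) x = _
    rw [h1]
    dsimp only
    rw [← Finset.sum_add_distrib]
    refine Finset.sum_congr rfl fun k _ => ?_
    rw [Vop_mul hO (hs j k) (pd_smoothOn hO hF k) i hx]
    dsimp only
    congr 1
    rw [Vop, Finset.mul_sum]
    exact Finset.sum_congr rfl fun l _ => by ring
  have hcomm : ∀ i j F, ContDiffOn ℝ ∞ F O → ∀ x ∈ O, Vop (cc H) i (Vop (cc H) j F) x - Vop (cc H) j (Vop (cc H) i F) x =
      ∑ k, (Vop (cc H) i (cc H j k) x - Vop (cc H) j (cc H i k) x) * pd k F x := by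
    intro i j F hF x hx
    rw [hexp i j F hF x hx, hexp j i F hF x hx]
    have : ∑ k, ∑ l, cc H j k x * cc H i l x * pd l (pd k F) x = ∑ k, ∑ l, cc H i k x * cc H j l x * pd l (pd k F) x := by
      rw [Finset.sum_comm]
      refine Finset.sum_congr rfl fun l _ => Finset.sum_congr rfl fun k _ => ?_
      rw [pd_comm hO hF l k hx]; ring
    rw [this]
    simp only [sub_mul, Finset.sum_sub_distrib]
    ring
  refine ⟨hO, hs, fun i j F hF x hx => ?_⟩
  have hz : ∀ l, ∑ k, pd k (H l) x * (Vop (cc H) i (cc H j k) x - Vop (cc H) j (cc H i k) x) = 0 := by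
    intro l
    have h1 := hcomm i j (H l) (hH l) x hx
    have h2 : ∀ i j, Vop (cc H) i (Vop (cc H) j (H l)) x = 0 := by
      intro i j
      have := Vop_congr (c := cc H) hO (F := Vop (cc H) j (H l)) (G := fun _ => if l = j then 1 else 0) (fun y hy => cc_dual (hD y hy) j l) i hx
      rw [this, Vop_const]
    rw [h2, h2, sub_zero] at h1
    rw [h1]
    exact Finset.sum_congr rfl fun k _ => by ring
  have h3 : ∀ k, Vop (cc H) i (cc H j k) x - Vop (cc H) j (cc H i k) x = 0 := by
    intro k
    have h4 := vec_unique (hD x hx) (i := i) (v := fun k => cc H i k x + (Vop (cc H) i (cc H j k) x - Vop (cc H) j (cc H i k) x)) (fun l => by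
      simp only [mul_add, Finset.sum_add_distrib, hz l, add_zero]
      rw [← cc_dual (hD x hx) i l, Vop]
      exact Finset.sum_congr rfl fun k _ => by ring) k
    linarith
  have h5 := hcomm i j F hF x hx
  simp only [h3, zero_mul, Finset.sum_const_zero] at h5
  linarith

/-- adapted frames -/
structure Frame (S : Stp M n) (X : Set (Fin n → ℝ)) where
  J : Finset (Fin n)
  H : Fin n → (Fin n → ℝ) → ℝ
  hH : ∀ i, H i ∈ S.R
  hI : ∀ i ∈ J, ∀ x ∈ X, H i x = 0
  hD : ∃ x ∈ X, DD H x ≠ 0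
  hmax : ∀ i ∉ J, ∀ g ∈ S.R, (∀ x ∈ X, g x = 0) → ∀ x ∈ X, DD H x * Vop (cc H) i g x = 0

theorem exists_frame {X : Set (Fin n → ℝ)} (hX : X.Nonempty) : Nonempty (Frame S X) := by
  classical
  set Q : Finset (Fin n) → Prop := fun J => ∃ H : Fin n → (Fin n → ℝ) → ℝ, (∀ i, H i ∈ S.R) ∧ (∀ i ∈ J, ∀ x ∈ X, H i x = 0) ∧ ∃ x ∈ X, DD H x ≠ 0 with hQ
  have h0 : Q ∅ := by
    refine ⟨fun i x => x i, fun i => R_coord i, by simp, hX.some, hX.some_mem, ?_⟩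
    have : Jm (fun (i : Fin n) (x : Fin n → ℝ) => x i) = 1 := by
      ext i k x
      simp only [Jm, Matrix.of_apply, pd_coord, Matrix.one_apply]
      split_ifs <;> rfl
    rw [DD, this, Matrix.det_one]; simp
  obtain ⟨J, hJ, hmax⟩ := Finset.exists_max_image (Finset.univ.filter Q) Finset.card ⟨∅, by simp [h0]⟩
  obtain ⟨H, hH, hI, hD⟩ := (Finset.mem_filter.1 hJ).2
  refine ⟨⟨J, H, hH, hI, hD, fun i hi g hg hgX x hx => ?_⟩⟩
  by_contra hne
  have hdx : DD H x ≠ 0 := fun h => hne (by rw [h, zero_mul])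
  have h1 : Q (insert i J) := by
    refine ⟨Function.update H i g, fun l => ?_, fun l hl y hy => ?_, x, hx, ?_⟩
    · rw [Function.update_apply]; split_ifs
      · exact hg
      · exact hH l
    · rw [Function.update_apply]; split_ifs with h
      · exact hgX y hy
      · exact hI l (Finset.mem_of_mem_insert_of_ne hl h) y hy
    · have h2 : Jm (Function.update H i g) = (Jm H).updateRow i (fun k => pd k g) := by
        ext l k : 2
        rw [Matrix.updateRow_apply]
        simp only [Jm, Matrix.of_apply, Function.update_apply]
        split_ifs <;> rfl
      rw [DD, h2, Matrix.det_eq_sum_mul_adjugate_row _ i, Finset.sum_apply]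
      simp only [Matrix.adjugate_apply, Matrix.updateRow_idem, Matrix.updateRow_self, Pi.mul_apply]
      convert hne using 1
      rw [Vop, Finset.mul_sum]
      refine Finset.sum_congr rfl fun k _ => ?_
      rw [cc, Matrix.adjugate_apply]; field_simp
  have h2 := hmax (insert i J) (by simp [h1])
  rw [Finset.card_insert_of_notMem hi] at h2
  omega

end Stp
end QDC
end


section
open Set Filter Topology
open scoped ContDiff Nat
set_option linter.unusedSectionVars false
set_option linter.unusedVariables false
namespace QDC

section tang
variable {M : ℕ → ℝ} [NSeq M] {n : ℕ} {S : Stp M n} {H : Fin n → (Fin n → ℝ) → ℝ}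

theorem fderiv_eq_sum (F : (Fin n → ℝ) → ℝ) (x v : Fin n → ℝ) : fderiv ℝ F x v = ∑ k, v k * pd k F x := by
  conv_lhs => rw [show v = ∑ k, v k • (Pi.single k (1 : ℝ) : Fin n → ℝ) from by funext j; simp [Finset.sum_apply, Pi.single_apply]]
  rw [map_sum]
  exact Finset.sum_congr rfl fun k _ => by rw [map_smul]; rfl

theorem exists_curve (hH : ∀ i, H i ∈ S.R) {a : Fin n → ℝ} (ha : a ∈ S.U0) (hD : DD H a ≠ 0) {O : Set (Fin n → ℝ)} (hO : IsOpen O)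
    (haO : a ∈ O) (i : Fin n) : ∃ (κ : (Fin n → ℝ) → (Fin n → ℝ)) (b : Fin n → ℝ) (ε : ℝ), 0 < ε ∧ κ b = a ∧
      (∀ t : ℝ, |t| < ε → κ (b + t • Pi.single i 1) ∈ O ∩ S.U0 ∩ {x | DD H x ≠ 0}) ∧
      (∀ t : ℝ, |t| < ε → DCAt M κ (b + t • Pi.single i 1)) ∧
      ∀ (F : (Fin n → ℝ) → ℝ), ∀ t : ℝ, |t| < ε → DifferentiableAt ℝ F (κ (b + t • Pi.single i 1)) →
        HasDerivAt (fun t : ℝ => F (κ (b + t • Pi.single i 1))) (Vop (cc H) i F (κ (b + t • Pi.single i 1))) t := by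
  set Hm : (Fin n → ℝ) → (Fin n → ℝ) := fun x l => H l x with hHm
  have hDC : DCAt M Hm a := dcAt_pi.2 fun l => (hH l).2 a ha
  have hHd : ∀ x, DifferentiableAt ℝ Hm x := fun x => differentiableAt_pi.2 fun l => (hH l).1.differentiable (by simp) x
  have hfd : ∀ x v l, fderiv ℝ Hm x v l = fderiv ℝ (H l) x v := by
    intro x v l
    have := hasFDerivAt_pi'.1 (hHd x).hasFDerivAt l
    rw [this.fderiv]; rfl
  have hdet : (jac Hm a).det ≠ 0 := by
    have : (jac Hm a) = (Pi.evalRingHom (fun _ : Fin n → ℝ => ℝ) a).mapMatrix (Jm H) := by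
      ext l k
      rw [jac_apply, hfd]; rfl
    rw [this, ← RingHom.map_det]; exact hD
  obtain ⟨e, hae, hee, -, heκ⟩ := dcAt_inverse hDC hdet
  set b := Hm a with hb
  have hκb : e.symm b = a := by rw [hb, ← hee a hae, e.left_inv hae]
  have hbt : b ∈ e.target := by rw [hb, ← hee a hae]; exact e.map_source hae
  have hDs : ContDiff ℝ ∞ (DD H) := DD_smooth fun i => (hH i).1
  have hO2 : IsOpen (O ∩ S.U0 ∩ {x | DD H x ≠ 0}) := (hO.inter S.hU0).inter (isOpen_ne_fun hDs.continuous continuous_const)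
  have hlin : Continuous (fun t : ℝ => b + t • (Pi.single i 1 : Fin n → ℝ)) := by fun_prop
  have hev : ∀ᶠ t in 𝓝 (0 : ℝ), b + t • (Pi.single i 1 : Fin n → ℝ) ∈ e.target ∧ e.symm (b + t • (Pi.single i 1 : Fin n → ℝ)) ∈ O ∩ S.U0 ∩ {x | DD H x ≠ 0} := by
    have h1 : Tendsto (fun t : ℝ => b + t • (Pi.single i 1 : Fin n → ℝ)) (𝓝 0) (𝓝 b) := by
      have := hlin.tendsto 0; simpa using this
    refine (h1.eventually (e.open_target.mem_nhds hbt)).and ?_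
    have h2 : ContinuousAt e.symm b := (heκ b hbt).continuousAt
    refine (h2.tendsto.comp h1).eventually (hO2.mem_nhds ?_)
    rw [hκb]; exact ⟨⟨haO, ha⟩, hD⟩
  obtain ⟨ε, hε, hball⟩ := Metric.eventually_nhds_iff.1 hev
  have hb' : ∀ t : ℝ, |t| < ε → _ := fun t ht => hball (y := t) (by rwa [Real.dist_eq, sub_zero])
  refine ⟨e.symm, b, ε, hε, hκb, fun t ht => (hb' t ht).2, fun t ht => heκ _ (hb' t ht).1, fun F t ht hF => ?_⟩
  obtain ⟨h1, h2⟩ := hb' t ht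
  set z := b + t • (Pi.single i 1 : Fin n → ℝ) with hz
  have hκd := ((heκ z h1).contDiffAt.differentiableAt (by simp)).hasFDerivAt
  have hld : HasDerivAt (fun t : ℝ => b + t • (Pi.single i 1 : Fin n → ℝ)) (Pi.single i 1) t := by
    have := ((hasDerivAt_id t).smul_const (Pi.single i 1 : Fin n → ℝ)).const_add b
    simp only [one_smul] at this
    exact this
  have hγ := hκd.comp_hasDerivAt t hld
  set v := fderiv ℝ e.symm z (Pi.single i 1) with hv
  have hvc : ∀ k, v k = cc H i k (e.symm z) := by
    refine vec_unique h2.2 fun l => ?_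
    have h3 := ((hH l).1.differentiable (by simp) (e.symm z)).hasFDerivAt.comp_hasDerivAt t hγ
    have h4 : (H l ∘ e.symm ∘ fun t : ℝ => b + t • (Pi.single i 1 : Fin n → ℝ)) =ᶠ[𝓝 t] fun t => (b + t • (Pi.single i 1 : Fin n → ℝ)) l := by
      filter_upwards [hlin.continuousAt.eventually (e.open_target.mem_nhds h1)] with s hs
      have h5 := e.right_inv hs
      rw [hee _ (e.map_target hs)] at h5
      exact congrFun h5 l
    have h6 := h3.congr_of_eventuallyEq h4.symm
    have h7 := hasDerivAt_pi.1 hld l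
    have h8 := h6.unique h7
    rw [fderiv_eq_sum, Pi.single_apply] at h8
    rw [← h8]
    exact Finset.sum_congr rfl fun k _ => by ring
  have h9 := hF.hasFDerivAt.comp_hasDerivAt t hγ
  rw [fderiv_eq_sum] at h9
  have h10 : ∑ k, v k * pd k F (e.symm z) = Vop (cc H) i F (e.symm z) := by
    rw [Vop]; exact Finset.sum_congr rfl fun k _ => by rw [hvc]
  rw [h10] at h9
  exact h9

variable {X : Set (Fin n → ℝ)}

/-- `D V_i` as an operator on `R` -/
theorem T_mem (hH : ∀ i, H i ∈ S.R) (i : Fin n) {r : (Fin n → ℝ) → ℝ} (hr : r ∈ S.R) :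
    ∃ s ∈ S.R, ∀ x, DD H x ≠ 0 → DD H x * Vop (cc H) i r x = s x := by
  refine ⟨∑ k, (Jm H).adjugate k i * pd k r, S.R.sum_mem fun k _ => S.R.mul_mem (R_adj (fun i k => R_pd (hH i) k) k i) (R_pd hr k), fun x hx => ?_⟩
  rw [Vop, Finset.mul_sum, Finset.sum_apply]
  refine Finset.sum_congr rfl fun k _ => ?_
  rw [cc, Pi.mul_apply]; field_simp

theorem iter_zero (fr : Frame S X) {i : Fin n} (hi : i ∉ fr.J) {r : (Fin n → ℝ) → ℝ} (hr : r ∈ S.R) (hrX : ∀ x ∈ X, r x = 0) (m : ℕ) :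
    ContDiffOn ℝ ∞ ((Vop (cc fr.H) i)^[m] r) {x | DD fr.H x ≠ 0} ∧ ∃ k : ℕ, ∃ s ∈ S.R, (∀ x ∈ X, DD fr.H x ≠ 0 → s x = 0) ∧
      ∀ x, DD fr.H x ≠ 0 → (Vop (cc fr.H) i)^[m] r x * DD fr.H x ^ k = s x := by
  have hDs : ContDiff ℝ ∞ (DD fr.H) := DD_smooth fun i => (fr.hH i).1
  have hDR : DD fr.H ∈ S.R := R_det fun i k => R_pd (fr.hH i) k
  have hO : IsOpen {x | DD fr.H x ≠ 0} := isOpen_ne_fun hDs.continuous continuous_const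
  have hVF := VF_cc (S := S) hO fr.hH fun x hx => hx
  induction m with
  | zero => exact ⟨hr.1.contDiffOn, 0, r, hr, fun x hx _ => hrX x hx, fun x _ => by simp⟩
  | succ m ih =>
    obtain ⟨hs, k, s, hsR, hsX, heq⟩ := ih
    rw [Function.iterate_succ_apply']
    set F := (Vop (cc fr.H) i)^[m] r with hF
    refine ⟨Vop_smooth hO hVF.smooth hs i, ?_⟩
    have hDk : (fun x => DD fr.H x ^ k) ∈ S.R := S.R.pow_mem hDR k
    have hDsR : (fun x => DD fr.H x * s x) ∈ S.R := S.R.mul_mem hDR hsR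
    obtain ⟨t1, ht1, ht1'⟩ := T_mem fr.hH i hsR
    obtain ⟨t2, ht2, ht2'⟩ := T_mem fr.hH i hDk
    obtain ⟨t3, ht3, ht3'⟩ := T_mem fr.hH i hDR
    have hDs0 : ∀ x ∈ X, DD fr.H x * s x = 0 := fun x hx => by
      by_cases h : DD fr.H x = 0
      · rw [h, zero_mul]
      · rw [hsX x hx h, mul_zero]
    refine ⟨2 * k + 1, fun x => DD fr.H x ^ k * t1 x - s x * t2 x, S.R.sub_mem (S.R.mul_mem hDk ht1) (S.R.mul_mem hsR ht2), fun x hx hx0 => ?_, fun x hx => ?_⟩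
    · have h1 := fr.hmax i hi _ hDsR hDs0 x hx
      rw [Vop_mul hO hDs.contDiffOn hsR.1.contDiffOn i hx0] at h1
      dsimp only at h1
      rw [hsX x hx hx0, mul_zero, zero_add] at h1
      have h2 : t1 x = 0 := by
        rw [← ht1' x hx0]
        rcases mul_eq_zero.1 h1 with h | h
        · exact absurd h hx0
        · exact h
      dsimp only
      rw [h2, hsX x hx hx0]; ring
    · have h1 : Vop (cc fr.H) i (fun x => F x * DD fr.H x ^ k) x = Vop (cc fr.H) i s x := Vop_congr hO (fun y hy => heq y hy) i hx
      rw [Vop_mul hO hs hDk.1.contDiffOn i hx] at h1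
      dsimp only at h1
      dsimp only
      rw [← ht1' x hx, ← ht2' x hx, ← h1, ← heq x hx]
      ring

theorem tang (fr : Frame S X) {r : (Fin n → ℝ) → ℝ} (hr : r ∈ S.R) (hX : X = S.V ∩ {x | r x = 0}) {i : Fin n} (hi : i ∉ fr.J)
    {O : Set (Fin n → ℝ)} (hO : IsOpen O) {a : Fin n → ℝ} (ha : a ∈ X) (haO : a ∈ O) (hD : DD fr.H a ≠ 0) {G : (Fin n → ℝ) → ℝ}
    (hG : ContDiffOn ℝ ∞ G O) (hG0 : ∀ x ∈ X ∩ O, G x = 0) : Vop (cc fr.H) i G a = 0 := by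
  rcases n with _ | n
  · exact i.elim0
  have haV : a ∈ S.V := by rw [hX] at ha; exact ha.1
  have hrX : ∀ x ∈ X, r x = 0 := fun x hx => by rw [hX] at hx; exact hx.2
  obtain ⟨κ, b, ε, hε, hκb, hκO, hκDC, hder⟩ := exists_curve fr.hH (S.hKU (S.hVK haV)) hD (hO.inter S.isOpenV) ⟨haO, haV⟩ i
  set γ : ℝ → (Fin (n + 1) → ℝ) := fun t => κ (b + t • Pi.single i 1) with hγ
  have hγ0 : γ 0 = a := by simp [hγ, hκb]
  have hDs : ContDiff ℝ ∞ (DD fr.H) := DD_smooth fun i => (fr.hH i).1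
  have hOD : IsOpen {x | DD fr.H x ≠ 0} := isOpen_ne_fun hDs.continuous continuous_const
  have hiter : ∀ k : ℕ, ∀ t : ℝ, |t| < ε → iteratedDeriv k (fun t => r (γ t)) t = (Vop (cc fr.H) i)^[k] r (γ t) := by
    intro k
    induction k with
    | zero => intro t _; simp
    | succ k ih =>
      intro t ht
      rw [iteratedDeriv_succ, Function.iterate_succ_apply']
      have h1 : iteratedDeriv k (fun t => r (γ t)) =ᶠ[𝓝 t] fun t => (Vop (cc fr.H) i)^[k] r (γ t) := by
        filter_upwards [(isOpen_lt continuous_abs continuous_const).mem_nhds ht] with s hs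
        exact ih s hs
      rw [h1.deriv_eq]
      refine (hder _ t ht ?_).deriv
      exact ((iter_zero fr hi hr hrX k).1.contDiffAt (hOD.mem_nhds (hκO t ht).2)).differentiableAt (by simp)
  have hzero : ∀ k : ℕ, (Vop (cc fr.H) i)^[k] r a = 0 := by
    intro k
    obtain ⟨-, m, s, -, hs0, hse⟩ := iter_zero fr hi hr hrX k
    have h1 := hse a hD
    rw [hs0 a ha hD] at h1
    exact (mul_eq_zero.1 h1).resolve_right (pow_ne_zero _ hD)
  have hrκ : ∀ t : ℝ, |t| < ε → DCAt M (fun y => r (κ y)) (b + t • Pi.single i 1) := fun t ht =>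
    DCAt.comp (g := r) (hr.2 _ (hκO t ht).1.2) (hκDC t ht)
  have hseg := quasi_segment (M := M) (f := fun y => r (κ y)) (a := b) (v := (ε / 2) • Pi.single i 1) (fun t ht => by
      rw [smul_smul]
      refine hrκ _ ?_
      rw [abs_of_nonneg (by have := ht.1; positivity)]
      nlinarith [ht.1, ht.2]) (fun k => by
      rw [ContinuousMultilinearMap.map_smul_univ]
      rw [← iteratedDeriv_line (M := M) (by simpa using hrκ 0 (by simpa using hε))]
      have := hiter k 0 (by simpa using hε)
      rw [hγ0, hzero k] at this
      change _ • iteratedDeriv k (fun t => r (γ t)) 0 = 0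
      rw [this, smul_zero])
  have hγX : ∀ t ∈ Icc (0 : ℝ) (ε / 2), G (γ t) = 0 := by
    intro t ht
    have ht' : |t| < ε := by rw [abs_of_nonneg ht.1]; linarith [ht.2]
    have h1 := hseg (t / (ε / 2)) ⟨by have := ht.1; positivity, by rw [div_le_one (by positivity)]; exact ht.2⟩
    rw [smul_smul, div_mul_cancel₀ _ (by positivity)] at h1
    refine hG0 _ ⟨?_, (hκO t ht').1.1.1⟩
    rw [hX]; exact ⟨(hκO t ht').1.1.2, h1⟩
  have h1 := hder G 0 (by simpa using hε) ((hG.contDiffAt (hO.mem_nhds (hκO 0 (by simpa using hε)).1.1.1)).differentiableAt (by simp))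
  have h2 : Vop (cc fr.H) i G (γ 0) = 0 := by
    have h3 : HasDerivWithinAt (fun t => G (γ t)) (Vop (cc fr.H) i G (γ 0)) (Icc 0 (ε / 2)) 0 := h1.hasDerivWithinAt
    have h4 : HasDerivWithinAt (fun t => G (γ t)) 0 (Icc 0 (ε / 2)) 0 :=
      (hasDerivWithinAt_const (0 : ℝ) (Icc 0 (ε / 2)) (0 : ℝ)).congr (fun t ht => hγX t ht) (hγX 0 ⟨le_rfl, by positivity⟩)
    exact (uniqueDiffOn_Icc (by positivity : (0 : ℝ) < ε / 2) 0 ⟨le_rfl, by positivity⟩).eq_deriv _ h3 h4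
  rwa [hγ0] at h2

/-- normal vector fields of a frame -/
noncomputable def Frame.c (fr : Frame S X) : {i // i ∈ fr.J} → Fin n → (Fin n → ℝ) → ℝ := fun i => cc fr.H i

theorem Frame.VF_c (fr : Frame S X) {O : Set (Fin n → ℝ)} (hO : IsOpen O) (hD : ∀ x ∈ O, DD fr.H x ≠ 0) : VF fr.c O := by
  have h := VF_cc (S := S) hO fr.hH hD
  exact ⟨hO, fun i k => h.smooth _ _, fun i j F hF => h.comm _ _ F hF⟩

theorem Frame.dual (fr : Frame S X) {x : Fin n → ℝ} (hD : DD fr.H x ≠ 0) (i j : {i // i ∈ fr.J}) :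
    Vop fr.c j (fr.H i) x = if i = j then 1 else 0 := by
  have := cc_dual hD (j : Fin n) (i : Fin n)
  simp only [Subtype.val_inj] at this
  exact this

theorem Vw_of_EE (fr : Frame S X) {O : Set (Fin n → ℝ)} (h : VF fr.c O) {F : (Fin n → ℝ) → ℝ} (hF : ContDiffOn ℝ ∞ F O) {x : Fin n → ℝ}
    (hx : x ∈ O) (hE : EE fr.c x F = 0) (l : List {i // i ∈ fr.J}) : Vw fr.c l F x = 0 := by
  have h1 := congrFun hE (Multiset.toFinsupp (l : Multiset {i // i ∈ fr.J}))
  have h2 : ec fr.c (Multiset.toFinsupp (l : Multiset {i // i ∈ fr.J})) F x = 0 := h1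
  rw [ec, Multiset.toFinsupp_toMultiset] at h2
  have h3 : ((∏ i, ((Multiset.toFinsupp (l : Multiset {i // i ∈ fr.J})) i)! : ℕ) : ℝ) ≠ 0 := by
    exact_mod_cast (Finset.prod_pos fun j _ => Nat.factorial_pos _).ne'
  have h4 := (mul_eq_zero.1 h2).resolve_left (inv_ne_zero h3)
  rw [Vw_perm h hF (l' := (l : Multiset {i // i ∈ fr.J}).toList) ?_ hx]
  · exact h4
  · rw [← Multiset.coe_eq_coe, Multiset.coe_toList]

theorem EE_of_Vw (fr : Frame S X) {F : (Fin n → ℝ) → ℝ} {x : Fin n → ℝ} (h : ∀ l, Vw fr.c l F x = 0) : EE fr.c x F = 0 := by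
  ext α; rw [coeff_EE, ec, h, mul_zero]; rfl

theorem flat_of_EE_frame (fr : Frame S X) {r : (Fin n → ℝ) → ℝ} (hr : r ∈ S.R) (hX : X = S.V ∩ {x | r x = 0})
    {O : Set (Fin n → ℝ)} (hO : IsOpen O) (hD : ∀ x ∈ O, DD fr.H x ≠ 0) {F : (Fin n → ℝ) → ℝ} (hF : ContDiffOn ℝ ∞ F O)
    (hE : ∀ x ∈ X ∩ O, EE fr.c x F = 0) : ∀ x ∈ X ∩ O, Flat F x := by
  have hVF := fr.VF_c hO hD
  have hVFc := VF_cc (S := S) hO fr.hH hD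
  have hstepV : ∀ F, ContDiffOn ℝ ∞ F O → (∀ x ∈ X ∩ O, EE fr.c x F = 0) → ∀ i, ∀ x ∈ X ∩ O, EE fr.c x (Vop (cc fr.H) i F) = 0 := by
    intro F hF hE i x hx
    refine EE_of_Vw fr fun l => ?_
    by_cases hi : i ∈ fr.J
    · have := Vw_of_EE fr hVF hF hx.2 (hE x hx) (l ++ [⟨i, hi⟩])
      rw [Vw_append] at this; exact this
    · have h1 : EqOn (Vw fr.c l (Vop (cc fr.H) i F)) (Vop (cc fr.H) i (Vw fr.c l F)) O := by
        induction l with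
        | nil => exact fun _ _ => rfl
        | cons j l ih =>
          have h2 : EqOn (Vop fr.c j (Vw fr.c l (Vop (cc fr.H) i F))) (Vop fr.c j (Vop (cc fr.H) i (Vw fr.c l F))) O := Vop_congr hO ih j
          exact h2.trans (hVFc.comm j i _ (Vw_smooth hVF hF l))
      rw [h1 hx.2]
      exact tang fr hr hX hi hO hx.1 hx.2 (hD x hx.2) (Vw_smooth hVF hF l) fun y hy => Vw_of_EE fr hVF hF hy.2 (hE y hy) l
  have hstep : ∀ F, ContDiffOn ℝ ∞ F O → (∀ x ∈ X ∩ O, EE fr.c x F = 0) → ∀ k, ∀ x ∈ X ∩ O, EE fr.c x (pd k F) = 0 := by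
    intro F hF hE k x hx
    have hs : ∀ i, ContDiffOn ℝ ∞ (pd k (fr.H i)) O := fun i => (pd_smooth (fr.hH i).1 k).contDiffOn
    have hs2 : ∀ i, ContDiffOn ℝ ∞ (Vop (cc fr.H) i F) O := fun i => Vop_smooth hO hVFc.smooth hF i
    rw [EE_congr hO (G := fun x => ∑ i, pd k (fr.H i) x * Vop (cc fr.H) i F x) (fun y hy => pd_eq_V (hD y hy) F k) hx.2,
      EE_sum hVF _ (fun i _ => (hs i).mul (hs2 i)) hx.2]
    refine Finset.sum_eq_zero fun i _ => ?_
    rw [EE_mul hVF (hs i) (hs2 i) hx.2, hstepV F hF hE i x hx, mul_zero]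
  have key : ∀ L : ℕ, ∀ F, ContDiffOn ℝ ∞ F O → (∀ x ∈ X ∩ O, EE fr.c x F = 0) → ∀ x ∈ X ∩ O, FlatTo L F x := by
    intro L
    induction L with
    | zero =>
      intro F hF hE x hx
      have := congrFun (hE x hx) 0
      change ec fr.c 0 F x = 0 at this
      rwa [ec_zero] at this
    | succ L ih =>
      intro F hF hE x hx
      refine ⟨?_, fun k => ih _ (pd_smoothOn hO hF k) (hstep F hF hE k) x hx⟩
      have := congrFun (hE x hx) 0
      change ec fr.c 0 F x = 0 at this
      rwa [ec_zero] at this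
  exact fun x hx L => key L F hF hE x hx

end tang
end QDC
end


section
open Set Filter Topology
open scoped ContDiff Nat
set_option linter.unusedSectionVars false
set_option linter.unusedVariables false
namespace QDC

section Cls
variable {M : ℕ → ℝ} [NSeq M] {n : ℕ} {S : Stp M n}

/-- the regular open set of `δ` -/
def Od (S : Stp M n) (δ : (Fin n → ℝ) → ℝ) : Set (Fin n → ℝ) := S.V ∩ {x | δ x ≠ 0}

/-- the class of fractions with powers of `δ` in the denominator -/
def Rd (S : Stp M n) (δ : (Fin n → ℝ) → ℝ) : Set ((Fin n → ℝ) → ℝ) :=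
  {F | ∃ k : ℕ, ∃ r ∈ S.R, ∀ x ∈ Od S δ, F x * δ x ^ k = r x}

variable {δ F G r : (Fin n → ℝ) → ℝ}

theorem isOpen_Od (hδ : δ ∈ S.R) : IsOpen (Od S δ) :=
  S.isOpenV.inter (isOpen_ne_fun hδ.1.continuous continuous_const)

theorem R_pow (hδ : δ ∈ S.R) (k : ℕ) : (fun x => δ x ^ k) ∈ S.R := S.R.pow_mem hδ k
theorem R_mul (hF : F ∈ S.R) (hG : G ∈ S.R) : (fun x => F x * G x) ∈ S.R := S.R.mul_mem hF hG
theorem R_add (hF : F ∈ S.R) (hG : G ∈ S.R) : (fun x => F x + G x) ∈ S.R := S.R.add_mem hF hG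
theorem R_sub (hF : F ∈ S.R) (hG : G ∈ S.R) : (fun x => F x - G x) ∈ S.R := S.R.sub_mem hF hG

theorem Rd_of_R (hr : r ∈ S.R) : r ∈ Rd S δ := ⟨0, r, hr, fun x _ => by simp⟩

theorem Rd_congr (h : EqOn F G (Od S δ)) (hF : F ∈ Rd S δ) : G ∈ Rd S δ := by
  obtain ⟨k, r, hr, h1⟩ := hF
  exact ⟨k, r, hr, fun x hx => by rw [← h hx]; exact h1 x hx⟩

theorem Rd_add (hδ : δ ∈ S.R) (hF : F ∈ Rd S δ) (hG : G ∈ Rd S δ) : (fun x => F x + G x) ∈ Rd S δ := by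
  obtain ⟨k, r, hr, h1⟩ := hF
  obtain ⟨l, s, hs, h2⟩ := hG
  refine ⟨k + l, _, R_add (R_mul hr (R_pow hδ l)) (R_mul hs (R_pow hδ k)), fun x hx => ?_⟩
  rw [← h1 x hx, ← h2 x hx]; ring

theorem Rd_mul (hF : F ∈ Rd S δ) (hG : G ∈ Rd S δ) : (fun x => F x * G x) ∈ Rd S δ := by
  obtain ⟨k, r, hr, h1⟩ := hF
  obtain ⟨l, s, hs, h2⟩ := hG
  refine ⟨k + l, _, R_mul hr hs, fun x hx => ?_⟩
  rw [← h1 x hx, ← h2 x hx]; ring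

theorem Rd_const (a : ℝ) : (fun _ => a) ∈ Rd S δ := Rd_of_R (R_const a)

theorem Rd_sum (hδ : δ ∈ S.R) {ι : Type*} (s : Finset ι) {F : ι → (Fin n → ℝ) → ℝ} (hF : ∀ j ∈ s, F j ∈ Rd S δ) :
    (fun x => ∑ j ∈ s, F j x) ∈ Rd S δ := by
  classical
  induction s using Finset.induction_on with
  | empty => simpa using Rd_const 0
  | insert a s ha ih =>
    simp only [Finset.sum_insert ha]
    exact Rd_add hδ (hF a (by simp)) (ih fun j hj => hF j (by simp [hj]))

theorem Rd_smooth (hF : F ∈ Rd S δ) (hδ : δ ∈ S.R) : ContDiffOn ℝ ∞ F (Od S δ) := by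
  obtain ⟨k, r, hr, h1⟩ := hF
  have h2 : ContDiffOn ℝ ∞ (fun x => r x / δ x ^ k) (Od S δ) :=
    hr.1.contDiffOn.div (hδ.1.pow k).contDiffOn fun x hx => pow_ne_zero k hx.2
  refine h2.congr fun x hx => ?_
  rw [← h1 x hx, mul_div_assoc, div_self (pow_ne_zero k hx.2), mul_one]

theorem Rd_pd (hδ : δ ∈ S.R) (hF : F ∈ Rd S δ) (i : Fin n) : pd i F ∈ Rd S δ := by
  have hs := Rd_smooth hF hδ
  obtain ⟨k, r, hr, h1⟩ := hF
  have hk := R_pow hδ k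
  refine ⟨2 * k, _, R_sub (R_mul (R_pd hr i) hk) (R_mul hr (R_pd hk i)), fun x hx => ?_⟩
  have h2 := pd_congr_on (isOpen_Od hδ) (f := fun x => F x * δ x ^ k) (g := r) (fun x hx => h1 x hx) i hx
  rw [pd_mul_on (isOpen_Od hδ) hs hk.1.contDiffOn i hx] at h2
  rw [← h2, ← h1 x hx]; ring

/-- bounded below inverse power of `δ` on the horn -/
def Btm (T : Set (Fin n → ℝ)) (δ F : (Fin n → ℝ) → ℝ) : Prop := ∃ (m : ℕ) (C : ℝ), 0 ≤ C ∧ ∀ x ∈ T, |F x| * (δ x ^ 2) ^ m ≤ C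
/-- flat with respect to `δ` on the horn -/
def Bfl (T : Set (Fin n → ℝ)) (δ F : (Fin n → ℝ) → ℝ) : Prop := ∀ k : ℕ, ∃ C : ℝ, 0 ≤ C ∧ ∀ x ∈ T, |F x| ≤ C * (δ x ^ 2) ^ k

/-- the horn -/
def Om (S : Stp M n) (ph δ : (Fin n → ℝ) → ℝ) : Set (Fin n → ℝ) := {x ∈ Od S δ | |ph x| ≤ |δ x|}

variable {ph : (Fin n → ℝ) → ℝ}

theorem Btm_congr (h : EqOn F G (Od S δ)) (hF : Btm (Om S ph δ) δ F) : Btm (Om S ph δ) δ G := by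
  obtain ⟨m, C, h0, h1⟩ := hF
  exact ⟨m, C, h0, fun x hx => by rw [← h hx.1]; exact h1 x hx⟩

theorem Bfl_congr (h : EqOn F G (Od S δ)) (hF : Bfl (Om S ph δ) δ F) : Bfl (Om S ph δ) δ G := by
  intro k
  obtain ⟨C, h0, h1⟩ := hF k
  exact ⟨C, h0, fun x hx => by rw [← h hx.1]; exact h1 x hx⟩

theorem R_bdd (hr : r ∈ S.R) : ∃ C : ℝ, 0 ≤ C ∧ ∀ x ∈ S.V, |r x| ≤ C := by
  obtain ⟨C, hC⟩ := S.hK.exists_bound_of_continuousOn hr.1.continuous.continuousOn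
  refine ⟨max C 0, le_max_right _ _, fun x hx => (hC x (S.hVK hx)).trans (le_max_left _ _)⟩

theorem Btm_add (hδ : δ ∈ S.R) (hF : Btm (Om S ph δ) δ F) (hG : Btm (Om S ph δ) δ G) : Btm (Om S ph δ) δ (fun x => F x + G x) := by
  obtain ⟨m, C, h0, h1⟩ := hF
  obtain ⟨l, D, h0', h2⟩ := hG
  obtain ⟨E, hE0, hE⟩ := R_bdd hδ
  refine ⟨m + l, C * (E ^ 2) ^ l + D * (E ^ 2) ^ m, by positivity, fun x hx => ?_⟩
  have h3 : δ x ^ 2 ≤ E ^ 2 := by rw [← sq_abs]; exact pow_le_pow_left₀ (abs_nonneg _) (hE x hx.1.1) 2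
  calc |F x + G x| * (δ x ^ 2) ^ (m + l) ≤ (|F x| + |G x|) * (δ x ^ 2) ^ (m + l) := by gcongr; exact abs_add_le _ _
    _ = |F x| * (δ x ^ 2) ^ m * (δ x ^ 2) ^ l + |G x| * (δ x ^ 2) ^ l * (δ x ^ 2) ^ m := by ring
    _ ≤ _ := by
      gcongr
      · exact h1 x hx
      · exact h2 x hx

theorem Btm_mul (hF : Btm (Om S ph δ) δ F) (hG : Btm (Om S ph δ) δ G) : Btm (Om S ph δ) δ (fun x => F x * G x) := by
  obtain ⟨m, C, h0, h1⟩ := hF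
  obtain ⟨l, D, h0', h2⟩ := hG
  refine ⟨m + l, C * D, by positivity, fun x hx => ?_⟩
  rw [abs_mul]
  calc |F x| * |G x| * (δ x ^ 2) ^ (m + l) = |F x| * (δ x ^ 2) ^ m * (|G x| * (δ x ^ 2) ^ l) := by ring
    _ ≤ _ := mul_le_mul (h1 x hx) (h2 x hx) (by positivity) h0

theorem Bfl_add (hF : Bfl (Om S ph δ) δ F) (hG : Bfl (Om S ph δ) δ G) : Bfl (Om S ph δ) δ (fun x => F x + G x) := by
  intro k
  obtain ⟨C, h0, h1⟩ := hF k
  obtain ⟨D, h0', h2⟩ := hG k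
  refine ⟨C + D, by positivity, fun x hx => (abs_add_le _ _).trans ?_⟩
  rw [add_mul]; exact add_le_add (h1 x hx) (h2 x hx)

theorem Bfl_mul (hF : Btm (Om S ph δ) δ F) (hG : Bfl (Om S ph δ) δ G) : Bfl (Om S ph δ) δ (fun x => F x * G x) := by
  intro k
  obtain ⟨m, C, h0, h1⟩ := hF
  obtain ⟨D, h0', h2⟩ := hG (k + m)
  refine ⟨C * D, by positivity, fun x hx => ?_⟩
  rw [abs_mul]
  calc |F x| * |G x| ≤ |F x| * (D * (δ x ^ 2) ^ (k + m)) := by gcongr; exact h2 x hx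
    _ = (|F x| * (δ x ^ 2) ^ m) * (D * (δ x ^ 2) ^ k) := by ring
    _ ≤ C * (D * (δ x ^ 2) ^ k) := by gcongr; exact h1 x hx
    _ = _ := by ring

/-- tempered functions -/
def Gg (S : Stp M n) (ph δ : (Fin n → ℝ) → ℝ) : Set ((Fin n → ℝ) → ℝ) :=
  {F | ContDiffOn ℝ ∞ F (Od S δ) ∧ ∀ L, Lv (Btm (Om S ph δ) δ) L F}
/-- flat functions -/
def Dd (S : Stp M n) (ph δ : (Fin n → ℝ) → ℝ) : Set ((Fin n → ℝ) → ℝ) :=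
  {F | ContDiffOn ℝ ∞ F (Od S δ) ∧ ∀ L, Lv (Bfl (Om S ph δ) δ) L F}

theorem Rd_Btm (hδ : δ ∈ S.R) (hF : F ∈ Rd S δ) : Btm (Om S ph δ) δ F := by
  obtain ⟨k, r, hr, h1⟩ := hF
  obtain ⟨E, hE0, hE⟩ := R_bdd (R_mul hr (R_pow hδ k))
  refine ⟨k, E, hE0, fun x hx => ?_⟩
  have := hE x hx.1.1
  rw [← h1 x hx.1] at this
  calc |F x| * (δ x ^ 2) ^ k = |F x| * |(δ x ^ 2) ^ k| := by rw [abs_of_nonneg (by positivity : 0 ≤ (δ x ^ 2) ^ k)]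
    _ = |F x * δ x ^ k * δ x ^ k| := by rw [← abs_mul]; congr 1; ring
    _ ≤ E := this

theorem Rd_Gg (hδ : δ ∈ S.R) (hF : F ∈ Rd S δ) : F ∈ Gg S ph δ := by
  refine ⟨Rd_smooth hF hδ, fun L => ?_⟩
  induction L generalizing F with
  | zero => exact Rd_Btm hδ hF
  | succ L ih => exact ⟨Rd_Btm hδ hF, fun i => ih (Rd_pd hδ hF i)⟩

theorem Dd_congr (hδ : δ ∈ S.R) (h : EqOn F G (Od S δ)) (hF : F ∈ Dd S ph δ) : G ∈ Dd S ph δ :=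
  ⟨hF.1.congr h.symm, fun L => Lv.congr (isOpen_Od hδ) (fun _ _ => Bfl_congr) h (hF.2 L)⟩

theorem Dd_add (hδ : δ ∈ S.R) (hF : F ∈ Dd S ph δ) (hG : G ∈ Dd S ph δ) : (fun x => F x + G x) ∈ Dd S ph δ :=
  ⟨hF.1.add hG.1, fun L => Lv.add (isOpen_Od hδ) (fun _ _ => Bfl_congr) (fun _ _ => Bfl_add) hF.1 hG.1 (hF.2 L) (hG.2 L)⟩

theorem Dd_zero : (fun _ => 0) ∈ Dd S ph δ :=
  ⟨contDiffOn_const, fun L => lv_zero (fun k => ⟨0, le_rfl, fun x _ => by simp⟩) L⟩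

theorem Dd_sum (hδ : δ ∈ S.R) {ι : Type*} (s : Finset ι) {F : ι → (Fin n → ℝ) → ℝ} (hF : ∀ j ∈ s, F j ∈ Dd S ph δ) :
    (fun x => ∑ j ∈ s, F j x) ∈ Dd S ph δ := by
  classical
  induction s using Finset.induction_on with
  | empty => simpa using Dd_zero
  | insert a s ha ih =>
    simp only [Finset.sum_insert ha]
    exact Dd_add hδ (hF a (by simp)) (ih fun j hj => hF j (by simp [hj]))

theorem Dd_mul (hδ : δ ∈ S.R) (hF : F ∈ Gg S ph δ) (hG : G ∈ Dd S ph δ) : (fun x => F x * G x) ∈ Dd S ph δ :=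
  ⟨hF.1.mul hG.1, fun L => Lv.mul (isOpen_Od hδ) (fun _ _ => Bfl_congr) (fun _ _ => Bfl_add) (fun _ _ => Bfl_mul) hF.1 hG.1 (hF.2 L) (hG.2 L)⟩

theorem Dd_sub (hδ : δ ∈ S.R) (hF : F ∈ Dd S ph δ) (hG : G ∈ Dd S ph δ) : (fun x => F x - G x) ∈ Dd S ph δ := by
  have := Dd_add hδ hF (Dd_mul hδ (Rd_Gg hδ (Rd_const (-1))) hG)
  refine Dd_congr hδ (fun x _ => ?_) this
  ring

theorem Dd_pd (hδ : δ ∈ S.R) (hF : F ∈ Dd S ph δ) (i : Fin n) : pd i F ∈ Dd S ph δ :=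
  ⟨pd_smoothOn (isOpen_Od hδ) hF.1 i, fun L => (hF.2 (L + 1)).2 i⟩

/-- cutoff functions are tempered -/
theorem chi_Gg (hδ : δ ∈ S.R) {u : (Fin n → ℝ) → ℝ} (hu : u ∈ Rd S δ) {χ : ℝ → ℝ} (hχ : ContDiff ℝ ∞ χ) (hc : HasCompactSupport χ) :
    (fun x => χ (u x)) ∈ Gg S ph δ := by
  have hus := Rd_smooth hu hδ
  have hO := isOpen_Od hδ
  have hsm : ∀ {χ : ℝ → ℝ}, ContDiff ℝ ∞ χ → ContDiffOn ℝ ∞ (fun x => χ (u x)) (Od S δ) := fun h => h.comp_contDiffOn hus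
  refine ⟨hsm hχ, fun L => ?_⟩
  have hb : ∀ {χ : ℝ → ℝ}, ContDiff ℝ ∞ χ → HasCompactSupport χ → Btm (Om S ph δ) δ (fun x => χ (u x)) := by
    intro χ hχ hc
    obtain ⟨C, hC⟩ := hc.exists_bound_of_continuous hχ.continuous
    exact ⟨0, max C 0, le_max_right _ _, fun x _ => by simpa using Or.inl (hC (u x))⟩
  induction L generalizing χ with
  | zero => exact hb hχ hc
  | succ L ih =>
    refine ⟨hb hχ hc, fun i => ?_⟩
    have hχ1 : ContDiff ℝ ∞ (deriv χ) := by
      have := (contDiff_succ_iff_deriv (n := (∞ : WithTop ℕ∞))).1 (by simpa using hχ)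
      exact this.2.2
    have heq : EqOn (fun x => deriv χ (u x) * pd i u x) (pd i (fun x => χ (u x))) (Od S δ) := by
      intro x hx
      have h1 := ((hus.contDiffAt (hO.mem_nhds hx)).differentiableAt (by simp)).hasFDerivAt
      have h2 := ((hχ.differentiable (by simp)) (u x)).hasDerivAt
      have h3 := h2.comp_hasFDerivAt x h1
      have h4 : HasFDerivAt (fun x => χ (u x)) (deriv χ (u x) • fderiv ℝ u x) x := h3
      simp only [pd]
      rw [h4.fderiv]; rfl
    refine Lv.congr hO (fun _ _ => Btm_congr) heq ?_
    exact Lv.mul hO (fun _ _ => Btm_congr) (fun _ _ => Btm_add hδ) (fun _ _ => Btm_mul) (hsm hχ1) (pd_smoothOn hO hus i)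
      (ih hχ1 hc.deriv) ((Rd_Gg hδ (Rd_pd hδ hu i)).2 L)

theorem flat_off (hF : ContDiff ℝ ∞ F) (h0 : ∀ x ∉ S.V, F x = 0) : ∀ x ∉ S.V, Flat F x := by
  intro x hx
  rw [flat_iff_pdw]
  intro w
  have hcont : Continuous (pdw w F) := (contDiffOn_univ.1 (pdw_smoothOn isOpen_univ (contDiffOn_univ.2 hF) w)).continuous
  have hcl : IsClosed {x | pdw w F x = 0} := isClosed_eq hcont continuous_const
  refine hcl.closure_subset_iff.2 (fun y hy => ?_) (S.hoff hx)
  refine flat_iff_pdw.1 (flat_of_eventually ?_) w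
  filter_upwards [isOpen_interior.mem_nhds hy] with z hz
  exact h0 z (interior_subset hz)

theorem flat_pdw {x : Fin n → ℝ} (h : Flat F x) (w : List (Fin n)) : Flat (pdw w F) x := by
  induction w with
  | nil => exact h
  | cons i w ih => exact ih.pd i

theorem pdw_off (h0 : ∀ x ∉ S.V, F x = 0) (w : List (Fin n)) : ∀ x ∉ S.K, pdw w F x = 0 := by
  intro x hx
  refine flat_iff_pdw.1 (flat_of_eventually ?_) w
  filter_upwards [S.hK.isClosed.isOpen_compl.mem_nhds hx] with z hz
  exact h0 z fun h => hz (S.hVK h)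

theorem flat_Dd (hδ : δ ∈ S.R) (hph : ph ∈ S.R) (hF : ContDiff ℝ ∞ F) (h0 : ∀ x ∉ S.V, F x = 0)
    (hfl : ∀ x ∈ S.V, ph x = 0 → δ x = 0 → Flat F x) : F ∈ Dd S ph δ := by
  refine ⟨hF.contDiffOn, fun L => lv_iff_pdw.2 fun w _ k => ?_⟩
  have hsm : ContDiff ℝ ∞ (pdw w F) := contDiffOn_univ.1 (pdw_smoothOn isOpen_univ (contDiffOn_univ.2 hF) w)
  have hcs : HasCompactSupport (pdw w F) := HasCompactSupport.intro S.hK (pdw_off h0 w)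
  have hQ : (fun x => ph x ^ 2 + δ x ^ 2) ∈ S.R := R_add (R_pow hph 2) (R_pow hδ 2)
  obtain ⟨N, C, hN, hC, h⟩ := lojasiewicz S.hK fun x hx => hQ.2 x (S.hKU hx)
  obtain ⟨C1, hC1, h1⟩ := taylor_est (N * k) hsm hcs
  obtain ⟨C2, h2⟩ := hcs.exists_bound_of_continuous hsm.continuous
  have hC2 : 0 ≤ C2 := (norm_nonneg _).trans (h2 0)
  refine ⟨C2 * (2 * C) ^ k + C1 * (2 * C) ^ k, by positivity, fun x hx => ?_⟩
  have hq : C * |ph x ^ 2 + δ x ^ 2| ≤ 2 * C * δ x ^ 2 := by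
    rw [abs_of_nonneg (by positivity)]
    have : ph x ^ 2 ≤ δ x ^ 2 := sq_le_sq.2 hx.2
    nlinarith
  rw [add_mul, mul_assoc, ← mul_pow, mul_assoc C1, ← mul_pow]
  have hp : 0 ≤ (2 * C * δ x ^ 2) ^ k := by positivity
  rcases h x (S.hVK hx.1.1) with h3 | ⟨z, hz, _, hd⟩
  · have : (1 : ℝ) ≤ (2 * C * δ x ^ 2) ^ k := one_le_pow₀ (h3.trans hq)
    have h4 : |pdw w F x| ≤ C2 := h2 x
    nlinarith [mul_nonneg hC1 hp]
  · have hz1 : ph z = 0 ∧ δ z = 0 := by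
      constructor <;> nlinarith [sq_nonneg (ph z), sq_nonneg (δ z)]
    have hzf : Flat F z := by
      by_cases hzV : z ∈ S.V
      · exact hfl z hzV hz1.1 hz1.2
      · exact flat_off hF h0 z hzV
    have h4 := h1 x z (flat_pdw hzf w)
    rw [pow_mul] at h4
    have h5 : (dist x z ^ N) ^ k ≤ (2 * C * δ x ^ 2) ^ k := pow_le_pow_left₀ (by positivity) (hd.trans hq) k
    nlinarith [mul_nonneg hC2 hp, mul_le_mul_of_nonneg_left h5 hC1]

variable {X : Set (Fin n → ℝ)}

/-- admissible denominators -/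
def Adm (fr : Frame S X) (δ : (Fin n → ℝ) → ℝ) : Prop :=
  ∃ t ∈ S.R, (∀ x, δ x = DD fr.H x * S.ψ x * t x) ∧ ∃ x ∈ X, δ x ≠ 0

theorem DD_mem (fr : Frame S X) : DD fr.H ∈ S.R := R_det fun i k => R_pd (fr.hH i) k

theorem Adm.mem {fr : Frame S X} (h : Adm fr δ) : δ ∈ S.R := by
  obtain ⟨t, ht, h1, _⟩ := h
  rw [show δ = fun x => DD fr.H x * S.ψ x * t x from funext h1]
  exact R_mul (R_mul (DD_mem fr) S.ψ_mem) ht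

theorem Adm.DD_ne {fr : Frame S X} (h : Adm fr δ) : ∀ x ∈ Od S δ, DD fr.H x ≠ 0 := by
  obtain ⟨t, ht, h1, _⟩ := h
  intro x hx h0
  exact hx.2 (by rw [h1, h0]; simp)

theorem Adm.VF {fr : Frame S X} (h : Adm fr δ) : VF fr.c (Od S δ) := fr.VF_c (isOpen_Od h.mem) h.DD_ne

theorem Adm.frontier {fr : Frame S X} (h : Adm fr δ) : ∀ x ∈ closure (Od S δ), x ∉ Od S δ → δ x = 0 := by
  obtain ⟨t, ht, h1, _⟩ := h
  intro x hx hx2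
  by_contra h0
  apply hx2
  refine ⟨?_, h0⟩
  have h3 : 0 ≤ S.ψ x := by
    have hcl : IsClosed {x | 0 ≤ S.ψ x} := isClosed_le continuous_const S.hψ.continuous
    refine hcl.closure_subset_iff.2 (fun y hy => ?_) hx
    have := hy.1
    rw [S.hV] at this
    have h5 : 0 < S.ψ y := this
    exact h5.le
  have h4 : S.ψ x ≠ 0 := fun h => h0 (by rw [h1, h]; simp)
  rw [S.hV]
  exact lt_of_le_of_ne h3 h4.symm

theorem Adm.c_Rd {fr : Frame S X} (h : Adm fr δ) (i : {i // i ∈ fr.J}) (k : Fin n) : fr.c i k ∈ Rd S δ := by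
  have hne := h.DD_ne
  obtain ⟨t, ht, h1, _⟩ := h
  refine ⟨1, _, R_mul (R_adj (A := Jm fr.H) (fun i k => R_pd (fr.hH i) k) k i) (R_mul S.ψ_mem ht), fun x hx => ?_⟩
  have := hne x hx
  rw [Frame.c, cc, pow_one, h1]; field_simp

theorem Adm.Rd_Vop {fr : Frame S X} (h : Adm fr δ) (hF : F ∈ Rd S δ) (i : {i // i ∈ fr.J}) : Vop fr.c i F ∈ Rd S δ :=
  Rd_sum h.mem _ fun k _ => Rd_mul (h.c_Rd i k) (Rd_pd h.mem hF k)

theorem Adm.Rd_ec {fr : Frame S X} (h : Adm fr δ) (hF : F ∈ Rd S δ) (β : {i // i ∈ fr.J} →₀ ℕ) : ec fr.c β F ∈ Rd S δ := by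
  refine Rd_mul (Rd_const _) ?_
  generalize (Finsupp.toMultiset β).toList = l
  induction l with
  | nil => exact hF
  | cons i l ih => exact h.Rd_Vop ih i

theorem Adm.Dd_Vop {fr : Frame S X} (h : Adm fr δ) (hF : F ∈ Dd S ph δ) (i : {i // i ∈ fr.J}) : Vop fr.c i F ∈ Dd S ph δ :=
  Dd_sum h.mem _ fun k _ => Dd_mul h.mem (Rd_Gg h.mem (h.c_Rd i k)) (Dd_pd h.mem hF k)

theorem Adm.Dd_ec {fr : Frame S X} (h : Adm fr δ) (hF : F ∈ Dd S ph δ) (β : {i // i ∈ fr.J} →₀ ℕ) : ec fr.c β F ∈ Dd S ph δ := by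
  refine Dd_mul h.mem (Rd_Gg h.mem (Rd_const _)) ?_
  generalize (Finsupp.toMultiset β).toList = l
  induction l with
  | nil => exact hF
  | cons i l ih => exact h.Dd_Vop ih i

/-- cut off and extend by zero -/
theorem Adm.cutoff {fr : Frame S X} (h : Adm fr δ) (hph : ph ∈ S.R) (hX : X = S.V ∩ {x | ph x = 0}) {a : (Fin n → ℝ) → ℝ} (ha : a ∈ Dd S ph δ) :
    ∃ b : (Fin n → ℝ) → ℝ, ContDiff ℝ ∞ b ∧ (∀ x ∉ Od S δ, Flat b x) ∧ ∀ x ∈ X ∩ Od S δ, b =ᶠ[𝓝 x] a := by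
  classical
  have hO := isOpen_Od h.mem
  let χ : ContDiffBump (0 : ℝ) := ⟨1 / 2, 1, by norm_num, by norm_num⟩
  have hχ : ContDiff ℝ ∞ (χ : ℝ → ℝ) := χ.contDiff
  set u : (Fin n → ℝ) → ℝ := fun x => ph x / δ x with hu
  have huR : u ∈ Rd S δ := ⟨1, ph, hph, fun x hx => by rw [hu, pow_one]; exact div_mul_cancel₀ _ hx.2⟩
  have hus := Rd_smooth huR h.mem
  have hD := Dd_mul (ph := ph) h.mem (chi_Gg h.mem huR hχ χ.hasCompactSupport) ha
  set b0 : (Fin n → ℝ) → ℝ := fun x => χ (u x) * a x with hb0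
  set b := (Od S δ).indicator b0 with hb
  have hbe : EqOn b0 b (Od S δ) := fun x hx => (indicator_of_mem hx _).symm
  have hbD := Dd_congr h.mem hbe hD
  obtain ⟨h1, h2⟩ := ext_zero (δ := δ) hO hbD.1 (fun x hx => indicator_of_notMem hx _) (h.mem.1.differentiable (by simp)) h.frontier (fun w => by
    obtain ⟨C, hC, hw⟩ := lv_iff_pdw.1 (hbD.2 w.length) w le_rfl 1
    refine ⟨C, hC, fun x hx => ?_⟩
    by_cases hx1 : |ph x| ≤ |δ x|
    · have := hw x ⟨hx, hx1⟩
      rwa [pow_one] at this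
    · have : Flat b x := by
        refine flat_of_eventually ?_
        have h3 : ∀ᶠ y in 𝓝 x, |δ y| < |ph y| :=
          (h.mem.1.continuous.abs).continuousAt.eventually_lt (hph.1.continuous.abs).continuousAt (not_le.1 hx1)
        filter_upwards [h3, hO.mem_nhds hx] with y hy hyO
        rw [← hbe hyO, hb0]
        dsimp only
        rw [χ.zero_of_le_dist, zero_mul]
        rw [Real.dist_eq, sub_zero, hu]
        dsimp only
        rw [abs_div, le_div_iff₀ (abs_pos.2 hyO.2)]
        simpa [χ] using hy.le
      rw [flat_iff_pdw.1 this w]; simp; positivity)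
  refine ⟨b, h1, h2, fun x hx => ?_⟩
  have hux : u x = 0 := by
    have := hx.1
    rw [hX] at this
    have h4 : ph x = 0 := this.2
    rw [hu]; dsimp only; rw [h4, zero_div]
  have hucont : ContinuousAt u x := (hus.contDiffAt (hO.mem_nhds hx.2)).continuousAt
  have : ∀ᶠ y in 𝓝 x, u y ∈ Metric.ball (0 : ℝ) (1 / 2) := hucont.eventually (by rw [hux]; exact Metric.ball_mem_nhds _ (by norm_num))
  filter_upwards [this, hO.mem_nhds hx.2] with y hy hyO
  rw [← hbe hyO, hb0]
  dsimp only
  rw [χ.one_of_mem_closedBall (Metric.ball_subset_closedBall hy), one_mul]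

end Cls
end QDC
end


section
open Set Filter Topology
open scoped ContDiff Nat
set_option linter.unusedSectionVars false
set_option linter.unusedVariables false
namespace QDC

section Div
variable {σ : Type} [Fintype σ] [DecidableEq σ] {p : ℕ}

/-- divisibility of module exponents -/
def EDvd (g e : (σ →₀ ℕ) × Fin p) : Prop := g.1 ≤ e.1 ∧ g.2 = e.2

theorem EDvd_wqo : WellQuasiOrdered (EDvd (σ := σ) (p := p)) :=
  WellQuasiOrdered.prod (r := (· ≤ ·)) (s := (· = ·)) wellQuasiOrdered_le (Finite.wellQuasiOrdered _)

theorem exists_gens (N : Set ((σ →₀ ℕ) × Fin p)) : ∃ Gs : Finset ((σ →₀ ℕ) × Fin p), (∀ g ∈ Gs, g ∈ N) ∧ ∀ e ∈ N, ∃ g ∈ Gs, EDvd g e := by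
  by_contra hcon
  push Not at hcon
  obtain ⟨f, hf, hr⟩ := exists_seq_of_forall_finset_exists (fun e => e ∈ N) (fun x y => ¬ EDvd x y) (fun s hs => by
    obtain ⟨e, he, h⟩ := hcon s hs
    exact ⟨e, he, h⟩)
  obtain ⟨k, l, hkl, h⟩ := EDvd_wqo f
  exact hr k l hkl h

theorem acc_upper {N : ℕ → Set ((σ →₀ ℕ) × Fin p)} (hmono : Monotone N) (hup : ∀ k g e, g ∈ N k → EDvd g e → e ∈ N k) : ∃ k, N (k + 1) ⊆ N k := by
  by_contra hcon
  push Not at hcon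
  have h2 : ∀ k, ∃ e, e ∈ N (k + 1) ∧ e ∉ N k := fun k => not_subset.1 (hcon k)
  choose e he he2 using h2
  obtain ⟨k, l, hkl, h⟩ := EDvd_wqo e
  exact he2 l (hup l _ _ (hmono (Nat.succ_le_of_lt hkl) (he k)) h)

variable (m : MonomialOrder σ)

/-- order key of a module exponent -/
noncomputable def ky (e : (σ →₀ ℕ) × Fin p) : m.syn ×ₗ Fin p := toLex (m.toSyn e.1, e.2)

theorem ky_inj {e e' : (σ →₀ ℕ) × Fin p} (h : ky m e = ky m e') : e = e' := by
  have h1 := congrArg ofLex h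
  simp only [ky, ofLex_toLex, Prod.mk.injEq] at h1
  exact Prod.ext (m.toSyn.injective h1.1) h1.2

theorem ky_lt {e e' : (σ →₀ ℕ) × Fin p} : ky m e < ky m e' ↔ m.toSyn e.1 < m.toSyn e'.1 ∨ e.1 = e'.1 ∧ e.2 < e'.2 := by
  rw [ky, ky, Prod.Lex.toLex_lt_toLex]
  simp

theorem ky_add_lt (b : σ →₀ ℕ) {e e' : (σ →₀ ℕ) × Fin p} : ky m (b + e.1, e.2) < ky m (b + e'.1, e'.2) ↔ ky m e < ky m e' := by
  rw [ky_lt, ky_lt]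
  simp

theorem ky_wf : WellFounded fun e e' : (σ →₀ ℕ) × Fin p => ky m e < ky m e' := InvImage.wf (ky m) wellFounded_lt

open Classical in
/-- division coefficients -/
noncomputable def dv (Gs : Finset ((σ →₀ ℕ) × Fin p)) (gen : (σ →₀ ℕ) × Fin p → (σ →₀ ℕ) × Fin p)
    (H : (σ →₀ ℕ) × Fin p → Fin p → MvPowerSeries σ ℝ) (W : Fin p → MvPowerSeries σ ℝ) : (σ →₀ ℕ) × Fin p → ℝ :=
  (ky_wf m).fix fun e rec => MvPowerSeries.coeff e.1 (W e.2) -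
    ∑ g ∈ Gs, ∑ b ∈ Finset.HasAntidiagonal.antidiagonal e.1,
      if h : ky m (b.1 + g.1, g.2) < ky m e ∧ gen (b.1 + g.1, g.2) = g then rec _ h.1 * MvPowerSeries.coeff b.2 (H g e.2) else 0

open Classical in
/-- division quotients -/
noncomputable def dvT (Gs : Finset ((σ →₀ ℕ) × Fin p)) (gen : (σ →₀ ℕ) × Fin p → (σ →₀ ℕ) × Fin p)
    (H : (σ →₀ ℕ) × Fin p → Fin p → MvPowerSeries σ ℝ) (W : Fin p → MvPowerSeries σ ℝ) (g : (σ →₀ ℕ) × Fin p) : MvPowerSeries σ ℝ :=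
  fun b => if gen (b + g.1, g.2) = g then dv m Gs gen H W (b + g.1, g.2) else 0

variable {m} {Gs : Finset ((σ →₀ ℕ) × Fin p)} {gen : (σ →₀ ℕ) × Fin p → (σ →₀ ℕ) × Fin p}
    {H : (σ →₀ ℕ) × Fin p → Fin p → MvPowerSeries σ ℝ} {W : Fin p → MvPowerSeries σ ℝ}

open Classical in
theorem dv_eq (e : (σ →₀ ℕ) × Fin p) : dv m Gs gen H W e = MvPowerSeries.coeff e.1 (W e.2) -
    ∑ g ∈ Gs, ∑ b ∈ Finset.HasAntidiagonal.antidiagonal e.1,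
      if ky m (b.1 + g.1, g.2) < ky m e ∧ gen (b.1 + g.1, g.2) = g then dv m Gs gen H W (b.1 + g.1, g.2) * MvPowerSeries.coeff b.2 (H g e.2) else 0 := by
  conv_lhs => rw [dv, WellFounded.fix_eq]
  congr 1

theorem coeff_dvT (g : (σ →₀ ℕ) × Fin p) (b : σ →₀ ℕ) [Decidable (gen (b + g.1, g.2) = g)] :
    MvPowerSeries.coeff b (dvT m Gs gen H W g) = if gen (b + g.1, g.2) = g then dv m Gs gen H W (b + g.1, g.2) else 0 := by
  have : MvPowerSeries.coeff b (dvT m Gs gen H W g) = dvT m Gs gen H W g b := rfl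
  rw [this, dvT]
  split_ifs <;> rfl

open Classical in
theorem dv_spec {N : Set ((σ →₀ ℕ) × Fin p)} (hgen : ∀ e ∈ N, gen e ∈ Gs ∧ EDvd (gen e) e) (hup : ∀ g ∈ Gs, ∀ b, (b + g.1, g.2) ∈ N)
    (hH0 : ∀ g ∈ Gs, ∀ e : (σ →₀ ℕ) × Fin p, ky m e < ky m g → MvPowerSeries.coeff e.1 (H g e.2) = 0)
    (hH1 : ∀ g ∈ Gs, MvPowerSeries.coeff g.1 (H g g.2) = 1) (β : σ →₀ ℕ) (c : Fin p) :
    MvPowerSeries.coeff β (W c - ∑ g ∈ Gs, dvT m Gs gen H W g * H g c) = if (β, c) ∈ N then 0 else dv m Gs gen H W (β, c) := by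
  rw [map_sub, map_sum]
  have key : ∀ g ∈ Gs, MvPowerSeries.coeff β (dvT m Gs gen H W g * H g c) =
      (∑ b ∈ Finset.HasAntidiagonal.antidiagonal β,
        if ky m (b.1 + g.1, g.2) < ky m (β, c) ∧ gen (b.1 + g.1, g.2) = g then dv m Gs gen H W (b.1 + g.1, g.2) * MvPowerSeries.coeff b.2 (H g c) else 0)
      + if (β, c) ∈ N ∧ gen (β, c) = g then dv m Gs gen H W (β, c) else 0 := by
    intro g hg
    rw [MvPowerSeries.coeff_mul]
    have h1 : ∀ b ∈ Finset.HasAntidiagonal.antidiagonal β, MvPowerSeries.coeff b.1 (dvT m Gs gen H W g) * MvPowerSeries.coeff b.2 (H g c) =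
        (if ky m (b.1 + g.1, g.2) < ky m (β, c) ∧ gen (b.1 + g.1, g.2) = g then dv m Gs gen H W (b.1 + g.1, g.2) * MvPowerSeries.coeff b.2 (H g c) else 0)
        + if b.2 = g.1 ∧ c = g.2 ∧ gen (β, c) = g then dv m Gs gen H W (β, c) else 0 := by
      intro b hb
      rw [Finset.HasAntidiagonal.mem_antidiagonal] at hb
      rw [coeff_dvT]
      by_cases hge : gen (b.1 + g.1, g.2) = g
      · rw [if_pos hge]
        have hlt : ky m (b.1 + g.1, g.2) < ky m (β, c) ↔ ky m g < ky m (b.2, c) := by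
          have := ky_add_lt m b.1 (e := g) (e' := (b.2, c))
          rw [← this]
          simp only [hb]
        rcases lt_trichotomy (ky m g) (ky m (b.2, c)) with h | h | h
        · rw [if_pos ⟨hlt.2 h, hge⟩, if_neg, add_zero]
          rintro ⟨h2, h3, _⟩
          have : g = (b.2, c) := Prod.ext h2.symm h3.symm
          rw [← this] at h
          exact lt_irrefl _ h
        · have hgb := ky_inj m h
          have h4 : (b.1 + g.1, g.2) = (β, c) := by rw [hgb]; simp [hb]
          rw [if_neg fun h' => (hlt.1 h'.1).ne h]
          rw [if_pos ⟨by rw [hgb], by rw [hgb], by rw [← h4]; exact hge⟩, zero_add, h4]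
          have h5 : MvPowerSeries.coeff b.2 (H g c) = 1 := by
            have := hH1 g hg
            rw [show g.1 = b.2 by rw [hgb], show g.2 = c by rw [hgb]] at this
            exact this
          rw [h5, mul_one]
        · rw [hH0 g hg (b.2, c) h]
          simp only [mul_zero, ite_self, zero_add]
          rw [if_neg]
          rintro ⟨h2, h3, _⟩
          have : g = (b.2, c) := Prod.ext h2.symm h3.symm
          rw [← this] at h
          exact lt_irrefl _ h
      · rw [if_neg hge, zero_mul, if_neg fun h => hge h.2, if_neg, zero_add]
        rintro ⟨h2, h3, h4⟩
        apply hge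
        rw [← h2, hb, ← h3, h4]
    rw [Finset.sum_congr rfl h1, Finset.sum_add_distrib]
    congr 1
    by_cases hN : (β, c) ∈ N ∧ gen (β, c) = g
    · rw [if_pos hN]
      have hd := (hgen _ hN.1).2
      rw [hN.2] at hd
      obtain ⟨b1, hb1⟩ := exists_add_of_le hd.1
      have hb1' : β = g.1 + b1 := hb1
      rw [Finset.sum_eq_single (b1, g.1)]
      · rw [if_pos ⟨rfl, hd.2.symm, hN.2⟩]
      · rintro b hb hne
        rw [if_neg]
        rintro ⟨h2, _, _⟩
        apply hne
        rw [Finset.HasAntidiagonal.mem_antidiagonal] at hb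
        refine Prod.ext ?_ h2
        have h6 : b.1 + g.1 = b1 + g.1 := by
          rw [← h2, hb, h2, hb1', add_comm]
        exact add_right_cancel h6
      · intro h
        exact absurd (by rw [Finset.HasAntidiagonal.mem_antidiagonal, hb1', add_comm]) h
    · rw [if_neg hN]
      refine Finset.sum_eq_zero fun b hb => ?_
      rw [if_neg]
      rintro ⟨h2, h3, h4⟩
      apply hN
      rw [Finset.HasAntidiagonal.mem_antidiagonal] at hb
      refine ⟨?_, h4⟩
      have := hup g hg b.1
      rwa [← h2, hb, ← h3] at this
  rw [Finset.sum_congr rfl key, Finset.sum_add_distrib]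
  have h0 := dv_eq (m := m) (Gs := Gs) (gen := gen) (H := H) (W := W) (β, c)
  dsimp only at h0
  have h7 : (∑ g ∈ Gs, if (β, c) ∈ N ∧ gen (β, c) = g then dv m Gs gen H W (β, c) else 0) = if (β, c) ∈ N then dv m Gs gen H W (β, c) else 0 := by
    by_cases hN : (β, c) ∈ N
    · rw [if_pos hN, Finset.sum_eq_single (gen (β, c))]
      · rw [if_pos ⟨hN, rfl⟩]
      · intro b _ hb
        rw [if_neg fun h => hb h.2.symm]
      · intro h; exact absurd (hgen _ hN).1 h
    · rw [if_neg hN]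
      exact Finset.sum_eq_zero fun g _ => if_neg fun h => hN h.1
  rw [h7]
  split_ifs with hN
  · linarith
  · linarith

end Div
end QDC
end


section
open Set Filter Topology
open scoped ContDiff Nat
set_option linter.unusedSectionVars false
set_option linter.unusedVariables false
namespace QDC

section Fam
variable {M : ℕ → ℝ} [NSeq M] {n : ℕ} {S : Stp M n} {δ ph : (Fin n → ℝ) → ℝ}
variable {σ : Type} [Fintype σ] [DecidableEq σ] {p q : ℕ}

/-- modules of functions over the class `Rd` -/
structure IsMod (S : Stp M n) (δ : (Fin n → ℝ) → ℝ) (C : Set ((Fin n → ℝ) → ℝ)) : Prop where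
  sum : ∀ {ι : Type} (s : Finset ι) (F : ι → (Fin n → ℝ) → ℝ), (∀ j ∈ s, F j ∈ C) → (fun x => ∑ j ∈ s, F j x) ∈ C
  sub : ∀ F G, F ∈ C → G ∈ C → (fun x => F x - G x) ∈ C
  smul : ∀ F G, F ∈ Rd S δ → G ∈ C → (fun x => F x * G x) ∈ C

theorem isMod_Rd (hδ : δ ∈ S.R) : IsMod S δ (Rd S δ) where
  sum s F hF := Rd_sum hδ s hF
  sub F G hF hG := Rd_congr (fun x _ => by ring) (Rd_add hδ hF (Rd_mul (Rd_const (-1)) hG))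
  smul F G hF hG := Rd_mul hF hG

theorem isMod_Dd (hδ : δ ∈ S.R) : IsMod S δ (Dd S ph δ) where
  sum s F hF := Dd_sum hδ s hF
  sub F G hF hG := Dd_sub hδ hF hG
  smul F G hF hG := Dd_mul hδ (Rd_Gg hδ hF) hG

/-- families of power series with coefficients in a class -/
def InC (C : Set ((Fin n → ℝ) → ℝ)) (P : (Fin n → ℝ) → MvPowerSeries σ ℝ) : Prop := ∀ β, (fun x => MvPowerSeries.coeff β (P x)) ∈ C

variable {C : Set ((Fin n → ℝ) → ℝ)}

theorem IsMod.zero (hC : IsMod S δ C) : (fun _ => (0 : ℝ)) ∈ C := by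
  have := hC.sum (∅ : Finset ℕ) (fun _ _ => 0) (by simp)
  simpa using this

theorem InC.mul (hC : IsMod S δ C) {P Q : (Fin n → ℝ) → MvPowerSeries σ ℝ} (hP : InC (Rd S δ) P) (hQ : InC C Q) : InC C (fun x => P x * Q x) := by
  intro β
  simp only [MvPowerSeries.coeff_mul]
  exact hC.sum _ _ fun b _ => hC.smul _ _ (hP b.1) (hQ b.2)

theorem InC.sum (hC : IsMod S δ C) {ι : Type} (s : Finset ι) {P : ι → (Fin n → ℝ) → MvPowerSeries σ ℝ} (hP : ∀ j ∈ s, InC C (P j)) :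
    InC C (fun x => ∑ j ∈ s, P j x) := by
  intro β
  simp only [map_sum]
  exact hC.sum _ _ fun b hb => hP b hb β

theorem InC.sub (hC : IsMod S δ C) {P Q : (Fin n → ℝ) → MvPowerSeries σ ℝ} (hP : InC C P) (hQ : InC C Q) : InC C (fun x => P x - Q x) := by
  intro β
  simp only [map_sub]
  exact hC.sub _ _ (hP β) (hQ β)

theorem InC_const (P : MvPowerSeries σ ℝ) : InC (Rd S δ) (fun _ => P) := fun β => Rd_const _

theorem dv_mem (hC : IsMod S δ C) {m : MonomialOrder σ} {Gs : Finset ((σ →₀ ℕ) × Fin p)} {gen : (σ →₀ ℕ) × Fin p → (σ →₀ ℕ) × Fin p}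
    {H : (σ →₀ ℕ) × Fin p → Fin p → (Fin n → ℝ) → MvPowerSeries σ ℝ} {W : Fin p → (Fin n → ℝ) → MvPowerSeries σ ℝ}
    (hH : ∀ g ∈ Gs, ∀ c, InC (Rd S δ) (H g c)) (hW : ∀ c, InC C (W c)) (e : (σ →₀ ℕ) × Fin p) :
    (fun x => dv m Gs gen (fun g c => H g c x) (fun c => W c x) e) ∈ C := by
  classical
  induction e using (ky_wf m).induction with
  | _ e ih =>
    simp only [dv_eq (m := m) (e := e)]
    refine hC.sub _ _ (hW _ _) (hC.sum _ _ fun g hg => hC.sum _ _ fun b _ => ?_)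
    by_cases h : ky m (b.1 + g.1, g.2) < ky m e ∧ gen (b.1 + g.1, g.2) = g
    · simp only [if_pos h]
      have := hC.smul _ _ (hH g hg e.2 b.2) (ih _ h.1)
      refine cast (congrArg (· ∈ C) (funext fun x => ?_)) this
      exact mul_comm _ _
    · simp only [if_neg h]
      exact hC.zero

theorem dvT_mem (hC : IsMod S δ C) {m : MonomialOrder σ} {Gs : Finset ((σ →₀ ℕ) × Fin p)} {gen : (σ →₀ ℕ) × Fin p → (σ →₀ ℕ) × Fin p}
    {H : (σ →₀ ℕ) × Fin p → Fin p → (Fin n → ℝ) → MvPowerSeries σ ℝ} {W : Fin p → (Fin n → ℝ) → MvPowerSeries σ ℝ}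
    (hH : ∀ g ∈ Gs, ∀ c, InC (Rd S δ) (H g c)) (hW : ∀ c, InC C (W c)) (g : (σ →₀ ℕ) × Fin p) :
    InC C (fun x => dvT m Gs gen (fun g c => H g c x) (fun c => W c x) g) := by
  classical
  intro b
  simp only [coeff_dvT]
  by_cases h : gen (b + g.1, g.2) = g
  · simp only [if_pos h]; exact dv_mem hC hH hW _
  · simp only [if_neg h]; exact hC.zero

end Fam

section Nst
variable {M : ℕ → ℝ} [NSeq M] {n : ℕ} {S : Stp M n} {δ ph : (Fin n → ℝ) → ℝ} {p q : ℕ}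
variable {X : Set (Fin n → ℝ)} {fr : Frame S X} {Φ : Fin q → Fin p → (Fin n → ℝ) → ℝ}

/-- linear combinations of the expansions of the `Φ j` -/
noncomputable def LC (fr : Frame S X) (Φ : Fin q → Fin p → (Fin n → ℝ) → ℝ) (P : Fin q → MvPowerSeries {i // i ∈ fr.J} ℝ) (x : Fin n → ℝ) (c : Fin p) :
    MvPowerSeries {i // i ∈ fr.J} ℝ := ∑ j, P j * EE fr.c x (Φ j c)

/-- `e` is the initial exponent of `W` with coefficient one -/
def Lead {σ : Type} [Fintype σ] [DecidableEq σ] (m : MonomialOrder σ) (e : (σ →₀ ℕ) × Fin p) (W : Fin p → MvPowerSeries σ ℝ) : Prop :=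
  (∀ e', ky m e' < ky m e → MvPowerSeries.coeff e'.1 (W e'.2) = 0) ∧ MvPowerSeries.coeff e.1 (W e.2) = 1

variable (m : MonomialOrder {i // i ∈ fr.J})

/-- generic initial exponents -/
def Nst (Φ : Fin q → Fin p → (Fin n → ℝ) → ℝ) (δ : (Fin n → ℝ) → ℝ) : Set (({i // i ∈ fr.J} →₀ ℕ) × Fin p) :=
  {e | ∃ Q : Fin q → (Fin n → ℝ) → MvPowerSeries {i // i ∈ fr.J} ℝ, (∀ j, InC (Rd S δ) (Q j)) ∧
    ∀ x ∈ X ∩ Od S δ, Lead m e (LC fr Φ (fun j => Q j x) x)}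

variable {m}

theorem Nst_up (hδ : δ ∈ S.R) {g e : ({i // i ∈ fr.J} →₀ ℕ) × Fin p} (hg : g ∈ Nst m Φ δ) (hge : EDvd g e) : e ∈ Nst m Φ δ := by
  obtain ⟨Q, hQ, h⟩ := hg
  obtain ⟨b, hb⟩ := exists_add_of_le hge.1
  obtain ⟨e1, c⟩ := e
  obtain ⟨g1, d⟩ := g
  obtain rfl : d = c := hge.2
  obtain rfl : e1 = b + g1 := by rw [add_comm]; exact hb
  refine ⟨fun j x => MvPowerSeries.monomial b (1 : ℝ) * Q j x, fun j => InC.mul (isMod_Rd hδ) (InC_const _) (hQ j), fun x hx => ?_⟩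
  have hLC : ∀ c, LC fr Φ (fun j => MvPowerSeries.monomial b (1 : ℝ) * Q j x) x c = MvPowerSeries.monomial b (1 : ℝ) * LC fr Φ (fun j => Q j x) x c := by
    intro c
    rw [LC, LC, Finset.mul_sum]
    exact Finset.sum_congr rfl fun j _ => mul_assoc _ _ _
  obtain ⟨h0, h1⟩ := h x hx
  refine ⟨fun e' he' => ?_, ?_⟩
  · rw [hLC, MvPowerSeries.coeff_monomial_mul]
    split_ifs with hbe
    · rw [one_mul]
      refine h0 (e'.1 - b, e'.2) ?_
      rw [← ky_add_lt m b]
      dsimp only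
      rwa [add_tsub_cancel_of_le hbe]
    · rfl
  · rw [hLC, MvPowerSeries.coeff_monomial_mul, if_pos (by exact le_self_add)]
    dsimp only
    rw [add_tsub_cancel_left, one_mul]
    exact h1

theorem Od_mono (r : (Fin n → ℝ) → ℝ) : Od S (fun x => δ x * r x) ⊆ Od S δ := fun x hx => ⟨hx.1, left_ne_zero_of_mul hx.2⟩

theorem Rd_mono {r F : (Fin n → ℝ) → ℝ} (hr : r ∈ S.R) (hF : F ∈ Rd S δ) : F ∈ Rd S (fun x => δ x * r x) := by
  obtain ⟨k, s, hs, h⟩ := hF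
  refine ⟨k, _, R_mul hs (R_pow hr k), fun x hx => ?_⟩
  rw [← h x (Od_mono r hx)]; ring

theorem Nst_mono {r : (Fin n → ℝ) → ℝ} (hr : r ∈ S.R) : Nst m Φ δ ⊆ Nst m Φ (fun x => δ x * r x) := by
  rintro e ⟨Q, hQ, h⟩
  exact ⟨Q, fun j β => Rd_mono hr (hQ j β), fun x hx => h x ⟨hx.1, Od_mono r hx.2⟩⟩

theorem Adm.mulr (h : Adm fr δ) {r : (Fin n → ℝ) → ℝ} (hr : r ∈ S.R) {x : Fin n → ℝ} (hx : x ∈ X) (h0 : δ x ≠ 0) (h1 : r x ≠ 0) :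
    Adm fr (fun x => δ x * r x) := by
  obtain ⟨t, ht, h2, _⟩ := h
  refine ⟨_, R_mul ht hr, fun y => ?_, x, hx, mul_ne_zero h0 h1⟩
  dsimp only
  rw [h2]; ring

theorem exists_adm (hXV : X ⊆ S.V) : ∃ δ, Adm fr δ := by
  obtain ⟨x, hx, h⟩ := fr.hD
  refine ⟨fun x => DD fr.H x * S.ψ x * 1, _, R_const 1, fun x => rfl, x, hx, ?_⟩
  have h2 := hXV hx
  rw [S.hV] at h2
  have h3 : 0 < S.ψ x := h2
  dsimp only
  rw [mul_one]
  exact mul_ne_zero h h3.ne'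

theorem exists_max (m : MonomialOrder {i // i ∈ fr.J}) (Φ : Fin q → Fin p → (Fin n → ℝ) → ℝ) (hXV : X ⊆ S.V) :
    ∃ δ, Adm fr δ ∧ ∀ r ∈ S.R, Adm fr (fun x => δ x * r x) → Nst m Φ (fun x => δ x * r x) ⊆ Nst m Φ δ := by
  by_contra hcon
  push Not at hcon
  obtain ⟨δ0, hδ0⟩ := exists_adm (fr := fr) hXV
  choose! r hr hA hN using hcon
  let d : ℕ → {δ // Adm fr δ} := fun k => Nat.rec ⟨δ0, hδ0⟩ (fun _ e => ⟨fun x => e.1 x * r e.1 x, hA e.1 e.2⟩) k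
  have hd : ∀ k, (d (k + 1)).1 = fun x => (d k).1 x * r (d k).1 x := fun k => rfl
  obtain ⟨k, hk⟩ := acc_upper (N := fun k => Nst m Φ (d k).1) (monotone_nat_of_le_succ fun k => by
    rw [hd]; exact Nst_mono (hr _ (d k).2)) (fun k g e hg hge => Nst_up (d k).2.mem hg hge)
  rw [hd] at hk
  exact hN _ (d k).2 hk

theorem LC_InC (h : Adm fr δ) (hΦ : ∀ j c, Φ j c ∈ S.R) {C : Set ((Fin n → ℝ) → ℝ)} (hC : IsMod S δ C)
    {P : Fin q → (Fin n → ℝ) → MvPowerSeries {i // i ∈ fr.J} ℝ} (hP : ∀ j, InC C (P j)) (c : Fin p) :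
    InC C (fun x => LC fr Φ (fun j => P j x) x c) := by
  refine InC.sum hC _ fun j _ => ?_
  have := InC.mul hC (P := fun x => EE fr.c x (Φ j c)) (fun β => h.Rd_ec (Rd_of_R (hΦ j c)) β) (hP j)
  simpa only [mul_comm] using this

/-- division of the expansion by the generic standard basis -/
theorem solve (h : Adm fr δ) (hΦ : ∀ j c, Φ j c ∈ S.R)
    (hmax : ∀ r ∈ S.R, Adm fr (fun x => δ x * r x) → Nst m Φ (fun x => δ x * r x) ⊆ Nst m Φ δ)
    {F : Fin p → (Fin n → ℝ) → ℝ} (hF : ∀ c, F c ∈ Dd S ph δ)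
    (hFD : ∀ x ∈ X ∩ Od S δ, ∃ P : Fin q → MvPowerSeries {i // i ∈ fr.J} ℝ, ∀ c, EE fr.c x (F c) = LC fr Φ P x c) :
    ∃ A : Fin q → (Fin n → ℝ) → MvPowerSeries {i // i ∈ fr.J} ℝ, (∀ j, InC (Dd S ph δ) (A j)) ∧
      ∀ x ∈ X ∩ Od S δ, ∀ c, EE fr.c x (F c) = LC fr Φ (fun j => A j x) x c := by
  classical
  set N := Nst m Φ δ with hN
  obtain ⟨Gs, hGs, hgen⟩ := exists_gens N
  choose! gen hgen1 hgen2 using hgen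
  have hGs' : ∀ g ∈ Gs, ∃ Q : Fin q → (Fin n → ℝ) → MvPowerSeries {i // i ∈ fr.J} ℝ, (∀ j, InC (Rd S δ) (Q j)) ∧
    ∀ x ∈ X ∩ Od S δ, Lead m g (LC fr Φ (fun j => Q j x) x) := fun g hg => hGs g hg
  choose! Q hQ hL using hGs'
  set H : ({i // i ∈ fr.J} →₀ ℕ) × Fin p → Fin p → (Fin n → ℝ) → MvPowerSeries {i // i ∈ fr.J} ℝ :=
    fun g c x => LC fr Φ (fun j => Q g j x) x c with hH
  have hmR := isMod_Rd h.mem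
  have hmD := isMod_Dd (ph := ph) h.mem
  have hHR : ∀ g ∈ Gs, ∀ c, InC (Rd S δ) (H g c) := fun g hg c => LC_InC h hΦ hmR (hQ g hg) c
  have hspec : ∀ x ∈ X ∩ Od S δ, ∀ W : Fin p → MvPowerSeries {i // i ∈ fr.J} ℝ, ∀ β c,
      MvPowerSeries.coeff β (W c - ∑ g ∈ Gs, dvT m Gs gen (fun g c => H g c x) W g * H g c x) =
      if (β, c) ∈ N then 0 else dv m Gs gen (fun g c => H g c x) W (β, c) := by
    intro x hx W β c
    refine dv_spec (H := fun g c => H g c x) (fun e he => ⟨hgen1 e he, hgen2 e he⟩) (fun g hg b => Nst_up h.mem (hGs g hg) ⟨le_add_self, rfl⟩)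
      (fun g hg e he => (hL g hg x hx).1 e he) (fun g hg => (hL g hg x hx).2) β c
  have hlin : ∀ (x : Fin n → ℝ) (T : ({i // i ∈ fr.J} →₀ ℕ) × Fin p → MvPowerSeries {i // i ∈ fr.J} ℝ) (c : Fin p),
      ∑ g ∈ Gs, T g * H g c x = LC fr Φ (fun j => ∑ g ∈ Gs, T g * Q g j x) x c := by
    intro x T c
    simp only [hH, LC, Finset.mul_sum, Finset.sum_mul]
    rw [Finset.sum_comm]
    exact Finset.sum_congr rfl fun j _ => Finset.sum_congr rfl fun g _ => (mul_assoc _ _ _).symm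
  -- remainders of constant combinations vanish
  have hrem : ∀ P : Fin q → MvPowerSeries {i // i ∈ fr.J} ℝ, ∀ e ∉ N, ∀ x ∈ X ∩ Od S δ,
      dv m Gs gen (fun g c => H g c x) (fun c => LC fr Φ P x c) e = 0 := by
    intro P e
    induction e using (ky_wf m).induction with
    | _ e ih =>
    intro heN
    by_contra hcon
    push Not at hcon
    obtain ⟨x0, hx0, hne⟩ := hcon
    have hWR : ∀ c, InC (Rd S δ) (fun x => LC fr Φ P x c) := fun c => LC_InC h hΦ hmR (P := fun j _ => P j) (fun j => InC_const _) c
    have htR := dv_mem (m := m) (gen := gen) hmR hHR hWR e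
    have hTR := fun g => dvT_mem (m := m) (gen := gen) hmR hHR hWR g
    set t : (Fin n → ℝ) → ℝ := fun x => dv m Gs gen (fun g c => H g c x) (fun c => LC fr Φ P x c) e with ht
    obtain ⟨k, r, hr, htr⟩ := id htR
    have hr0 : r x0 ≠ 0 := by
      rw [← htr x0 hx0.2]; exact mul_ne_zero hne (pow_ne_zero k hx0.2.2)
    have hA' := h.mulr hr hx0.1 hx0.2.2 hr0
    apply heN
    refine hmax r hr hA' ?_
    have hti : (fun x => (t x)⁻¹) ∈ Rd S (fun x => δ x * r x) := by
      refine ⟨1, _, R_mul (R_pow h.mem (k + 1)) (R_const 1), fun x hx => ?_⟩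
      have h1 := htr x (Od_mono r hx)
      have h2 : r x ≠ 0 := right_ne_zero_of_mul hx.2
      have h3 : t x ≠ 0 := by
        intro h4; rw [h4, zero_mul] at h1; exact h2 h1.symm
      rw [pow_one]; dsimp only; rw [← h1]; field_simp; ring
    have hmR' := isMod_Rd hA'.mem
    refine ⟨fun j x => MvPowerSeries.C (t x)⁻¹ * (P j - ∑ g ∈ Gs, dvT m Gs gen (fun g c => H g c x) (fun c => LC fr Φ P x c) g * Q g j x), fun j => ?_, fun x hx => ?_⟩
    · refine InC.mul hmR' ?_ ?_
      · intro β
        simp only [MvPowerSeries.coeff_C]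
        by_cases hβ : β = 0
        · simp only [if_pos hβ]; exact hti
        · simp only [if_neg hβ]; exact Rd_const 0
      · have h5 : InC (Rd S δ) (fun x => P j - ∑ g ∈ Gs, dvT m Gs gen (fun g c => H g c x) (fun c => LC fr Φ P x c) g * Q g j x) :=
          InC.sub hmR (InC_const _) (InC.sum hmR Gs fun g hg => InC.mul hmR (hTR g) (hQ g hg j))
        exact fun β => Rd_mono hr (h5 β)
    · have hxO : x ∈ X ∩ Od S δ := ⟨hx.1, Od_mono r hx.2⟩
      have h6 : ∀ c, LC fr Φ (fun j => MvPowerSeries.C (t x)⁻¹ * (P j - ∑ g ∈ Gs, dvT m Gs gen (fun g c => H g c x) (fun c => LC fr Φ P x c) g * Q g j x)) x c =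
          MvPowerSeries.C (t x)⁻¹ * (LC fr Φ P x c - ∑ g ∈ Gs, dvT m Gs gen (fun g c => H g c x) (fun c => LC fr Φ P x c) g * H g c x) := by
        intro c
        rw [hlin, LC, LC, LC, ← Finset.sum_sub_distrib, Finset.mul_sum]
        refine Finset.sum_congr rfl fun j _ => ?_
        ring
      have h7 := hspec x hxO (fun c => LC fr Φ P x c)
      have h2 : t x ≠ 0 := by
        intro h4
        have h1 := htr x hxO.2
        rw [h4, zero_mul] at h1; exact right_ne_zero_of_mul hx.2.2 h1.symm
      refine ⟨fun e' he' => ?_, ?_⟩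
      · rw [h6, MvPowerSeries.coeff_C_mul, h7]
        split_ifs with hN'
        · rw [mul_zero]
        · rw [show ((e'.1, e'.2) : ({i // i ∈ fr.J} →₀ ℕ) × Fin p) = e' from rfl, ih e' he' hN' x hxO, mul_zero]
      · rw [h6, MvPowerSeries.coeff_C_mul, h7, if_neg heN]
        exact inv_mul_cancel₀ h2
  have hWD : ∀ c, InC (Dd S ph δ) (fun x => EE fr.c x (F c)) := fun c β => h.Dd_ec (hF c) β
  have hTD := fun g => dvT_mem (m := m) (gen := gen) hmD hHR hWD g
  refine ⟨fun j x => ∑ g ∈ Gs, dvT m Gs gen (fun g c => H g c x) (fun c => EE fr.c x (F c)) g * Q g j x, fun j => ?_, fun x hx c => ?_⟩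
  · refine InC.sum hmD Gs fun g hg => ?_
    have := InC.mul hmD (hQ g hg j) (hTD g)
    simpa only [mul_comm] using this
  · rw [← hlin, ← sub_eq_zero]
    ext β
    rw [hspec x hx (fun c => EE fr.c x (F c)) β c]
    split_ifs with hN'
    · rfl
    · obtain ⟨P, hP⟩ := hFD x hx
      rw [show (fun c => EE fr.c x (F c)) = fun c => LC fr Φ P x c from funext hP, hrem P _ hN' x hx]
      rfl

end Nst
end QDC
end


section
open Set Filter Topology
open scoped ContDiff Nat
set_option linter.unusedSectionVars false
set_option linter.unusedVariables false
namespace QDC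

section Step
variable {M : ℕ → ℝ} [NSeq M] {n : ℕ} {S : Stp M n} {δ ph F G : (Fin n → ℝ) → ℝ} {p q : ℕ}

theorem Flat.add {x : Fin n → ℝ} (hF : ContDiff ℝ ∞ F) (hG : ContDiff ℝ ∞ G) (h1 : Flat F x) (h2 : Flat G x) : Flat (fun x => F x + G x) x :=
  fun L => FlatTo.add isOpen_univ (mem_univ x) hF.contDiffOn hG.contDiffOn (h1 L) (h2 L)

theorem Flat.mul {x : Fin n → ℝ} (hF : ContDiff ℝ ∞ F) (hG : ContDiff ℝ ∞ G) (h1 : Flat F x) : Flat (fun x => F x * G x) x :=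
  fun L => FlatTo.mul isOpen_univ (mem_univ x) hF.contDiffOn hG.contDiffOn (h1 L)

theorem Flat.sub {x : Fin n → ℝ} (hF : ContDiff ℝ ∞ F) (hG : ContDiff ℝ ∞ G) (h1 : Flat F x) (h2 : Flat G x) : Flat (fun x => F x - G x) x := by
  have := Flat.add hF (hG.mul contDiff_const) h1 (h2.mul hG (contDiff_const (c := (-1 : ℝ))))
  have e : (fun x => F x + G x * -1) = fun x => F x - G x := by funext x; ring
  rwa [e] at this

/-- combination of the columns -/
def cmb (Φ : Fin q → Fin p → (Fin n → ℝ) → ℝ) (g : Fin q → (Fin n → ℝ) → ℝ) (c : Fin p) : (Fin n → ℝ) → ℝ := fun x => ∑ j, g j x * Φ j c x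

theorem cmb_smooth {Φ : Fin q → Fin p → (Fin n → ℝ) → ℝ} (hΦ : ∀ j c, ContDiff ℝ ∞ (Φ j c)) {g : Fin q → (Fin n → ℝ) → ℝ}
    (hg : ∀ j, ContDiff ℝ ∞ (g j)) (c : Fin p) : ContDiff ℝ ∞ (cmb Φ g c) :=
  ContDiff.sum fun j _ => (hg j).mul (hΦ j c)

theorem cmb_flat {Φ : Fin q → Fin p → (Fin n → ℝ) → ℝ} (hΦ : ∀ j c, ContDiff ℝ ∞ (Φ j c)) {g : Fin q → (Fin n → ℝ) → ℝ}
    (hg : ∀ j, ContDiff ℝ ∞ (g j)) (c : Fin p) {x : Fin n → ℝ} (h : ∀ j, Flat (g j) x) : Flat (cmb Φ g c) x := fun L =>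
  FlatTo.sum isOpen_univ (mem_univ x) _ (fun j _ => ((hg j).mul (hΦ j c)).contDiffOn) fun j _ => (h j).mul (hg j) (hΦ j c) L

theorem cmb_EE {Φ : Fin q → Fin p → (Fin n → ℝ) → ℝ} (hΦ : ∀ j c, ContDiff ℝ ∞ (Φ j c)) {g : Fin q → (Fin n → ℝ) → ℝ}
    (hg : ∀ j, ContDiff ℝ ∞ (g j)) (c : Fin p) {σ : Type} [Fintype σ] [DecidableEq σ] {v : σ → Fin n → (Fin n → ℝ) → ℝ} {O : Set (Fin n → ℝ)}
    (hv : VF v O) {x : Fin n → ℝ} (hx : x ∈ O) : EE v x (cmb Φ g c) = ∑ j, EE v x (g j) * EE v x (Φ j c) := by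
  unfold cmb
  rw [EE_sum hv _ (fun j _ => ((hg j).mul (hΦ j c)).contDiffOn) hx]
  exact Finset.sum_congr rfl fun j _ => EE_mul hv (hg j).contDiffOn (hΦ j c).contDiffOn hx

/-- formally divisible data, zero off `V` -/
def Dvb (S : Stp M n) (Φ : Fin q → Fin p → (Fin n → ℝ) → ℝ) (f : Fin p → (Fin n → ℝ) → ℝ) : Prop :=
  (∀ c, ContDiff ℝ ∞ (f c)) ∧ (∀ c, ∀ x ∉ S.V, f c x = 0) ∧
  ∀ a ∈ S.V, ∃ G : Fin q → (Fin n → ℝ) → ℝ, (∀ j, ContDiff ℝ ∞ (G j)) ∧ ∀ c, Flat (fun x => f c x - cmb Φ G c x) a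

/-- solvability modulo functions flat on the zero set -/
def Slv (S : Stp M n) (Φ : Fin q → Fin p → (Fin n → ℝ) → ℝ) (ph : (Fin n → ℝ) → ℝ) : Prop :=
  ∀ f, Dvb S Φ f → ∃ g : Fin q → (Fin n → ℝ) → ℝ, (∀ j, ContDiff ℝ ∞ (g j)) ∧ (∀ j, ∀ x ∉ S.V, g j x = 0) ∧
    ∀ x ∈ S.V, ph x = 0 → ∀ c, Flat (fun x => f c x - cmb Φ g c x) x

theorem exists_coefs {X : Set (Fin n → ℝ)} {fr : Frame S X} (h : Adm fr δ) {A : (Fin n → ℝ) → MvPowerSeries {i // i ∈ fr.J} ℝ}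
    (hA : InC (Dd S ph δ) A) : ∃ a : ({i // i ∈ fr.J} →₀ ℕ) → (Fin n → ℝ) → ℝ, (∀ β, a β ∈ Dd S ph δ) ∧
      ∀ β x, ∑ e ∈ Finset.HasAntidiagonal.antidiagonal β, ec fr.c e.1 (a e.2) x = MvPowerSeries.coeff β (A x) := by
  classical
  have wf : WellFounded (fun a b : {i // i ∈ fr.J} →₀ ℕ => a.degree < b.degree) := InvImage.wf _ Nat.lt_wfRel.wf
  let a : ({i // i ∈ fr.J} →₀ ℕ) → (Fin n → ℝ) → ℝ := wf.fix fun β rec x =>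
    MvPowerSeries.coeff β (A x) - ∑ e ∈ Finset.HasAntidiagonal.antidiagonal β,
      if h : e.2.degree < β.degree then ec fr.c e.1 (rec e.2 h) x else 0
  have ha : ∀ β, a β = fun x => MvPowerSeries.coeff β (A x) - ∑ e ∈ Finset.HasAntidiagonal.antidiagonal β,
      if e.2.degree < β.degree then ec fr.c e.1 (a e.2) x else 0 := fun β => by
    have := wf.fix_eq (fun β rec x =>
      MvPowerSeries.coeff β (A x) - ∑ e ∈ Finset.HasAntidiagonal.antidiagonal β,
      if h : e.2.degree < β.degree then ec fr.c e.1 (rec e.2 h) x else 0) β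
    funext x
    refine (congrFun this x).trans ?_
    dsimp only
    refine congrArg _ (Finset.sum_congr rfl fun e _ => ?_)
    split_ifs <;> rfl
  refine ⟨a, fun β => ?_, fun β x => ?_⟩
  · induction β using wf.induction with
    | _ β ih =>
    rw [ha]
    refine Dd_sub h.mem (hA β) (Dd_sum h.mem _ fun e _ => ?_)
    by_cases he : e.2.degree < β.degree
    · simp only [if_pos he]; exact h.Dd_ec (ih _ he) _
    · simp only [if_neg he]; exact Dd_zero
  · have h1 : ∑ e ∈ Finset.HasAntidiagonal.antidiagonal β, ec fr.c e.1 (a e.2) x =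
        ∑ e ∈ Finset.HasAntidiagonal.antidiagonal β, ((if e.2.degree < β.degree then ec fr.c e.1 (a e.2) x else 0) + if e = (0, β) then a β x else 0) := by
      refine Finset.sum_congr rfl fun e he => ?_
      rw [Finset.HasAntidiagonal.mem_antidiagonal] at he
      by_cases h0 : e.1 = 0
      · rw [h0, zero_add] at he
        have h2 : e = (0, β) := Prod.ext h0 he
        rw [h2, if_neg (lt_irrefl _), if_pos rfl, ec_zero, zero_add]
      · have h2 : e.1.degree ≠ 0 := fun h3 => h0 ((Finsupp.degree_eq_zero_iff _).1 h3)
        have h3 : e.1.degree + e.2.degree = β.degree := by rw [← he, map_add]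
        rw [if_pos (by omega), if_neg (fun h4 => h0 (by rw [h4])), add_zero]
    rw [h1, Finset.sum_add_distrib, Finset.sum_ite_eq', if_pos (by rw [Finset.HasAntidiagonal.mem_antidiagonal, zero_add])]
    have h2 := congrFun (ha β) x
    rw [h2]; ring

theorem step {Φ : Fin q → Fin p → (Fin n → ℝ) → ℝ} (hΦ : ∀ j c, Φ j c ∈ S.R) (hph : ph ∈ S.R) (hne : ∃ x ∈ S.V, ph x = 0) :
    ∃ δ ∈ S.R, (∃ x ∈ S.V, ph x = 0 ∧ δ x ≠ 0) ∧ (Slv S Φ (fun x => ph x ^ 2 + δ x ^ 2) → Slv S Φ ph) := by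
  classical
  obtain ⟨X, hX⟩ : ∃ X, X = S.V ∩ {x | ph x = 0} := ⟨_, rfl⟩
  have hXV : X ⊆ S.V := by rw [hX]; exact inter_subset_left
  have hX0 : ∀ x ∈ X, ph x = 0 := by rw [hX]; exact fun x hx => hx.2
  obtain ⟨fr⟩ := exists_frame (S := S) (X := X) (by rw [hX]; obtain ⟨x, h1, h2⟩ := hne; exact ⟨x, h1, h2⟩)
  obtain ⟨δ, hδ, hmax⟩ := exists_max (fr := fr) (MonomialOrder.lex) Φ hXV
  refine ⟨δ, hδ.mem, ?_, ?_⟩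
  · obtain ⟨x, hx, hx1⟩ := id hδ.choose_spec.2.2
    exact ⟨x, hXV hx, hX0 x hx, hx1⟩
  intro hS f hf
  have hΦs : ∀ j c, ContDiff ℝ ∞ (Φ j c) := fun j c => (hΦ j c).1
  obtain ⟨g0, hg0, hg0V, hg0f⟩ := hS f hf
  set F : Fin p → (Fin n → ℝ) → ℝ := fun c x => f c x - cmb Φ g0 c x with hFdef
  have hFs : ∀ c, ContDiff ℝ ∞ (F c) := fun c => (hf.1 c).sub (cmb_smooth hΦs hg0 c)
  have hFV : ∀ c, ∀ x ∉ S.V, F c x = 0 := fun c x hx => by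
    simp only [hFdef, cmb, hf.2.1 c x hx, hg0V _ x hx, zero_mul, Finset.sum_const_zero, sub_zero]
  have hFfl : ∀ c, ∀ x ∈ S.V, ph x = 0 → δ x = 0 → Flat (F c) x := fun c x hx h1 h2 =>
    hg0f x hx (by dsimp only; rw [h1, h2]; norm_num) c
  have hFD : ∀ c, F c ∈ Dd S ph δ := fun c => flat_Dd hδ.mem hph (hFs c) (hFV c) (hFfl c)
  have hOo := isOpen_Od hδ.mem
  have hfd : ∀ x ∈ X ∩ Od S δ, ∃ P : Fin q → MvPowerSeries {i // i ∈ fr.J} ℝ, ∀ c, EE fr.c x (F c) = LC fr Φ P x c := by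
    intro x hx
    obtain ⟨G, hG, hGf⟩ := hf.2.2 x (hXV hx.1)
    refine ⟨fun j => EE fr.c x (G j) - EE fr.c x (g0 j), fun c => ?_⟩
    have h1 := EE_flat hδ.VF ((hf.1 c).sub (cmb_smooth hΦs hG c)).contDiffOn hx.2 (hGf c)
    rw [EE_sub hδ.VF (hf.1 c).contDiffOn (cmb_smooth hΦs hG c).contDiffOn hx.2, sub_eq_zero] at h1
    rw [hFdef]; dsimp only
    rw [EE_sub hδ.VF (hf.1 c).contDiffOn (cmb_smooth hΦs hg0 c).contDiffOn hx.2, h1, cmb_EE hΦs hG c hδ.VF hx.2,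
      cmb_EE hΦs hg0 c hδ.VF hx.2, LC, ← Finset.sum_sub_distrib]
    exact Finset.sum_congr rfl fun j _ => (sub_mul _ _ _).symm
  obtain ⟨A, hA, hAF⟩ := solve hδ hΦ hmax hFD hfd
  choose a haD hasum using fun j => exists_coefs hδ (hA j)
  choose b hbs hbf hba using fun j β => hδ.cutoff hph hX (haD j β)
  have hOK : ∀ x ∉ S.K, x ∉ Od S δ := fun x hx h => hx (S.hVK h.1)
  choose g hgs hgf hgB using fun j => borel S.hK (h := fun i : {i // i ∈ fr.J} => fr.H i) (fun i => (fr.hH i).1) (hbs j)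
    (fun β x hx => (hbf j β x (hOK x hx)).eq_zero)
  have hgflat : ∀ j, ∀ x ∉ Od S δ, Flat (g j) x := fun j x hx => hgf j x fun β => hbf j β x hx
  have hgE : ∀ j, ∀ x ∈ X ∩ Od S δ, EE fr.c x (g j) = A j x := by
    intro j x hx
    ext α
    obtain ⟨B, hB, hBf⟩ := hgB j α.degree
    have hx0 : ∀ i : {i // i ∈ fr.J}, fr.H i x = 0 := fun i => fr.hI i i.2 x hx.1
    rw [coeff_EE, ec_borel hδ.VF (fun i => (fr.hH i).1) (fun i k y hy => fr.dual (hδ.DD_ne y hy) i k) hx.2 hx0 (hgs j) (hbs j) α hB (hBf x hx0),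
      ← hasum]
    refine Finset.sum_congr rfl fun e _ => ?_
    obtain ⟨O, hO1, hO2, hO3⟩ := eventually_nhds_iff.1 (hba j e.2 x hx)
    exact ec_congr hO2 (fun y hy => hO1 y hy) _ hO3
  have hcs := fun c => cmb_smooth hΦs hgs c
  refine ⟨fun j x => g0 j x + g j x, fun j => (hg0 j).add (hgs j), fun j x hx => ?_, fun x hx hx0 c => ?_⟩
  · dsimp only
    rw [hg0V j x hx, (hgflat j x fun h => hx h.1).eq_zero, add_zero]
  have e : (fun x => f c x - cmb Φ (fun j x => g0 j x + g j x) c x) = fun x => F c x - cmb Φ g c x := by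
    funext y
    simp only [hFdef, cmb, add_mul, Finset.sum_add_distrib]; ring
  rw [e]
  have hxX : x ∈ X := by rw [hX]; exact ⟨hx, hx0⟩
  by_cases hd : δ x = 0
  · exact Flat.sub (hFs c) (hcs c) (hFfl c x hx hx0 hd) (cmb_flat hΦs hgs c fun j => hgflat j x fun h => h.2 hd)
  · refine flat_of_EE_frame fr hph hX hOo hδ.DD_ne ((hFs c).sub (hcs c)).contDiffOn (fun y hy => ?_) x ⟨hxX, hx, hd⟩
    rw [EE_sub hδ.VF (hFs c).contDiffOn (hcs c).contDiffOn hy.2, hAF y hy c, cmb_EE hΦs hgs c hδ.VF hy.2, LC, sub_eq_zero]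
    exact Finset.sum_congr rfl fun j _ => by rw [hgE j y hy]

/-- Noetherian induction -/
theorem slv_zero {Φ : Fin q → Fin p → (Fin n → ℝ) → ℝ} (hΦ : ∀ j c, Φ j c ∈ S.R) : Slv S Φ (fun _ => 0) := by
  by_contra hcon
  have key : ∀ ph : {r // r ∈ S.R ∧ ¬ Slv S Φ r}, ∃ r : {r // r ∈ S.R ∧ ¬ Slv S Φ r},
      (∀ x, r.1 x = 0 → ph.1 x = 0) ∧ ∃ x ∈ S.V, ph.1 x = 0 ∧ r.1 x ≠ 0 := by
    rintro ⟨ph, hph, hns⟩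
    have hne : ∃ x ∈ S.V, ph x = 0 := by
      by_contra hc
      push Not at hc
      exact hns fun f hf => ⟨fun _ _ => 0, fun _ => contDiff_const, fun _ _ _ => rfl, fun x hx h => absurd h (hc x hx)⟩
    obtain ⟨δ, hδ, ⟨x, hx, h0, h1⟩, h2⟩ := step hΦ hph hne
    refine ⟨⟨fun x => ph x ^ 2 + δ x ^ 2, R_add (R_pow hph 2) (R_pow hδ 2), fun h => hns (h2 h)⟩, fun y hy => ?_, x, hx, h0, ?_⟩
    · dsimp only at hy ⊢
      nlinarith [sq_nonneg (ph y), sq_nonneg (δ y), pow_eq_zero_iff (n := 2) (a := ph y) two_ne_zero |>.1 (by nlinarith [sq_nonneg (ph y), sq_nonneg (δ y)])]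
    · dsimp only
      rw [h0]; positivity
  choose nx h1 h2 using key
  let s : ℕ → {r // r ∈ S.R ∧ ¬ Slv S Φ r} := fun k => Nat.rec ⟨fun _ => 0, R_const 0, hcon⟩ (fun _ e => nx e) k
  have hs : ∀ k, s (k + 1) = nx (s k) := fun k => rfl
  have hdown : ∀ k x, (s k).1 x = 0 → ∀ j ≤ k, (s j).1 x = 0 := by
    intro k x
    induction k with
    | zero => intro h j hj; rwa [Nat.le_zero.1 hj]
    | succ k ih =>
      intro h j hj
      rcases Nat.le_succ_iff.1 hj with h' | h'
      · exact ih (h1 (s k) x h) j h'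
      · rwa [h']
  obtain ⟨k, hk⟩ := noeth_dim (M := M) n S.U0 (fun k => (s k).1) S.hU0 (fun k => (s k).2.1.2) S.K S.hKU S.hK
  obtain ⟨x, hx, hx0, hx1⟩ := h2 (s k)
  refine hx1 ?_
  rw [← hs]
  refine hk x (S.hVK hx) (fun j hj => ?_) (k + 1)
  exact hdown k x hx0 j hj

end Step
end QDC
end


section
open Set Filter Topology
open scoped ContDiff Nat
set_option linter.unusedSectionVars false
set_option linter.unusedVariables false
namespace QDC

section Final
variable {n p q : ℕ}

/-- the defining function of a euclidean ball -/
def bal (a : Fin n → ℝ) (s : ℝ) : (Fin n → ℝ) → ℝ := fun x => s ^ 2 - ∑ i, (x i - a i) ^ 2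

theorem bal_smooth (a : Fin n → ℝ) (s : ℝ) : ContDiff ℝ ∞ (bal a s) :=
  contDiff_const.sub (ContDiff.sum fun i _ => ((contDiff_apply ℝ ℝ i).sub contDiff_const).pow 2)

theorem bal_mem {a x : Fin n → ℝ} {s : ℝ} (hs : 0 ≤ s) (hx : 0 ≤ bal a s x) : x ∈ Metric.closedBall a s := by
  rw [Metric.mem_closedBall, dist_pi_le_iff hs]
  intro i
  rw [Real.dist_eq]
  refine abs_le_of_sq_le_sq ?_ hs
  have h1 : (x i - a i) ^ 2 ≤ ∑ i, (x i - a i) ^ 2 :=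
    Finset.single_le_sum (f := fun i => (x i - a i) ^ 2) (fun i _ => sq_nonneg _) (Finset.mem_univ i)
  unfold bal at hx
  linarith

theorem bal_off {a : Fin n → ℝ} {s : ℝ} (hs : 0 < s) : {x | 0 < bal a s x}ᶜ ⊆ closure (interior {x | 0 < bal a s x}ᶜ) := by
  intro x hx
  have hx' : bal a s x ≤ 0 := not_lt.1 hx
  have hO : IsOpen {x | bal a s x < 0} := isOpen_lt (bal_smooth a s).continuous continuous_const
  have hsub : {x | bal a s x < 0} ⊆ interior {x | 0 < bal a s x}ᶜ :=
    interior_maximal (fun y hy => by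
      have hy' : bal a s y < 0 := hy
      exact not_lt.2 hy'.le) hO
  refine closure_mono hsub ?_
  have ht : Tendsto (fun t : ℝ => fun i => a i + t * (x i - a i)) (𝓝[>] 1) (𝓝 x) := by
    have h1 : Continuous (fun t : ℝ => fun i => a i + t * (x i - a i)) := by fun_prop
    have h2 := (h1.tendsto 1).mono_left (nhdsWithin_le_nhds (s := Ioi 1))
    have h3 : (fun i => a i + 1 * (x i - a i)) = x := by funext i; ring
    rwa [h3] at h2
  refine mem_closure_of_tendsto ht ?_
  filter_upwards [self_mem_nhdsWithin] with t ht1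
  have ht2 : (1 : ℝ) < t := ht1
  have e : bal a s (fun i => a i + t * (x i - a i)) = s ^ 2 - t ^ 2 * ∑ i, (x i - a i) ^ 2 := by
    unfold bal
    rw [Finset.mul_sum]
    exact congrArg _ (Finset.sum_congr rfl fun i _ => by ring)
  rw [e]
  unfold bal at hx'
  have h4 : 0 < s ^ 2 := by positivity
  nlinarith [mul_pos (show (0 : ℝ) < t ^ 2 - 1 by nlinarith) (show 0 < ∑ i, (x i - a i) ^ 2 by linarith)]

/-- the local setup around a point -/
noncomputable def mkS (M : ℕ → ℝ) [NSeq M] (a : Fin n → ℝ) (r : ℝ) (hr : 0 < r) : Stp M n where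
  U0 := Metric.ball a r
  K := {x | 0 ≤ bal a (r / 2) x}
  V := {x | 0 < bal a (r / 2) x}
  ψ := bal a (r / 2)
  hU0 := Metric.isOpen_ball
  hK := (isCompact_closedBall a (r / 2)).of_isClosed_subset (isClosed_le continuous_const (bal_smooth a _).continuous)
    fun x hx => bal_mem (by positivity) hx
  hKU := fun x hx => Metric.closedBall_subset_ball (by linarith) (bal_mem (by positivity) hx)
  hVK := fun x hx => by
    have hx' : 0 < bal a (r / 2) x := hx
    exact hx'.le
  hV := rfl
  hψ := bal_smooth a _
  hψ' := fun x _ => (dcAt_const _).sub (dcAt_sum _ fun i _ =>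
    ((DCAt.clm (ContinuousLinearMap.proj i : (Fin n → ℝ) →L[ℝ] ℝ)).sub (dcAt_const (a i))).pow 2)
  hoff := bal_off (by positivity)

theorem cut_smooth {U : Set (Fin n → ℝ)} (hU : IsOpen U) {F χ : (Fin n → ℝ) → ℝ} (hF : ContDiffOn ℝ ∞ F U) (hχ : ContDiff ℝ ∞ χ)
    (hs : tsupport χ ⊆ U) : ContDiff ℝ ∞ (fun x => χ x * F x) := by
  rw [contDiff_iff_contDiffAt]
  intro x
  by_cases hx : x ∈ U
  · exact hχ.contDiffAt.mul (hF.contDiffAt (hU.mem_nhds hx))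
  · have h1 : χ =ᶠ[𝓝 x] 0 := notMem_tsupport_iff_eventuallyEq.1 fun h => hx (hs h)
    refine (contDiffAt_const (c := (0 : ℝ))).congr_of_eventuallyEq ?_
    filter_upwards [h1] with y hy
    rw [hy]; exact zero_mul _

theorem local_solve (M : ℕ → ℝ) (hM : IsDCSeq M) (U : Set (Fin n → ℝ)) (hU : IsOpen U)
    (Φ : Fin q → Fin p → (Fin n → ℝ) → ℝ) (hΦ : ∀ j c, MemDC M U (Φ j c))
    (f : Fin p → (Fin n → ℝ) → ℝ) (hf : ∀ c, ContDiffOn ℝ ∞ (f c) U)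
    (hfd : ∀ a ∈ U, ∃ G : Fin q → MvPowerSeries (Fin n) ℝ, ∀ c, taylorAt (f c) a = ∑ j, G j * taylorAt (Φ j c) a)
    (a : Fin n → ℝ) (ha : a ∈ U) : ∃ V ⊆ U, IsOpen V ∧ a ∈ V ∧ ∃ g : Fin q → (Fin n → ℝ) → ℝ,
      (∀ j, ContDiffOn ℝ ∞ (g j) V) ∧ ∀ x ∈ V, ∀ c, f c x = ∑ j, g j x * Φ j c x := by
  have := nrm_nseq hM
  obtain ⟨R, hR, hRU⟩ := Metric.nhds_basis_closedBall.mem_iff.1 (hU.mem_nhds ha)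
  obtain ⟨θ, hθ1, hθ2⟩ : ∃ θ : ContDiffBump a, θ.rIn = R / 2 ∧ θ.rOut = R := ⟨⟨R / 2, R, by positivity, by linarith⟩, rfl, rfl⟩
  have hr : 0 < R / 2 := by positivity
  set S := mkS (nrm M) a (R / 2) hr with hS
  have hχs : ContDiff ℝ ∞ (θ : (Fin n → ℝ) → ℝ) := θ.contDiff
  have hts : tsupport (θ : (Fin n → ℝ) → ℝ) ⊆ U := by rw [θ.tsupport_eq, hθ2]; exact hRU
  have h0U : S.U0 ⊆ U := (Metric.ball_subset_closedBall.trans (Metric.closedBall_subset_closedBall (by linarith))).trans hRU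
  have hVU0 : S.V ⊆ S.U0 := S.hVK.trans S.hKU
  have hχ1 : ∀ x ∈ S.U0, θ x = 1 := fun x hx => θ.one_of_mem_closedBall (by rw [hθ1]; exact Metric.ball_subset_closedBall hx)
  have hΦs : ∀ j c, ContDiff ℝ ∞ (fun x => θ x * Φ j c x) := fun j c => cut_smooth hU (hΦ j c).1 hχs hts
  have hfs : ∀ c, ContDiff ℝ ∞ (fun x => θ x * f c x) := fun c => cut_smooth hU (hf c) hχs hts
  set Ψ : Fin q → Fin p → (Fin n → ℝ) → ℝ := fun j c x => θ x * Φ j c x with hΨ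
  have hev : ∀ F : (Fin n → ℝ) → ℝ, EqOn (fun x => θ x * F x) F S.U0 := fun F x hx => by dsimp only; rw [hχ1 x hx, one_mul]
  have hΨR : ∀ j c, Ψ j c ∈ S.R := fun j c => ⟨hΦs j c, fun x hx =>
    (dcAt_of_memDC hM hU (hΦ j c) (h0U hx)).congr (mem_of_superset (S.hU0.mem_nhds hx) fun y hy => hev _ hy)⟩
  set b : (Fin n → ℝ) → ℝ := fun x => expNegInvGlue (S.ψ x) with hb
  have hbs : ContDiff ℝ ∞ b := expNegInvGlue.contDiff.comp S.hψ
  have hbV : ∀ x ∈ S.V, 0 < b x := fun x hx => expNegInvGlue.pos_of_pos (by rw [S.hV] at hx; exact hx)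
  have hbV0 : ∀ x ∉ S.V, b x = 0 := fun x hx => expNegInvGlue.zero_of_nonpos (by rw [S.hV] at hx; exact not_lt.1 hx)
  have hD : Dvb S Ψ (fun c x => b x * (θ x * f c x)) := by
    refine ⟨fun c => hbs.mul (hfs c), fun c x hx => by dsimp only; rw [hbV0 x hx, zero_mul], fun y hy => ?_⟩
    have hyU0 := hVU0 hy
    have hyU := h0U hyU0
    obtain ⟨G, hG⟩ := hfd y hyU
    choose g hgs hgE using fun j => borel_pt y (G j)
    have hgb : ∀ j, ContDiff ℝ ∞ (fun x => b x * g j x) := fun j => hbs.mul (hgs j)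
    refine ⟨fun j x => b x * g j x, hgb, fun c => ?_⟩
    have hvf := VF_idc (n := n) isOpen_univ
    refine flat_of_EE isOpen_univ ((hbs.mul (hfs c)).sub (cmb_smooth hΦs hgb c)).contDiffOn (mem_univ y) ?_
    rw [EE_sub hvf (hbs.mul (hfs c)).contDiffOn (cmb_smooth hΦs hgb c).contDiffOn (mem_univ y), cmb_EE hΦs hgb c hvf (mem_univ y),
      EE_mul hvf hbs.contDiffOn (hfs c).contDiffOn (mem_univ y), EE_congr S.hU0 (hev (f c)) hyU0, ← taylorAt_eq hU (hf c) hyU, hG c, sub_eq_zero,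
      Finset.mul_sum]
    refine Finset.sum_congr rfl fun j _ => ?_
    rw [EE_mul hvf hbs.contDiffOn (hgs j).contDiffOn (mem_univ y), hgE, EE_congr S.hU0 (hev (Φ j c)) hyU0, ← taylorAt_eq hU (hΦ j c).1 hyU, mul_assoc]
  obtain ⟨g, hgs, -, hgf⟩ := slv_zero hΨR _ hD
  refine ⟨S.V, hVU0.trans h0U, S.isOpenV, ?_, fun j x => g j x / b x, fun j => (hgs j).contDiffOn.div hbs.contDiffOn fun x hx => (hbV x hx).ne', fun x hx c => ?_⟩
  · change 0 < bal a (R / 2 / 2) a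
    unfold bal
    simp only [sub_self]
    have : (0 : ℝ) < R / 2 / 2 := by positivity
    simp; positivity
  · have h1 := (hgf x hx rfl c).eq_zero
    simp only [cmb, hΨ, hχ1 x (hVU0 hx), one_mul, sub_eq_zero] at h1
    have h2 := (hbV x hx).ne'
    have h3 : ∑ j, g j x / b x * Φ j c x = (∑ j, g j x * Φ j c x) / b x := by
      rw [Finset.sum_div]; exact Finset.sum_congr rfl fun j _ => by ring
    rw [h3, ← h1]; field_simp

open scoped Manifold in
theorem glue (U : Set (Fin n → ℝ)) (hU : IsOpen U) (t : (Fin n → ℝ) → Set (Fin q → ℝ)) (ht : ∀ x, Convex ℝ (t x))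
    (h : ∀ a ∈ U, ∃ V ⊆ U, IsOpen V ∧ a ∈ V ∧ ∃ g : (Fin n → ℝ) → Fin q → ℝ, ContDiffOn ℝ ∞ g V ∧ ∀ x ∈ V, g x ∈ t x) :
    ∃ g : (Fin n → ℝ) → Fin q → ℝ, ContDiffOn ℝ ∞ g U ∧ ∀ x ∈ U, g x ∈ t x := by
  classical
  let W : TopologicalSpace.Opens (Fin n → ℝ) := ⟨U, hU⟩
  have : LocallyCompactSpace W := hU.locallyCompactSpace
  have : SigmaCompactSpace W := inferInstance
  obtain ⟨g, hg⟩ := exists_contMDiffMap_forall_mem_convex_of_local (M := W) (n := (⊤ : ℕ∞)) (F := Fin q → ℝ) 𝓘(ℝ, Fin n → ℝ) (t := fun x => t x.1) (fun x => ht x.1) (by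
    intro x
    obtain ⟨V, hVU, hV, hxV, g, hg, hgt⟩ := h x.1 x.2
    refine ⟨Subtype.val ⁻¹' V, (hV.preimage continuous_subtype_val).mem_nhds hxV, fun y => g y.1, fun y hy => ?_, fun y hy => hgt y.1 hy⟩
    refine ContMDiffAt.contMDiffWithinAt ?_
    exact contMDiffAt_subtype_iff.2 (hg.contDiffAt (hV.mem_nhds hy)).contMDiffAt)
  refine ⟨fun x => if hx : x ∈ U then g ⟨x, hx⟩ else 0, fun x hx => ?_, fun x hx => ?_⟩
  · refine ContDiffAt.contDiffWithinAt (contMDiffAt_iff_contDiffAt.1 ?_)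
    refine (contMDiffAt_subtype_iff (U := W) (x := ⟨x, hx⟩)).1 ?_
    have e : (fun y : W => (fun x => if hx : x ∈ U then g ⟨x, hx⟩ else 0) (y : Fin n → ℝ)) = g := by
      funext y; exact dif_pos y.2
    rw [e]
    exact g.contMDiff _
  · dsimp only; rw [dif_pos hx]; exact hg ⟨x, hx⟩

end Final

theorem malgrange_division_quasianalytic
    {n p q : ℕ} (hp : 0 < p) (hq : 0 < q)
    (M : ℕ → ℝ) (hM : IsDCSeq M)
    (U : Set (Fin n → ℝ)) (hU : IsOpen U)
    (Φ : Fin q → (Fin n → ℝ) → (Fin p → ℝ))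
    (hΦ : ∀ (j : Fin q) (c : Fin p), MemDC M U (fun x => Φ j x c))
    (f : (Fin n → ℝ) → (Fin p → ℝ)) (hf : ContDiffOn ℝ (⊤ : ℕ∞) f U) :
    (∃ g : Fin q → (Fin n → ℝ) → ℝ,
        (∀ j, ContDiffOn ℝ (⊤ : ℕ∞) (g j) U) ∧
        ∀ x ∈ U, ∀ c : Fin p, f x c = ∑ j, g j x * Φ j x c) ↔
    (∀ a ∈ U, ∃ G : Fin q → MvPowerSeries (Fin n) ℝ, ∀ c : Fin p,
        taylorAt (fun x => f x c) a = ∑ j, G j * taylorAt (fun x => Φ j x c) a) := by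
  have hfc : ∀ c, ContDiffOn ℝ ∞ (fun x => f x c) U := contDiffOn_pi.1 hf
  constructor
  · rintro ⟨g, hg, hfg⟩ a ha
    have hvf := VF_idc (n := n) hU
    refine ⟨fun j => taylorAt (g j) a, fun c => ?_⟩
    rw [taylorAt_eq hU (hfc c) ha, EE_congr hU (fun x hx => hfg x hx c) ha, EE_sum hvf _ (fun j _ => (hg j).mul (hΦ j c).1) ha]
    refine Finset.sum_congr rfl fun j _ => ?_
    dsimp only
    rw [EE_mul hvf (hg j) (hΦ j c).1 ha, taylorAt_eq hU (hg j) ha, taylorAt_eq hU (hΦ j c).1 ha]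
  · intro h
    obtain ⟨g, hg, hgt⟩ := glue U hU (fun x => {v : Fin q → ℝ | ∀ c, f x c = ∑ j, v j * Φ j x c}) (fun x => by
      intro v hv w hw s t hs ht hst c
      simp only [Pi.add_apply, Pi.smul_apply, smul_eq_mul, add_mul, Finset.sum_add_distrib, mul_assoc, ← Finset.mul_sum]
      rw [← hv c, ← hw c, ← add_mul, hst, one_mul]) (fun a ha => by
      obtain ⟨V, hVU, hV, haV, g, hg, hgf⟩ := local_solve M hM U hU (fun j c x => Φ j x c) hΦ (fun c x => f x c) hfc h a ha
      exact ⟨V, hVU, hV, haV, fun x j => g j x, contDiffOn_pi.2 hg, hgf⟩)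
    exact ⟨fun j x => g x j, contDiffOn_pi.1 hg, hgt⟩

end QDC
end
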